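/- For every c ∈ (0,1] there exists α_*(c) ∈ (0,1) such that for every α ∈ (0, α_*(c)], every regular domain Ω ⊂ ℝ² that is (α,c)-sandwiched, and every λ ∈ (8π, λ̲(α,c)) with λ not an integer multiple of 8π, the problem P(λ,Ω) admits at least two distinct solutions u and v, both with finite Dirichlet energy, satisfying F_λ(u) < F_λ(v). -/

import Mathlib

open MeasureTheory Real Set Filter

noncomputable section

/-- The Euclidean plane ℝ². -/
abbrev R2 : Type := EuclideanSpace ℝ (Fin 2)

/-- The Laplacian of `u : R2 → ℝ`: the sum of the second derivatives of `u`
along the two coordinate axes. -/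
def lap (u : R2 → ℝ) (p : R2) : ℝ :=
  ∑ i : Fin 2, iteratedDeriv 2 (fun t : ℝ => u (p + t • EuclideanSpace.single i (1 : ℝ))) 0

/-- `u` is a solution of the mean field problem `P(λ, Ω)`:
`u ∈ C²(Ω) ∩ C⁰(cl Ω)`, `u = 0` on `∂Ω` and `-Δu = λ eᵘ / ∫_Ω eᵘ` in `Ω`. -/
def IsSolP (Ω : Set R2) (lam : ℝ) (u : R2 → ℝ) : Prop :=
  ContDiffOn ℝ 2 u Ω ∧ ContinuousOn u (closure Ω) ∧
    (∀ p ∈ frontier Ω, u p = 0) ∧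
    ∀ p ∈ Ω, -lap u p = lam * Real.exp (u p) / ∫ q in Ω, Real.exp (u q)

/-- A simple domain: a bounded open simply connected set whose boundary is the support of a
simple rectifiable (i.e. of bounded variation) Jordan curve. -/
def IsSimpleDomain (Ω : Set R2) : Prop :=
  IsOpen Ω ∧ Bornology.IsBounded Ω ∧ SimplyConnectedSpace Ω ∧
    ∃ γ : ℝ → R2, ContinuousOn γ (Icc 0 1) ∧ γ 0 = γ 1 ∧ InjOn γ (Ico 0 1) ∧
      γ '' Icc 0 1 = frontier Ω ∧ BoundedVariationOn γ (Icc 0 1)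

/-- Identification of `R2` with `ℂ`. -/
def toC (p : R2) : ℂ := (p 0 : ℂ) + (p 1 : ℂ) * Complex.I

/-- A regular domain: a simple domain whose boundary is a continuous piecewise `C²` Jordan
curve with bounded derivative, having at most finitely many corner points: at each corner the
one-sided limiting tangent vectors exist, are nonzero and non-parallel (so that the inner angle
is well defined and lies in `(0, 2π) \ {π}`), and each corner admits a conformal bijection of a
neighborhood mapping the boundary onto a `C²` curve. -/
def IsRegularDomain (Ω : Set R2) : Prop :=
  IsSimpleDomain Ω ∧
    ∃ (γ : ℝ → R2) (m : ℕ) (t : Fin m → ℝ) (C : ℝ),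
      ContinuousOn γ (Icc 0 1) ∧ γ 0 = γ 1 ∧ InjOn γ (Ico 0 1) ∧
      γ '' Icc 0 1 = frontier Ω ∧
      StrictMono t ∧ (∀ i, t i ∈ Ico (0 : ℝ) 1) ∧
      (∀ s ∈ Icc (0 : ℝ) 1, (∀ i, s ≠ t i) →
        ContDiffWithinAt ℝ 2 γ (Icc 0 1) s ∧ ‖derivWithin γ (Icc 0 1) s‖ ≤ C) ∧
      (∀ i : Fin m, ∃ vm vp : R2, vm ≠ 0 ∧ vp ≠ 0 ∧
        Filter.Tendsto (fun s => (s - t i)⁻¹ • (γ s - γ (t i)))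
          (nhdsWithin (t i) (Iio (t i))) (nhds vm) ∧
        Filter.Tendsto (fun s => (s - t i)⁻¹ • (γ s - γ (t i)))
          (nhdsWithin (t i) (Ioi (t i))) (nhds vp) ∧
        (∀ r : ℝ, vp ≠ r • vm)) ∧
      (∀ i : Fin m, ∃ (U : Set ℂ) (f : ℂ → ℂ) (η : ℝ → ℂ),
        IsOpen U ∧ toC (γ (t i)) ∈ U ∧ DifferentiableOn ℂ f U ∧ InjOn f U ∧
        ContDiff ℝ 2 η ∧ f '' (U ∩ toC '' frontier Ω) ⊆ Set.range η)

/-- The closed ellipse `E_α(β) = {α²x² + y² ≤ β²}`. -/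
def EllipseSet (α β : ℝ) : Set R2 := {p | α ^ 2 * p 0 ^ 2 + p 1 ^ 2 ≤ β ^ 2}

/-- `Ω` is `(α,c)`-sandwiched: `E_α(β₋) ⊆ Ω ⊆ E_α(β₊)` with `c = β₋²/β₊²`. -/
def Sandwiched (α c : ℝ) (Ω : Set R2) : Prop :=
  ∃ βm βp : ℝ, 0 < βm ∧ βm ≤ βp ∧ c = βm ^ 2 / βp ^ 2 ∧
    EllipseSet α βm ⊆ Ω ∧ Ω ⊆ EllipseSet α βp

/-- `γ̲²(α,c)`. -/
def gammaLowSq (α c : ℝ) : ℝ :=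
  (1 + α ^ 2) * (c - 4 + c * α ^ 2 + 4 * Real.sqrt (1 - c * α ^ 2)) /
    (8 * (1 - α ^ 2) - c * (1 + α ^ 2) ^ 2)

/-- `λ̲(α,c) = (π c (1+α²)²/(2α)) (1 + γ̲²(α,c))`. -/
def lamLow (α c : ℝ) : ℝ :=
  π * c * (1 + α ^ 2) ^ 2 / (2 * α) * (1 + gammaLowSq α c)

/-- The free-energy functional `F_λ(u) = (1/2)∫_Ω |∇u|² − λ log ∫_Ω eᵘ`. -/
def freeEnergy (Ω : Set R2) (lam : ℝ) (u : R2 → ℝ) : ℝ :=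
  (1 / 2) * (∫ p in Ω, ‖gradient u p‖ ^ 2) - lam * Real.log (∫ p in Ω, Real.exp (u p))

/-- `u` has finite Dirichlet energy on `Ω`. -/
def FiniteDirichlet (Ω : Set R2) (u : R2 → ℝ) : Prop :=
  IntegrableOn (fun p => ‖gradient u p‖ ^ 2) Ω

namespace MeanField
open scoped Topology ComplexConjugate
open Metric

/-! ### The Riemann mapping theorem for bounded domains -/

theorem exists_tendstoLocallyUniformlyOn_ultrafilter {Ω : Set ℂ} (hΩ : IsOpen Ω)
    (𝒰 : Ultrafilter ℕ) {f : ℕ → ℂ → ℂ} (hd : ∀ n, DifferentiableOn ℂ (f n) Ω)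
    (hm : ∀ n, MapsTo (f n) Ω (ball 0 1)) :
    ∃ F : ℂ → ℂ, TendstoLocallyUniformlyOn f F 𝒰 Ω := by
  have hpt : ∀ z, ∃ w, z ∈ Ω → Tendsto (fun n => f n z) 𝒰 (𝓝 w) := by
    intro z
    by_cases hz : z ∈ Ω
    · have hc : IsCompact (closedBall (0 : ℂ) 1) := isCompact_closedBall _ _
      obtain ⟨w, -, hw⟩ := hc.ultrafilter_le_nhds (𝒰.map (fun n => f n z)) (by
        rw [le_principal_iff, Ultrafilter.mem_coe, Ultrafilter.mem_map]
        exact univ_mem' fun n => ball_subset_closedBall (hm n hz))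
      exact ⟨w, fun _ => hw⟩
    · exact ⟨0, fun h => absurd h hz⟩
  choose F hF using hpt
  refine ⟨F, ?_⟩
  rw [Metric.tendstoLocallyUniformlyOn_iff]
  intro ε hε x hx
  obtain ⟨R, hR, hRΩ⟩ := Metric.isOpen_iff.1 hΩ x hx
  have hlip : ∀ n, ∀ y ∈ ball x R, dist (f n y) (f n x) ≤ 2 / R * dist y x := fun n y hy =>
    Complex.dist_le_div_mul_dist_of_mapsTo_ball ((hd n).mono hRΩ) (fun z hz => by
      have h1 := hm n (hRΩ hz)
      have h2 := hm n hx
      rw [mem_ball_zero_iff] at h1 h2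
      rw [mem_closedBall, dist_eq_norm]
      linarith [norm_sub_le (f n z) (f n x)]) hy
  have hlipF : ∀ y ∈ ball x R, dist (F y) (F x) ≤ 2 / R * dist y x := fun y hy =>
    le_of_tendsto ((hF y (hRΩ hy)).dist (hF x hx)) (Eventually.of_forall fun n => hlip n y hy)
  refine ⟨ball x (min R (ε * R / 8)), mem_nhdsWithin_of_mem_nhds
    (ball_mem_nhds _ (lt_min hR (by positivity))), ?_⟩
  have hev : ∀ᶠ n in (𝒰 : Filter ℕ), dist (f n x) (F x) < ε / 2 :=
    (Metric.tendsto_nhds.1 (hF x hx)) _ (by positivity)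
  filter_upwards [hev] with n hn y hy
  rw [mem_ball, lt_min_iff] at hy
  have hb : 2 / R * dist y x ≤ ε / 4 := by
    rw [div_mul_eq_mul_div, div_le_iff₀ hR]
    nlinarith [hy.2]
  have h1 := hlip n y hy.1
  have h2 := hlipF y hy.1
  have h3 := dist_triangle4 (F y) (F x) (f n x) (f n y)
  rw [dist_comm (F x), dist_comm (f n x) (f n y)] at h3
  linarith

theorem hurwitz_ne_zero {U : Set ℂ} (hU : IsOpen U) {l : Filter ℕ} [l.NeBot]
    {g : ℕ → ℂ → ℂ} {G : ℂ → ℂ} (hd : ∀ n, DifferentiableOn ℂ (g n) U)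
    (hg : ∀ n, ∀ z ∈ U, g n z ≠ 0) (hlim : TendstoLocallyUniformlyOn g G l U)
    {a : ℂ} (ha : a ∈ U) (hG : ¬ ∀ᶠ z in 𝓝 a, G z = 0) : G a ≠ 0 := by
  have hGd : DifferentiableOn ℂ G U := hlim.differentiableOn (Eventually.of_forall hd) hU
  have han : AnalyticAt ℂ G a := hGd.analyticAt (hU.mem_nhds ha)
  have hne := han.eventually_eq_zero_or_eventually_ne_zero.resolve_left hG
  rw [eventually_nhdsWithin_iff] at hne
  obtain ⟨ρ, hρ, hρ'⟩ := Metric.eventually_nhds_iff.1 (hne.and (hU.mem_nhds ha))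
  set r := ρ / 2 with hr
  have hr0 : 0 < r := by positivity
  have hcb : closedBall a r ⊆ U := fun z hz => (hρ' (by
    rw [mem_closedBall] at hz; linarith)).2
  have hsU : sphere a r ⊆ U := sphere_subset_closedBall.trans hcb
  have hsc : IsCompact (sphere a r) := isCompact_sphere a r
  have hsn : (sphere a r).Nonempty := NormedSpace.sphere_nonempty.2 hr0.le
  obtain ⟨w, hw, hwmin⟩ := hsc.exists_isMinOn hsn ((hGd.continuousOn.mono hsU).norm)
  have hwne : G w ≠ 0 := (hρ' (by rw [mem_sphere] at hw; linarith)).1 (by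
    rintro rfl
    simp at hw
    linarith)
  set m := ‖G w‖ / 2 with hm
  have hm0 : 0 < m := by have := norm_pos_iff.2 hwne; positivity
  have hunif := (tendstoLocallyUniformlyOn_iff_tendstoUniformlyOn_of_compact hsc).1
    (hlim.mono hsU)
  have hev := (Metric.tendstoUniformlyOn_iff.1 hunif) m hm0
  have hge : ∀ᶠ n in l, m ≤ ‖g n a‖ := by
    filter_upwards [hev] with n hn
    have hfr : ∀ z ∈ frontier (ball a r), ‖(g n z)⁻¹‖ ≤ m⁻¹ := by
      intro z hz
      rw [frontier_ball a hr0.ne'] at hz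
      rw [norm_inv]
      apply inv_anti₀ hm0
      have h1 := hn z hz
      have h2 : ‖G w‖ ≤ ‖G z‖ := hwmin hz
      rw [dist_eq_norm] at h1
      have h3 := norm_sub_norm_le (G z) (g n z)
      linarith
    have hdc : DiffContOnCl ℂ (fun z => (g n z)⁻¹) (ball a r) := by
      apply DifferentiableOn.diffContOnCl
      rw [closure_ball a hr0.ne']
      exact ((hd n).mono hcb).inv fun z hz => hg n z (hcb hz)
    have := Complex.norm_le_of_forall_mem_frontier_norm_le isBounded_ball hdc hfr
      (subset_closure (mem_ball_self hr0))
    rw [norm_inv] at this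
    exact (inv_le_inv₀ (norm_pos_iff.2 (hg n a ha)) hm0).1 this
  have hlima := (hlim.tendsto_at ha).norm
  have := ge_of_tendsto hlima hge
  exact norm_pos_iff.1 (hm0.trans_le this)

/-- The involutive Möbius automorphism of the unit disc exchanging `0` and `w`. -/
def mob (w z : ℂ) : ℂ := (w - z) / (1 - conj w * z)

theorem one_sub_conj_mul_ne_zero {w z : ℂ} (hw : ‖w‖ < 1) (hz : ‖z‖ ≤ 1) :
    1 - conj w * z ≠ 0 := by
  intro h
  have h1 : conj w * z = 1 := (sub_eq_zero.1 h).symm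
  have h2 : ‖conj w * z‖ = 1 := by rw [h1]; simp
  rw [norm_mul, RCLike.norm_conj] at h2
  nlinarith [norm_nonneg w, norm_nonneg z]

theorem normSq_one_sub_conj_mul (w z : ℂ) :
    ‖1 - conj w * z‖ ^ 2 - ‖w - z‖ ^ 2 = (1 - ‖w‖ ^ 2) * (1 - ‖z‖ ^ 2) := by
  simp only [← Complex.normSq_eq_norm_sq, Complex.normSq_apply]
  simp
  ring

theorem norm_mob_lt_one {w z : ℂ} (hw : ‖w‖ < 1) (hz : ‖z‖ < 1) : ‖mob w z‖ < 1 := by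
  have h := normSq_one_sub_conj_mul w z
  have h0 : 0 < ‖1 - conj w * z‖ := norm_pos_iff.2 (one_sub_conj_mul_ne_zero hw hz.le)
  rw [mob, norm_div, div_lt_one h0]
  have h1 : 0 < (1 - ‖w‖ ^ 2) * (1 - ‖z‖ ^ 2) := by
    apply mul_pos <;> nlinarith [norm_nonneg w, norm_nonneg z]
  nlinarith [norm_nonneg (w - z)]

theorem mob_mob {w z : ℂ} (hw : ‖w‖ < 1) (hz : ‖z‖ < 1) : mob w (mob w z) = z := by
  have h0 := one_sub_conj_mul_ne_zero hw hz.le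
  have h1 := one_sub_conj_mul_ne_zero hw hw.le
  have h2 := one_sub_conj_mul_ne_zero hw (norm_mob_lt_one hw hz).le
  rw [mob, div_eq_iff h2]
  unfold mob
  obtain ⟨D, hD⟩ : ∃ D, D = 1 - conj w * z := ⟨_, rfl⟩
  rw [← hD] at h0 ⊢
  field_simp
  rw [hD]
  ring

theorem hasDerivAt_mob {w z : ℂ} (hw : ‖w‖ < 1) (hz : ‖z‖ < 1) :
    HasDerivAt (mob w) (-(1 - conj w * w) / (1 - conj w * z) ^ 2) z := by
  have h0 := one_sub_conj_mul_ne_zero hw hz.le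
  have h1 : HasDerivAt (fun z => w - z) (-1) z := by simpa using (hasDerivAt_id z).const_sub w
  have h2 : HasDerivAt (fun z => 1 - conj w * z) (-(conj w)) z := by
    simpa using ((hasDerivAt_id z).const_mul (conj w)).const_sub 1
  refine (h1.div h2 h0).congr_deriv ?_
  ring

theorem mob_zero (w : ℂ) : mob w 0 = w := by simp [mob]
theorem mob_self (w : ℂ) : mob w w = 0 := by simp [mob]

theorem mob_eq_zero {w z : ℂ} (hw : ‖w‖ < 1) (hz : ‖z‖ < 1) (h : mob w z = 0) : z = w := by
  rw [← mob_mob hw hz, h, mob_zero]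

theorem differentiableOn_mob {w : ℂ} (hw : ‖w‖ < 1) : DifferentiableOn ℂ (mob w) (ball 0 1) :=
  fun _ hz => (hasDerivAt_mob hw (mem_ball_zero_iff.1 hz)).differentiableAt.differentiableWithinAt

theorem deriv_mob_ne_zero {w z : ℂ} (hw : ‖w‖ < 1) (hz : ‖z‖ < 1) : deriv (mob w) z ≠ 0 := by
  rw [(hasDerivAt_mob hw hz).deriv]
  exact div_ne_zero (neg_ne_zero.2 (one_sub_conj_mul_ne_zero hw hw.le))
    (pow_ne_zero _ (one_sub_conj_mul_ne_zero hw hz.le))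

/-- Normalized univalent maps of `Ω` into the unit disc. -/
structure IsUnivalentInto (Ω : Set ℂ) (z0 : ℂ) (f : ℂ → ℂ) : Prop where
  mapsTo : MapsTo f Ω (ball 0 1)
  injOn : InjOn f Ω
  diff : DifferentiableOn ℂ f Ω
  deriv_ne : ∀ z ∈ Ω, deriv f z ≠ 0
  zero : f z0 = 0

theorem exists_univalent_deriv_max {Ω : Set ℂ} (hΩ : IsOpen Ω) (hconn : IsPreconnected Ω)
    (hb : Bornology.IsBounded Ω) {z0 : ℂ} (hz0 : z0 ∈ Ω) :
    ∃ F, IsUnivalentInto Ω z0 F ∧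
      ∀ f, IsUnivalentInto Ω z0 f → ‖deriv f z0‖ ≤ ‖deriv F z0‖ := by
  obtain ⟨R, hR, hRΩ⟩ := Metric.isOpen_iff.1 hΩ z0 hz0
  obtain ⟨M, hM⟩ := hb.subset_ball z0
  have hM0 : 0 < M := by simpa using hM hz0
  set S : Set ℝ := {s | ∃ f, IsUnivalentInto Ω z0 f ∧ s = ‖deriv f z0‖} with hS
  have hlin : ∀ z, HasDerivAt (fun z : ℂ => (z - z0) / M) (1 / M) z := fun z =>
    ((hasDerivAt_id z).sub_const z0).div_const _
  have hMC : (M : ℂ) ≠ 0 := by exact_mod_cast hM0.ne'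
  have hSmem : ∃ s ∈ S, 0 < s := by
    refine ⟨_, ⟨fun z => (z - z0) / M, ⟨?_, ?_, ?_, ?_, by simp⟩, rfl⟩, ?_⟩
    · intro z hz
      have := hM hz
      rw [mem_ball, dist_eq_norm] at this
      rw [mem_ball_zero_iff, norm_div, Complex.norm_real, Real.norm_of_nonneg hM0.le,
        div_lt_one hM0]
      exact this
    · intro a _ b _ hab
      simpa [hMC, div_left_inj'] using hab
    · exact fun z _ => (hlin z).differentiableAt.differentiableWithinAt
    · intro z _
      rw [(hlin z).deriv]
      simpa using hMC
    · rw [(hlin z0).deriv]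
      simpa using hM0.ne'
  have hSb : BddAbove S := by
    refine ⟨1 / R, ?_⟩
    rintro _ ⟨f, hf, rfl⟩
    apply Complex.norm_deriv_le_div_of_mapsTo_ball (hf.diff.mono hRΩ) _ hR
    rw [hf.zero]
    exact fun z hz => ball_subset_closedBall (hf.mapsTo (hRΩ hz))
  obtain ⟨s0, hs0, hs0pos⟩ := hSmem
  obtain ⟨u, -, hu, huS⟩ := exists_seq_tendsto_sSup ⟨s0, hs0⟩ hSb
  choose f hf hfu using huS
  obtain ⟨F, hF⟩ := exists_tendstoLocallyUniformlyOn_ultrafilter hΩ (hyperfilter ℕ)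
    (fun n => (hf n).diff) fun n => (hf n).mapsTo
  have hFd := hF.differentiableOn (Eventually.of_forall fun n => (hf n).diff) hΩ
  have hF' := hF.deriv (Eventually.of_forall fun n => (hf n).diff) hΩ
  have hle : ((hyperfilter ℕ : Ultrafilter ℕ) : Filter ℕ) ≤ atTop := Nat.hyperfilter_le_atTop
  have hder : ‖deriv F z0‖ = sSup S := by
    have h1 := (hF'.tendsto_at hz0).norm
    have h2 : Tendsto u (hyperfilter ℕ : Filter ℕ) (𝓝 (sSup S)) := hu.mono_left hle
    refine tendsto_nhds_unique h1 (h2.congr fun n => ?_)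
    rw [hfu n]; rfl
  have hder0 : deriv F z0 ≠ 0 := by
    rw [← norm_pos_iff, hder]
    exact hs0pos.trans_le (le_csSup hSb hs0)
  have hFan : AnalyticOnNhd ℂ F Ω := hFd.analyticOnNhd hΩ
  have hnonconst : ∀ a ∈ Ω, ∀ c, ¬ ∀ᶠ z in 𝓝 a, F z - c = 0 := by
    intro a ha c h
    have h1 : EqOn F (fun _ => c) Ω :=
      hFan.eqOn_of_preconnected_of_eventuallyEq analyticOnNhd_const hconn ha
        (h.mono fun z hz => sub_eq_zero.1 hz)
    apply hder0
    have h2 : F =ᶠ[𝓝 z0] fun _ => c := h1.eventuallyEq_of_mem (hΩ.mem_nhds hz0)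
    rw [h2.deriv_eq]
    simp
  have hF0 : F z0 = 0 := by
    exact tendsto_nhds_unique (hF.tendsto_at hz0)
      (tendsto_const_nhds.congr fun n => ((hf n).zero).symm)
  have hFle : ∀ z ∈ Ω, ‖F z‖ ≤ 1 := fun z hz =>
    le_of_tendsto (hF.tendsto_at hz).norm (Eventually.of_forall fun n =>
      (mem_ball_zero_iff.1 ((hf n).mapsTo hz)).le)
  refine ⟨F, ⟨?_, ?_, hFd, ?_, hF0⟩, ?_⟩
  · intro z hz
    rw [mem_ball_zero_iff]
    refine lt_of_le_of_ne (hFle z hz) fun h => ?_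
    have := Complex.eqOn_of_isPreconnected_of_isMaxOn_norm hconn hΩ hFd hz
      (fun y hy => by simpa [h] using hFle y hy) hz0
    rw [hF0] at this
    rw [← show (0 : ℂ) = F z from this, norm_zero] at h
    exact zero_ne_one h
  · intro a ha b hb' hab
    by_contra hne
    obtain ⟨ρ, hρ, hρΩ⟩ := Metric.isOpen_iff.1 hΩ b hb'
    set V := ball b (min ρ (dist a b)) with hV
    have hVΩ : V ⊆ Ω := (ball_subset_ball (min_le_left _ _)).trans hρΩ
    have haV : a ∉ V := fun h => by
      rw [hV, mem_ball, lt_min_iff] at h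
      exact lt_irrefl _ h.2
    have hbV : b ∈ V := mem_ball_self (lt_min hρ (dist_pos.2 hne))
    have hconv : TendstoLocallyUniformlyOn (fun n z => f n z - f n a) (fun z => F z - F a)
        (hyperfilter ℕ : Filter ℕ) V := by
      rw [Metric.tendstoLocallyUniformlyOn_iff]
      intro ε hε x hx
      obtain ⟨t, ht, hev⟩ := Metric.tendstoLocallyUniformlyOn_iff.1 (hF.mono hVΩ) (ε / 2)
        (by positivity) x hx
      refine ⟨t, ht, ?_⟩
      filter_upwards [hev, Metric.tendsto_nhds.1 (hF.tendsto_at ha) (ε / 2) (by positivity)]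
        with n h1 h2 y hy
      have h3 := h1 y hy
      rw [dist_eq_norm] at *
      have : F y - F a - (f n y - f n a) = (F y - f n y) + (f n a - F a) := by ring
      rw [this]
      exact (norm_add_le _ _).trans_lt (by linarith)
    refine hurwitz_ne_zero isOpen_ball (fun n => ((hf n).diff.mono hVΩ).sub_const _) ?_ hconv hbV
      (hnonconst b hb' (F a)) (by simp [hab])
    intro n z hz h0
    have := (hf n).injOn (hVΩ hz) ha (sub_eq_zero.1 h0)
    exact haV (this ▸ hz)
  · intro a ha
    have hd' : ∀ n, DifferentiableOn ℂ (deriv (f n)) Ω := fun n => (hf n).diff.deriv hΩ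
    refine hurwitz_ne_zero hΩ hd' (fun n => (hf n).deriv_ne) hF' ha ?_
    intro h
    have hd2 : AnalyticOnNhd ℂ (deriv F) Ω := hFan.deriv
    have h1 : EqOn (deriv F) (fun _ => 0) Ω :=
      hd2.eqOn_of_preconnected_of_eventuallyEq analyticOnNhd_const hconn ha h
    exact hder0 (h1 hz0)
  · intro g hg
    rw [hder]
    exact le_csSup hSb ⟨g, hg, rfl⟩

theorem IsUnivalentInto.mob_comp {Ω : Set ℂ} (hΩ : IsOpen Ω) {f : ℂ → ℂ}
    (hm : MapsTo f Ω (ball 0 1)) (hi : InjOn f Ω) (hd : DifferentiableOn ℂ f Ω)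
    (hd0 : ∀ z ∈ Ω, deriv f z ≠ 0) {z0 : ℂ} (hz0 : z0 ∈ Ω) :
    IsUnivalentInto Ω z0 (fun z => mob (f z0) (f z)) := by
  have h0 : ‖f z0‖ < 1 := mem_ball_zero_iff.1 (hm hz0)
  refine ⟨fun z hz => ?_, fun a ha b hb h => ?_, ?_, fun z hz => ?_, mob_self _⟩
  · exact mem_ball_zero_iff.2 (norm_mob_lt_one h0 (mem_ball_zero_iff.1 (hm hz)))
  · apply hi ha hb
    have h' := congrArg (mob (f z0)) h
    simpa only [mob_mob h0 (mem_ball_zero_iff.1 (hm ha)),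
      mob_mob h0 (mem_ball_zero_iff.1 (hm hb))] using h'
  · exact (differentiableOn_mob h0).comp hd hm
  · have hz1 : ‖f z‖ < 1 := mem_ball_zero_iff.1 (hm hz)
    have h1 := (hasDerivAt_mob h0 hz1).comp z ((hd.differentiableAt (hΩ.mem_nhds hz)).hasDerivAt)
    have h2 : deriv (fun z => mob (f z0) (f z)) z = _ := h1.deriv
    rw [h2]
    refine mul_ne_zero ?_ (hd0 z hz)
    rw [← (hasDerivAt_mob h0 hz1).deriv]
    exact deriv_mob_ne_zero h0 hz1

theorem IsUnivalentInto.surjOn_of_max {Ω : Set ℂ} (hΩ : IsOpen Ω) (hsc : IsSimplyConnected Ω)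
    {z0 : ℂ} (hz0 : z0 ∈ Ω) {F : ℂ → ℂ} (hF : IsUnivalentInto Ω z0 F)
    (hmax : ∀ f, IsUnivalentInto Ω z0 f → ‖deriv f z0‖ ≤ ‖deriv F z0‖) :
    SurjOn F Ω (ball 0 1) := by
  intro w hw
  rw [mem_ball_zero_iff] at hw
  by_contra hwF
  have hF1 : ∀ z ∈ Ω, ‖F z‖ < 1 := fun z hz => mem_ball_zero_iff.1 (hF.mapsTo hz)
  have hw0 : w ≠ 0 := by
    rintro rfl
    exact hwF ⟨z0, hz0, hF.zero⟩
  have hpd : DifferentiableOn ℂ (fun z => mob w (F z)) Ω :=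
    (differentiableOn_mob hw).comp hF.diff hF.mapsTo
  have hp0 : ∀ z ∈ Ω, mob w (F z) ≠ 0 := fun z hz h =>
    hwF ⟨z, hz, mob_eq_zero hw (hF1 z hz) h⟩
  obtain ⟨h, hhc, hh⟩ := Complex.exists_continuousOn_pow_eq hsc hΩ hpd.continuousOn
    (by rintro ⟨z, hz, hz'⟩; exact hp0 z hz hz') two_ne_zero
  have hh0 : ∀ z ∈ Ω, h z ≠ 0 := fun z hz hz' => hp0 z hz (by rw [← hh, hz']; simp)
  have hFder : ∀ z ∈ Ω, HasDerivAt (fun z => mob w (F z))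
      (-(1 - conj w * w) / (1 - conj w * F z) ^ 2 * deriv F z) z := fun z hz =>
    (hasDerivAt_mob hw (hF1 z hz)).comp z
      ((hF.diff.differentiableAt (hΩ.mem_nhds hz)).hasDerivAt)
  have hhd : ∀ z ∈ Ω, HasDerivAt h
      ((2 * h z)⁻¹ * (-(1 - conj w * w) / (1 - conj w * F z) ^ 2 * deriv F z)) z := by
    intro z hz
    have hca : ContinuousAt h z := hhc.continuousAt (hΩ.mem_nhds hz)
    have hsq : HasDerivAt (fun u : ℂ => u ^ 2) (2 * h z) (h z) := by
      simpa using hasDerivAt_pow 2 (h z)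
    have h2 : (2 * h z) ≠ 0 := mul_ne_zero two_ne_zero (hh0 z hz)
    rw [hasDerivAt_iff_tendsto_slope]
    have hcong := hFder z hz
    rw [hasDerivAt_iff_tendsto_slope] at hcong
    have hsum : Tendsto (fun y => (h y + h z)⁻¹) (𝓝[≠] z) (𝓝 (2 * h z)⁻¹) := by
      apply Tendsto.inv₀ _ h2
      have : Tendsto (fun y => h y + h z) (𝓝 z) (𝓝 (h z + h z)) := hca.tendsto.add_const _
      rw [two_mul]
      exact this.mono_left nhdsWithin_le_nhds
    refine (hsum.mul hcong).congr' ?_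
    have hne : ∀ᶠ y in 𝓝[≠] z, h y + h z ≠ 0 := by
      have : ContinuousAt (fun y => h y + h z) z := hca.add continuousAt_const
      exact (this.eventually_ne (by simpa [two_mul] using h2)).filter_mono nhdsWithin_le_nhds
    filter_upwards [hne] with y hy
    simp only [slope_def_field]
    rw [← hh y, ← hh z]
    have : h y ^ 2 - h z ^ 2 = (h y + h z) * (h y - h z) := by ring
    rw [this, mul_div_assoc, inv_mul_cancel_left₀ hy]
  have hhm : MapsTo h Ω (ball 0 1) := by
    intro z hz
    rw [mem_ball_zero_iff, ← pow_lt_one_iff_of_nonneg (norm_nonneg _) two_ne_zero, ← norm_pow, hh]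
    exact norm_mob_lt_one hw (hF1 z hz)
  have hhi : InjOn h Ω := by
    intro a ha b hb hab
    apply hF.injOn ha hb
    have h1 : mob w (F a) = mob w (F b) := by rw [← hh, ← hh, hab]
    have h2 := congrArg (mob w) h1
    rwa [mob_mob hw (hF1 a ha), mob_mob hw (hF1 b hb)] at h2
  have hw1 : 1 - conj w * w ≠ 0 := one_sub_conj_mul_ne_zero hw hw.le
  have hK := IsUnivalentInto.mob_comp hΩ hhm hhi
    (fun z hz => (hhd z hz).differentiableAt.differentiableWithinAt) (fun z hz => by
      rw [(hhd z hz).deriv]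
      have h1 := one_sub_conj_mul_ne_zero hw (hF1 z hz).le
      have h2 := hh0 z hz
      exact mul_ne_zero (inv_ne_zero (mul_ne_zero two_ne_zero h2)) (mul_ne_zero
        (div_ne_zero (neg_ne_zero.2 hw1) (pow_ne_zero _ h1)) (hF.deriv_ne z hz))) hz0
  have hle := hmax _ hK
  have hh1 : ‖h z0‖ < 1 := mem_ball_zero_iff.1 (hhm hz0)
  have hKd : HasDerivAt (fun z => mob (h z0) (h z)) _ z0 :=
    (hasDerivAt_mob hh1 hh1).comp z0 (hhd z0 hz0)
  rw [hKd.deriv, hF.zero] at hle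
  have hsqn : ‖h z0‖ ^ 2 = ‖w‖ := by rw [← norm_pow, hh, hF.zero, mob_zero]
  have hnsq : ∀ u : ℂ, ‖u‖ < 1 → ‖1 - conj u * u‖ = 1 - ‖u‖ ^ 2 := by
    intro u hu
    have : (1 : ℂ) - conj u * u = ((1 - ‖u‖ ^ 2 : ℝ) : ℂ) := by
      rw [mul_comm, Complex.mul_conj, Complex.normSq_eq_norm_sq]
      push_cast
      ring
    rw [this, Complex.norm_real, Real.norm_of_nonneg]
    nlinarith [norm_nonneg u]
  have hF'pos : 0 < ‖deriv F z0‖ := norm_pos_iff.2 (hF.deriv_ne z0 hz0)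
  simp only [norm_mul, norm_div, norm_neg, norm_pow, norm_inv, hnsq _ hh1, hnsq _ hw, mul_zero,
    sub_zero, norm_one, Complex.norm_ofNat, hsqn] at hle
  set s := ‖h z0‖ with hs
  have hs0 : 0 < s := norm_pos_iff.2 (hh0 z0 hz0)
  have h1s : 0 < 1 - s ^ 2 := by nlinarith
  rw [← hsqn] at hle
  have : (1 - s ^ 2) / (1 - s ^ 2) ^ 2 * ((2 * s)⁻¹ * ((1 - (s ^ 2) ^ 2) / 1 ^ 2 * ‖deriv F z0‖))
      = (1 + s ^ 2) / (2 * s) * ‖deriv F z0‖ := by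
    field_simp
    ring
  rw [this] at hle
  have h3 : (1 + s ^ 2) / (2 * s) ≤ 1 := by
    by_contra hc
    push Not at hc
    nlinarith
  rw [div_le_one (by positivity)] at h3
  nlinarith [sq_nonneg (1 - s)]

/-- A Riemann map `φ : Ω → 𝔻` together with its inverse `f : 𝔻 → Ω`. -/
structure RiemannPair (Ω : Set ℂ) (φ f : ℂ → ℂ) : Prop where
  mapsTo : MapsTo φ Ω (ball 0 1)
  mapsTo_inv : MapsTo f (ball 0 1) Ω
  left_inv : ∀ x ∈ Ω, f (φ x) = x
  right_inv : ∀ z ∈ ball (0 : ℂ) 1, φ (f z) = z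
  diff : DifferentiableOn ℂ φ Ω
  diff_inv : DifferentiableOn ℂ f (ball 0 1)
  isOpen : IsOpen Ω

theorem exists_riemannPair {Ω : Set ℂ} (hΩ : IsOpen Ω) (hsc : IsSimplyConnected Ω)
    (hb : Bornology.IsBounded Ω) {z0 : ℂ} (hz0 : z0 ∈ Ω) :
    ∃ φ f, RiemannPair Ω φ f := by
  obtain ⟨φ, hφ, hmax⟩ := exists_univalent_deriv_max hΩ
    hsc.isPathConnected.isConnected.isPreconnected hb hz0
  have hsurj := hφ.surjOn_of_max hΩ hsc hz0 hmax
  have hbij : BijOn φ Ω (ball 0 1) := ⟨hφ.mapsTo, hφ.injOn, hsurj⟩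
  set f := Function.invFunOn φ Ω with hf
  have hfm : MapsTo f (ball 0 1) Ω := hsurj.mapsTo_invFunOn
  have hr : ∀ z ∈ ball (0 : ℂ) 1, φ (f z) = z := fun z hz => hsurj.rightInvOn_invFunOn hz
  have hl : ∀ x ∈ Ω, f (φ x) = x := fun x hx => hφ.injOn.leftInvOn_invFunOn hx
  refine ⟨φ, f, hφ.mapsTo, hfm, hl, hr, hφ.diff, ?_, hΩ⟩
  have hcont : ∀ z ∈ ball (0 : ℂ) 1, ContinuousAt f z := by
    intro z hz
    rw [ContinuousAt, tendsto_def]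
    intro V hV
    have hx := hfm hz
    have hs : HasStrictDerivAt φ (deriv φ (f z)) (f z) :=
      (hφ.diff.analyticAt (hΩ.mem_nhds hx)).hasStrictDerivAt
    have hmap := hs.map_nhds_eq (hφ.deriv_ne _ hx)
    have : φ '' (V ∩ Ω) ∈ 𝓝 (φ (f z)) := by
      rw [← hmap]
      exact image_mem_map (inter_mem hV (hΩ.mem_nhds hx))
    rw [hr z hz] at this
    filter_upwards [this]
    rintro _ ⟨x, ⟨hxV, hxΩ⟩, rfl⟩
    rw [mem_preimage, hl x hxΩ]
    exact hxV
  intro z hz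
  have hx := hfm hz
  have hd : HasDerivAt φ (deriv φ (f z)) (f z) :=
    (hφ.diff.differentiableAt (hΩ.mem_nhds hx)).hasDerivAt
  have := HasDerivAt.of_local_left_inverse (hcont z hz) hd (hφ.deriv_ne _ hx)
    (by filter_upwards [isOpen_ball.mem_nhds hz] with y hy using hr y hy)
  exact this.differentiableAt.differentiableWithinAt

section

/-! ### The Green function of a bounded simply connected domain -/

/-- The pseudo-hyperbolic distance. -/
def pd (z w : ℂ) : ℝ := ‖mob w z‖

theorem pd_eq (z w : ℂ) : pd z w = ‖z - w‖ / ‖1 - conj w * z‖ := by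
  rw [pd, mob, norm_div, norm_sub_rev]

theorem pd_comm (z w : ℂ) : pd z w = pd w z := by
  rw [pd_eq, pd_eq, norm_sub_rev]
  congr 1
  rw [← RCLike.norm_conj (1 - conj w * z)]
  simp [mul_comm]

theorem pd_nonneg (z w : ℂ) : 0 ≤ pd z w := norm_nonneg _

theorem pd_lt_one {z w : ℂ} (hz : ‖z‖ < 1) (hw : ‖w‖ < 1) : pd z w < 1 := norm_mob_lt_one hw hz

theorem pd_eq_zero {z w : ℂ} (hz : ‖z‖ < 1) (hw : ‖w‖ < 1) : pd z w = 0 ↔ z = w := by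
  rw [pd, norm_eq_zero]
  exact ⟨mob_eq_zero hw hz, fun h => h ▸ mob_self _⟩

open Classical in
/-- The Green function of `Ω` expressed through a Riemann map `φ`. -/
def green (Ω : Set ℂ) (φ : ℂ → ℂ) (x y : ℂ) : ℝ :=
  if x ∈ Ω ∧ y ∈ Ω then -(2 * π)⁻¹ * Real.log (pd (φ x) (φ y)) else 0

section
variable {Ω : Set ℂ} {φ f : ℂ → ℂ}

theorem green_of_mem {x y : ℂ} (hx : x ∈ Ω) (hy : y ∈ Ω) :
    green Ω φ x y = -(2 * π)⁻¹ * Real.log (pd (φ x) (φ y)) := if_pos ⟨hx, hy⟩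

theorem green_of_notMem_left {x : ℂ} (hx : x ∉ Ω) (y : ℂ) : green Ω φ x y = 0 :=
  if_neg fun h => hx h.1

theorem green_of_notMem_right (x : ℂ) {y : ℂ} (hy : y ∉ Ω) : green Ω φ x y = 0 :=
  if_neg fun h => hy h.2

theorem green_comm (x y : ℂ) : green Ω φ x y = green Ω φ y x := by
  by_cases h : x ∈ Ω ∧ y ∈ Ω
  · rw [green_of_mem h.1 h.2, green_of_mem h.2 h.1, pd_comm]
  · rw [green, green, if_neg h, if_neg fun h' => h h'.symm]

theorem RiemannPair.norm_lt (hR : RiemannPair Ω φ f) {x : ℂ} (hx : x ∈ Ω) : ‖φ x‖ < 1 :=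
  mem_ball_zero_iff.1 (hR.mapsTo hx)

theorem RiemannPair.injOn (hR : RiemannPair Ω φ f) : InjOn φ Ω := fun a ha b hb h => by
  rw [← hR.left_inv a ha, h, hR.left_inv b hb]

theorem RiemannPair.pd_pos (hR : RiemannPair Ω φ f) {x y : ℂ} (hx : x ∈ Ω) (hy : y ∈ Ω)
    (hxy : x ≠ y) : 0 < pd (φ x) (φ y) :=
  lt_of_le_of_ne (pd_nonneg _ _) fun h =>
    hxy (hR.injOn hx hy ((pd_eq_zero (hR.norm_lt hx) (hR.norm_lt hy)).1 h.symm))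

theorem green_nonneg (hR : RiemannPair Ω φ f) (x y : ℂ) : 0 ≤ green Ω φ x y := by
  rw [green]
  split_ifs with h
  · have h1 := Real.log_nonpos (pd_nonneg (φ x) (φ y))
      (pd_lt_one (hR.norm_lt h.1) (hR.norm_lt h.2)).le
    have h2 : 0 < (2 * π)⁻¹ := by positivity
    nlinarith
  · exact le_rfl

theorem RiemannPair.dist_le_pd (hR : RiemannPair Ω φ f) {M : ℝ} (hM : Ω ⊆ ball 0 M) {z w : ℂ}
    (hz : ‖z‖ < 1) (hw : ‖w‖ < 1) : dist (f z) (f w) ≤ 2 * M * pd z w := by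
  have hm : MapsTo (mob w) (ball 0 1) (ball 0 1) := fun u hu =>
    mem_ball_zero_iff.2 (norm_mob_lt_one hw (mem_ball_zero_iff.1 hu))
  have h := Complex.dist_le_div_mul_dist_of_mapsTo_ball (f := fun u => f (mob w u)) (c := 0)
    (R₁ := 1) (R₂ := 2 * M) (z := mob w z) (hR.diff_inv.comp (differentiableOn_mob hw) hm)
    (fun u hu => by
      have h1 := hM (hR.mapsTo_inv (hm hu))
      have h2 := hM (hR.mapsTo_inv (hm (mem_ball_self one_pos)))
      rw [mem_ball_zero_iff] at h1 h2
      rw [mem_closedBall, dist_eq_norm]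
      exact (norm_sub_le _ _).trans (by linarith))
    (mem_ball_zero_iff.2 (norm_mob_lt_one hw hz))
  simpa [mob_mob hw hz, mob_zero, pd] using h

theorem exp_green_le (hR : RiemannPair Ω φ f) {M : ℝ} (hM : Ω ⊆ ball 0 M) {β : ℝ} (hβ : 0 ≤ β)
    {x y : ℂ} (hxy : x ≠ y) :
    Real.exp (β * green Ω φ x y) ≤ 1 + (2 * M) ^ (β / (2 * π)) * ‖x - y‖ ^ (-(β / (2 * π))) := by
  by_cases h : x ∈ Ω ∧ y ∈ Ω
  · have hM0 : 0 < M := (norm_nonneg x).trans_lt (mem_ball_zero_iff.1 (hM h.1))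
    have hp := hR.pd_pos h.1 h.2 hxy
    have hn : 0 < ‖x - y‖ := norm_pos_iff.2 (sub_ne_zero.2 hxy)
    have hd := hR.dist_le_pd hM (hR.norm_lt h.1) (hR.norm_lt h.2)
    rw [hR.left_inv x h.1, hR.left_inv y h.2, dist_eq_norm] at hd
    have hb : 0 ≤ β / (2 * π) := by positivity
    rw [green_of_mem h.1 h.2]
    have : Real.exp (β * (-(2 * π)⁻¹ * Real.log (pd (φ x) (φ y))))
        = pd (φ x) (φ y) ^ (-(β / (2 * π))) := by
      rw [Real.rpow_def_of_pos hp]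
      congr 1
      field_simp
    rw [this]
    have h2 : pd (φ x) (φ y) ^ (-(β / (2 * π))) ≤ (‖x - y‖ / (2 * M)) ^ (-(β / (2 * π))) := by
      apply Real.rpow_le_rpow_of_nonpos (by positivity) _ (by linarith)
      rw [div_le_iff₀ (by positivity)]
      linarith
    rw [Real.div_rpow hn.le (by positivity), Real.rpow_neg (by positivity : 0 ≤ 2 * M), div_inv_eq_mul] at h2
    linarith [mul_comm ((2 * M) ^ (β / (2 * π))) (‖x - y‖ ^ (-(β / (2 * π))))]
  · rw [green, if_neg h]
    simp only [mul_zero, Real.exp_zero]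
    have hx : 0 ≤ ‖x - y‖ ^ (-(β / (2 * π))) := by positivity
    by_cases hM0 : 0 ≤ M
    · have : 0 ≤ (2 * M) ^ (β / (2 * π)) := by positivity
      nlinarith
    · exfalso
      have : (0 : ℂ) ∈ ball (0 : ℂ) 1 := mem_ball_self one_pos
      have := mem_ball_zero_iff.1 (hM (hR.mapsTo_inv this))
      linarith [norm_nonneg (f 0)]

theorem measurable_indicator_of_continuousOn {Ω : Set ℂ} (hΩ : IsOpen Ω) {φ : ℂ → ℂ}
    (hφ : ContinuousOn φ Ω) : Measurable (Ω.indicator φ) := by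
  classical
  have h := hφ.measurable_piecewise (continuousOn_const (c := (0 : ℂ)) (s := Ωᶜ)) hΩ.measurableSet
  rwa [show Ω.piecewise φ (fun _ => 0) = Ω.indicator φ from piecewise_eq_indicator] at h

theorem measurable_pd : Measurable (fun p : ℂ × ℂ => pd p.1 p.2) := by
  unfold pd mob
  fun_prop

theorem measurable_green (hR : RiemannPair Ω φ f) :
    Measurable (fun p : ℂ × ℂ => green Ω φ p.1 p.2) := by
  have hm := measurable_indicator_of_continuousOn hR.isOpen hR.diff.continuousOn
  have h1 : Measurable (fun p : ℂ × ℂ => -(2 * π)⁻¹ *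
      Real.log (pd (Ω.indicator φ p.1) (Ω.indicator φ p.2))) :=
    (Real.measurable_log.comp (measurable_pd.comp
      ((hm.comp measurable_fst).prodMk (hm.comp measurable_snd)))).const_mul _
  have h2 := h1.indicator (hR.isOpen.measurableSet.prod hR.isOpen.measurableSet)
  convert h2 using 1
  ext p
  by_cases h : p.1 ∈ Ω ∧ p.2 ∈ Ω
  · rw [green_of_mem h.1 h.2, indicator_of_mem (by exact h), indicator_of_mem h.1,
      indicator_of_mem h.2]
  · rw [green, if_neg h, indicator_of_notMem (by exact h)]

theorem measurable_green_right (hR : RiemannPair Ω φ f) (x : ℂ) : Measurable (green Ω φ x) :=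
  (measurable_green hR).comp measurable_prodMk_left

theorem integrable_ball_norm_rpow {p : ℝ} (hp : p < 2) :
    Integrable ((ball (0 : ℂ) 1).indicator fun y => ‖y‖ ^ (-p)) := by
  rw [integrable_indicator_iff measurableSet_ball]
  refine integrableOn_ball_of_norm_le_rpow (C := 1) (α := p) (by simp)
    (by simpa using hp) (Eventually.of_forall fun x => ?_)
    (measurable_norm.pow_const (-p)).aestronglyMeasurable
  rw [one_mul, Real.norm_of_nonneg (by positivity)]

theorem norm_rpow_neg_le {p : ℝ} (hp : 0 ≤ p) (y : ℂ) :
    ‖y‖ ^ (-p) ≤ (ball (0 : ℂ) 1).indicator (fun y => ‖y‖ ^ (-p)) y + 1 := by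
  by_cases hy : y ∈ ball (0 : ℂ) 1
  · rw [indicator_of_mem hy]; linarith
  · rw [indicator_of_notMem hy]
    have : 1 ≤ ‖y‖ := by simpa using hy
    have := Real.rpow_le_one_of_one_le_of_nonpos this (by linarith : -p ≤ 0)
    linarith

theorem exists_integral_norm_rpow_le {Ω : Set ℂ} (hv : volume Ω ≠ ⊤) {p : ℝ} (hp0 : 0 ≤ p)
    (hp : p < 2) : ∃ C, 0 ≤ C ∧ ∀ x : ℂ, IntegrableOn (fun y => ‖x - y‖ ^ (-p)) Ω ∧
      ∫ y in Ω, ‖x - y‖ ^ (-p) ≤ C := by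
  set h : ℂ → ℝ := (ball (0 : ℂ) 1).indicator fun y => ‖y‖ ^ (-p) with hh
  have hi : Integrable h := integrable_ball_norm_rpow hp
  have hnn : ∀ y, 0 ≤ h y := fun y => indicator_nonneg (fun y _ => by positivity) y
  have hx : ∀ x : ℂ, Integrable (fun y => h (x - y)) := fun x => hi.comp_sub_left x
  have hone : IntegrableOn (fun _ : ℂ => (1 : ℝ)) Ω := by
    simp [lt_top_iff_ne_top, hv]
  have hmeas : ∀ x : ℂ, AEStronglyMeasurable (fun y => ‖x - y‖ ^ (-p)) (volume.restrict Ω) :=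
    fun x => (Measurable.pow_const (by fun_prop) (-p)).aestronglyMeasurable
  refine ⟨(∫ y, h y) + volume.real Ω, by have : 0 ≤ ∫ y, h y := integral_nonneg hnn; positivity, fun x => ?_⟩
  have hInt : IntegrableOn (fun y => h (x - y) + 1) Ω := (hx x).integrableOn.add hone
  have hI : IntegrableOn (fun y => ‖x - y‖ ^ (-p)) Ω :=
    hInt.mono' (hmeas x) (Eventually.of_forall fun y => by
      rw [Real.norm_of_nonneg (by positivity)]
      exact norm_rpow_neg_le hp0 _)
  refine ⟨hI, ?_⟩
  calc ∫ y in Ω, ‖x - y‖ ^ (-p) ≤ ∫ y in Ω, (h (x - y) + 1) :=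
        integral_mono hI hInt fun y => norm_rpow_neg_le hp0 _
    _ = (∫ y in Ω, h (x - y)) + volume.real Ω := by
        rw [integral_add (hx x).integrableOn hone]; simp
    _ ≤ (∫ y, h (x - y)) + volume.real Ω := by
        refine add_le_add_left ?_ _
        exact setIntegral_le_integral (hx x) (Eventually.of_forall fun y => hnn _)
    _ = (∫ y, h y) + volume.real Ω := by rw [integral_sub_left_eq_self h volume x]

theorem ae_ne (x : ℂ) {μ : Measure ℂ} [NullSingletonClass μ] : ∀ᵐ y ∂μ, x ≠ y := by
  rw [ae_iff]
  simp

theorem exists_integral_exp_green_le (hR : RiemannPair Ω φ f) (hb : Bornology.IsBounded Ω)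
    {β : ℝ} (hβ : 0 ≤ β) (hβ' : β < 4 * π) : ∃ C, 0 < C ∧ ∀ x : ℂ,
      IntegrableOn (fun y => Real.exp (β * green Ω φ x y)) Ω ∧
      ∫ y in Ω, Real.exp (β * green Ω φ x y) ≤ C := by
  obtain ⟨M, hM⟩ := hb.subset_ball 0
  have hv : volume Ω ≠ ⊤ := hb.measure_lt_top.ne
  have hp0 : 0 ≤ β / (2 * π) := by positivity
  have hp : β / (2 * π) < 2 := by rw [div_lt_iff₀ (by positivity)]; linarith
  obtain ⟨C, hC0, hC⟩ := exists_integral_norm_rpow_le hv hp0 hp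
  have hone : IntegrableOn (fun _ : ℂ => (1 : ℝ)) Ω := by
    simp [lt_top_iff_ne_top, hv]
  set K := (2 * M) ^ (β / (2 * π)) with hK
  refine ⟨volume.real Ω + |K| * C + 1, by positivity, fun x => ?_⟩
  have hInt : IntegrableOn (fun y => 1 + K * ‖x - y‖ ^ (-(β / (2 * π)))) Ω :=
    hone.add ((hC x).1.const_mul K)
  have hle : ∀ᵐ y ∂(volume.restrict Ω), Real.exp (β * green Ω φ x y)
      ≤ 1 + K * ‖x - y‖ ^ (-(β / (2 * π))) := by
    filter_upwards [ae_ne x] with y hy using exp_green_le hR hM hβ hy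
  have hI : IntegrableOn (fun y => Real.exp (β * green Ω φ x y)) Ω := by
    refine hInt.mono' ?_ ?_
    · exact (Real.measurable_exp.comp
        ((measurable_green_right hR x).const_mul β)).aestronglyMeasurable
    · filter_upwards [hle] with y hy
      rwa [Real.norm_of_nonneg (Real.exp_pos _).le]
  refine ⟨hI, (integral_mono_ae hI hInt hle).trans ?_⟩
  rw [integral_add hone ((hC x).1.const_mul K), integral_const_mul]
  simp only [integral_const, MeasurableSet.univ, measureReal_restrict_apply, univ_inter,
    smul_eq_mul, mul_one]
  have h1 : 0 ≤ ∫ y in Ω, ‖x - y‖ ^ (-(β / (2 * π))) := integral_nonneg fun y => by positivity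
  have h2 : K * ∫ y in Ω, ‖x - y‖ ^ (-(β / (2 * π))) ≤ |K| * C :=
    mul_le_mul (le_abs_self K) (hC x).2 h1 (abs_nonneg _)
  linarith

theorem continuousAt_green (hR : RiemannPair Ω φ f) {x y : ℂ} (hxy : x ≠ y) :
    ContinuousAt (fun x => green Ω φ x y) x := by
  by_cases hy : y ∈ Ω
  swap
  · simp only [green_of_notMem_right _ hy]
    exact continuousAt_const
  have hw := hR.norm_lt hy
  by_cases hx : x ∈ Ω
  · have h1 : ContinuousAt (fun x => -(2 * π)⁻¹ * Real.log (pd (φ x) (φ y))) x := by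
      have hφ : ContinuousAt φ x := hR.diff.continuousOn.continuousAt (hR.isOpen.mem_nhds hx)
      have hm : ContinuousAt (mob (φ y)) (φ x) := (hasDerivAt_mob hw (hR.norm_lt hx)).continuousAt
      have hp : ContinuousAt (fun x => pd (φ x) (φ y)) x :=
        (ContinuousAt.comp (g := mob (φ y)) hm hφ).norm
      exact (hp.log (hR.pd_pos hx hy hxy).ne').const_mul _
    refine h1.congr ?_
    filter_upwards [hR.isOpen.mem_nhds hx] with u hu
    rw [green_of_mem hu hy]
  · rw [ContinuousAt, green_of_notMem_left hx, Metric.tendsto_nhds]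
    intro ε hε
    set r := Real.exp (-(2 * π * ε)) with hr
    have hr0 : 0 < r := Real.exp_pos _
    have hr1 : r < 1 := by rw [hr, Real.exp_lt_one_iff]; simp; positivity
    set K := (fun u => f (mob (φ y) u)) '' closedBall 0 r with hK
    have hcb : closedBall (0 : ℂ) r ⊆ ball 0 1 := closedBall_subset_ball hr1
    have hm : MapsTo (mob (φ y)) (ball 0 1) (ball 0 1) := fun u hu =>
      mem_ball_zero_iff.2 (norm_mob_lt_one hw (mem_ball_zero_iff.1 hu))
    have hKc : IsCompact K := (isCompact_closedBall 0 r).image_of_continuousOn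
      ((hR.diff_inv.continuousOn.comp (differentiableOn_mob hw).continuousOn hm).mono hcb)
    have hxK : x ∉ K := by
      rintro ⟨u, hu, rfl⟩
      exact hx (hR.mapsTo_inv (hm (hcb hu)))
    filter_upwards [hKc.isClosed.isOpen_compl.mem_nhds hxK] with u hu
    by_cases huΩ : u ∈ Ω
    · have hpd : r < pd (φ u) (φ y) := by
        by_contra hle
        push Not at hle
        apply hu
        refine ⟨mob (φ y) (φ u), ?_, ?_⟩
        · rw [mem_closedBall_zero_iff]; exact hle
        · simp only [mob_mob hw (hR.norm_lt huΩ), hR.left_inv u huΩ]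
      rw [Real.dist_eq, sub_zero, abs_of_nonneg (green_nonneg hR _ _), green_of_mem huΩ hy]
      have := Real.log_lt_log hr0 hpd
      rw [hr, Real.log_exp] at this
      have h2 : 0 < (2 * π)⁻¹ := by positivity
      calc -(2 * π)⁻¹ * Real.log (pd (φ u) (φ y)) < (2 * π)⁻¹ * (2 * π * ε) := by nlinarith
        _ = ε := by field_simp
    · rw [green_of_notMem_left huΩ]
      simpa using hε

/-- Cauchy–Schwarz for real integrals. -/
theorem sq_integral_mul_le {X : Type*} [MeasurableSpace X] {μ : Measure X} {a b : X → ℝ}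
    (ha : Integrable (fun x => a x ^ 2) μ) (hb : Integrable (fun x => b x ^ 2) μ)
    (hab : Integrable (fun x => a x * b x) μ) :
    (∫ x, a x * b x ∂μ) ^ 2 ≤ (∫ x, a x ^ 2 ∂μ) * ∫ x, b x ^ 2 ∂μ := by
  have h : ∀ t : ℝ, 0 ≤ (∫ x, b x ^ 2 ∂μ) * (t * t) + (2 * ∫ x, a x * b x ∂μ) * t
      + ∫ x, a x ^ 2 ∂μ := by
    intro t
    have h1 : (∫ x, (a x + t * b x) ^ 2 ∂μ) = (∫ x, b x ^ 2 ∂μ) * (t * t)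
        + (2 * ∫ x, a x * b x ∂μ) * t + ∫ x, a x ^ 2 ∂μ := by
      have : ∀ x, (a x + t * b x) ^ 2 = (t * t) * b x ^ 2 + (2 * t) * (a x * b x) + a x ^ 2 :=
        fun x => by ring
      simp_rw [this]
      rw [integral_add ((hb.const_mul _).fun_add (hab.const_mul _)) ha,
        integral_add (hb.const_mul _) (hab.const_mul _), integral_const_mul, integral_const_mul]
      ring
    rw [← h1]
    exact integral_nonneg fun x => sq_nonneg _
  have := discrim_le_zero h
  rw [discrim] at this
  nlinarith

theorem integrable_mul_of_sq {X : Type*} [MeasurableSpace X] {μ : Measure X} {a b : X → ℝ}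
    (ham : AEStronglyMeasurable a μ) (hbm : AEStronglyMeasurable b μ)
    (ha : Integrable (fun x => a x ^ 2) μ) (hb : Integrable (fun x => b x ^ 2) μ) :
    Integrable (fun x => a x * b x) μ := by
  refine (ha.add hb).mono' (ham.mul hbm) (Eventually.of_forall fun x => ?_)
  simp only [Pi.add_apply]
  rw [Real.norm_eq_abs, abs_le]
  constructor <;> nlinarith [sq_nonneg (a x + b x), sq_nonneg (a x - b x)]

theorem sq_le_two_mul_exp {s : ℝ} (hs : 0 ≤ s) : s ^ 2 ≤ 2 * Real.exp s := by
  have := Real.quadratic_le_exp_of_nonneg hs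
  nlinarith

theorem integrable_green_sq (hR : RiemannPair Ω φ f) (hb : Bornology.IsBounded Ω) (x : ℂ) :
    IntegrableOn (fun y => green Ω φ x y ^ 2) Ω := by
  obtain ⟨C, -, hC⟩ := exists_integral_exp_green_le hR hb zero_le_one
    (by linarith [Real.pi_gt_three] : (1 : ℝ) < 4 * π)
  refine ((hC x).1.const_mul 2).mono' ((measurable_green_right hR x).pow_const 2).aestronglyMeasurable
    (Eventually.of_forall fun y => ?_)
  rw [Real.norm_of_nonneg (sq_nonneg _), one_mul]
  exact sq_le_two_mul_exp (green_nonneg hR x y)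

theorem sub_sq_le_trunc (a b m : ℝ) :
    (a - b) ^ 2 ≤ 3 * (min a m - min b m) ^ 2 + 6 * Real.exp (-m) * Real.exp a
      + 6 * Real.exp (-m) * Real.exp b := by
  have key : ∀ c : ℝ, (c - min c m) ^ 2 ≤ 2 * (Real.exp (-m) * Real.exp c) := by
    intro c
    rw [← Real.exp_add]
    rcases le_total c m with h | h
    · rw [min_eq_left h]
      have := (Real.exp_pos (-m + c)).le
      simpa using this
    · rw [min_eq_right h]
      have := sq_le_two_mul_exp (sub_nonneg.2 h)
      rwa [show -m + c = c - m by ring]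
  have h1 := key a
  have h2 := key b
  nlinarith [sq_nonneg ((min a m - min b m) - (a - min a m)),
    sq_nonneg ((min a m - min b m) + (b - min b m)), sq_nonneg ((a - min a m) + (b - min b m))]

theorem tendsto_integral_green_sub_sq (hR : RiemannPair Ω φ f) (hb : Bornology.IsBounded Ω)
    (x0 : ℂ) : Tendsto (fun x => ∫ y in Ω, (green Ω φ x y - green Ω φ x0 y) ^ 2) (𝓝 x0) (𝓝 0) := by
  obtain ⟨C, hC0, hC⟩ := exists_integral_exp_green_le hR hb zero_le_one
    (by linarith [Real.pi_gt_three] : (1 : ℝ) < 4 * π)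
  simp only [one_mul] at hC
  have hv : volume Ω ≠ ⊤ := hb.measure_lt_top.ne
  have : IsFiniteMeasure (volume.restrict Ω) := ⟨by simpa using hv.lt_top⟩
  have hmeas : ∀ x m, Measurable fun y => (min (green Ω φ x y) m - min (green Ω φ x0 y) m) ^ 2 :=
    fun x m => (((measurable_green_right hR x).min measurable_const).sub
      ((measurable_green_right hR x0).min measurable_const)).pow_const 2
  have hbd : ∀ m, 0 ≤ m → ∀ x y, (min (green Ω φ x y) m - min (green Ω φ x0 y) m) ^ 2 ≤ m ^ 2 := by
    intro m hm x y
    have h1 := le_min (green_nonneg hR x y) hm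
    have h2 := le_min (green_nonneg hR x0 y) hm
    have h3 := min_le_right (green Ω φ x y) m
    have h4 := min_le_right (green Ω φ x0 y) m
    apply sq_le_sq'  <;> linarith
  have hI : ∀ m, 0 ≤ m → ∀ x,
      IntegrableOn (fun y => (min (green Ω φ x y) m - min (green Ω φ x0 y) m) ^ 2) Ω := by
    intro m hm x
    refine (integrable_const (m ^ 2)).mono' (hmeas x m).aestronglyMeasurable
      (Eventually.of_forall fun y => ?_)
    rw [Real.norm_of_nonneg (sq_nonneg _)]
    exact hbd m hm x y
  rw [Metric.tendsto_nhds]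
  intro ε hε
  obtain ⟨m, hm0, hm⟩ : ∃ m : ℝ, 0 ≤ m ∧ 12 * Real.exp (-m) * C < ε / 2 := by
    have : Tendsto (fun m : ℝ => 12 * Real.exp (-m) * C) atTop (𝓝 (12 * 0 * C)) :=
      ((Real.tendsto_exp_neg_atTop_nhds_zero).const_mul 12).mul_const C
    simp only [mul_zero, zero_mul] at this
    obtain ⟨m, h1, h2⟩ := ((this.eventually (gt_mem_nhds (by positivity : 0 < ε / 2))).and
      (eventually_ge_atTop 0)).exists
    exact ⟨m, h2, h1⟩
  have hdct : Tendsto (fun x => ∫ y in Ω, (min (green Ω φ x y) m - min (green Ω φ x0 y) m) ^ 2)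
      (𝓝 x0) (𝓝 0) := by
    have h0 : (0 : ℝ) = ∫ y in Ω, (0 : ℝ) := by simp
    rw [h0]
    refine tendsto_integral_filter_of_dominated_convergence (fun _ => m ^ 2)
      (Eventually.of_forall fun x => (hmeas x m).aestronglyMeasurable)
      (Eventually.of_forall fun x => Eventually.of_forall fun y => ?_) (integrable_const _) ?_
    · rw [Real.norm_of_nonneg (sq_nonneg _)]
      exact hbd m hm0 x y
    · filter_upwards [ae_ne x0] with y hy
      have hc := (continuousAt_green hR hy).tendsto
      have := ((hc.min (tendsto_const_nhds (x := m))).sub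
        (tendsto_const_nhds (x := min (green Ω φ x0 y) m))).pow 2
      simpa using this
  filter_upwards [Metric.tendsto_nhds.1 hdct (ε / 6) (by positivity)] with x hx
  rw [Real.dist_eq, sub_zero, abs_of_nonneg (integral_nonneg fun y => sq_nonneg _)] at hx ⊢
  have hbI := Integrable.fun_add ((hI m hm0 x).const_mul 3) ((hC x).1.const_mul (6 * Real.exp (-m)))
  calc ∫ y in Ω, (green Ω φ x y - green Ω φ x0 y) ^ 2
      ≤ ∫ y in Ω, (3 * (min (green Ω φ x y) m - min (green Ω φ x0 y) m) ^ 2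
        + 6 * Real.exp (-m) * Real.exp (green Ω φ x y)
        + 6 * Real.exp (-m) * Real.exp (green Ω φ x0 y)) := by
        refine integral_mono_of_nonneg (Eventually.of_forall fun y => sq_nonneg _)
          (hbI.add ((hC x0).1.const_mul (6 * Real.exp (-m)))) (Eventually.of_forall fun y => ?_)
        exact sub_sq_le_trunc _ _ _
    _ = 3 * (∫ y in Ω, (min (green Ω φ x y) m - min (green Ω φ x0 y) m) ^ 2)
        + 6 * Real.exp (-m) * (∫ y in Ω, Real.exp (green Ω φ x y))
        + 6 * Real.exp (-m) * (∫ y in Ω, Real.exp (green Ω φ x0 y)) := by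
        rw [integral_add hbI ((hC x0).1.const_mul (6 * Real.exp (-m))),
          integral_add ((hI m hm0 x).const_mul 3) ((hC x).1.const_mul (6 * Real.exp (-m))),
          integral_const_mul, integral_const_mul, integral_const_mul]
    _ < ε := by
        have he := Real.exp_pos (-m)
        have h1 := mul_le_mul_of_nonneg_left (hC x).2 (by positivity : 0 ≤ 6 * Real.exp (-m))
        have h2 := mul_le_mul_of_nonneg_left (hC x0).2 (by positivity : 0 ≤ 6 * Real.exp (-m))
        linarith

end

end

section

/-! ### The Green operator on bounded continuous functions -/

/-- Bounded continuous real functions on the plane. -/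
abbrev BC : Type := BoundedContinuousFunction ℂ ℝ

theorem BC.abs_le (g : BC) (x : ℂ) : |g x| ≤ ‖g‖ := g.norm_coe_le_norm x

/-- The potential of the density `g` on `Ω`. -/
def potential (Ω : Set ℂ) (φ : ℂ → ℂ) (g : ℂ → ℝ) (x : ℂ) : ℝ :=
  ∫ y in Ω, green Ω φ x y * g y

/-- Continuous functions bounded on a bounded set are integrable on it. -/
theorem integrableOn_of_continuous {Ω : Set ℂ} (hb : Bornology.IsBounded Ω) {h : ℂ → ℝ}
    (hh : Continuous h) : IntegrableOn h Ω := by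
  obtain ⟨M, hM⟩ := hb.subset_closedBall 0
  exact (hh.continuousOn.integrableOn_compact (isCompact_closedBall 0 M)).mono_set hM

section
variable {Ω : Set ℂ} {φ f : ℂ → ℂ}

theorem integrable_green_mul (hR : RiemannPair Ω φ f) (hb : Bornology.IsBounded Ω)
    {g : ℂ → ℝ} (hm : AEStronglyMeasurable g (volume.restrict Ω))
    (hg : IntegrableOn (fun y => g y ^ 2) Ω) (x : ℂ) :
    IntegrableOn (fun y => green Ω φ x y * g y) Ω :=
  integrable_mul_of_sq (measurable_green_right hR x).aestronglyMeasurable hm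
    (integrable_green_sq hR hb x) hg

theorem sq_potential_sub_le (hR : RiemannPair Ω φ f) (hb : Bornology.IsBounded Ω)
    {g : ℂ → ℝ} (hm : AEStronglyMeasurable g (volume.restrict Ω))
    (hg : IntegrableOn (fun y => g y ^ 2) Ω) (x x0 : ℂ) :
    (potential Ω φ g x - potential Ω φ g x0) ^ 2 ≤
      (∫ y in Ω, (green Ω φ x y - green Ω φ x0 y) ^ 2) * ∫ y in Ω, g y ^ 2 := by
  have h1 := integrable_green_mul hR hb hm hg
  rw [potential, potential, ← integral_sub (h1 x) (h1 x0)]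
  simp_rw [← sub_mul]
  have hd : AEStronglyMeasurable (fun y => green Ω φ x y - green Ω φ x0 y) (volume.restrict Ω) :=
    ((measurable_green_right hR x).sub (measurable_green_right hR x0)).aestronglyMeasurable
  have hsq : IntegrableOn (fun y => (green Ω φ x y - green Ω φ x0 y) ^ 2) Ω := by
    refine (((integrable_green_sq hR hb x).add (integrable_green_sq hR hb x0)).const_mul 2).mono'
      (hd.pow 2) (Eventually.of_forall fun y => ?_)
    simp only [Pi.add_apply]
    rw [Real.norm_of_nonneg (sq_nonneg _)]
    nlinarith [sq_nonneg (green Ω φ x y + green Ω φ x0 y)]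
  exact sq_integral_mul_le hsq hg (integrable_mul_of_sq hd hm hsq hg)

theorem potential_of_notMem (g : ℂ → ℝ) {x : ℂ} (hx : x ∉ Ω) : potential Ω φ g x = 0 := by
  simp [potential, green_of_notMem_left hx]

theorem continuous_potential (hR : RiemannPair Ω φ f) (hb : Bornology.IsBounded Ω)
    {g : ℂ → ℝ} (hm : AEStronglyMeasurable g (volume.restrict Ω))
    (hg : IntegrableOn (fun y => g y ^ 2) Ω) : Continuous (potential Ω φ g) := by
  rw [continuous_iff_continuousAt]
  intro x0
  rw [ContinuousAt, tendsto_iff_dist_tendsto_zero]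
  have h := ((tendsto_integral_green_sub_sq hR hb x0).mul_const (∫ y in Ω, g y ^ 2)).sqrt
  simp only [zero_mul, Real.sqrt_zero] at h
  refine squeeze_zero (fun _ => dist_nonneg) (fun x => ?_) h
  rw [Real.dist_eq]
  exact Real.abs_le_sqrt (sq_potential_sub_le hR hb hm hg x x0)

theorem exists_integral_green_le (hR : RiemannPair Ω φ f) (hb : Bornology.IsBounded Ω) :
    ∃ C, 0 < C ∧ ∀ x, IntegrableOn (green Ω φ x) Ω ∧ ∫ y in Ω, green Ω φ x y ≤ C := by
  obtain ⟨C, hC0, hC⟩ := exists_integral_exp_green_le hR hb zero_le_one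
    (by linarith [Real.pi_gt_three] : (1 : ℝ) < 4 * π)
  simp only [one_mul] at hC
  refine ⟨C, hC0, fun x => ?_⟩
  have hle : ∀ y, green Ω φ x y ≤ Real.exp (green Ω φ x y) := fun y => by
    linarith [Real.add_one_le_exp (green Ω φ x y)]
  have hi : IntegrableOn (green Ω φ x) Ω :=
    (hC x).1.mono' (measurable_green_right hR x).aestronglyMeasurable
      (Eventually.of_forall fun y => by
        rw [Real.norm_of_nonneg (green_nonneg hR x y)]; exact hle y)
  exact ⟨hi, (integral_mono hi (hC x).1 hle).trans (hC x).2⟩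

theorem abs_potential_le (hR : RiemannPair Ω φ f) {C : ℝ}
    (hC : ∀ x, IntegrableOn (green Ω φ x) Ω ∧ ∫ y in Ω, green Ω φ x y ≤ C) (g : BC) (x : ℂ) :
    |potential Ω φ g x| ≤ C * ‖g‖ := by
  calc |potential Ω φ g x| ≤ ∫ y in Ω, green Ω φ x y * ‖g‖ := by
        rw [potential, ← Real.norm_eq_abs]
        refine norm_integral_le_of_norm_le ((hC x).1.mul_const _) (Eventually.of_forall fun y => ?_)
        rw [norm_mul, Real.norm_of_nonneg (green_nonneg hR x y)]
        exact mul_le_mul_of_nonneg_left (g.norm_coe_le_norm y) (green_nonneg hR x y)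
    _ ≤ C * ‖g‖ := by
        rw [integral_mul_const]
        exact mul_le_mul_of_nonneg_right (hC x).2 (norm_nonneg _)

theorem BC.integrableOn_sq (hb : Bornology.IsBounded Ω) (g : BC) :
    IntegrableOn (fun y => g y ^ 2) Ω :=
  integrableOn_of_continuous hb (g.continuous.pow 2)

theorem BC.integrable_green_mul (hR : RiemannPair Ω φ f) (hb : Bornology.IsBounded Ω) (g : BC)
    (x : ℂ) : IntegrableOn (fun y => green Ω φ x y * g y) Ω :=
  MeanField.integrable_green_mul hR hb g.continuous.aestronglyMeasurable
    (BC.integrableOn_sq hb g) x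

/-- The Green operator as a bounded operator on `BC`. -/
def greenOp (hR : RiemannPair Ω φ f) (hb : Bornology.IsBounded Ω) : BC →L[ℝ] BC :=
  LinearMap.mkContinuous
    { toFun := fun g => BoundedContinuousFunction.ofNormedAddCommGroup (potential Ω φ g)
        (continuous_potential hR hb g.continuous.aestronglyMeasurable (BC.integrableOn_sq hb g))
        ((exists_integral_green_le hR hb).choose * ‖g‖)
        (abs_potential_le hR (exists_integral_green_le hR hb).choose_spec.2 g)
      map_add' := fun g h => by
        ext x
        simp only [BoundedContinuousFunction.coe_ofNormedAddCommGroup,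
          BoundedContinuousFunction.coe_add, Pi.add_apply, potential, mul_add]
        exact integral_add (BC.integrable_green_mul hR hb g x) (BC.integrable_green_mul hR hb h x)
      map_smul' := fun c g => by
        ext x
        simp only [BoundedContinuousFunction.coe_ofNormedAddCommGroup,
          BoundedContinuousFunction.coe_smul, potential, smul_eq_mul, RingHom.id_apply]
        rw [← integral_const_mul]
        congr 1
        ext y
        ring }
    (exists_integral_green_le hR hb).choose fun g => by
      have hC := (exists_integral_green_le hR hb).choose_spec
      refine (BoundedContinuousFunction.norm_le (mul_nonneg hC.1.le (norm_nonneg _))).2 fun x => ?_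
      exact abs_potential_le hR hC.2 g x

theorem greenOp_apply (hR : RiemannPair Ω φ f) (hb : Bornology.IsBounded Ω) (g : BC) (x : ℂ) :
    greenOp hR hb g x = ∫ y in Ω, green Ω φ x y * g y := rfl

theorem greenOp_of_notMem (hR : RiemannPair Ω φ f) (hb : Bornology.IsBounded Ω) (g : BC) {x : ℂ}
    (hx : x ∉ Ω) : greenOp hR hb g x = 0 := potential_of_notMem _ hx

theorem greenOp_nonneg (hR : RiemannPair Ω φ f) (hb : Bornology.IsBounded Ω) {g : BC}
    (hg : ∀ x ∈ Ω, 0 ≤ g x) (x : ℂ) : 0 ≤ greenOp hR hb g x :=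
  setIntegral_nonneg hR.isOpen.measurableSet fun y hy => mul_nonneg (green_nonneg hR x y) (hg y hy)

theorem integrable_prod_green (hR : RiemannPair Ω φ f) (hb : Bornology.IsBounded Ω) :
    Integrable (fun p : ℂ × ℂ => green Ω φ p.1 p.2)
      ((volume.restrict Ω).prod (volume.restrict Ω)) := by
  obtain ⟨C, hC0, hC⟩ := exists_integral_green_le hR hb
  have : IsFiniteMeasure (volume.restrict Ω) := ⟨by simpa using hb.measure_lt_top⟩
  rw [integrable_prod_iff (measurable_green hR).aestronglyMeasurable]
  refine ⟨Eventually.of_forall fun x => (hC x).1, ?_⟩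
  refine (integrable_const C).mono' ?_ (Eventually.of_forall fun x => ?_)
  · exact (measurable_green hR).norm.aestronglyMeasurable.integral_prod_right'
  · simp only [Real.norm_of_nonneg (green_nonneg hR x _)]
    rw [Real.norm_of_nonneg (integral_nonneg fun y => green_nonneg hR x y)]
    exact (hC x).2

theorem integrable_prod_green_mul (hR : RiemannPair Ω φ f) (hb : Bornology.IsBounded Ω)
    {k : ℂ × ℂ → ℝ} (hk : Continuous k) {B : ℝ} (hB : ∀ p, |k p| ≤ B) :
    Integrable (fun p : ℂ × ℂ => green Ω φ p.1 p.2 * k p)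
      ((volume.restrict Ω).prod (volume.restrict Ω)) :=
  (integrable_prod_green hR hb).mul_bdd hk.aestronglyMeasurable
    (Eventually.of_forall fun p => hB p)

theorem integral_mul_greenOp_eq (hR : RiemannPair Ω φ f) (hb : Bornology.IsBounded Ω) (g h : BC) :
    ∫ x in Ω, g x * greenOp hR hb h x = ∫ x in Ω, ∫ y in Ω, green Ω φ x y * (g x * h y) := by
  refine integral_congr_ae (Eventually.of_forall fun x => ?_)
  simp only [greenOp_apply]
  rw [← integral_const_mul]
  congr 1
  ext y
  ring

theorem greenOp_symm (hR : RiemannPair Ω φ f) (hb : Bornology.IsBounded Ω) (g h : BC) :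
    ∫ x in Ω, g x * greenOp hR hb h x = ∫ x in Ω, h x * greenOp hR hb g x := by
  have hi := integrable_prod_green_mul hR hb (k := fun p => g p.1 * h p.2) (by fun_prop)
    (B := ‖g‖ * ‖h‖) fun p => by
      rw [abs_mul]
      exact mul_le_mul (g.abs_le _) (h.abs_le _) (abs_nonneg _) (norm_nonneg _)
  have : SFinite (volume.restrict Ω) := inferInstance
  rw [integral_mul_greenOp_eq, integral_mul_greenOp_eq, integral_integral_swap hi]
  refine integral_congr_ae (Eventually.of_forall fun x => ?_)
  refine integral_congr_ae (Eventually.of_forall fun y => ?_)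
  simp only [green_comm y x]
  ring

/-- Young's inequality for the pair `s log s`, `eᵗ`. -/
theorem mul_le_mul_log_add_exp {s : ℝ} (hs : 0 ≤ s) (t : ℝ) :
    s * t ≤ s * Real.log s - s + Real.exp t := by
  rcases hs.eq_or_lt with rfl | hs
  · simp [(Real.exp_pos t).le]
  · have h := Real.add_one_le_exp (t - Real.log s)
    have h2 : s * Real.exp (t - Real.log s) = Real.exp t := by
      rw [Real.exp_sub, Real.exp_log hs]
      field_simp
    nlinarith

theorem exists_greenOp_le_entropy (hR : RiemannPair Ω φ f) (hb : Bornology.IsBounded Ω) :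
    ∃ C, ∀ ρ : BC, (∀ x ∈ Ω, 0 ≤ ρ x) → ∀ x, greenOp hR hb ρ x ≤
      (∫ y in Ω, ρ y * Real.log (ρ y)) + C := by
  obtain ⟨C, hC0, hC⟩ := exists_integral_exp_green_le hR hb zero_le_one
    (by linarith [Real.pi_gt_three] : (1 : ℝ) < 4 * π)
  simp only [one_mul] at hC
  refine ⟨C, fun ρ hρ x => ?_⟩
  have hi : IntegrableOn (fun y => ρ y * Real.log (ρ y)) Ω :=
    integrableOn_of_continuous hb (Real.continuous_mul_log.comp ρ.continuous)
  rw [greenOp_apply]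
  calc ∫ y in Ω, green Ω φ x y * ρ y
      ≤ ∫ y in Ω, (ρ y * Real.log (ρ y) + Real.exp (green Ω φ x y)) := by
        refine setIntegral_mono_on (BC.integrable_green_mul hR hb ρ x) (hi.fun_add (hC x).1)
          hR.isOpen.measurableSet fun y hy => ?_
        have := mul_le_mul_log_add_exp (hρ y hy) (green Ω φ x y)
        linarith [hρ y hy]
    _ ≤ _ := by
        rw [integral_add hi (hC x).1]
        linarith [(hC x).2]

theorem greenOp_compact (hR : RiemannPair Ω φ f) (hb : Bornology.IsBounded Ω)
    (𝒰 : Ultrafilter ℕ) {g : ℕ → BC} {A : ℝ} (hA : ∀ n, ∫ y in Ω, g n y ^ 2 ≤ A) :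
    ∃ v : BC, Tendsto (fun n => greenOp hR hb (g n)) 𝒰 (𝓝 v) := by
  obtain ⟨C, hC0, hC⟩ := exists_integral_exp_green_le hR hb zero_le_one
    (by linarith [Real.pi_gt_three] : (1 : ℝ) < 4 * π)
  simp only [one_mul] at hC
  have hA0 : 0 ≤ A := (integral_nonneg fun y => sq_nonneg _).trans (hA 0)
  have hosc : ∀ n x x0, |greenOp hR hb (g n) x - greenOp hR hb (g n) x0| ≤
      √((∫ y in Ω, (green Ω φ x y - green Ω φ x0 y) ^ 2) * A) := by
    intro n x x0
    apply Real.abs_le_sqrt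
    refine (sq_potential_sub_le hR hb (g n).continuous.aestronglyMeasurable
      (BC.integrableOn_sq hb _) x x0).trans ?_
    exact mul_le_mul_of_nonneg_left (hA n) (integral_nonneg fun y => sq_nonneg _)
  obtain ⟨M, hM⟩ := hb.subset_closedBall 0
  obtain ⟨p, hp⟩ : ∃ p, p ∉ Ω := by
    refine ⟨((|M| + 1 : ℝ) : ℂ), fun h => ?_⟩
    have := hM h
    rw [mem_closedBall_zero_iff, Complex.norm_real, Real.norm_of_nonneg (by positivity)] at this
    linarith [le_abs_self M]
  have hbd : ∀ n x, |greenOp hR hb (g n) x| ≤ √(2 * C * A) := by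
    intro n x
    have h := hosc n x p
    rw [greenOp_of_notMem hR hb _ hp, sub_zero] at h
    refine h.trans (Real.sqrt_le_sqrt (mul_le_mul_of_nonneg_right ?_ hA0))
    have hle : ∫ y in Ω, (green Ω φ x y - green Ω φ p y) ^ 2 ≤
        ∫ y in Ω, 2 * Real.exp (green Ω φ x y) := by
      refine integral_mono_of_nonneg (Eventually.of_forall fun y => sq_nonneg _)
        ((hC x).1.const_mul 2) (Eventually.of_forall fun y => ?_)
      simp only [green_of_notMem_left hp, sub_zero]
      exact sq_le_two_mul_exp (green_nonneg hR x y)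
    rw [integral_const_mul] at hle
    linarith [(hC x).2]
  have hpt : ∀ x, ∃ w, Tendsto (fun n => greenOp hR hb (g n) x) 𝒰 (𝓝 w) := by
    intro x
    obtain ⟨w, -, hw⟩ := (isCompact_Icc (a := -√(2 * C * A)) (b := √(2 * C * A))).ultrafilter_le_nhds
      (𝒰.map fun n => greenOp hR hb (g n) x) (by
        rw [le_principal_iff, Ultrafilter.mem_coe, Ultrafilter.mem_map]
        exact univ_mem' fun n => abs_le.1 (hbd n x))
    exact ⟨w, hw⟩
  choose v hv using hpt
  have hvosc : ∀ x x0, |v x - v x0| ≤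
      √((∫ y in Ω, (green Ω φ x y - green Ω φ x0 y) ^ 2) * A) := fun x x0 =>
    le_of_tendsto ((hv x).sub (hv x0)).abs (Eventually.of_forall fun n => hosc n x x0)
  have hvbd : ∀ x, |v x| ≤ √(2 * C * A) := fun x =>
    le_of_tendsto (hv x).abs (Eventually.of_forall fun n => hbd n x)
  have hmod : ∀ x0, Tendsto (fun x => √((∫ y in Ω, (green Ω φ x y - green Ω φ x0 y) ^ 2) * A))
      (𝓝 x0) (𝓝 0) := fun x0 => by
    simpa using ((tendsto_integral_green_sub_sq hR hb x0).mul_const A).sqrt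
  have hvc : Continuous v := by
    rw [continuous_iff_continuousAt]
    intro x0
    rw [ContinuousAt, tendsto_iff_dist_tendsto_zero]
    exact squeeze_zero (fun _ => dist_nonneg) (fun x => hvosc x x0) (hmod x0)
  refine ⟨BoundedContinuousFunction.ofNormedAddCommGroup v hvc _ hvbd, ?_⟩
  rw [BoundedContinuousFunction.tendsto_iff_tendstoUniformly]
  have hloc : TendstoLocallyUniformly (fun n x => greenOp hR hb (g n) x) v 𝒰 := by
    rw [Metric.tendstoLocallyUniformly_iff]
    intro ε hε x0
    have h1 := (hmod x0).eventually (gt_mem_nhds (by positivity : 0 < ε / 3))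
    refine ⟨_, h1, ?_⟩
    filter_upwards [Metric.tendsto_nhds.1 (hv x0) (ε / 3) (by positivity)] with n hn x hx
    have h2 := hosc n x x0
    have h3 := hvosc x x0
    have hx' : √((∫ y in Ω, (green Ω φ x y - green Ω φ x0 y) ^ 2) * A) < ε / 3 := hx
    rw [Real.dist_eq] at hn ⊢
    rw [abs_le] at h2 h3
    rw [abs_lt] at hn ⊢
    constructor <;> linarith [h2.1, h2.2, h3.1, h3.2, hn.1, hn.2]
  have hun := (tendstoLocallyUniformlyOn_iff_tendstoUniformlyOn_of_compact
    (isCompact_closedBall (0 : ℂ) M)).1 hloc.tendstoLocallyUniformlyOn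
  rw [Metric.tendstoUniformly_iff]
  intro ε hε
  filter_upwards [Metric.tendstoUniformlyOn_iff.1 hun ε hε] with n hn x
  by_cases hx : x ∈ Ω
  · exact hn x (hM hx)
  · have h0 : v x = 0 := tendsto_nhds_unique (hv x)
      (tendsto_const_nhds.congr fun n => (greenOp_of_notMem hR hb (g n) hx).symm)
    change dist (v x) (greenOp hR hb (g n) x) < ε
    rw [greenOp_of_notMem hR hb (g n) hx, h0, dist_self]
    exact hε

end

end

section

/-! ### The variational framework -/

/-- Evaluation at a point as a ring homomorphism. -/
def evalHom (x : ℂ) : BC →+* ℝ where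
  toFun v := v x
  map_one' := rfl
  map_mul' _ _ := rfl
  map_zero' := rfl
  map_add' _ _ := rfl

/-- The exponential of a bounded continuous function. -/
def ex (v : BC) : BC := NormedSpace.exp v

theorem ex_apply (v : BC) (x : ℂ) : ex v x = Real.exp (v x) := by
  have h : Continuous (evalHom x) :=
    (BoundedContinuousFunction.evalCLM ℝ x : BC →L[ℝ] ℝ).continuous
  rw [Real.exp_eq_exp_ℝ]
  exact NormedSpace.map_exp (evalHom x) h v

theorem continuous_ex : Continuous ex := NormedSpace.exp_continuous

/-- Absolute value of a bounded continuous function. -/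
def ab (v : BC) : BC := |v|

theorem ab_apply (v : BC) (x : ℂ) : ab v x = |v x| := rfl

/-- The properties of the Green operator of a bounded planar domain used by the variational
argument; `I` is integration over `Ω`. -/
structure GreenForm (Ω : Set ℂ) (I : BC →L[ℝ] ℝ) (T : BC →L[ℝ] BC) : Prop where
  isOpen : IsOpen Ω
  bdd : Bornology.IsBounded Ω
  nonempty : Ω.Nonempty
  int_apply : ∀ g, I g = ∫ x in Ω, g x
  off : ∀ g, ∀ x ∉ Ω, T g x = 0
  pos : ∀ g : BC, (∀ x, 0 ≤ g x) → ∀ x, 0 ≤ T g x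
  symm : ∀ g h : BC, I (g * T h) = I (h * T g)
  psd : ∀ g : BC, 0 ≤ I (g * T g)
  compact : ∀ (𝒰 : Ultrafilter ℕ) (g : ℕ → BC) (A : ℝ), (∀ n, I (g n * g n) ≤ A) →
    ∃ v : BC, Tendsto (fun n => T (g n)) 𝒰 (𝓝 v)
  entropy : ∃ C, ∀ ρ : BC, (∀ x, 0 ≤ ρ x) → ∀ x, T ρ x ≤ (∫ y in Ω, ρ y * Real.log (ρ y)) + C

section
variable {Ω : Set ℂ} {I : BC →L[ℝ] ℝ} {T : BC →L[ℝ] BC}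

namespace GreenForm

theorem integrable (H : GreenForm Ω I T) (g : BC) : IntegrableOn g Ω :=
  integrableOn_of_continuous H.bdd g.continuous

theorem mono (H : GreenForm Ω I T) {g h : BC} (hgh : ∀ x ∈ Ω, g x ≤ h x) : I g ≤ I h := by
  rw [H.int_apply, H.int_apply]
  exact setIntegral_mono_on (H.integrable g) (H.integrable h) H.isOpen.measurableSet hgh

theorem nonneg (H : GreenForm Ω I T) {g : BC} (hg : ∀ x ∈ Ω, 0 ≤ g x) : 0 ≤ I g := by
  simpa using H.mono (g := 0) (h := g) hg

theorem one_pos (H : GreenForm Ω I T) : 0 < I 1 := by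
  rw [H.int_apply]
  simp only [BoundedContinuousFunction.coe_one, Pi.one_apply, integral_const, smul_eq_mul, mul_one]
  rw [measureReal_restrict_apply_univ]
  exact ENNReal.toReal_pos (H.isOpen.measure_pos volume H.nonempty).ne' H.bdd.measure_lt_top.ne

theorem const (_ : GreenForm Ω I T) (a : ℝ) : I (BoundedContinuousFunction.const ℂ a) = a * I 1 := by
  have : (BoundedContinuousFunction.const ℂ a : BC) = a • 1 := by ext; simp
  rw [this, map_smul, smul_eq_mul]

theorem ex_pos (H : GreenForm Ω I T) (v : BC) : 0 < I (ex v) := by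
  have h : Real.exp (-‖v‖) * I 1 ≤ I (ex v) := by
    rw [← H.const]
    refine H.mono fun x _ => ?_
    rw [ex_apply]
    exact Real.exp_le_exp.2 (neg_le_of_abs_le (v.abs_le x))
  exact lt_of_lt_of_le (mul_pos (Real.exp_pos _) H.one_pos) h

theorem abs_le (H : GreenForm Ω I T) (g : BC) : |I g| ≤ I (ab g) := by
  rw [_root_.abs_le]
  constructor
  · rw [neg_le, ← map_neg]
    exact H.mono fun x _ => neg_le_abs (g x)
  · exact H.mono fun x _ => le_abs_self (g x)

/-- A function with `I (g * g) = 0` vanishes on `Ω`. -/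
theorem eq_zero_of_sq (H : GreenForm Ω I T) {g : BC} (hg : I (g * g) = 0) : ∀ x ∈ Ω, g x = 0 := by
  rw [H.int_apply, setIntegral_eq_zero_iff_of_nonneg_ae
    (Eventually.of_forall fun x => by simpa using mul_self_nonneg (g x)) (H.integrable _)] at hg
  have := (Measure.eqOn_open_of_ae_eq (f := (g * g : BC)) (g := fun _ => (0 : ℝ)) hg H.isOpen
    (g * g).continuous.continuousOn continuousOn_const)
  intro x hx
  simpa using this hx

end GreenForm

/-- The energy pairing. -/
def ip (I : BC →L[ℝ] ℝ) (T : BC →L[ℝ] BC) (g h : BC) : ℝ := I (g * T h)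

theorem ip_add_left (g g' h : BC) : ip I T (g + g') h = ip I T g h + ip I T g' h := by
  simp [ip, add_mul]
theorem ip_sub_left (g g' h : BC) : ip I T (g - g') h = ip I T g h - ip I T g' h := by
  simp [ip, sub_mul]
theorem ip_smul_left (a : ℝ) (g h : BC) : ip I T (a • g) h = a * ip I T g h := by
  have : a • g * T h = a • (g * T h) := by ext; simp [mul_assoc]
  rw [ip, this, map_smul, smul_eq_mul, ip]
theorem ip_add_right (g h h' : BC) : ip I T g (h + h') = ip I T g h + ip I T g h' := by
  simp [ip, mul_add]
theorem ip_sub_right (g h h' : BC) : ip I T g (h - h') = ip I T g h - ip I T g h' := by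
  simp [ip, mul_sub]
theorem ip_smul_right (a : ℝ) (g h : BC) : ip I T g (a • h) = a * ip I T g h := by
  have : g * T (a • h) = a • (g * T h) := by ext; simp [mul_left_comm]
  rw [ip, this, map_smul, smul_eq_mul, ip]

theorem continuous_ip_self : Continuous fun g : BC => ip I T g g := by
  unfold ip; fun_prop

theorem GreenForm.ip_comm (H : GreenForm Ω I T) (g h : BC) : ip I T g h = ip I T h g := H.symm g h

theorem GreenForm.ip_self_nonneg (H : GreenForm Ω I T) (g : BC) : 0 ≤ ip I T g g := H.psd g

theorem GreenForm.ip_sq_le (H : GreenForm Ω I T) (g h : BC) :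
    ip I T g h ^ 2 ≤ ip I T g g * ip I T h h := by
  have key : ∀ s : ℝ, 0 ≤ ip I T h h * (s * s) + 2 * ip I T g h * s + ip I T g g := fun s => by
    have := H.ip_self_nonneg (g + s • h)
    simp only [ip_add_left, ip_add_right, ip_smul_left, ip_smul_right] at this
    rw [H.ip_comm h g] at this
    linarith
  have := discrim_le_zero key
  rw [discrim] at this
  nlinarith

/-- The log-partition functional. -/
def LZ (I : BC →L[ℝ] ℝ) (T : BC →L[ℝ] BC) (g : BC) : ℝ := Real.log (I (ex (T g)))

/-- The reduced free energy at inverse parameter `t`. -/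
def Psi (I : BC →L[ℝ] ℝ) (T : BC →L[ℝ] BC) (t : ℝ) (g : BC) : ℝ := t / 2 * ip I T g g - LZ I T g

/-- The mean field map at inverse parameter `t`. -/
def NM (I : BC →L[ℝ] ℝ) (T : BC →L[ℝ] BC) (t : ℝ) (g : BC) : BC :=
  (t * I (ex (T g)))⁻¹ • ex (T g)

namespace GreenForm

/-- Jensen's inequality for the Gibbs measure. -/
theorem log_int_ex_add (H : GreenForm Ω I T) (v w : BC) :
    Real.log (I (ex v)) + I (ex v * w) / I (ex v) ≤ Real.log (I (ex (v + w))) := by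
  set Z := I (ex v) with hZ
  have hZ0 : 0 < Z := H.ex_pos v
  set m := I (ex v * w) / Z with hm
  have h : Real.exp m * Z ≤ I (ex (v + w)) := by
    have h1 : I (Real.exp m • ((1 - m) • ex v + ex v * w)) ≤ I (ex (v + w)) := by
      refine H.mono fun x _ => ?_
      simp only [BoundedContinuousFunction.coe_smul, BoundedContinuousFunction.coe_add,
        BoundedContinuousFunction.coe_mul, Pi.add_apply, Pi.mul_apply, smul_eq_mul, ex_apply]
      have := Real.add_one_le_exp (w x - m)
      calc Real.exp m * ((1 - m) * Real.exp (v x) + Real.exp (v x) * w x)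
          = Real.exp m * Real.exp (v x) * (w x - m + 1) := by ring
        _ ≤ Real.exp m * Real.exp (v x) * Real.exp (w x - m) := by gcongr
        _ = Real.exp (v x + w x) := by rw [← Real.exp_add, ← Real.exp_add]; ring_nf
    rw [map_smul, map_add, map_smul, smul_eq_mul, smul_eq_mul] at h1
    have h2 : I (ex v * w) = m * Z := by rw [hm]; field_simp
    rw [h2, ← hZ] at h1
    linarith [h1]
  have := Real.log_le_log (mul_pos (Real.exp_pos m) hZ0) h
  rw [Real.log_mul (Real.exp_pos m).ne' hZ0.ne', Real.log_exp] at this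
  linarith

theorem NM_nonneg (H : GreenForm Ω I T) {t : ℝ} (ht : 0 < t) (g : BC) (x : ℂ) :
    0 ≤ NM I T t g x := by
  simp only [NM, BoundedContinuousFunction.coe_smul, smul_eq_mul, ex_apply]
  have := H.ex_pos (T g)
  positivity

theorem continuous_NM (H : GreenForm Ω I T) {t : ℝ} (ht : 0 < t) : Continuous (NM I T t) := by
  have h1 : Continuous fun g : BC => ex (T g) := continuous_ex.comp T.continuous
  unfold NM
  refine (Continuous.inv₀ (by fun_prop) fun g => (mul_pos ht (H.ex_pos _)).ne').smul h1

theorem continuous_Psi (H : GreenForm Ω I T) (t : ℝ) : Continuous (Psi I T t) := by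
  have h1 : Continuous fun g : BC => ex (T g) := continuous_ex.comp T.continuous
  unfold Psi LZ
  refine (continuous_ip_self.const_mul _ |>.congr fun _ => rfl).sub ?_
  exact Continuous.log (by fun_prop) fun g => (H.ex_pos _).ne'

theorem Psi_NM_le (H : GreenForm Ω I T) {t s : ℝ} (ht : 0 < t) (g : BC) :
    Psi I T t (g + s • (NM I T t g - g)) ≤
      Psi I T t g - t * (s - s ^ 2 / 2) * ip I T (g - NM I T t g) (g - NM I T t g) := by
  set h := NM I T t g with hh
  have hJ := H.log_int_ex_add (T g) (T (s • (h - g)))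
  have hZ := H.ex_pos (T g)
  have h2 : I (ex (T g) * T (s • (h - g))) / I (ex (T g)) = t * s * (ip I T h h - ip I T h g) := by
    have : ex (T g) = (t * I (ex (T g))) • h := by
      rw [hh, NM, smul_smul, mul_inv_cancel₀ (mul_pos ht hZ).ne', one_smul]
    have h3 : I (ex (T g) * T (s • (h - g))) = ip I T (ex (T g)) (s • (h - g)) := rfl
    rw [h3, this, ip_smul_left, ip_smul_right, ip_sub_right, ← this]
    field_simp
  rw [h2] at hJ
  simp only [Psi, LZ, map_add]
  simp only [ip_add_left, ip_add_right, ip_smul_left, ip_smul_right, ip_sub_left, ip_sub_right]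
  rw [H.ip_comm g h]
  linarith

/-- A Moser–Trudinger type inequality. -/
theorem exists_LZ_le (H : GreenForm Ω I T) : ∃ C, ∀ g, LZ I T g ≤ ip I T g g / 4 + C := by
  obtain ⟨C, hC⟩ := H.entropy
  refine ⟨C, fun g => ?_⟩
  set Z := I (ex (T g)) with hZ
  have hZ0 : 0 < Z := H.ex_pos _
  set ρ : BC := Z⁻¹ • ex (T g) with hρ
  have hρx : ∀ x, ρ x = Z⁻¹ * Real.exp (T g x) := fun x => by simp [hρ, ex_apply]
  have hρ0 : ∀ x, 0 ≤ ρ x := fun x => by rw [hρx]; positivity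
  have hI : I ρ = 1 := by
    rw [hρ, map_smul, smul_eq_mul, ← hZ, inv_mul_cancel₀ hZ0.ne']
  have hent : (∫ y in Ω, ρ y * Real.log (ρ y)) = ip I T ρ g - LZ I T g := by
    have : ∀ y, ρ y * Real.log (ρ y) = (ρ * T g - Real.log Z • ρ) y := fun y => by
      have : Real.log (ρ y) = T g y - Real.log Z := by
        rw [hρx, Real.log_mul (inv_pos.2 hZ0).ne' (Real.exp_pos _).ne', Real.log_exp, Real.log_inv]
        ring
      rw [this]
      simp only [BoundedContinuousFunction.coe_sub, BoundedContinuousFunction.coe_smul,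
        BoundedContinuousFunction.coe_mul, Pi.sub_apply, Pi.mul_apply, smul_eq_mul]
      ring
    simp_rw [this]
    rw [← H.int_apply, map_sub, map_smul, hI]
    simp [ip, LZ, hZ]
  have h1 : ip I T ρ ρ ≤ ip I T ρ g - LZ I T g + C := by
    rw [← hent]
    calc ip I T ρ ρ ≤ I (((∫ y in Ω, ρ y * Real.log (ρ y)) + C) • ρ) := by
          refine H.mono fun x _ => ?_
          simp only [BoundedContinuousFunction.coe_smul, BoundedContinuousFunction.coe_mul,
            Pi.mul_apply, smul_eq_mul]
          rw [mul_comm]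
          exact mul_le_mul_of_nonneg_right (hC ρ hρ0 x) (hρ0 x)
      _ = _ := by rw [map_smul, hI, smul_eq_mul, mul_one]
  have h2 := H.ip_self_nonneg (ρ - (1 / 2 : ℝ) • g)
  simp only [ip_sub_left, ip_sub_right, ip_smul_left, ip_smul_right] at h2
  rw [H.ip_comm g ρ] at h2
  linarith

/-- Exponential integrability at a scale controlled by the energy. -/
theorem exists_int_ex_scaled_le (H : GreenForm Ω I T) : ∃ C, 0 < C ∧ ∀ (d : BC) (ε : ℝ), 0 < ε →
    ip I T d d ≤ ε ^ 2 → ∀ s : ℝ, |s| ≤ 2 → I (ex (T ((s / ε) • d))) ≤ C := by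
  obtain ⟨C, hC⟩ := H.exists_LZ_le
  refine ⟨Real.exp (1 + C), Real.exp_pos _, fun d ε hε hd s hs => ?_⟩
  have h := hC ((s / ε) • d)
  rw [ip_smul_left, ip_smul_right] at h
  rw [← Real.exp_log (H.ex_pos (T ((s / ε) • d)))]
  refine Real.exp_le_exp.2 (h.trans ?_)
  have : s / ε * (s / ε * ip I T d d) ≤ 4 := by
    have h1 : s / ε * (s / ε * ip I T d d) = s ^ 2 * (ip I T d d / ε ^ 2) := by field_simp
    rw [h1]
    have h2 : ip I T d d / ε ^ 2 ≤ 1 := (div_le_one (by positivity)).2 hd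
    have h3 : s ^ 2 ≤ 4 := by nlinarith [sq_abs s, abs_nonneg s]
    nlinarith [div_nonneg (H.ip_self_nonneg d) (sq_nonneg ε), sq_nonneg s]
  linarith

end GreenForm
end

end

section

/-! ### The Palais–Smale condition -/

theorem abs_exp_sub_one_le_exp_abs_sub_one (x : ℝ) : |Real.exp x - 1| ≤ Real.exp |x| - 1 := by
  rcases le_total 0 x with h | h
  · rw [abs_of_nonneg h, abs_of_nonneg (by linarith [Real.add_one_le_exp x])]
  · rw [abs_of_nonpos h, abs_of_nonpos (by linarith [Real.exp_le_one_iff.2 h])]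
    have h1 := Real.exp_pos x
    have h2 : Real.exp x * Real.exp (-x) = 1 := by rw [← Real.exp_add]; simp
    nlinarith [sq_nonneg (Real.exp x - 1), Real.exp_pos (-x), Real.add_one_le_exp x,
      Real.add_one_le_exp (-x), sq_nonneg (Real.exp x - Real.exp (-x))]

theorem exp_abs_le_add (x : ℝ) : Real.exp |x| ≤ Real.exp x + Real.exp (-x) := by
  rcases abs_cases x with ⟨h, _⟩ | ⟨h, _⟩ <;> rw [h] <;>
    linarith [Real.exp_pos x, Real.exp_pos (-x)]

theorem abs_exp_sub_one_le {ε : ℝ} (hε : 0 < ε) (hε1 : ε ≤ 1) (x : ℝ) :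
    |Real.exp x - 1| ≤ ε * (Real.exp (1 / ε * x) + Real.exp (-1 / ε * x)) := by
  have h := convexOn_exp.2 (mem_univ (|x| / ε)) (mem_univ 0) hε.le (sub_nonneg.2 hε1)
    (add_sub_cancel ε 1)
  simp only [smul_eq_mul, mul_zero, add_zero, Real.exp_zero, mul_one] at h
  rw [mul_div_cancel₀ _ hε.ne'] at h
  have h2 := exp_abs_le_add (x / ε)
  rw [abs_div, abs_of_pos hε] at h2
  have e1 : 1 / ε * x = x / ε := by ring
  have e2 : -1 / ε * x = -(x / ε) := by ring
  rw [e1, e2]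
  have := mul_le_mul_of_nonneg_left h2 hε.le
  linarith [abs_exp_sub_one_le_exp_abs_sub_one x]

section
variable {Ω : Set ℂ} {I : BC →L[ℝ] ℝ} {T : BC →L[ℝ] BC}

namespace GreenForm

theorem compact_eventually (H : GreenForm Ω I T) (𝒰 : Ultrafilter ℕ) {g : ℕ → BC} {A : ℝ}
    (hA : ∀ᶠ n in 𝒰, I (g n * g n) ≤ A) :
    ∃ v : BC, Tendsto (fun n => T (g n)) 𝒰 (𝓝 v) := by
  classical
  obtain ⟨v, hv⟩ := H.compact 𝒰 (fun n => if I (g n * g n) ≤ A then g n else 0) (max A 0)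
    fun n => by
      split_ifs with h
      · exact h.trans (le_max_left _ _)
      · simp
  refine ⟨v, hv.congr' ?_⟩
  filter_upwards [hA] with n hn
  rw [if_pos hn]

theorem exists_int_ab_ex_sub_one_le (H : GreenForm Ω I T) : ∃ C, 0 < C ∧ ∀ (d : BC) (ε : ℝ),
    0 < ε → ε ≤ 1 → ip I T d d ≤ ε ^ 2 → I (ab (ex (T d) - 1)) ≤ C * ε := by
  obtain ⟨C, hC0, hC⟩ := H.exists_int_ex_scaled_le
  refine ⟨2 * C, by positivity, fun d ε hε hε1 hd => ?_⟩
  have h1 := hC d ε hε hd 1 (by norm_num)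
  have h2 := hC d ε hε hd (-1) (by norm_num)
  calc I (ab (ex (T d) - 1))
      ≤ I (ε • (ex (T ((1 / ε) • d)) + ex (T ((-1 / ε) • d)))) := by
        refine H.mono fun x _ => ?_
        have := abs_exp_sub_one_le hε hε1 (T d x)
        rw [mul_add] at this
        simpa [ab_apply, ex_apply] using this
    _ ≤ 2 * C * ε := by
        rw [map_smul, map_add, smul_eq_mul]
        nlinarith

theorem tendsto_int_ab_ex_sub_one (H : GreenForm Ω I T) {l : Filter ℕ} {d : ℕ → BC}
    (hd : Tendsto (fun n => ip I T (d n) (d n)) l (𝓝 0)) :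
    Tendsto (fun n => I (ab (ex (T (d n)) - 1))) l (𝓝 0) := by
  obtain ⟨C, hC0, hC⟩ := H.exists_int_ab_ex_sub_one_le
  rw [Metric.tendsto_nhds]
  intro η hη
  set ε := min 1 (η / (2 * C)) with hε
  have hε0 : 0 < ε := lt_min zero_lt_one (by positivity)
  filter_upwards [hd.eventually (gt_mem_nhds (pow_pos hε0 2))] with n hn
  have h := hC (d n) ε hε0 (min_le_left _ _) hn.le
  have h0 : 0 ≤ I (ab (ex (T (d n)) - 1)) := H.nonneg fun x _ => abs_nonneg _
  rw [Real.dist_eq, sub_zero, abs_of_nonneg h0]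
  calc _ ≤ C * ε := h
    _ ≤ C * (η / (2 * C)) := by gcongr; exact min_le_right _ _
    _ = η / 2 := by field_simp
    _ < η := by linarith

theorem int_ab_mul_le (H : GreenForm Ω I T) (a k : BC) : |I (a * k)| ≤ I (ab a) * ‖k‖ := by
  refine (H.abs_le _).trans ?_
  have h : I (ab (a * k)) ≤ I (‖k‖ • ab a) := by
    refine H.mono fun x _ => ?_
    simp only [ab_apply, BoundedContinuousFunction.coe_mul, BoundedContinuousFunction.coe_smul,
      Pi.mul_apply, smul_eq_mul, abs_mul]
    rw [mul_comm]
    exact mul_le_mul_of_nonneg_right (k.abs_le x) (abs_nonneg _)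
  rw [map_smul, smul_eq_mul, mul_comm ‖k‖] at h
  exact h

theorem int_ab_le (H : GreenForm Ω I T) (a : BC) : I (ab a) ≤ ‖a‖ * I 1 := by
  rw [← H.const]
  exact H.mono fun x _ => a.abs_le x

/-- The Palais–Smale condition along an ultrafilter. -/
theorem palaisSmale (H : GreenForm Ω I T) (𝒰 : Ultrafilter ℕ) {t : ℝ} (ht : 0 < t) {τ : ℕ → ℝ}
    (hτt : ∀ n, t ≤ τ n) (hτ : Tendsto τ 𝒰 (𝓝 t)) {g : ℕ → BC} (hg : ∀ n x, 0 ≤ g n x) {A : ℝ}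
    (hA : ∀ᶠ n in 𝒰, ip I T (g n) (g n) ≤ A)
    (hd : Tendsto (fun n => ip I T (g n - NM I T (τ n) (g n)) (g n - NM I T (τ n) (g n))) 𝒰
      (𝓝 0)) :
    ∃ g' : BC, NM I T t g' = g' ∧
      Tendsto (fun n => Psi I T (τ n) (g n)) 𝒰 (𝓝 (Psi I T t g')) := by
  obtain ⟨C, hC⟩ := H.exists_LZ_le
  set h : ℕ → BC := fun n => NM I T (τ n) (g n) with hh
  set d : ℕ → BC := fun n => g n - h n with hdd
  replace hd : Tendsto (fun n => ip I T (d n) (d n)) 𝒰 (𝓝 0) := hd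
  set Z : ℕ → ℝ := fun n => I (ex (T (g n))) with hZ
  have hτ0 : ∀ n, 0 < τ n := fun n => ht.trans_le (hτt n)
  have hZ1 : ∀ n, I 1 ≤ Z n := fun n => H.mono fun x _ => by
    rw [ex_apply]; exact Real.one_le_exp (H.pos _ (hg n) x)
  have h1 := H.one_pos
  have hZ0 : ∀ n, 0 < Z n := fun n => h1.trans_le (hZ1 n)
  have hL2 : ∀ᶠ n in 𝒰, I (h n * h n) ≤ (t * I 1)⁻¹ ^ 2 * Real.exp (A + C) := by
    filter_upwards [hA] with n hn
    have e : h n * h n = ((τ n * Z n)⁻¹ ^ 2) • ex (T ((2 : ℝ) • g n)) := by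
      ext x
      simp only [hh, NM, BoundedContinuousFunction.coe_mul, BoundedContinuousFunction.coe_smul,
        Pi.mul_apply, smul_eq_mul, ex_apply, map_smul]
      rw [two_mul, Real.exp_add]
      ring
    rw [e, map_smul, smul_eq_mul]
    have h2 := hC ((2 : ℝ) • g n)
    rw [ip_smul_left, ip_smul_right] at h2
    have h3 : I (ex (T ((2 : ℝ) • g n))) ≤ Real.exp (A + C) := by
      rw [← Real.exp_log (H.ex_pos (T ((2 : ℝ) • g n)))]
      refine Real.exp_le_exp.2 (h2.trans ?_)
      linarith
    have h4 : (τ n * Z n)⁻¹ ≤ (t * I 1)⁻¹ :=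
      inv_anti₀ (mul_pos ht h1) (mul_le_mul (hτt n) (hZ1 n) h1.le (hτ0 n).le)
    have h5 : 0 ≤ (τ n * Z n)⁻¹ := (inv_pos.2 (mul_pos (hτ0 n) (hZ0 n))).le
    exact mul_le_mul (pow_le_pow_left₀ h5 h4 2) h3 (H.ex_pos _).le (by positivity)
  obtain ⟨v, hv⟩ := H.compact_eventually 𝒰 hL2
  have hexv : Tendsto (fun n => ex (T (h n))) 𝒰 (𝓝 (ex v)) := (continuous_ex.tendsto v).comp hv
  have hL1 : Tendsto (fun n => I (ab (ex (T (g n)) - ex v))) 𝒰 (𝓝 0) := by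
    have a1 : Tendsto (fun n => I (ab (ex (T (d n)) - 1)) * ‖ex (T (h n))‖ +
        ‖ex (T (h n)) - ex v‖ * I 1) 𝒰 (𝓝 0) := by
      have b1 := (H.tendsto_int_ab_ex_sub_one hd).mul hexv.norm
      have b2 := (tendsto_iff_norm_sub_tendsto_zero.1 hexv).mul_const (I 1)
      simpa only [zero_mul, add_zero] using b1.add b2
    refine squeeze_zero (fun n => H.nonneg fun x _ => abs_nonneg _) (fun n => ?_) a1
    have b3 : I (ab (ex (T (g n)) - ex v)) ≤
        I (ab (ex (T (d n)) - 1) * ex (T (h n))) + I (ab (ex (T (h n)) - ex v)) := by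
      rw [← map_add]
      refine H.mono fun x _ => ?_
      simp only [ab_apply, BoundedContinuousFunction.coe_add, BoundedContinuousFunction.coe_mul,
        BoundedContinuousFunction.coe_sub, BoundedContinuousFunction.coe_one, Pi.add_apply,
        Pi.mul_apply, Pi.sub_apply, Pi.one_apply, ex_apply]
      have e : Real.exp (T (g n) x) - Real.exp (v x) =
          (Real.exp (T (d n) x) - 1) * Real.exp (T (h n) x) +
            (Real.exp (T (h n) x) - Real.exp (v x)) := by
        have : T (g n) x = T (d n) x + T (h n) x := by simp [hdd]
        rw [this, Real.exp_add]; ring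
      rw [e]
      refine (abs_add_le _ _).trans ?_
      rw [abs_mul, abs_of_pos (Real.exp_pos (T (h n) x))]
    have b4 := (le_abs_self _).trans (H.int_ab_mul_le (ab (ex (T (d n)) - 1)) (ex (T (h n))))
    have e : ab (ab (ex (T (d n)) - 1)) = ab (ex (T (d n)) - 1) := by
      ext x; simp [ab_apply]
    rw [e] at b4
    linarith [H.int_ab_le (ex (T (h n)) - ex v)]
  have hpair : ∀ {k : ℕ → BC} {k' : BC}, Tendsto k 𝒰 (𝓝 k') →
      Tendsto (fun n => I (ex (T (g n)) * k n)) 𝒰 (𝓝 (I (ex v * k'))) := by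
    intro k k' hk
    have a1 : Tendsto (fun n => I ((ex (T (g n)) - ex v) * k n)) 𝒰 (𝓝 0) := by
      refine squeeze_zero_norm (fun n => H.int_ab_mul_le _ _) ?_
      simpa using hL1.mul hk.norm
    have a2 : Tendsto (fun n => I (ex v * k n)) 𝒰 (𝓝 (I (ex v * k'))) :=
      (I.continuous.tendsto _).comp (hk.const_mul (ex v))
    have a3 := a1.add a2
    rw [zero_add] at a3
    refine a3.congr fun n => ?_
    rw [← map_add]; congr 1; ring
  have hZlim : Tendsto Z 𝒰 (𝓝 (I (ex v))) := by
    simpa using hpair (k := fun _ => 1) (k' := 1) tendsto_const_nhds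
  have hZv : 0 < I (ex v) := H.ex_pos v
  set g' : BC := (t * I (ex v))⁻¹ • ex v with hg'
  have hpair' : ∀ {k : ℕ → BC} {k' : BC}, Tendsto k 𝒰 (𝓝 k') →
      Tendsto (fun n => I (h n * k n)) 𝒰 (𝓝 (I (g' * k'))) := by
    intro k k' hk
    have a1 := ((hτ.mul hZlim).inv₀ (mul_pos ht hZv).ne').mul (hpair hk)
    have e : ∀ (a : ℝ) (p r : BC), I ((a • p) * r) = a * I (p * r) := fun a p r => by
      have : (a • p) * r = a • (p * r) := by ext; simp [mul_assoc]
      rw [this, map_smul, smul_eq_mul]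
    rw [← e] at a1
    refine a1.congr fun n => ?_
    rw [hh]; simp only [NM]; rw [e]
  have hvT : v = T g' := by
    have a1 : ∀ k : BC, I (k * v) = I (k * T g') := fun k => by
      have b1 : Tendsto (fun n => I (k * T (h n))) 𝒰 (𝓝 (I (k * v))) :=
        (I.continuous.tendsto _).comp (hv.const_mul k)
      have b2 := hpair' (k := fun _ => T k) (k' := T k) tendsto_const_nhds
      rw [H.symm g' k] at b2
      exact tendsto_nhds_unique b1 (b2.congr fun n => H.symm _ _)
    have a2 : I ((v - T g') * (v - T g')) = 0 := by
      rw [mul_sub, map_sub, a1, sub_self]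
    have a3 := H.eq_zero_of_sq a2
    ext x
    by_cases hx : x ∈ Ω
    · have := a3 x hx
      simpa [sub_eq_zero] using this
    · rw [H.off _ x hx]
      have b1 : Tendsto (fun n => T (h n) x) 𝒰 (𝓝 (v x)) :=
        ((BoundedContinuousFunction.evalCLM ℝ x : BC →L[ℝ] ℝ).continuous.tendsto v).comp hv
      have b2 : (fun n => T (h n) x) = fun _ => 0 := by
        ext n; exact H.off _ x hx
      rw [b2] at b1
      exact tendsto_nhds_unique b1 tendsto_const_nhds
  have hqh : Tendsto (fun n => ip I T (h n) (h n)) 𝒰 (𝓝 (ip I T g' g')) := by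
    have := hpair' hv
    rw [hvT] at this
    exact this
  have hhd : Tendsto (fun n => ip I T (h n) (d n)) 𝒰 (𝓝 0) := by
    refine squeeze_zero_norm (fun n => ?_)
      (by simpa using (hqh.mul hd).sqrt)
    exact Real.abs_le_sqrt (H.ip_sq_le (h n) (d n))
  have hqg : Tendsto (fun n => ip I T (g n) (g n)) 𝒰 (𝓝 (ip I T g' g')) := by
    have a1 := (hqh.add (hhd.const_mul 2)).add hd
    simp only [mul_zero, add_zero] at a1
    refine a1.congr fun n => ?_
    have : g n = h n + d n := by simp [hdd]
    rw [this]
    simp only [ip_add_left, ip_add_right]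
    rw [H.ip_comm (d n) (h n)]
    ring
  refine ⟨g', ?_, ?_⟩
  · rw [NM, ← hvT]
  · have a1 := ((hτ.div_const 2).mul hqg).sub (hZlim.log hZv.ne')
    rw [hvT] at a1
    exact a1

end GreenForm
end

end

section

/-! ### The mountain pass and the monotonicity trick -/

section
variable {Ω : Set ℂ} {I : BC →L[ℝ] ℝ} {T : BC →L[ℝ] BC}

/-- Connected families of nonnegative densities joining `g0` to `g1`. -/
structure Joins (g0 g1 : BC) (K : Set BC) : Prop where
  conn : IsPreconnected K
  nonneg : ∀ g ∈ K, ∀ x, 0 ≤ g x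
  left : g0 ∈ K
  right : g1 ∈ K

/-- Admissible upper levels for the mountain pass problem. -/
def levels (I : BC →L[ℝ] ℝ) (T : BC →L[ℝ] BC) (g0 g1 : BC) (t : ℝ) : Set ℝ :=
  {s | ∃ K, Joins g0 g1 K ∧ ∀ g ∈ K, Psi I T t g ≤ s}

/-- The mountain pass level. -/
def level (I : BC →L[ℝ] ℝ) (T : BC →L[ℝ] BC) (g0 g1 : BC) (t : ℝ) : ℝ := sInf (levels I T g0 g1 t)

namespace GreenForm

theorem levels_nonempty (H : GreenForm Ω I T) {g0 g1 : BC} (h0 : ∀ x, 0 ≤ g0 x)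
    (h1 : ∀ x, 0 ≤ g1 x) (t : ℝ) : (levels I T g0 g1 t).Nonempty := by
  have hc : IsCompact (segment ℝ g0 g1) := by
    rw [segment_eq_image_lineMap]
    exact isCompact_Icc.image (AffineMap.lineMap_continuous)
  obtain ⟨s, hs⟩ := (hc.image (H.continuous_Psi t)).bddAbove
  refine ⟨s, segment ℝ g0 g1, ⟨(convex_segment g0 g1).isPreconnected, ?_, left_mem_segment _ _ _,
    right_mem_segment _ _ _⟩, fun g hg => hs (mem_image_of_mem _ hg)⟩
  rintro g ⟨a, b, ha, hb, _, rfl⟩ x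
  simp only [BoundedContinuousFunction.coe_add, BoundedContinuousFunction.coe_smul, Pi.add_apply,
    smul_eq_mul]
  have := h0 x; have := h1 x
  positivity

theorem levels_bddBelow (g0 g1 : BC) (t : ℝ) : BddBelow (levels I T g0 g1 t) :=
  ⟨Psi I T t g0, by rintro s ⟨K, hK, hs⟩; exact hs g0 hK.left⟩

theorem Psi_mono (H : GreenForm Ω I T) {t t' : ℝ} (h : t ≤ t') (g : BC) :
    Psi I T t g ≤ Psi I T t' g := by
  have := H.ip_self_nonneg g
  unfold Psi
  nlinarith

theorem level_mono (H : GreenForm Ω I T) {g0 g1 : BC} (h0 : ∀ x, 0 ≤ g0 x)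
    (h1 : ∀ x, 0 ≤ g1 x) : Monotone (level I T g0 g1) := fun t t' h => by
  refine csInf_le_csInf (levels_bddBelow g0 g1 t) (H.levels_nonempty h0 h1 t') ?_
  rintro s ⟨K, hK, hs⟩
  exact ⟨K, hK, fun g hg => (H.Psi_mono h g).trans (hs g hg)⟩

/-- Segments from a density to its image under the mean field map stay below its level. -/
theorem Psi_le_of_mem_segment_NM (H : GreenForm Ω I T) {t : ℝ} (ht : 0 < t) {g k : BC}
    (hk : k ∈ segment ℝ g (NM I T t g)) : Psi I T t k ≤ Psi I T t g := by
  rw [segment_eq_image'] at hk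
  obtain ⟨s, ⟨hs0, hs1⟩, rfl⟩ := hk
  refine (H.Psi_NM_le ht g).trans ?_
  have := H.ip_self_nonneg (g - NM I T t g)
  have : 0 ≤ t * (s - s ^ 2 / 2) := mul_nonneg ht.le (by nlinarith)
  nlinarith [mul_nonneg this (H.ip_self_nonneg (g - NM I T t g))]

theorem nonneg_of_mem_segment {g k l : BC} (hg : ∀ x, 0 ≤ g x) (hl : ∀ x, 0 ≤ l x)
    (hk : k ∈ segment ℝ g l) (x : ℂ) : 0 ≤ k x := by
  obtain ⟨a, b, ha, hb, _, rfl⟩ := hk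
  simp only [BoundedContinuousFunction.coe_add, BoundedContinuousFunction.coe_smul, Pi.add_apply,
    smul_eq_mul]
  have := hg x; have := hl x
  positivity

theorem exists_critical_of_differentiableAt (H : GreenForm Ω I T) {g0 g1 : BC}
    (h0 : ∀ x, 0 ≤ g0 x) (h1 : ∀ x, 0 ≤ g1 x) {t : ℝ} (ht : 0 < t)
    (hdiff : DifferentiableAt ℝ (level I T g0 g1) t)
    (hl0 : Psi I T t g0 < level I T g0 g1 t) (hl1 : Psi I T t g1 < level I T g0 g1 t) :
    ∃ g, NM I T t g = g ∧ Psi I T t g = level I T g0 g1 t := by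
  set c := level I T g0 g1 with hc
  set M : ℝ := |deriv c t| + 1 with hM
  have hM0 : 0 < M := by positivity
  -- one-sided growth bound
  have hgrow : ∀ᶠ s in 𝓝 t, t ≤ s → c s ≤ c t + M * (s - t) := by
    have := hdiff.hasDerivAt.isLittleO.def (zero_lt_one)
    filter_upwards [this] with s hs hts
    rw [Real.norm_eq_abs, Real.norm_eq_abs, smul_eq_mul, abs_of_nonneg (sub_nonneg.2 hts)] at hs
    have h2 := (le_abs_self _).trans hs
    have h3 : (s - t) * deriv c t ≤ (s - t) * |deriv c t| :=
      mul_le_mul_of_nonneg_left (le_abs_self _) (sub_nonneg.2 hts)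
    rw [hM]; linarith
  set gap := min (c t - Psi I T t g0) (c t - Psi I T t g1) with hgap
  have hgap0 : 0 < gap := lt_min (sub_pos.2 hl0) (sub_pos.2 hl1)
  have key : ∀ᶠ s in 𝓝[>] t, ∃ g : BC, (∀ x, 0 ≤ g x) ∧ c t - (s - t) ≤ Psi I T t g ∧
      Psi I T t g ≤ c t + (M + 1) * (s - t) ∧ ip I T g g ≤ 2 * (M + 2) ∧
      ip I T (g - NM I T t g) (g - NM I T t g) ≤ 2 * (M + 2) / t * (s - t) := by
    have hlt : ∀ᶠ s in 𝓝 t, s < t + gap := gt_mem_nhds (by linarith)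
    filter_upwards [self_mem_nhdsWithin, nhdsWithin_le_nhds hgrow, nhdsWithin_le_nhds hlt]
      with s hs hgs hsg
    have hts : 0 < s - t := sub_pos.2 hs
    obtain ⟨σ, ⟨K, hK, hKs⟩, hσ⟩ := exists_lt_of_csInf_lt (H.levels_nonempty h0 h1 s)
      (show sInf (levels I T g0 g1 s) < c s + (s - t) by
        change c s < _; linarith)
    have hup : ∀ g ∈ K, Psi I T s g ≤ c t + (M + 1) * (s - t) := fun g hg => by
      have := hKs g hg; have := hgs hs.le; linarith
    have hex : ∃ g ∈ K, c t - (s - t) < Psi I T t (NM I T t g) := by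
      by_contra hcon
      push Not at hcon
      set K' : Set BC := (segment ℝ g0 (NM I T t g0) ∪ NM I T t '' K) ∪
        segment ℝ g1 (NM I T t g1) with hK'
      have hpre : IsPreconnected K' := by
        refine IsPreconnected.union (NM I T t g1) (Or.inr (mem_image_of_mem _ hK.right))
          (right_mem_segment _ _ _) ?_ (convex_segment _ _).isPreconnected
        exact IsPreconnected.union (NM I T t g0) (right_mem_segment _ _ _)
          (mem_image_of_mem _ hK.left) (convex_segment _ _).isPreconnected
          (hK.conn.image _ (H.continuous_NM ht).continuousOn)
      have hJ : Joins g0 g1 K' := by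
        refine ⟨hpre, ?_, Or.inl (Or.inl (left_mem_segment _ _ _)), Or.inr (left_mem_segment _ _ _)⟩
        rintro g ((hg | ⟨k, hk, rfl⟩) | hg)
        · exact nonneg_of_mem_segment h0 (H.NM_nonneg ht g0) hg
        · exact H.NM_nonneg ht k
        · exact nonneg_of_mem_segment h1 (H.NM_nonneg ht g1) hg
      have hmem : c t - (s - t) ∈ levels I T g0 g1 t := by
        refine ⟨K', hJ, ?_⟩
        rintro g ((hg | ⟨k, hk, rfl⟩) | hg)
        · have := H.Psi_le_of_mem_segment_NM ht hg
          have := min_le_left (c t - Psi I T t g0) (c t - Psi I T t g1)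
          linarith
        · exact hcon k hk
        · have := H.Psi_le_of_mem_segment_NM ht hg
          have := min_le_right (c t - Psi I T t g0) (c t - Psi I T t g1)
          linarith
      have : c t ≤ c t - (s - t) := csInf_le (levels_bddBelow g0 g1 t) hmem
      linarith
    obtain ⟨g, hg, hlow⟩ := hex
    have hN := H.Psi_NM_le (s := 1) ht g
    rw [one_smul, add_sub_cancel] at hN
    have hq := H.ip_self_nonneg g
    have hqd := H.ip_self_nonneg (g - NM I T t g)
    have hup' := hup g hg
    have hst : Psi I T s g = Psi I T t g + (s - t) / 2 * ip I T g g := by unfold Psi; ring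
    rw [hst] at hup'
    have hp : 0 ≤ (s - t) / 2 * ip I T g g := by positivity
    have hp2 : 0 ≤ t * ip I T (g - NM I T t g) (g - NM I T t g) := by positivity
    refine ⟨g, hK.nonneg g hg, by linarith, by linarith, ?_, ?_⟩
    · by_contra hcon
      push Not at hcon
      have : (s - t) / 2 * (2 * (M + 2)) < (s - t) / 2 * ip I T g g :=
        mul_lt_mul_of_pos_left hcon (by linarith)
      linarith
    · rw [div_mul_eq_mul_div, le_div_iff₀ ht]
      linarith
  obtain ⟨s, hs, hsl, hst⟩ : ∃ s : ℕ → ℝ, (∀ n, ∃ g : BC, (∀ x, 0 ≤ g x) ∧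
      c t - (s n - t) ≤ Psi I T t g ∧
      Psi I T t g ≤ c t + (M + 1) * (s n - t) ∧ ip I T g g ≤ 2 * (M + 2) ∧
      ip I T (g - NM I T t g) (g - NM I T t g) ≤ 2 * (M + 2) / t * (s n - t)) ∧
      Tendsto s atTop (𝓝 t) ∧ True := by
    obtain ⟨u, hu, hus⟩ := exists_seq_forall_of_frequently key.frequently
    exact ⟨u, hus, tendsto_nhds_of_tendsto_nhdsWithin hu, trivial⟩
  choose g hgn hglow hgup hgq hgd using hs
  have hs0 : Tendsto (fun n => s n - t) atTop (𝓝 0) := by simpa using hsl.sub_const t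
  have hle := Nat.hyperfilter_le_atTop
  obtain ⟨g', hg', hlim⟩ := H.palaisSmale (hyperfilter ℕ) ht (τ := fun _ => t) (fun _ => le_rfl)
    tendsto_const_nhds hgn (A := 2 * (M + 2)) (Eventually.of_forall hgq)
    (squeeze_zero (fun n => H.ip_self_nonneg _) hgd
      (by simpa using (hs0.const_mul (2 * (M + 2) / t)).mono_left hle))
  refine ⟨g', hg', tendsto_nhds_unique hlim ?_⟩
  refine Tendsto.mono_left ?_ hle
  refine tendsto_of_tendsto_of_tendsto_of_le_of_le (g := fun n => c t - (s n - t))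
    (h := fun n => c t + (M + 1) * (s n - t)) ?_ ?_ hglow hgup
  · simpa using hs0.const_sub (c t)
  · simpa using (hs0.const_mul (M + 1)).const_add (c t)

/-- Existence of approximating mountain pass critical points. -/
theorem exists_mountainPass_seq (H : GreenForm Ω I T) {g0 g1 : BC}
    (h0 : ∀ x, 0 ≤ g0 x) (h1 : ∀ x, 0 ≤ g1 x) {t : ℝ} (ht : 0 < t) {m : ℝ}
    (hm : ∀ K, Joins g0 g1 K → ∃ g ∈ K, m ≤ Psi I T t g)
    (hm0 : Psi I T t g0 < m) (hm1 : Psi I T t g1 < m) :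
    ∃ (τ : ℕ → ℝ) (g : ℕ → BC) (M : ℝ), (∀ n, t < τ n) ∧ Tendsto τ atTop (𝓝 t) ∧
      (∀ n, NM I T (τ n) (g n) = g n) ∧
      ∀ n, m ≤ Psi I T (τ n) (g n) ∧ Psi I T (τ n) (g n) ≤ M := by
  set c := level I T g0 g1 with hc
  have hmono := H.level_mono h0 h1
  have hmc : ∀ s, t ≤ s → m ≤ c s := fun s hs => by
    refine le_csInf (H.levels_nonempty h0 h1 s) ?_
    rintro σ ⟨K, hK, hKs⟩
    obtain ⟨g, hg, hmg⟩ := hm K hK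
    exact (hmg.trans (H.Psi_mono hs g)).trans (hKs g hg)
  have hcont : ∀ g, Continuous fun s => Psi I T s g := fun g => by unfold Psi; fun_prop
  have hev : ∀ᶠ s in 𝓝 t, Psi I T s g0 < m ∧ Psi I T s g1 < m ∧ s < t + 1 :=
    (((hcont g0).tendsto t).eventually (gt_mem_nhds hm0)).and
      ((((hcont g1).tendsto t).eventually (gt_mem_nhds hm1)).and (gt_mem_nhds (by linarith)))
  have hdense : Dense {s | DifferentiableAt ℝ c s} :=
    Measure.dense_of_ae (μ := volume) hmono.ae_differentiableAt
  have hfreq : ∃ᶠ s in 𝓝[>] t, ∃ g, NM I T s g = g ∧ t < s ∧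
      m ≤ Psi I T s g ∧ Psi I T s g ≤ c (t + 1) := by
    intro hcon
    obtain ⟨u, hu, hsub⟩ := (mem_nhdsGT_iff_exists_Ioo_subset).1
      (hcon.and (nhdsWithin_le_nhds hev))
    obtain ⟨s, hs, hsu⟩ := hdense.exists_mem_open isOpen_Ioo (nonempty_Ioo.2 hu)
    obtain ⟨hn, hs0, hs1, hs2⟩ := hsub hsu
    have hms := hmc s hsu.1.le
    obtain ⟨g, hg, hgl⟩ := H.exists_critical_of_differentiableAt h0 h1 (ht.trans hsu.1) hs
      (hs0.trans_le hms) (hs1.trans_le hms)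
    exact hn ⟨g, hg, hsu.1, hgl ▸ hms, hgl ▸ hmono hs2.le⟩
  obtain ⟨τ, hτ, hτs⟩ := exists_seq_forall_of_frequently hfreq
  choose g hg1 hg2 hg3 hg4 using hτs
  exact ⟨τ, g, c (t + 1), hg2, tendsto_nhds_of_tendsto_nhdsWithin hτ, hg1,
    fun n => ⟨hg3 n, hg4 n⟩⟩

end GreenForm
end

end

section

/-! ### Logarithmic potentials -/

/-- The real linear functional `h ↦ Re (q h)`. -/
def reMul (q : ℂ) : ℂ →L[ℝ] ℝ := Complex.reCLM ∘L ContinuousLinearMap.mul ℝ ℂ q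

theorem reMul_apply (q h : ℂ) : reMul q h = (q * h).re := rfl

/-- Twice the Cauchy–Riemann operator. -/
def dbar (q : ℂ → ℂ) (z : ℂ) : ℂ := fderiv ℝ q z 1 + Complex.I * fderiv ℝ q z Complex.I

theorem locallyIntegrable_inv : LocallyIntegrable (fun w : ℂ => w⁻¹) := by
  refine locallyIntegrable_of_norm_le_rpow (C := 1) (α := 1) (by simp) (by simp)
    (Eventually.of_forall fun x => ?_) measurable_inv.aestronglyMeasurable
  rw [norm_inv, Real.rpow_neg_one, one_mul]

theorem locallyIntegrable_norm_inv : LocallyIntegrable (fun w : ℂ => ‖w⁻¹‖) := by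
  refine locallyIntegrable_of_norm_le_rpow (C := 1) (α := 1) (by simp) (by simp)
    (Eventually.of_forall fun x => ?_) measurable_inv.norm.aestronglyMeasurable
  rw [norm_norm, norm_inv, Real.rpow_neg_one, one_mul]

theorem abs_log_le_inv_add {r : ℝ} (hr : 0 ≤ r) : |Real.log r| ≤ r⁻¹ + r := by
  rcases hr.eq_or_lt with rfl | hr
  · simp
  · have h1 := Real.log_le_sub_one_of_pos hr
    have h2 := Real.log_le_sub_one_of_pos (inv_pos.2 hr)
    rw [Real.log_inv] at h2
    rw [abs_le]
    have := inv_pos.2 hr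
    constructor <;> linarith

theorem locallyIntegrable_log_norm : LocallyIntegrable (fun w : ℂ => Real.log ‖w‖) := by
  have h : LocallyIntegrable (fun w : ℂ => ‖w⁻¹‖ + ‖w‖) :=
    locallyIntegrable_norm_inv.add continuous_norm.locallyIntegrable
  refine h.mono (Real.measurable_log.comp measurable_norm).aestronglyMeasurable
    (Eventually.of_forall fun w => ?_)
  rw [Real.norm_eq_abs, Real.norm_of_nonneg (by positivity), norm_inv]
  exact abs_log_le_inv_add (norm_nonneg w)

/-- The logarithmic potential of a density. -/
def logPot (κ : ℂ → ℝ) (z : ℂ) : ℝ := ∫ ζ, κ ζ * Real.log ‖z - ζ‖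

/-- The Cauchy transform of a density. -/
def cauchyT (κ : ℂ → ℝ) (z : ℂ) : ℂ := ∫ ζ, (κ ζ : ℂ) * (z - ζ)⁻¹

section
variable {κ : ℂ → ℝ}

theorem hasCompactSupport_ofReal (hs : HasCompactSupport κ) :
    HasCompactSupport fun ζ => (κ ζ : ℂ) := hs.comp_left (g := fun x : ℝ => (x : ℂ)) (by simp)

theorem integrable_mul_log (hc : Continuous κ) (hs : HasCompactSupport κ) (z : ℂ) :
    Integrable fun ζ => κ ζ * Real.log ‖z - ζ‖ :=
  hs.convolutionExists_left (ContinuousLinearMap.mul ℝ ℝ) hc locallyIntegrable_log_norm z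

theorem integrable_mul_inv (hc : Continuous κ) (hs : HasCompactSupport κ) (z : ℂ) :
    Integrable fun ζ => (κ ζ : ℂ) * (z - ζ)⁻¹ :=
  (hasCompactSupport_ofReal hs).convolutionExists_left (ContinuousLinearMap.mul ℝ ℂ)
    (by fun_prop) locallyIntegrable_inv z

theorem cauchyT_eq : cauchyT κ = convolution (fun ζ => (κ ζ : ℂ)) (fun w : ℂ => w⁻¹)
    (ContinuousLinearMap.mul ℝ ℂ) volume := rfl

theorem continuous_cauchyT (hc : Continuous κ) (hs : HasCompactSupport κ) :
    Continuous (cauchyT κ) := by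
  rw [cauchyT_eq]
  exact (hasCompactSupport_ofReal hs).continuous_convolution_left _ (by fun_prop)
    locallyIntegrable_inv

theorem ae_notMem_line (z h : ℂ) : ∀ᵐ ζ : ℂ, ∀ s : ℝ, z + s * h - ζ ≠ 0 := by
  have h1 : Submodule.span ℝ {h} ≠ ⊤ := by
    intro htop
    have h2 := finrank_span_le_card (R := ℝ) ({h} : Set ℂ)
    rw [htop, finrank_top, Complex.finrank_real_complex] at h2
    simp at h2
  have h3 := Measure.addHaar_submodule (volume : Measure ℂ) _ h1
  have h4 : volume ((fun ζ => ζ + -z) ⁻¹' (Submodule.span ℝ {h} : Set ℂ)) = 0 := by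
    rw [measure_preimage_add_right]; exact h3
  rw [ae_iff]
  refine measure_mono_null (fun ζ hζ => ?_) h4
  simp only [ne_eq, mem_ofPred_eq, not_forall, not_not] at hζ
  obtain ⟨s, hs⟩ := hζ
  simp only [mem_preimage, SetLike.mem_coe]
  have : ζ + -z = s • h := by rw [Complex.real_smul]; linear_combination -hs
  rw [this]
  exact Submodule.smul_mem _ _ (Submodule.mem_span_singleton_self h)

theorem hasDerivAt_log_norm_line {z h ζ : ℂ} {s : ℝ} (hne : z + s * h - ζ ≠ 0) :
    HasDerivAt (fun s : ℝ => Real.log ‖z + s * h - ζ‖) (((z + s * h - ζ)⁻¹ * h).re) s := by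
  set w := z + s * h - ζ with hw
  have h1 : HasDerivAt (fun s : ℝ => z + s * h - ζ) h s := by
    have := ((Complex.ofRealCLM.hasDerivAt (x := s)).mul_const h).const_add z |>.sub_const ζ
    simpa using this
  have h2 : HasDerivAt (fun s : ℝ => ‖z + s * h - ζ‖ ^ 2) (2 * inner ℝ w h) s := h1.norm_sq
  have h3 := (h2.log (by positivity)).const_mul (1 / 2 : ℝ)
  have e : (fun s : ℝ => Real.log ‖z + s * h - ζ‖) =
      fun s : ℝ => 1 / 2 * Real.log (‖z + s * h - ζ‖ ^ 2) := by
    ext s; rw [Real.log_pow]; push_cast; ring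
  rw [e]
  refine h3.congr_deriv ?_
  symm
  rw [Complex.inv_def, Complex.inner, Complex.normSq_eq_norm_sq]
  have h5 : (conj w * ((‖w‖ ^ 2)⁻¹ : ℝ) * h).re = (‖w‖ ^ 2)⁻¹ * (conj w * h).re := by
    rw [mul_right_comm, mul_comm, Complex.re_ofReal_mul]
  have h6 : ((starRingEnd ℂ) w * h).re = (h * (starRingEnd ℂ) w).re := by rw [mul_comm]
  rw [h5, ← hw, h6]
  field_simp

theorem logPot_sub_eq (hc : Continuous κ) (hs : HasCompactSupport κ) (z h : ℂ) :
    logPot κ (z + h) - logPot κ z = ∫ s in (0 : ℝ)..1, (cauchyT κ (z + s * h) * h).re := by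
  obtain ⟨Φ, hΦ'⟩ : ∃ Φ : ℂ × ℝ → ℂ, Φ = fun p => (κ p.1 : ℂ) * (z + p.2 * h - p.1)⁻¹ := ⟨_, rfl⟩
  have hΦ : ∀ ζ s, Φ (ζ, s) = (κ ζ : ℂ) * (z + s * h - ζ)⁻¹ := fun ζ s => by rw [hΦ']
  have hΦm : Measurable Φ := by
    have := hc.measurable
    rw [hΦ']
    fun_prop
  have hA : Continuous fun z' : ℂ => ∫ ζ, ‖(κ ζ : ℂ) * (z' - ζ)⁻¹‖ := by
    have := (hs.norm).continuous_convolution_left (ContinuousLinearMap.mul ℝ ℝ) hc.norm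
      locallyIntegrable_norm_inv (μ := volume)
    convert this using 2 with z'
    simp [convolution_def]
  have hInt : Integrable Φ ((volume : Measure ℂ).prod (volume.restrict (Ioc (0 : ℝ) 1))) := by
    rw [integrable_prod_iff' hΦm.aestronglyMeasurable]
    refine ⟨Eventually.of_forall fun s => ?_, ?_⟩
    · simp only [hΦ]
      exact integrable_mul_inv hc hs (z + s * h)
    have : Continuous fun s : ℝ => ∫ ζ, ‖Φ (ζ, s)‖ := by
      simp only [hΦ]
      exact hA.comp (by fun_prop : Continuous fun s : ℝ => z + s * h)
    exact (this.integrableOn_Icc (a := 0) (b := 1)).mono_set Ioc_subset_Icc_self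
  have hre : Integrable (fun p => (Φ p * h).re)
      ((volume : Measure ℂ).prod (volume.restrict (Ioc (0 : ℝ) 1))) := (hInt.mul_const h).re
  have hswap := integral_integral_swap (f := fun ζ s => (Φ (ζ, s) * h).re) hre
  rw [intervalIntegral.integral_of_le zero_le_one]
  have hR : ∀ s : ℝ, ∫ ζ, (Φ (ζ, s) * h).re = (cauchyT κ (z + s * h) * h).re := fun s => by
    have h1 := (integrable_mul_inv hc hs (z + s * h)).mul_const h
    have := integral_re h1
    rw [integral_mul_const] at this
    simp only [hΦ]
    exact this
  simp_rw [hR] at hswap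
  rw [← hswap, logPot, logPot, ← integral_sub (integrable_mul_log hc hs _)
    (integrable_mul_log hc hs _)]
  refine integral_congr_ae ?_
  filter_upwards [ae_notMem_line z h] with ζ hζ
  have h1 : ∀ s : ℝ, HasDerivAt (fun s : ℝ => κ ζ * Real.log ‖z + s * h - ζ‖)
      ((Φ (ζ, s) * h).re) s := fun s => by
    have := (hasDerivAt_log_norm_line (hζ s)).const_mul (κ ζ)
    refine this.congr_deriv ?_
    rw [hΦ, mul_assoc, Complex.re_ofReal_mul]
  have h2 : Continuous fun s : ℝ => (Φ (ζ, s) * h).re := by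
    simp only [hΦ]
    refine Complex.continuous_re.comp (Continuous.mul (Continuous.mul continuous_const ?_)
      continuous_const)
    exact Continuous.inv₀ (by fun_prop) hζ
  have h3 := intervalIntegral.integral_eq_sub_of_hasDerivAt (a := 0) (b := 1) (fun s _ => h1 s)
    (h2.intervalIntegrable _ _)
  rw [intervalIntegral.integral_of_le zero_le_one] at h3
  rw [h3]
  simp

theorem hasFDerivAt_logPot (hc : Continuous κ) (hs : HasCompactSupport κ) (z : ℂ) :
    HasFDerivAt (logPot κ) (reMul (cauchyT κ z)) z := by
  rw [hasFDerivAt_iff_isLittleO_nhds_zero, Asymptotics.isLittleO_iff]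
  intro ε hε
  have hQ := continuous_cauchyT hc hs
  obtain ⟨δ, hδ, hball⟩ := Metric.continuousAt_iff.1 hQ.continuousAt ε hε
  filter_upwards [Metric.ball_mem_nhds (0 : ℂ) hδ] with h hh
  have hh' : ‖h‖ < δ := by simpa using hh
  have hci : Continuous fun s : ℝ => (cauchyT κ (z + s * h) * h).re := by fun_prop
  rw [logPot_sub_eq hc hs, reMul_apply]
  have e : (cauchyT κ z * h).re = ∫ s in (0 : ℝ)..1, (cauchyT κ z * h).re := by simp
  rw [e, ← intervalIntegral.integral_sub (hci.intervalIntegrable _ _) (by simp)]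
  have := intervalIntegral.norm_integral_le_of_norm_le_const (a := 0) (b := 1)
    (f := fun s : ℝ => (cauchyT κ (z + s * h) * h).re - (cauchyT κ z * h).re)
    (C := ε * ‖h‖) fun s hs => by
      rw [uIoc_of_le zero_le_one] at hs
      rw [← Complex.sub_re, ← sub_mul]
      refine (Complex.abs_re_le_norm _).trans ?_
      rw [norm_mul]
      refine mul_le_mul_of_nonneg_right ?_ (norm_nonneg _)
      rw [← dist_eq_norm]
      refine (hball ?_).le
      rw [dist_eq_norm, add_sub_cancel_left, norm_mul, Complex.norm_real, Real.norm_of_nonneg hs.1.le]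
      nlinarith [norm_nonneg h, hs.2]
  simpa using this

theorem contDiff_cauchyT (hc : ContDiff ℝ 1 κ) (hs : HasCompactSupport κ) :
    ContDiff ℝ 1 (cauchyT κ) := by
  rw [cauchyT_eq]
  exact (hasCompactSupport_ofReal hs).contDiff_convolution_left (n := 1) _
    (Complex.ofRealCLM.contDiff.comp hc) locallyIntegrable_inv

theorem fderiv_cauchyT_apply (hc : ContDiff ℝ 1 κ) (hs : HasCompactSupport κ) (z h : ℂ) :
    fderiv ℝ (cauchyT κ) z h = cauchyT (fun ζ => fderiv ℝ κ ζ h) z := by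
  have hC : ContDiff ℝ 1 fun ζ => (κ ζ : ℂ) := Complex.ofRealCLM.contDiff.comp hc
  have h1 := (hasCompactSupport_ofReal hs).hasFDerivAt_convolution_left
    (ContinuousLinearMap.mul ℝ ℂ) hC locallyIntegrable_inv z (μ := volume)
  have h2 := ((hasCompactSupport_ofReal hs).fderiv ℝ).convolutionExists_left
    ((ContinuousLinearMap.mul ℝ ℂ).precompL ℂ) (hC.continuous_fderiv one_ne_zero)
    locallyIntegrable_inv z (μ := volume)
  rw [cauchyT_eq, h1.fderiv, convolution_def, ContinuousLinearMap.integral_apply h2, cauchyT]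
  congr 1
  ext ζ
  have : fderiv ℝ (fun ζ => (κ ζ : ℂ)) ζ h = ((fderiv ℝ κ ζ h : ℝ) : ℂ) := by
    have := (Complex.ofRealCLM.hasFDerivAt.comp ζ
      ((hc.differentiable one_ne_zero) ζ).hasFDerivAt).fderiv
    change fderiv ℝ (Complex.ofRealCLM ∘ κ) ζ h = _
    rw [this]; rfl
  rw [ContinuousLinearMap.precompL_apply, ContinuousLinearMap.mul_apply', this]

theorem re_dbar_cauchyT_integrand (L : ℂ →L[ℝ] ℝ) (w : ℂ) :
    ((L 1 : ℂ) * w⁻¹ + Complex.I * ((L Complex.I : ℂ) * w⁻¹)).re = (‖w‖ ^ 2)⁻¹ * L w := by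
  have h : L w = w.re * L 1 + w.im * L Complex.I := by
    have : w = w.re • (1 : ℂ) + w.im • Complex.I := by simp [Complex.re_add_im]
    conv_lhs => rw [this]
    rw [map_add, map_smul, map_smul, smul_eq_mul, smul_eq_mul]
  rw [h, ← Complex.normSq_eq_norm_sq]
  simp only [Complex.add_re, Complex.mul_re, Complex.ofReal_re, Complex.inv_re, Complex.ofReal_im,
    Complex.inv_im, Complex.I_re, Complex.I_im, Complex.mul_im]
  ring

theorem integral_polar_fderiv (hc : ContDiff ℝ 1 κ) (hs : HasCompactSupport κ) (z : ℂ) :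
    ∫ w, (‖w‖ ^ 2)⁻¹ * fderiv ℝ κ (z - w) w = 2 * π * κ z := by
  rw [← Complex.integral_comp_polarCoord_symm]
  obtain ⟨e, he⟩ : ∃ e : ℝ → ℂ, e = fun θ => (Real.cos θ + Real.sin θ * Complex.I : ℂ) := ⟨_, rfl⟩
  have hec : Continuous e := by rw [he]; fun_prop
  have hen : ∀ θ, ‖e θ‖ = 1 := fun θ => by
    rw [he]
    simp only [Complex.ofReal_cos, Complex.ofReal_sin]
    rw [← Complex.exp_mul_I, Complex.norm_exp_ofReal_mul_I]
  obtain ⟨R, hR0, hR⟩ : ∃ R, 0 < R ∧ ∀ w : ℂ, R ≤ ‖w‖ → z - w ∉ tsupport κ := by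
    obtain ⟨R, hR⟩ := hs.isCompact.isBounded.subset_closedBall (0 : ℂ)
    refine ⟨‖z‖ + |R| + 1, by positivity, fun w hw hmem => ?_⟩
    have := hR hmem
    rw [mem_closedBall_zero_iff] at this
    have h1 : ‖w‖ ≤ ‖z‖ + ‖z - w‖ := by
      have := norm_sub_le z (z - w)
      simpa using this
    linarith [le_abs_self R]
  have hDc : Continuous fun p : ℝ × ℝ => fderiv ℝ κ (z - p.1 * e p.2) (e p.2) := by
    have := hc.continuous_fderiv one_ne_zero
    exact (this.comp (by fun_prop)).clm_apply (by fun_prop)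
  have hD0 : ∀ r θ : ℝ, R ≤ r → fderiv ℝ κ (z - r * e θ) = 0 := fun r θ hr => by
    refine image_eq_zero_of_notMem_tsupport fun hmem => ?_
    refine hR (r * e θ) ?_ (tsupport_fderiv_subset ℝ hmem)
    rw [norm_mul, hen, mul_one, Complex.norm_real]
    exact hr.trans (le_abs_self _)
  have e1 : ∫ p in polarCoord.target, p.1 • ((‖Complex.polarCoord.symm p‖ ^ 2)⁻¹ *
        fderiv ℝ κ (z - Complex.polarCoord.symm p) (Complex.polarCoord.symm p)) =
      ∫ p in Ioi (0 : ℝ) ×ˢ Ioo (-π) π, fderiv ℝ κ (z - p.1 * e p.2) (e p.2) := by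
    refine setIntegral_congr_fun (measurableSet_Ioi.prod measurableSet_Ioo) fun p hp => ?_
    have hp1 : 0 < p.1 := hp.1
    have h2 : Complex.polarCoord.symm p = p.1 * e p.2 := by
      rw [Complex.polarCoord_symm_apply, he]
    have h3 : ((p.1 : ℂ) * e p.2) = p.1 • e p.2 := by simp
    simp only [h2]
    rw [h3, map_smul, norm_smul, hen, mul_one, Real.norm_of_nonneg hp1.le, smul_eq_mul, smul_eq_mul]
    field_simp
  have hInt : IntegrableOn (fun p : ℝ × ℝ => fderiv ℝ κ (z - p.1 * e p.2) (e p.2))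
      (Ioi (0 : ℝ) ×ˢ Ioo (-π) π) := by
    refine IntegrableOn.of_forall_sdiff_eq_zero (s := Icc 0 R ×ˢ Icc (-π) π)
      (hDc.continuousOn.integrableOn_compact (isCompact_Icc.prod isCompact_Icc))
      (measurableSet_Ioi.prod measurableSet_Ioo) fun p hp => ?_
    have : R ≤ p.1 := by
      by_contra! hlt
      exact hp.2 ⟨⟨(mem_Ioi.1 hp.1.1).le, hlt.le⟩, ⟨hp.1.2.1.le, hp.1.2.2.le⟩⟩
    rw [hD0 _ _ this]; rfl
  have hrad : ∀ θ, ∫ r in Ioi (0 : ℝ), fderiv ℝ κ (z - r * e θ) (e θ) = κ z := fun θ => by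
    have hk : ContDiff ℝ 1 fun r : ℝ => κ (z - r * e θ) := by
      refine hc.comp ?_
      exact contDiff_const.sub (Complex.ofRealCLM.contDiff.mul contDiff_const)
    have hks : HasCompactSupport fun r : ℝ => κ (z - r * e θ) := by
      refine HasCompactSupport.intro (isCompact_Icc (a := -R) (b := R)) fun r hr => ?_
      refine image_eq_zero_of_notMem_tsupport (hR _ ?_)
      rw [norm_mul, hen, mul_one, Complex.norm_real]
      by_contra! hlt
      exact hr (abs_le.1 hlt.le)
    have h1 := hks.integral_Ioi_deriv_eq hk 0
    have h2 : ∀ r : ℝ, deriv (fun r : ℝ => κ (z - r * e θ)) r =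
        -fderiv ℝ κ (z - r * e θ) (e θ) := fun r => by
      have h3 : HasDerivAt (fun r : ℝ => z - r * e θ) (-e θ) r := by
        have := ((Complex.ofRealCLM.hasDerivAt (x := r)).mul_const (e θ)).const_sub z
        simpa using this
      have := ((hc.differentiable one_ne_zero _).hasFDerivAt.comp_hasDerivAt r h3).deriv
      rw [map_neg] at this
      exact this
    simp only [h2, integral_neg] at h1
    simpa using h1
  refine e1.trans ?_
  rw [IntegrableOn, Measure.volume_eq_prod, ← Measure.prod_restrict] at hInt
  rw [Measure.volume_eq_prod, ← Measure.prod_restrict, integral_prod_symm _ hInt]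
  have hvol : volume.real (Ioo (-π) π) = 2 * π := by
    rw [Real.volume_real_Ioo_of_le (by linarith [pi_pos])]; ring
  simp only [hrad]
  rw [setIntegral_const, hvol, smul_eq_mul]

theorem re_dbar_cauchyT (hc : ContDiff ℝ 1 κ) (hs : HasCompactSupport κ) (z : ℂ) :
    (dbar (cauchyT κ) z).re = 2 * π * κ z := by
  have hcd : ∀ h, Continuous fun ζ => fderiv ℝ κ ζ h := fun h =>
    (hc.continuous_fderiv one_ne_zero).clm_apply continuous_const
  have hsd : ∀ h, HasCompactSupport fun ζ => fderiv ℝ κ ζ h := fun h => hs.fderiv_apply ℝ h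
  have hi := fun h => integrable_mul_inv (hcd h) (hsd h) z
  rw [dbar, fderiv_cauchyT_apply hc hs, fderiv_cauchyT_apply hc hs, cauchyT, cauchyT,
    ← integral_const_mul, ← integral_add (hi 1) ((hi Complex.I).const_mul _)]
  have h1 := integral_re ((hi 1).add ((hi Complex.I).const_mul Complex.I))
  simp only [Pi.add_apply] at h1
  refine Eq.trans h1.symm ?_
  rw [← integral_polar_fderiv hc hs z, ← integral_sub_left_eq_self _ volume z]
  refine integral_congr_ae (Eventually.of_forall fun ζ => ?_)
  simp only [sub_sub_cancel]
  exact re_dbar_cauchyT_integrand _ _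

end

end

section

/-! ### Regularity of Green potentials on the disc -/

/-- `reMul` as a continuous linear map. -/
def reMulL : ℂ →L[ℝ] (ℂ →L[ℝ] ℝ) :=
  (ContinuousLinearMap.compL ℝ ℂ ℂ ℝ Complex.reCLM) ∘L (ContinuousLinearMap.mul ℝ ℂ)

theorem reMulL_apply (q : ℂ) : reMulL q = reMul q := rfl

theorem norm_reMul_le (q : ℂ) : ‖reMul q‖ ≤ ‖q‖ := by
  refine ContinuousLinearMap.opNorm_le_bound _ (norm_nonneg _) fun h => ?_
  rw [reMul_apply, ← norm_mul]
  exact Complex.abs_re_le_norm _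

theorem hasFDerivAt_log_norm {F : ℂ → ℂ} {F' z : ℂ} (hF : HasDerivAt F F' z) (h0 : F z ≠ 0) :
    HasFDerivAt (fun z => Real.log ‖F z‖) (reMul ((F z)⁻¹ * F')) z := by
  have h1 : HasFDerivAt F (ContinuousLinearMap.mul ℝ ℂ F') z := by
    refine (hF.hasFDerivAt.restrictScalars ℝ).congr_fderiv ?_
    ext; simp [mul_comm]
  have h3 := (h1.norm_sq.log (by positivity)).const_mul (1 / 2 : ℝ)
  have e : (fun z => Real.log ‖F z‖) = fun z => 1 / 2 * Real.log (‖F z‖ ^ 2) := by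
    ext s; rw [Real.log_pow]; push_cast; ring
  rw [e]
  refine h3.congr_fderiv ?_
  have key : ∀ h, (1 / 2 : ℝ) * ((‖F z‖ ^ 2)⁻¹ * (2 * inner ℝ (F z) (F' * h))) =
      ((F z)⁻¹ * F' * h).re := fun h => by
    rw [Complex.inv_def, Complex.inner, Complex.normSq_eq_norm_sq]
    have : conj (F z) * ((‖F z‖ ^ 2)⁻¹ : ℝ) * F' * h =
        ((‖F z‖ ^ 2)⁻¹ : ℝ) * (F' * h * conj (F z)) := by ring
    rw [this, Complex.re_ofReal_mul]
    ring
  refine ContinuousLinearMap.ext fun h => ?_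
  rw [reMul_apply, ← key h]
  simp
  left
  ring

theorem contDiff_of_tsupport {κ : ℂ → ℝ} (h : ∀ x ∈ tsupport κ, ContDiffAt ℝ 1 κ x) :
    ContDiff ℝ 1 κ := by
  refine contDiff_iff_contDiffAt.2 fun x => ?_
  by_cases hx : x ∈ tsupport κ
  · exact h x hx
  · exact contDiffAt_const.congr_of_eventuallyEq (notMem_tsupport_iff_eventuallyEq.1 hx)

theorem hasFDerivAt_integral_reMul {μ : Measure ℂ} {h : ℂ → ℂ → ℝ} {p p' : ℂ → ℂ → ℂ}
    {κ : ℂ → ℝ} {z0 : ℂ} {r B : ℝ} (hκ : Integrable κ μ)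
    (hm : ∀ z, AEStronglyMeasurable (h z) μ) (pm : ∀ z, AEStronglyMeasurable (p z) μ)
    (pm' : ∀ z, AEStronglyMeasurable (p' z) μ)
    (hh : ∀ᵐ ζ ∂μ, κ ζ ≠ 0 → ∀ z ∈ ball z0 r, |h z ζ| ≤ B ∧ ‖p z ζ‖ ≤ B ∧ ‖p' z ζ‖ ≤ B ∧
      HasFDerivAt (fun z => h z ζ) (reMul (p z ζ)) z ∧ HasDerivAt (fun z => p z ζ) (p' z ζ) z)
    {z : ℂ} (hz : z ∈ ball z0 r) :
    Integrable (fun ζ => h z ζ * κ ζ) μ ∧ Integrable (fun ζ => p z ζ * κ ζ) μ ∧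
    HasFDerivAt (fun z => ∫ ζ, h z ζ * κ ζ ∂μ) (reMul (∫ ζ, p z ζ * κ ζ ∂μ)) z ∧
      DifferentiableAt ℂ (fun z => ∫ ζ, p z ζ * κ ζ ∂μ) z := by
  have hκm : AEStronglyMeasurable (fun ζ => (κ ζ : ℂ)) μ :=
    Complex.continuous_ofReal.comp_aestronglyMeasurable hκ.1
  have hbd : Integrable (fun ζ => B * ‖κ ζ‖) μ := hκ.norm.const_mul B
  have hs : ball z0 r ∈ 𝓝 z := isOpen_ball.mem_nhds hz
  have i1 : Integrable (fun ζ => h z ζ * κ ζ) μ := by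
    refine hbd.mono' ((hm z).mul hκ.1) ?_
    filter_upwards [hh] with ζ hζ
    by_cases h0 : κ ζ = 0
    · simp [h0]
    · rw [norm_mul]
      exact mul_le_mul_of_nonneg_right (hζ h0 z hz).1 (norm_nonneg _)
  have i2 : Integrable (fun ζ => p z ζ * κ ζ) μ := by
    refine hbd.mono' ((pm z).mul hκm) ?_
    filter_upwards [hh] with ζ hζ
    by_cases h0 : κ ζ = 0
    · simp [h0]
    · rw [norm_mul, Complex.norm_real]
      exact mul_le_mul_of_nonneg_right (hζ h0 z hz).2.1 (norm_nonneg _)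
  refine ⟨i1, i2, ?_, ?_⟩
  · have := hasFDerivAt_integral_of_dominated_of_fderiv_le (𝕜 := ℝ) (μ := μ)
      (F := fun z ζ => h z ζ * κ ζ) (F' := fun z ζ => reMulL (p z ζ * κ ζ))
      (bound := fun ζ => B * ‖κ ζ‖) hs (Eventually.of_forall fun z => (hm z).mul hκ.1) i1
      (reMulL.continuous.comp_aestronglyMeasurable ((pm z).mul hκm))
      (by
        filter_upwards [hh] with ζ hζ z hz
        refine (norm_reMul_le _).trans ?_
        by_cases h0 : κ ζ = 0
        · simp [h0]
        · rw [norm_mul, Complex.norm_real]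
          exact mul_le_mul_of_nonneg_right (hζ h0 z hz).2.1 (norm_nonneg _)) hbd
      (by
        filter_upwards [hh] with ζ hζ z hz
        by_cases h0 : κ ζ = 0
        · simp only [h0, mul_zero, Complex.ofReal_zero, map_zero]
          exact hasFDerivAt_const _ _
        · refine ((hζ h0 z hz).2.2.2.1.mul_const (κ ζ)).congr_fderiv ?_
          refine ContinuousLinearMap.ext fun w => ?_
          simp only [smul_apply, reMulL_apply, reMul_apply, smul_eq_mul]
          rw [← Complex.re_ofReal_mul]
          congr 1; ring)
    rwa [reMulL.integral_comp_comm i2] at this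
  · exact (hasDerivAt_integral_of_dominated_loc_of_deriv_le (𝕜 := ℂ) (μ := μ)
      (F := fun z ζ => p z ζ * κ ζ) (F' := fun z ζ => p' z ζ * κ ζ)
      (bound := fun ζ => B * ‖κ ζ‖) hs (Eventually.of_forall fun z => (pm z).mul hκm) i2
      ((pm' z).mul hκm)
      (by
        filter_upwards [hh] with ζ hζ z hz
        by_cases h0 : κ ζ = 0
        · simp [h0]
        · rw [norm_mul, Complex.norm_real]
          exact mul_le_mul_of_nonneg_right (hζ h0 z hz).2.2.1 (norm_nonneg _)) hbd
      (by
        filter_upwards [hh] with ζ hζ z hz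
        by_cases h0 : κ ζ = 0
        · simp only [h0, mul_zero, Complex.ofReal_zero]
          exact hasDerivAt_const _ _
        · exact (hζ h0 z hz).2.2.2.2.mul_const _)).2.differentiableAt

/-- The Green potential on the unit disc. -/
def diskPot (κ : ℂ → ℝ) (z : ℂ) : ℝ :=
  ∫ ζ in ball (0 : ℂ) 1, -(2 * π)⁻¹ * Real.log (pd z ζ) * κ ζ

/-- The complex gradient of the Green function of the unit disc in its first variable. -/
def gradK (z ζ : ℂ) : ℂ := -(2 * π)⁻¹ * ((z - ζ)⁻¹ + conj ζ * (1 - z * conj ζ)⁻¹)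

/-- The complex gradient of the Green potential on the unit disc. -/
def diskGrad (κ : ℂ → ℝ) (z : ℂ) : ℂ := ∫ ζ in ball (0 : ℂ) 1, gradK z ζ * κ ζ

theorem exists_disk_decomp {κ : ℂ → ℝ} (hi : IntegrableOn κ (ball 0 1))
    (hc : ContinuousOn κ (ball 0 1)) {z0 : ℂ} (hz0 : z0 ∈ ball (0 : ℂ) 1) :
    ∃ (κ₁ : ℂ → ℝ) (P : ℂ → ℂ) (δ : ℝ), 0 < δ ∧ Continuous κ₁ ∧ HasCompactSupport κ₁ ∧
      κ₁ z0 = κ z0 ∧ (ContDiffAt ℝ 1 κ z0 → ContDiff ℝ 1 κ₁) ∧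
      ∀ z ∈ ball z0 δ, DifferentiableAt ℂ P z ∧
        IntegrableOn (fun ζ => gradK z ζ * κ ζ) (ball 0 1) ∧
        HasFDerivAt (diskPot κ) (reMul (diskGrad κ z)) z ∧
        diskGrad κ z = -(2 * π)⁻¹ * (cauchyT κ₁ z + P z) := by
  have hz1 : ‖z0‖ < 1 := by simpa using hz0
  obtain ⟨ρ, hρ, hρ1, hρC⟩ : ∃ ρ > 0, ‖z0‖ + 2 * ρ < 1 ∧
      (ContDiffAt ℝ 1 κ z0 → ∀ x ∈ closedBall z0 (2 * ρ), ContDiffAt ℝ 1 κ x) := by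
    by_cases hC : ContDiffAt ℝ 1 κ z0
    · have h1 : ∀ᶠ x in 𝓝 z0, ContDiffAt ℝ 1 κ x := hC.eventually (by simp)
      obtain ⟨r, hr, hr'⟩ := Metric.eventually_nhds_iff_ball.1 h1
      refine ⟨min (r / 3) ((1 - ‖z0‖) / 3), lt_min (by linarith) (by linarith), ?_, fun _ x hx => hr' x ?_⟩
      · have := min_le_right (r / 3) ((1 - ‖z0‖) / 3)
        linarith
      · have := min_le_left (r / 3) ((1 - ‖z0‖) / 3)
        rw [mem_closedBall] at hx
        rw [mem_ball]; linarith
    · exact ⟨(1 - ‖z0‖) / 3, by linarith, by linarith, fun h => absurd h hC⟩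
  let χ : ContDiffBump z0 := ⟨ρ, 2 * ρ, hρ, by linarith⟩
  have hχs : tsupport χ = closedBall z0 (2 * ρ) := χ.tsupport_eq
  have hsub : closedBall z0 (2 * ρ) ⊆ ball 0 1 := fun x hx => by
    rw [mem_closedBall, dist_eq_norm] at hx
    rw [mem_ball_zero_iff]
    linarith [norm_le_norm_add_norm_sub' x z0]
  obtain ⟨κ₁, hκ₁⟩ : ∃ κ₁ : ℂ → ℝ, κ₁ = fun ζ => χ ζ * κ ζ := ⟨_, rfl⟩
  have hsupp : tsupport κ₁ ⊆ closedBall z0 (2 * ρ) := by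
    rw [hκ₁, ← hχs]; exact tsupport_mul_subset_left
  have hc₁ : Continuous κ₁ := by
    refine continuous_of_tsupport fun x hx => ?_
    rw [hκ₁]
    exact χ.continuous.continuousAt.mul
      ((hc x (hsub (hsupp hx))).continuousAt (isOpen_ball.mem_nhds (hsub (hsupp hx))))
  have hs₁ : HasCompactSupport κ₁ := by
    rw [hκ₁]; exact χ.hasCompactSupport.mul_right
  have hi₁ : Integrable κ₁ := hc₁.integrable_of_hasCompactSupport hs₁
  have hi₂ : Integrable (fun ζ => κ ζ - κ₁ ζ) (volume.restrict (ball 0 1)) :=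
    hi.sub hi₁.integrableOn
  have h₂ : ∀ ζ, κ ζ - κ₁ ζ ≠ 0 → ρ < dist ζ z0 := fun ζ hζ => by
    by_contra! hle
    refine hζ ?_
    rw [hκ₁]
    simp [χ.one_of_mem_closedBall (mem_closedBall.2 hle)]
  have hD : ∀ᵐ ζ ∂(volume.restrict (ball (0 : ℂ) 1)), ‖ζ‖ < 1 := by
    filter_upwards [ae_restrict_mem measurableSet_ball] with ζ hζ
    simpa using hζ
  have hz' : ∀ z ∈ ball z0 (ρ / 2), ‖z‖ < 1 - ρ := fun z hz => by
    rw [mem_ball, dist_eq_norm] at hz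
    linarith [norm_le_norm_add_norm_sub' z z0]
  have hB : 0 < ρ⁻¹ := inv_pos.2 hρ
  have A := fun (z : ℂ) (hz : z ∈ ball z0 (ρ / 2)) =>
    hasFDerivAt_integral_reMul (μ := volume.restrict (ball (0 : ℂ) 1))
      (h := fun z ζ => Real.log ‖z - ζ‖) (p := fun z ζ => (z - ζ)⁻¹)
      (p' := fun z ζ => -1 / (z - ζ) ^ 2) (κ := fun ζ => κ ζ - κ₁ ζ)
      (z0 := z0) (r := ρ / 2) (B := 4 * ρ⁻¹ ^ 2 + 2 * ρ⁻¹ + 2) hi₂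
      (fun z => (Real.measurable_log.comp (by fun_prop)).aestronglyMeasurable)
      (fun z => (by fun_prop : Measurable fun ζ => (z - ζ)⁻¹).aestronglyMeasurable)
      (fun z => (by fun_prop : Measurable fun ζ => -1 / (z - ζ) ^ 2).aestronglyMeasurable)
      (by
        filter_upwards [hD] with ζ hζ h0 z hz
        have h1 := h₂ ζ h0
        have h2 : ρ / 2 ≤ ‖z - ζ‖ := by
          rw [mem_ball] at hz
          rw [← dist_eq_norm]
          linarith [dist_triangle ζ z z0, dist_comm z ζ]
        have h3 : z - ζ ≠ 0 := norm_pos_iff.1 (by linarith)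
        have h4 : ‖z - ζ‖ ≤ 2 := by linarith [norm_sub_le z ζ, hz' z hz]
        have h5 : ‖z - ζ‖⁻¹ ≤ 2 * ρ⁻¹ := by
          have := inv_anti₀ (by linarith : 0 < ρ / 2) h2
          rwa [inv_div, div_eq_mul_inv] at this
        have hd : HasDerivAt (fun z => z - ζ) 1 z := (hasDerivAt_id z).sub_const ζ
        refine ⟨?_, ?_, ?_, ?_, ?_⟩
        · have := abs_log_le_inv_add (norm_nonneg (z - ζ))
          nlinarith
        · rw [norm_inv]; nlinarith
        · rw [norm_div, norm_neg, norm_one, norm_pow, one_div, ← inv_pow]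
          have : ‖z - ζ‖⁻¹ ^ 2 ≤ (2 * ρ⁻¹) ^ 2 := by gcongr
          nlinarith
        · simpa using hasFDerivAt_log_norm hd h3
        · exact hd.inv h3) hz
  have A' := fun (z : ℂ) (hz : z ∈ ball z0 (ρ / 2)) =>
    hasFDerivAt_integral_reMul (μ := volume.restrict (ball (0 : ℂ) 1))
      (h := fun z ζ => Real.log ‖1 - z * conj ζ‖) (p := fun z ζ => (1 - z * conj ζ)⁻¹ * (-conj ζ))
      (p' := fun z ζ => -(-conj ζ) / (1 - z * conj ζ) ^ 2 * (-conj ζ)) (κ := κ)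
      (z0 := z0) (r := ρ / 2) (B := 4 * ρ⁻¹ ^ 2 + 2 * ρ⁻¹ + 2) hi
      (fun z => (Real.measurable_log.comp (Measurable.norm (measurable_const.sub
        (measurable_const.mul Complex.continuous_conj.measurable)))).aestronglyMeasurable)
      (fun z => (((measurable_const.sub (measurable_const.mul
        Complex.continuous_conj.measurable)).inv).mul
          Complex.continuous_conj.measurable.neg).aestronglyMeasurable)
      (fun z => (((Complex.continuous_conj.measurable.neg.neg).div ((measurable_const.sub
        (measurable_const.mul Complex.continuous_conj.measurable)).pow_const 2)).mul
          Complex.continuous_conj.measurable.neg).aestronglyMeasurable)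
      (by
        filter_upwards [hD] with ζ hζ h0 z hz
        have hcζ : ‖conj ζ‖ < 1 := by rwa [RCLike.norm_conj]
        have h1 : ‖z * conj ζ‖ ≤ 1 - ρ := by
          rw [norm_mul]
          nlinarith [hz' z hz, norm_nonneg z, norm_nonneg (conj ζ)]
        have h2 : ρ ≤ ‖1 - z * conj ζ‖ := by
          have := norm_sub_norm_le (1 : ℂ) (z * conj ζ)
          rw [norm_one] at this
          linarith
        have h3 : 1 - z * conj ζ ≠ 0 := norm_pos_iff.1 (by linarith)
        have h4 : ‖1 - z * conj ζ‖ ≤ 2 := by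
          have := norm_sub_le (1 : ℂ) (z * conj ζ)
          rw [norm_one] at this
          linarith
        have h5 : ‖1 - z * conj ζ‖⁻¹ ≤ ρ⁻¹ := inv_anti₀ hρ h2
        have h6 : 0 ≤ ‖1 - z * conj ζ‖⁻¹ := by positivity
        have h7 : ‖1 - z * conj ζ‖⁻¹ ^ 2 ≤ ρ⁻¹ ^ 2 := by gcongr
        have hd : HasDerivAt (fun z => 1 - z * conj ζ) (-conj ζ) z := by
          simpa using ((hasDerivAt_id z).mul_const (conj ζ)).const_sub 1
        refine ⟨?_, ?_, ?_, ?_, ?_⟩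
        · have := abs_log_le_inv_add (norm_nonneg (1 - z * conj ζ))
          nlinarith
        · rw [norm_mul, norm_inv, norm_neg]
          nlinarith [norm_nonneg (conj ζ)]
        · rw [norm_mul, norm_div, norm_neg, norm_neg, norm_pow, div_eq_mul_inv, ← inv_pow]
          have h8 : ‖conj ζ‖ * ‖1 - z * conj ζ‖⁻¹ ^ 2 * ‖conj ζ‖ ≤ 1 * ρ⁻¹ ^ 2 * 1 := by
            gcongr
          nlinarith
        · exact hasFDerivAt_log_norm hd h3
        · exact (hd.inv h3).mul_const _) hz
  refine ⟨κ₁, fun z => (∫ ζ in ball (0 : ℂ) 1, (z - ζ)⁻¹ * ((κ ζ - κ₁ ζ : ℝ) : ℂ)) -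
    ∫ ζ in ball (0 : ℂ) 1, (1 - z * conj ζ)⁻¹ * (-conj ζ) * κ ζ, ρ / 2, by positivity, hc₁, hs₁,
    ?_, fun hC => ?_, ?_⟩
  · rw [hκ₁]; simp [χ.one_of_mem_closedBall (mem_closedBall_self hρ.le)]
  · refine contDiff_of_tsupport fun x hx => ?_
    rw [hκ₁]
    exact χ.contDiff.contDiffAt.mul (hρC hC x (hsupp hx))
  intro z hz
  have hset : ∀ {E : Type} [NormedAddCommGroup E] [NormedSpace ℝ E] (F : ℂ → E),
      (∀ ζ, κ₁ ζ = 0 → F ζ = 0) → ∫ ζ in ball (0 : ℂ) 1, F ζ = ∫ ζ, F ζ := fun F hF =>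
    setIntegral_eq_integral_of_forall_compl_eq_zero fun ζ hζ => hF ζ
      (image_eq_zero_of_notMem_tsupport fun h => hζ (hsub (hsupp h)))
  have hlog : ∀ z ∈ ball z0 (ρ / 2), diskPot κ z = -(2 * π)⁻¹ * (logPot κ₁ z +
      (∫ ζ in ball (0 : ℂ) 1, Real.log ‖z - ζ‖ * (κ ζ - κ₁ ζ)) -
      ∫ ζ in ball (0 : ℂ) 1, Real.log ‖1 - z * conj ζ‖ * κ ζ) := fun z hz => by
    rw [logPot, ← hset _ (fun ζ h => by rw [h, zero_mul]),
      ← integral_add (integrable_mul_log hc₁ hs₁ z).integrableOn (A z hz).1, ← integral_sub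
      ((integrable_mul_log hc₁ hs₁ z).integrableOn.fun_add (A z hz).1) (A' z hz).1,
      ← integral_const_mul, diskPot]
    refine integral_congr_ae ?_
    filter_upwards [hD, ae_restrict_of_ae (ae_ne z)] with ζ hζ hne
    have hne' : ‖z - ζ‖ ≠ 0 := norm_ne_zero_iff.2 (sub_ne_zero.2 hne)
    have hne2 : ‖1 - z * conj ζ‖ ≠ 0 := norm_ne_zero_iff.2 (by
      rw [mul_comm]
      exact one_sub_conj_mul_ne_zero hζ (by linarith [hz' z hz]))
    rw [pd_eq, mul_comm (conj ζ), Real.log_div hne' hne2]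
    ring
  have hgr : IntegrableOn (fun ζ => gradK z ζ * κ ζ) (ball 0 1) ∧
      diskGrad κ z = -(2 * π)⁻¹ * (cauchyT κ₁ z +
        ((∫ ζ in ball (0 : ℂ) 1, (z - ζ)⁻¹ * ((κ ζ - κ₁ ζ : ℝ) : ℂ)) -
        ∫ ζ in ball (0 : ℂ) 1, (1 - z * conj ζ)⁻¹ * (-conj ζ) * κ ζ)) := by
    have e : (fun ζ => gradK z ζ * κ ζ) = fun ζ => -(2 * π : ℂ)⁻¹ * ((κ₁ ζ : ℂ) * (z - ζ)⁻¹ +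
        ((z - ζ)⁻¹ * ((κ ζ - κ₁ ζ : ℝ) : ℂ) - (1 - z * conj ζ)⁻¹ * (-conj ζ) * κ ζ)) := by
      ext ζ
      rw [gradK]
      push_cast
      ring
    have j1 := (integrable_mul_inv hc₁ hs₁ z).integrableOn (s := ball 0 1)
    have j2 : Integrable (fun ζ => (z - ζ)⁻¹ * ((κ ζ - κ₁ ζ : ℝ) : ℂ) -
        (1 - z * conj ζ)⁻¹ * (-conj ζ) * κ ζ) (volume.restrict (ball 0 1)) :=
      (A z hz).2.1.sub (A' z hz).2.1
    refine ⟨?_, ?_⟩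
    · rw [e]; exact (j1.add j2).const_mul _
    · rw [diskGrad, e, integral_const_mul, cauchyT,
        ← hset _ (fun ζ h => by rw [h, Complex.ofReal_zero, zero_mul]),
        ← integral_sub (A z hz).2.1 (A' z hz).2.1, ← integral_add j1 j2]
      push_cast
      rfl
  refine ⟨(A z hz).2.2.2.sub (A' z hz).2.2.2, hgr.1, ?_, hgr.2⟩
  have h5 := ((((hasFDerivAt_logPot hc₁ hs₁ z).add (A z hz).2.2.1).sub
    (A' z hz).2.2.1).const_mul (-(2 * π)⁻¹)).congr_of_eventuallyEq
      (f₁ := diskPot κ) (by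
        filter_upwards [isOpen_ball.mem_nhds hz] with w hw using hlog w hw)
  refine h5.congr_fderiv ?_
  rw [hgr.2]
  refine ContinuousLinearMap.ext fun w => ?_
  simp only [smul_apply, sub_apply, add_apply, reMul_apply, smul_eq_mul]
  have e : ∀ (r : ℝ) (X : ℂ), (-(r : ℂ) * X * w).re = -r * (X * w).re := fun r X => by
    rw [mul_assoc, ← Complex.ofReal_neg, Complex.re_ofReal_mul]
  rw [e, ← Complex.add_re, ← Complex.sub_re]
  congr 2
  ring

theorem dbar_congr {p q : ℂ → ℂ} {z : ℂ} (h : p =ᶠ[𝓝 z] q) : dbar p z = dbar q z := by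
  rw [dbar, dbar, h.fderiv_eq]

theorem dbar_add {p q : ℂ → ℂ} {z : ℂ} (hp : DifferentiableAt ℝ p z)
    (hq : DifferentiableAt ℝ q z) : dbar (fun z => p z + q z) z = dbar p z + dbar q z := by
  rw [dbar, dbar, dbar, fderiv_fun_add hp hq]
  simp only [add_apply]
  ring

theorem dbar_const_mul {q : ℂ → ℂ} {z : ℂ} (c : ℂ) (hq : DifferentiableAt ℝ q z) :
    dbar (fun z => c * q z) z = c * dbar q z := by
  rw [dbar, dbar, fderiv_const_mul hq]
  simp only [smul_apply, smul_eq_mul]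
  ring

theorem dbar_eq_zero {q : ℂ → ℂ} {z : ℂ} (hq : DifferentiableAt ℂ q z) : dbar q z = 0 := by
  rw [dbar, hq.fderiv_restrictScalars ℝ]
  simp only [ContinuousLinearMap.coe_restrictScalars']
  have : fderiv ℂ q z Complex.I = Complex.I * fderiv ℂ q z 1 := by
    simp
  rw [this, ← mul_assoc, Complex.I_mul_I]
  ring

section
variable {κ : ℂ → ℝ} {z : ℂ}

theorem hasFDerivAt_diskPot (hi : IntegrableOn κ (ball 0 1)) (hc : ContinuousOn κ (ball 0 1))
    (hz : z ∈ ball (0 : ℂ) 1) : HasFDerivAt (diskPot κ) (reMul (diskGrad κ z)) z := by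
  obtain ⟨κ₁, P, δ, hδ, -, -, -, -, h⟩ := exists_disk_decomp hi hc hz
  exact (h z (mem_ball_self hδ)).2.2.1

theorem integrableOn_gradK_mul (hi : IntegrableOn κ (ball 0 1)) (hc : ContinuousOn κ (ball 0 1))
    (hz : z ∈ ball (0 : ℂ) 1) : IntegrableOn (fun ζ => gradK z ζ * κ ζ) (ball 0 1) := by
  obtain ⟨κ₁, P, δ, hδ, -, -, -, -, h⟩ := exists_disk_decomp hi hc hz
  exact (h z (mem_ball_self hδ)).2.1

theorem continuousAt_diskGrad (hi : IntegrableOn κ (ball 0 1)) (hc : ContinuousOn κ (ball 0 1))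
    (hz : z ∈ ball (0 : ℂ) 1) : ContinuousAt (diskGrad κ) z := by
  obtain ⟨κ₁, P, δ, hδ, h1, h2, -, -, h⟩ := exists_disk_decomp hi hc hz
  have : ContinuousAt (fun z => -(2 * π : ℝ)⁻¹ * (cauchyT κ₁ z + P z)) z :=
    continuousAt_const.mul ((continuous_cauchyT h1 h2).continuousAt.add
      (h z (mem_ball_self hδ)).1.continuousAt)
  refine this.congr ?_
  filter_upwards [ball_mem_nhds z hδ] with w hw
  rw [(h w hw).2.2.2]

theorem contDiffAt_diskGrad (hi : IntegrableOn κ (ball 0 1)) (hc : ContinuousOn κ (ball 0 1))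
    (hz : z ∈ ball (0 : ℂ) 1) (hκ : ContDiffAt ℝ 1 κ z) :
    ContDiffAt ℝ 1 (diskGrad κ) z ∧ (dbar (diskGrad κ) z).re = -κ z := by
  obtain ⟨κ₁, P, δ, hδ, h1, h2, h3, h4, h⟩ := exists_disk_decomp hi hc hz
  have hC := contDiff_cauchyT (h4 hκ) h2
  have e : diskGrad κ =ᶠ[𝓝 z] fun z => ((-(2 * π)⁻¹ : ℝ) : ℂ) * (cauchyT κ₁ z + P z) := by
    filter_upwards [ball_mem_nhds z hδ] with w hw
    rw [(h w hw).2.2.2]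
    push_cast
    rfl
  have hP : ContDiffAt ℝ 1 P z := by
    have : DifferentiableOn ℂ P (ball z δ) := fun w hw => (h w hw).1.differentiableWithinAt
    exact ((this.analyticAt (ball_mem_nhds z hδ)).contDiffAt).restrict_scalars ℝ
  refine ⟨(contDiffAt_const.mul (hC.contDiffAt.add hP)).congr_of_eventuallyEq e, ?_⟩
  have d1 : DifferentiableAt ℝ (cauchyT κ₁) z := hC.contDiffAt.differentiableAt one_ne_zero
  have d2 : DifferentiableAt ℝ P z := hP.differentiableAt one_ne_zero
  rw [dbar_congr e, dbar_const_mul _ (d1.fun_add d2), dbar_add d1 d2,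
    dbar_eq_zero (h z (mem_ball_self hδ)).1, add_zero, Complex.re_ofReal_mul,
    re_dbar_cauchyT (h4 hκ) h2, h3]
  field_simp

end

/-! ### Regularity of Green potentials on simply connected domains -/

theorem abs_det_mul (a : ℂ) : |(ContinuousLinearMap.mul ℝ ℂ a).det| = ‖a‖ ^ 2 := by
  have : (ContinuousLinearMap.mul ℝ ℂ a).det = Algebra.norm ℝ a := rfl
  rw [this, Algebra.norm_complex_apply, Complex.normSq_eq_norm_sq]
  exact abs_of_nonneg (by positivity)

theorem hasFDerivAt_real_of_hasDerivAt {F : ℂ → ℂ} {F' z : ℂ} (hF : HasDerivAt F F' z) :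
    HasFDerivAt F (ContinuousLinearMap.mul ℝ ℂ F') z := by
  refine (hF.hasFDerivAt.restrictScalars ℝ).congr_fderiv ?_
  ext; simp [mul_comm]

/-- The density on the disc of the pull-back of a density on `Ω`. -/
def pullDensity (f : ℂ → ℂ) (g : ℂ → ℝ) (ζ : ℂ) : ℝ := ‖deriv f ζ‖ ^ 2 * g (f ζ)

section
variable {Ω : Set ℂ} {φ f : ℂ → ℂ}

theorem RiemannPair.image_eq (hR : RiemannPair Ω φ f) : f '' ball 0 1 = Ω := by
  ext x
  refine ⟨fun ⟨z, hz, hzx⟩ => hzx ▸ hR.mapsTo_inv hz, fun hx => ⟨φ x, hR.mapsTo hx, hR.left_inv x hx⟩⟩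

theorem RiemannPair.hasDerivAt_inv (hR : RiemannPair Ω φ f) {z : ℂ} (hz : z ∈ ball (0 : ℂ) 1) :
    HasDerivAt f (deriv f z) z :=
  (hR.diff_inv.differentiableAt (isOpen_ball.mem_nhds hz)).hasDerivAt

theorem RiemannPair.hasDerivAt (hR : RiemannPair Ω φ f) {x : ℂ} (hx : x ∈ Ω) :
    HasDerivAt φ (deriv φ x) x :=
  (hR.diff.differentiableAt (hR.isOpen.mem_nhds hx)).hasDerivAt

theorem RiemannPair.deriv_mul_deriv (hR : RiemannPair Ω φ f) {x : ℂ} (hx : x ∈ Ω) :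
    deriv f (φ x) * deriv φ x = 1 := by
  have h1 := (hR.hasDerivAt_inv (hR.mapsTo hx)).comp x (hR.hasDerivAt hx)
  refine h1.unique ((hasDerivAt_id x).congr_of_eventuallyEq ?_)
  filter_upwards [hR.isOpen.mem_nhds hx] with y hy using hR.left_inv y hy

theorem RiemannPair.injOn_inv (hR : RiemannPair Ω φ f) : InjOn f (ball 0 1) := fun a ha b hb h => by
  rw [← hR.right_inv a ha, h, hR.right_inv b hb]

theorem RiemannPair.integral_eq (hR : RiemannPair Ω φ f) (F : ℂ → ℝ) :
    ∫ y in Ω, F y = ∫ ζ in ball (0 : ℂ) 1, ‖deriv f ζ‖ ^ 2 * F (f ζ) := by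
  have := integral_image_eq_integral_abs_det_fderiv_smul volume
    (measurableSet_ball (x := (0 : ℂ)) (ε := 1)) (f := f)
    (f' := fun z => ContinuousLinearMap.mul ℝ ℂ (deriv f z))
    (fun z hz => (hasFDerivAt_real_of_hasDerivAt (hR.hasDerivAt_inv hz)).hasFDerivWithinAt)
    hR.injOn_inv F
  rw [hR.image_eq] at this
  simpa only [abs_det_mul, smul_eq_mul] using this

theorem RiemannPair.integrableOn_pull (hR : RiemannPair Ω φ f) {F : ℂ → ℝ}
    (hF : IntegrableOn F Ω) : IntegrableOn (pullDensity f F) (ball 0 1) := by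
  have := (integrableOn_image_iff_integrableOn_abs_det_fderiv_smul volume
    (measurableSet_ball (x := (0 : ℂ)) (ε := 1)) (f := f)
    (f' := fun z => ContinuousLinearMap.mul ℝ ℂ (deriv f z))
    (fun z hz => (hasFDerivAt_real_of_hasDerivAt (hR.hasDerivAt_inv hz)).hasFDerivWithinAt)
    hR.injOn_inv F).1 (by rwa [hR.image_eq])
  simp only [abs_det_mul, smul_eq_mul] at this
  exact this

theorem RiemannPair.continuousOn_deriv_inv (hR : RiemannPair Ω φ f) :
    ContinuousOn (deriv f) (ball 0 1) := (hR.diff_inv.deriv isOpen_ball).continuousOn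

theorem RiemannPair.continuousOn_pull (hR : RiemannPair Ω φ f) {g : ℂ → ℝ} (hg : Continuous g) :
    ContinuousOn (pullDensity f g) (ball 0 1) :=
  (hR.continuousOn_deriv_inv.norm.pow 2).mul (hg.comp_continuousOn hR.diff_inv.continuousOn)

theorem RiemannPair.contDiffAt_pull (hR : RiemannPair Ω φ f) {g : ℂ → ℝ} {z : ℂ}
    (hz : z ∈ ball (0 : ℂ) 1) (hg : ContDiffAt ℝ 1 g (f z)) :
    ContDiffAt ℝ 1 (pullDensity f g) z := by
  have hd : ContDiffAt ℝ 1 (deriv f) z := ((hR.diff_inv.deriv isOpen_ball).analyticAt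
    (isOpen_ball.mem_nhds hz)).contDiffAt.restrict_scalars ℝ
  have hf : ContDiffAt ℝ 1 f z := (hR.diff_inv.analyticAt
    (isOpen_ball.mem_nhds hz)).contDiffAt.restrict_scalars ℝ
  exact (hd.norm_sq ℝ).mul (hg.comp z hf)

theorem greenOp_eq_diskPot (hR : RiemannPair Ω φ f) (hb : Bornology.IsBounded Ω) (g : BC) {x : ℂ}
    (hx : x ∈ Ω) : greenOp hR hb g x = diskPot (pullDensity f g) (φ x) := by
  rw [greenOp_apply, hR.integral_eq, diskPot]
  refine setIntegral_congr_fun measurableSet_ball fun ζ hζ => ?_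
  simp only [pullDensity]
  rw [green_of_mem hx (hR.mapsTo_inv hζ), hR.right_inv ζ hζ]
  ring

/-- The complex gradient of a Green potential. -/
def greenGrad (φ f : ℂ → ℂ) (g : ℂ → ℝ) (x : ℂ) : ℂ :=
  deriv φ x * diskGrad (pullDensity f g) (φ x)

theorem hasFDerivAt_greenOp (hR : RiemannPair Ω φ f) (hb : Bornology.IsBounded Ω) (g : BC) {x : ℂ}
    (hx : x ∈ Ω) : HasFDerivAt (greenOp hR hb g) (reMul (greenGrad φ f g x)) x := by
  have hi := hR.integrableOn_pull (integrableOn_of_continuous hb g.continuous)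
  have h1 := (hasFDerivAt_diskPot hi (hR.continuousOn_pull g.continuous) (hR.mapsTo hx)).comp x
    (hasFDerivAt_real_of_hasDerivAt (hR.hasDerivAt hx))
  refine (h1.congr_of_eventuallyEq ?_).congr_fderiv ?_
  · filter_upwards [hR.isOpen.mem_nhds hx] with y hy using greenOp_eq_diskPot hR hb g hy
  · refine ContinuousLinearMap.ext fun h => ?_
    simp only [ContinuousLinearMap.comp_apply, reMul_apply, ContinuousLinearMap.mul_apply', greenGrad]
    congr 1
    ring

theorem continuousOn_greenGrad (hR : RiemannPair Ω φ f) (hb : Bornology.IsBounded Ω) (g : BC) :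
    ContinuousOn (greenGrad φ f g) Ω := by
  have hi := hR.integrableOn_pull (integrableOn_of_continuous hb g.continuous)
  have h : ContinuousOn (diskGrad (pullDensity f g)) (ball 0 1) := fun z hz =>
    (continuousAt_diskGrad hi (hR.continuousOn_pull g.continuous) hz).continuousWithinAt
  exact (hR.diff.deriv hR.isOpen).continuousOn.mul (h.comp hR.diff.continuousOn hR.mapsTo)

theorem greenGrad_regular (hR : RiemannPair Ω φ f) (hb : Bornology.IsBounded Ω) (g : BC) {x : ℂ}
    (hx : x ∈ Ω) (hg : ContDiffAt ℝ 1 g x) :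
    ContDiffAt ℝ 1 (greenGrad φ f g) x ∧ (dbar (greenGrad φ f g) x).re = -g x := by
  have hi := hR.integrableOn_pull (integrableOn_of_continuous hb g.continuous)
  have hx' := hR.left_inv x hx
  obtain ⟨h1, h2⟩ := contDiffAt_diskGrad hi (hR.continuousOn_pull g.continuous) (hR.mapsTo hx)
    (hR.contDiffAt_pull (hR.mapsTo hx) (by rwa [hx']))
  have hd : ContDiffAt ℝ 1 (deriv φ) x := ((hR.diff.deriv hR.isOpen).analyticAt
    (hR.isOpen.mem_nhds hx)).contDiffAt.restrict_scalars ℝ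
  have hφ : ContDiffAt ℝ 1 φ x := (hR.diff.analyticAt
    (hR.isOpen.mem_nhds hx)).contDiffAt.restrict_scalars ℝ
  refine ⟨hd.mul (h1.comp x hφ), ?_⟩
  have e1 := hasFDerivAt_real_of_hasDerivAt (((hR.diff.deriv hR.isOpen).differentiableAt
    (hR.isOpen.mem_nhds hx)).hasDerivAt)
  have e2 := (h1.differentiableAt one_ne_zero).hasFDerivAt.comp x
    (hasFDerivAt_real_of_hasDerivAt (hR.hasDerivAt hx))
  have e3 := (e1.mul e2).fderiv
  set L := fderiv ℝ (diskGrad (pullDensity f g)) (φ x) with hL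
  have hlin : ∀ a : ℂ, L a + Complex.I * L (a * Complex.I) =
      conj a * (L 1 + Complex.I * L Complex.I) := fun a => by
    have : ∀ w, L w = w.re * L 1 + w.im * L Complex.I := fun w => by
      have : w = w.re • (1 : ℂ) + w.im • Complex.I := by simp [Complex.re_add_im]
      conv_lhs => rw [this]
      rw [map_add, map_smul, map_smul, Complex.real_smul, Complex.real_smul]
    rw [this a, this (a * Complex.I)]
    have ha : conj a = a.re - a.im * Complex.I := by
      apply Complex.ext <;> simp
    rw [ha]
    simp only [Complex.mul_re, Complex.mul_im, Complex.I_re, Complex.I_im]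
    push_cast
    linear_combination (a.im * L Complex.I : ℂ) * Complex.I_sq
  have key : dbar (greenGrad φ f g) x =
      ((‖deriv φ x‖ ^ 2 : ℝ) : ℂ) * dbar (diskGrad (pullDensity f g)) (φ x) := by
    rw [dbar, dbar, ← hL]
    change fderiv ℝ (deriv φ * diskGrad (pullDensity f g) ∘ φ) x 1 + Complex.I *
      fderiv ℝ (deriv φ * diskGrad (pullDensity f g) ∘ φ) x Complex.I = _
    rw [e3]
    simp only [add_apply, smul_apply, ContinuousLinearMap.comp_apply,
      ContinuousLinearMap.mul_apply', smul_eq_mul, mul_one]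
    have h3 := hlin (deriv φ x)
    have h4 : ((‖deriv φ x‖ ^ 2 : ℝ) : ℂ) = deriv φ x * conj (deriv φ x) := by
      rw [Complex.mul_conj, Complex.normSq_eq_norm_sq]
    rw [h4]
    linear_combination (deriv φ x) * h3 +
      ((diskGrad (pullDensity f g) ∘ φ) x) * (deriv (deriv φ) x) * Complex.I_sq
  rw [key, Complex.re_ofReal_mul, h2, pullDensity, hx']
  have h5 : ‖deriv f (φ x)‖ * ‖deriv φ x‖ = 1 := by
    rw [← norm_mul, hR.deriv_mul_deriv hx, norm_one]
  have h6 : ‖deriv φ x‖ ^ 2 * ‖deriv f (φ x)‖ ^ 2 = 1 := by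
    rw [← mul_pow, mul_comm, h5, one_pow]
  linear_combination (-(g x)) * h6

end

end

section

/-- Derivative of the truncation `cut`. -/
def cutDeriv (ε s : ℝ) : ℝ := 1 - ε ^ 2 / max (s ^ 2) (ε ^ 2)

/-- A `C¹` truncation of the identity of `ℝ` vanishing on `[-ε, ε]`. -/
def cut (ε s : ℝ) : ℝ := ∫ r in (0 : ℝ)..s, cutDeriv ε r

section
variable {ε : ℝ}

theorem max_sq_pos (hε : 0 < ε) (s : ℝ) : 0 < max (s ^ 2) (ε ^ 2) :=
  lt_max_of_lt_right (by positivity)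

theorem continuous_cutDeriv (hε : 0 < ε) : Continuous (cutDeriv ε) := by
  unfold cutDeriv
  exact continuous_const.sub (continuous_const.div (by fun_prop) fun s => (max_sq_pos hε s).ne')

theorem cutDeriv_nonneg (hε : 0 < ε) (s : ℝ) : 0 ≤ cutDeriv ε s := by
  rw [cutDeriv, sub_nonneg, div_le_one (max_sq_pos hε s)]
  exact le_max_right _ _

theorem cutDeriv_le_one (hε : 0 < ε) (s : ℝ) : cutDeriv ε s ≤ 1 := by
  have := max_sq_pos hε s
  rw [cutDeriv, sub_le_self_iff]
  positivity

theorem cutDeriv_eq_zero (hε : 0 < ε) {s : ℝ} (hs : |s| ≤ ε) : cutDeriv ε s = 0 := by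
  have : s ^ 2 ≤ ε ^ 2 := sq_le_sq' (abs_le.1 hs).1 (abs_le.1 hs).2
  rw [cutDeriv, max_eq_right this, div_self (by positivity), sub_self]

theorem tendsto_cutDeriv {e : ℕ → ℝ} (h : Tendsto e atTop (𝓝 0)) {s : ℝ} (hs : s ≠ 0) :
    Tendsto (fun n => cutDeriv (e n) s) atTop (𝓝 1) := by
  have h2 : 0 < s ^ 2 := by positivity
  have : Tendsto (fun n => 1 - e n ^ 2 / max (s ^ 2) (e n ^ 2)) atTop
      (𝓝 (1 - 0 ^ 2 / max (s ^ 2) (0 ^ 2))) :=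
    tendsto_const_nhds.sub ((h.pow 2).div (tendsto_const_nhds.max (h.pow 2)) (by simp [hs]))
  simpa [cutDeriv] using this

theorem hasDerivAt_cut (hε : 0 < ε) (s : ℝ) : HasDerivAt (cut ε) (cutDeriv ε s) s :=
  ((continuous_cutDeriv hε).integral_hasStrictDerivAt 0 s).hasDerivAt

theorem contDiff_cut (hε : 0 < ε) : ContDiff ℝ 1 (cut ε) :=
  contDiff_one_iff_deriv.2 ⟨fun s => (hasDerivAt_cut hε s).differentiableAt, by
    rw [show deriv (cut ε) = cutDeriv ε from funext fun s => (hasDerivAt_cut hε s).deriv]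
    exact continuous_cutDeriv hε⟩

theorem cut_eq_zero (hε : 0 < ε) {s : ℝ} (hs : |s| ≤ ε) : cut ε s = 0 := by
  rw [cut, intervalIntegral.integral_congr (g := fun _ => 0), intervalIntegral.integral_zero]
  intro r hr
  refine cutDeriv_eq_zero hε ?_
  have := abs_sub_left_of_mem_uIcc hr
  simp only [sub_zero] at this
  exact this.trans hs

theorem abs_cut_le (hε : 0 < ε) (s : ℝ) : |cut ε s| ≤ |s| := by
  have := intervalIntegral.norm_integral_le_of_norm_le_const (a := 0) (b := s) (f := cutDeriv ε)
    (C := 1) fun r _ => by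
      rw [Real.norm_eq_abs, abs_of_nonneg (cutDeriv_nonneg hε r)]
      exact cutDeriv_le_one hε r
  simpa [cut] using this

theorem tendsto_cut {e : ℕ → ℝ} (he : ∀ n, 0 < e n) (h : Tendsto e atTop (𝓝 0)) (s : ℝ) :
    Tendsto (fun n => cut (e n) s) atTop (𝓝 s) := by
  have h1 : s = ∫ _ in (0 : ℝ)..s, (1 : ℝ) := by simp
  conv => enter [3]; rw [h1]
  refine intervalIntegral.tendsto_integral_filter_of_dominated_convergence (fun _ => 1)
    (.of_forall fun n => (continuous_cutDeriv (he n)).aestronglyMeasurable)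
    (.of_forall fun n => ae_of_all _ fun r _ => ?_) (by simp) ?_
  · rw [Real.norm_eq_abs, abs_of_nonneg (cutDeriv_nonneg (he n) r)]
    exact cutDeriv_le_one (he n) r
  · have : ∀ᵐ r : ℝ, r ≠ 0 := by simp [ae_iff]
    filter_upwards [this] with r hr _
    exact tendsto_cutDeriv h hr

end

theorem integral_fderiv_apply_eq_zero {V : ℂ → ℂ} (hV : ContDiff ℝ 1 V)
    (hc : HasCompactSupport V) (v : ℂ) :
    Integrable (fun z => fderiv ℝ V z v) ∧ ∫ z, fderiv ℝ V z v = 0 := by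
  have hi : Integrable (fun z => fderiv ℝ V z v) :=
    ((hV.continuous_fderiv one_ne_zero).clm_apply continuous_const).integrable_of_hasCompactSupport
      (hc.fderiv_apply ℝ v)
  refine ⟨hi, ?_⟩
  have := integral_mul_fderiv_eq_neg_fderiv_mul_of_integrable (μ := volume) (𝕜 := ℂ)
    (f := fun _ : ℂ => (1 : ℂ)) (g := V) (v := v) (by simp) (by simpa using hi)
    (by simpa using hV.continuous.integrable_of_hasCompactSupport hc) (by simp)
    (fun x _ => (hV.differentiable one_ne_zero).differentiableAt)
  simpa using this

theorem integral_re_dbar_eq_zero {V : ℂ → ℂ} (hV : ContDiff ℝ 1 V) (hc : HasCompactSupport V) :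
    ∫ z, (dbar V z).re = 0 := by
  obtain ⟨i1, h1⟩ := integral_fderiv_apply_eq_zero hV hc 1
  obtain ⟨i2, h2⟩ := integral_fderiv_apply_eq_zero hV hc Complex.I
  have : ∫ z, dbar V z = 0 := by
    unfold dbar
    rw [integral_add i1 (i2.const_mul _), integral_const_mul, h1, h2, mul_zero, add_zero]
  have h3 := integral_re (𝕜 := ℂ) (f := dbar V) (μ := volume) (i1.add (i2.const_mul _))
  simpa [this] using h3

section
variable {Ω : Set ℂ} {u : ℂ → ℝ} {Q : ℂ → ℂ} {g : BC}

theorem energy_cutoff (hb : Bornology.IsBounded Ω) (hu : Continuous u)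
    (hu0 : ∀ x ∉ Ω, u x = 0) (hD : ∀ x ∈ Ω, HasFDerivAt u (reMul (Q x)) x)
    (hQ : ∀ x ∈ Ω, ContDiffAt ℝ 1 Q x) (hQg : ∀ x ∈ Ω, (dbar Q x).re = -g x)
    (hΩ : IsOpen Ω) {ε : ℝ} (hε : 0 < ε) :
    IntegrableOn (fun x => cutDeriv ε (u x) * ‖Q x‖ ^ 2) Ω ∧
      ∫ x in Ω, cutDeriv ε (u x) * ‖Q x‖ ^ 2 = ∫ x in Ω, cut ε (u x) * g x := by
  set V : ℂ → ℂ := fun x => (cut ε (u x) : ℂ) * Q x with hVdef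
  have hK : IsClosed {x | ε ≤ |u x|} := isClosed_le continuous_const hu.abs
  have hKΩ : {x | ε ≤ |u x|} ⊆ Ω := fun x hx => by
    by_contra h
    simp only [mem_ofPred_eq, hu0 x h, abs_zero] at hx
    linarith
  have hKc : IsCompact {x | ε ≤ |u x|} := isCompact_of_isClosed_isBounded hK (hb.subset hKΩ)
  have hV0 : ∀ x ∉ {x | ε ≤ |u x|}, V x = 0 := fun x hx => by
    simp only [mem_ofPred_eq, not_le] at hx
    simp [hVdef, cut_eq_zero hε hx.le]
  have huC : ∀ x ∈ Ω, ContDiffAt ℝ 1 u x := fun x hx => by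
    refine contDiffAt_one_iff.2 ⟨fun y => reMul (Q y), Ω, hΩ.mem_nhds hx, ?_, fun y hy => hD y hy⟩
    have : ContinuousOn Q Ω := fun y hy => (hQ y hy).continuousAt.continuousWithinAt
    exact reMulL.continuous.comp_continuousOn this
  have hVΩ : ∀ x ∈ Ω, ContDiffAt ℝ 1 V x := fun x hx =>
    (Complex.ofRealCLM.contDiff.contDiffAt.comp x
      ((contDiff_cut hε).contDiffAt.comp x (huC x hx))).mul (hQ x hx)
  have hV : ContDiff ℝ 1 V := contDiff_iff_contDiffAt.2 fun x => by
    by_cases hx : x ∈ {x | ε ≤ |u x|}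
    · exact hVΩ x (hKΩ hx)
    · exact contDiffAt_const (c := (0 : ℂ)) |>.congr_of_eventuallyEq
        (eventually_of_mem (hK.isOpen_compl.mem_nhds hx) fun y hy => hV0 y hy)
  have hVc : HasCompactSupport V := HasCompactSupport.intro hKc hV0
  have hI := integral_re_dbar_eq_zero hV hVc
  have hdb : ∀ x ∈ Ω, (dbar V x).re = cutDeriv ε (u x) * ‖Q x‖ ^ 2 - cut ε (u x) * g x := by
    intro x hx
    have h1 : HasFDerivAt (fun x => (cut ε (u x) : ℂ))
        (Complex.ofRealCLM.comp (cutDeriv ε (u x) • reMul (Q x))) x :=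
      Complex.ofRealCLM.hasFDerivAt.comp x ((hasDerivAt_cut hε (u x)).comp_hasFDerivAt x (hD x hx))
    have h2 := (h1.mul ((hQ x hx).differentiableAt one_ne_zero).hasFDerivAt).fderiv
    have h3 : dbar V x = (cut ε (u x) : ℂ) * dbar Q x + (cutDeriv ε (u x) * ‖Q x‖ ^ 2 : ℝ) := by
      have h4 : ((‖Q x‖ ^ 2 : ℝ) : ℂ) = ((Q x).re - (Q x).im * Complex.I) * Q x := by
        rw [← Complex.normSq_eq_norm_sq]
        apply Complex.ext <;> simp [Complex.normSq_apply]
        ring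
      rw [Complex.ofReal_mul, h4, dbar, dbar]
      change fderiv ℝ ((fun x => (cut ε (u x) : ℂ)) * Q) x 1 + Complex.I *
        fderiv ℝ ((fun x => (cut ε (u x) : ℂ)) * Q) x Complex.I = _
      rw [h2]
      simp only [add_apply, smul_apply, ContinuousLinearMap.comp_apply, reMul_apply,
        Complex.ofRealCLM_apply, smul_eq_mul, mul_one, Complex.mul_re, Complex.I_re, Complex.I_im,
        mul_zero, zero_sub]
      push_cast
      ring
    rw [h3, Complex.add_re, Complex.re_ofReal_mul, hQg x hx, Complex.ofReal_re]
    ring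
  have hdb0 : ∀ x ∉ Ω, (dbar V x).re = 0 := fun x hx => by
    have : V =ᶠ[𝓝 x] fun _ => 0 :=
      eventually_of_mem (hK.isOpen_compl.mem_nhds fun h => hx (hKΩ h)) fun y hy => hV0 y hy
    simp [dbar, this.fderiv_eq]
  have hcontV : Continuous (fun x => (dbar V x).re) := by
    have := hV.continuous_fderiv one_ne_zero
    unfold dbar
    fun_prop
  have hI1 : IntegrableOn (fun x => (dbar V x).re) Ω := integrableOn_of_continuous hb hcontV
  have hI2 : IntegrableOn (fun x => cut ε (u x) * g x) Ω := integrableOn_of_continuous hb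
    (((contDiff_cut hε).continuous.comp hu).mul g.continuous)
  have hI3 : IntegrableOn (fun x => cutDeriv ε (u x) * ‖Q x‖ ^ 2) Ω :=
    (hI1.add hI2).congr_fun (fun x hx => by simp [hdb x hx]) hΩ.measurableSet
  refine ⟨hI3, ?_⟩
  rw [← setIntegral_eq_integral_of_forall_compl_eq_zero (s := Ω) hdb0,
    setIntegral_congr_fun hΩ.measurableSet hdb, integral_sub hI3 hI2] at hI
  linarith

theorem tendsto_integral_cut (hb : Bornology.IsBounded Ω) (hu : Continuous u)
    {e : ℕ → ℝ} (he : ∀ n, 0 < e n) (h : Tendsto e atTop (𝓝 0)) :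
    Tendsto (fun n => ∫ x in Ω, cut (e n) (u x) * g x) atTop (𝓝 (∫ x in Ω, u x * g x)) := by
  refine tendsto_integral_of_dominated_convergence (fun x => |u x * g x|)
    (fun n => ((((contDiff_cut (he n)).continuous.comp hu).mul
      g.continuous)).aestronglyMeasurable)
    (integrableOn_of_continuous hb (hu.mul g.continuous).abs)
    (fun n => ae_of_all _ fun x => ?_) (ae_of_all _ fun x => ?_)
  · rw [Real.norm_eq_abs, abs_mul, abs_mul]
    exact mul_le_mul_of_nonneg_right (abs_cut_le (he n) _) (abs_nonneg _)
  · exact (tendsto_cut he h (u x)).mul_const _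

theorem energy_nonneg (hb : Bornology.IsBounded Ω) (hu : Continuous u)
    (hu0 : ∀ x ∉ Ω, u x = 0) (hD : ∀ x ∈ Ω, HasFDerivAt u (reMul (Q x)) x)
    (hQ : ∀ x ∈ Ω, ContDiffAt ℝ 1 Q x) (hQg : ∀ x ∈ Ω, (dbar Q x).re = -g x)
    (hΩ : IsOpen Ω) : 0 ≤ ∫ x in Ω, u x * g x := by
  have he : ∀ n : ℕ, (0 : ℝ) < 1 / ((n : ℝ) + 1) := fun n => by positivity
  refine ge_of_tendsto' (tendsto_integral_cut hb hu he
    tendsto_one_div_add_atTop_nhds_zero_nat) fun n => ?_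
  rw [← (energy_cutoff hb hu hu0 hD hQ hQg hΩ (he n)).2]
  exact integral_nonneg fun x => mul_nonneg (cutDeriv_nonneg (he n) _) (by positivity)

theorem energy_eq (hb : Bornology.IsBounded Ω) (hu : Continuous u)
    (hu0 : ∀ x ∉ Ω, u x = 0) (hpos : ∀ x ∈ Ω, 0 < u x)
    (hD : ∀ x ∈ Ω, HasFDerivAt u (reMul (Q x)) x)
    (hQ : ∀ x ∈ Ω, ContDiffAt ℝ 1 Q x) (hQg : ∀ x ∈ Ω, (dbar Q x).re = -g x)
    (hΩ : IsOpen Ω) :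
    IntegrableOn (fun x => ‖Q x‖ ^ 2) Ω ∧ ∫ x in Ω, ‖Q x‖ ^ 2 = ∫ x in Ω, u x * g x := by
  have he : ∀ n : ℕ, (0 : ℝ) < 1 / ((n : ℝ) + 1) := fun n => by positivity
  have he0 : Tendsto (fun n : ℕ => (1 : ℝ) / ((n : ℝ) + 1)) atTop (𝓝 0) :=
    tendsto_one_div_add_atTop_nhds_zero_nat
  have hlim := tendsto_integral_cut (g := g) hb hu he he0
  have hE := fun n => energy_cutoff hb hu hu0 hD hQ hQg hΩ (he n)
  have hcQ : ContinuousOn Q Ω := fun y hy => (hQ y hy).continuousAt.continuousWithinAt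
  have hm : AEStronglyMeasurable (fun x => ‖Q x‖ ^ 2) (volume.restrict Ω) :=
    (hcQ.norm.pow 2).aestronglyMeasurable hΩ.measurableSet
  have hpt : ∀ᵐ x ∂(volume.restrict Ω),
      Tendsto (fun n : ℕ => cutDeriv (1 / ((n : ℝ) + 1)) (u x) * ‖Q x‖ ^ 2) atTop
        (𝓝 (‖Q x‖ ^ 2)) := by
    filter_upwards [ae_restrict_mem hΩ.measurableSet] with x hx
    simpa using (tendsto_cutDeriv he0 (hpos x hx).ne').mul_const (‖Q x‖ ^ 2)
  have hInt : IntegrableOn (fun x => ‖Q x‖ ^ 2) Ω := by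
    refine ⟨hm, ?_⟩
    have h0 : ∫⁻ x in Ω, ‖‖Q x‖ ^ 2‖ₑ = ∫⁻ x in Ω,
        liminf (fun n : ℕ => ‖cutDeriv (1 / ((n : ℝ) + 1)) (u x) * ‖Q x‖ ^ 2‖ₑ) atTop :=
      lintegral_congr_ae (hpt.mono fun x hx => hx.enorm.liminf_eq.symm)
    rw [hasFiniteIntegral_def, h0]
    refine (lintegral_liminf_le'
      fun n => (hE n).1.aestronglyMeasurable.aemeasurable.enorm).trans_lt ?_
    have h1 : ∀ n : ℕ, ∫⁻ x in Ω, ‖cutDeriv (1 / ((n : ℝ) + 1)) (u x) * ‖Q x‖ ^ 2‖ₑ =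
        ENNReal.ofReal (∫ x in Ω, cut (1 / ((n : ℝ) + 1)) (u x) * g x) := fun n => by
      rw [← (hE n).2, ofReal_integral_eq_lintegral_ofReal (hE n).1 (ae_of_all _ fun x =>
        mul_nonneg (cutDeriv_nonneg (he n) _) (by positivity))]
      refine lintegral_congr fun x => Real.enorm_of_nonneg
        (mul_nonneg (cutDeriv_nonneg (he n) _) (by positivity))
    simp_rw [h1]
    exact ((ENNReal.continuous_ofReal.tendsto _).comp hlim).liminf_eq.trans_lt
      ENNReal.ofReal_lt_top
  refine ⟨hInt, tendsto_nhds_unique ?_ hlim⟩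
  simp_rw [← fun n => (hE n).2]
  refine tendsto_integral_of_dominated_convergence (fun x => ‖Q x‖ ^ 2)
    (fun n => (hE n).1.aestronglyMeasurable) hInt (fun n => ae_of_all _ fun x => ?_) hpt
  rw [Real.norm_eq_abs, abs_of_nonneg (mul_nonneg (cutDeriv_nonneg (he n) _) (by positivity))]
  exact mul_le_of_le_one_left (by positivity) (cutDeriv_le_one (he n) _)

end

/-- Integration over a bounded set as a continuous linear functional. -/
def intCLM {Ω : Set ℂ} (hb : Bornology.IsBounded Ω) : BC →L[ℝ] ℝ :=
  LinearMap.mkContinuous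
    { toFun := fun g => ∫ x in Ω, g x
      map_add' := fun g h => integral_add (integrableOn_of_continuous hb g.continuous)
        (integrableOn_of_continuous hb h.continuous)
      map_smul' := fun c g => integral_const_mul c _ }
    (volume.real Ω) fun g => by
      have := norm_setIntegral_le_of_norm_le_const (μ := volume) (s := Ω) (f := g) (C := ‖g‖)
        (hb.measure_lt_top) fun x _ => g.norm_coe_le_norm x
      simpa [mul_comm] using this

theorem intCLM_apply {Ω : Set ℂ} (hb : Bornology.IsBounded Ω) (g : BC) :
    intCLM hb g = ∫ x in Ω, g x := rfl

section
variable {Ω : Set ℂ} {φ f : ℂ → ℂ}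

theorem exists_contDiff_tendsto (g : BC) :
    ∃ G : ℕ → BC, (∀ n, ContDiff ℝ 1 (G n)) ∧ Tendsto G atTop (𝓝 g) := by
  have h : ∀ n : ℕ, ∃ k : BC, ContDiff ℝ 1 k ∧ dist k g ≤ 1 / ((n : ℝ) + 1) := fun n => by
    have he : (0 : ℝ) < 1 / ((n : ℝ) + 1) := by positivity
    obtain ⟨k, hk, hd, -⟩ := g.continuous.exists_contDiff_approx 1
      (continuous_const (y := 1 / ((n : ℝ) + 1))) fun _ => he
    refine ⟨BoundedContinuousFunction.ofNormedAddCommGroup k hk.continuous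
      (‖g‖ + 1 / ((n : ℝ) + 1)) fun x => ?_, by exact_mod_cast hk, ?_⟩
    · have h1 := (hd x).le
      rw [dist_eq_norm] at h1
      have h2 := norm_le_insert' (k x) (g x)
      have h3 := g.norm_coe_le_norm x
      linarith
    · exact (BoundedContinuousFunction.dist_le he.le).2 fun x => (hd x).le
  choose G hG hd using h
  exact ⟨G, hG, tendsto_iff_dist_tendsto_zero.2 (squeeze_zero (fun _ => dist_nonneg) hd
    tendsto_one_div_add_atTop_nhds_zero_nat)⟩

theorem ip_greenOp_nonneg (hR : RiemannPair Ω φ f) (hb : Bornology.IsBounded Ω) (g : BC) :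
    0 ≤ ip (intCLM hb) (greenOp hR hb) g g := by
  obtain ⟨G, hG, hlim⟩ := exists_contDiff_tendsto g
  refine ge_of_tendsto' ((continuous_ip_self.tendsto g).comp hlim) fun n => ?_
  have := energy_nonneg hb (greenOp hR hb (G n)).continuous
    (fun x hx => greenOp_of_notMem hR hb (G n) hx)
    (fun x hx => hasFDerivAt_greenOp hR hb (G n) hx)
    (fun x hx => (greenGrad_regular hR hb (G n) hx (hG n).contDiffAt).1)
    (fun x hx => (greenGrad_regular hR hb (G n) hx (hG n).contDiffAt).2) hR.isOpen
  simpa [ip, intCLM_apply, mul_comm] using this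

theorem greenForm (hR : RiemannPair Ω φ f) (hb : Bornology.IsBounded Ω) :
    GreenForm Ω (intCLM hb) (greenOp hR hb) where
  isOpen := hR.isOpen
  bdd := hb
  nonempty := ⟨f 0, hR.mapsTo_inv (by simp)⟩
  int_apply _ := rfl
  off g x hx := greenOp_of_notMem hR hb g hx
  pos g hg x := greenOp_nonneg hR hb (fun y _ => hg y) x
  symm g h := by simpa [intCLM_apply] using greenOp_symm hR hb g h
  psd g := ip_greenOp_nonneg hR hb g
  compact 𝒰 g A hA := greenOp_compact hR hb 𝒰 fun n => by
    simpa [intCLM_apply, sq] using hA n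
  entropy := by
    obtain ⟨C, hC⟩ := exists_greenOp_le_entropy hR hb
    exact ⟨C, fun ρ hρ x => hC ρ (fun y _ => hρ y) x⟩

end

end

section

/-! ### The stable branch below a supersolution -/

theorem green_schur {Ω : Set ℂ} {φ f : ℂ → ℂ} (hR : RiemannPair Ω φ f)
    (hb : Bornology.IsBounded Ω) {p h W : BC} (hh : ∀ x, 0 ≤ h x) (hW : ∀ x, 0 ≤ W x)
    (hp : ∀ x, p x ^ 2 = h x * W x) :
    ip (intCLM hb) (greenOp hR hb) p p ≤ ip (intCLM hb) (greenOp hR hb) h W := by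
  have key : ∀ a b : BC, Integrable (fun q : ℂ × ℂ => green Ω φ q.1 q.2 * (a q.1 * b q.2))
      ((volume.restrict Ω).prod (volume.restrict Ω)) ∧ ip (intCLM hb) (greenOp hR hb) a b =
      ∫ q, green Ω φ q.1 q.2 * (a q.1 * b q.2) ∂((volume.restrict Ω).prod (volume.restrict Ω)) := by
    intro a b
    have hi := integrable_prod_green_mul hR hb (k := fun p => a p.1 * b p.2) (by fun_prop)
      (B := ‖a‖ * ‖b‖) fun p => by
        rw [abs_mul]
        exact mul_le_mul (a.abs_le _) (b.abs_le _) (abs_nonneg _) (norm_nonneg _)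
    refine ⟨hi, ?_⟩
    rw [integral_prod _ hi]
    exact integral_mul_greenOp_eq hR hb a b
  have h1 : 2 * ip (intCLM hb) (greenOp hR hb) p p ≤
      ip (intCLM hb) (greenOp hR hb) h W + ip (intCLM hb) (greenOp hR hb) W h := by
    rw [(key p p).2, (key h W).2, (key W h).2, ← integral_const_mul,
      ← integral_add (key h W).1 (key W h).1]
    refine integral_mono ((key p p).1.const_mul _) ((key h W).1.add (key W h).1) fun q => ?_
    simp only []
    have hG := green_nonneg hR q.1 q.2
    have h2 : 2 * (p q.1 * p q.2) ≤ h q.1 * W q.2 + W q.1 * h q.2 := by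
      have hx := hp q.1
      have hy := hp q.2
      have hA : 0 ≤ h q.1 * W q.2 := mul_nonneg (hh _) (hW _)
      have hB : 0 ≤ W q.1 * h q.2 := mul_nonneg (hW _) (hh _)
      have hs : (p q.1 * p q.2) ^ 2 = (h q.1 * W q.2) * (W q.1 * h q.2) := by
        rw [mul_pow, hx, hy]; ring
      refine (abs_le_of_sq_le_sq' ?_ (by positivity)).2
      nlinarith [sq_nonneg (h q.1 * W q.2 - W q.1 * h q.2)]
    nlinarith
  rw [(greenForm hR hb).ip_comm W h] at h1
  linarith

section
variable {Ω : Set ℂ} {I : BC →L[ℝ] ℝ} {T : BC →L[ℝ] BC} {U : BC} {M : ℝ}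

/-- Solutions of `u = μ T e^u` in the order interval `[0, U]`. -/
structure BranchSol (T : BC →L[ℝ] BC) (U : BC) (μ : ℝ) (u : BC) : Prop where
  nonneg : ∀ x, 0 ≤ u x
  le : ∀ x, u x ≤ U x
  eq : u = μ • T (ex u)

namespace GreenForm

theorem T_mono (H : GreenForm Ω I T) {g h : BC} (hgh : ∀ x, g x ≤ h x) (x : ℂ) :
    T g x ≤ T h x := by
  have := H.pos (h - g) (fun x => sub_nonneg.2 (hgh x)) x
  simp only [map_sub, BoundedContinuousFunction.coe_sub, Pi.sub_apply] at this
  linarith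

theorem T_ex_mono (H : GreenForm Ω I T) {g h : BC} (hgh : ∀ x, g x ≤ h x) (x : ℂ) :
    T (ex g) x ≤ T (ex h) x :=
  H.T_mono (fun y => by simpa [ex_apply] using hgh y) x

theorem eq_zero_of_nonneg (H : GreenForm Ω I T) {g : BC} (h0 : ∀ x, 0 ≤ g x) (hg : I g ≤ 0) :
    ∀ x ∈ Ω, g x = 0 := by
  have hg' : I g = 0 := le_antisymm hg (H.nonneg fun x _ => h0 x)
  rw [H.int_apply, setIntegral_eq_zero_iff_of_nonneg_ae
    (Eventually.of_forall h0) (H.integrable _)] at hg'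
  have := (Measure.eqOn_open_of_ae_eq (f := g) (g := fun _ => (0 : ℝ)) hg' H.isOpen
    g.continuous.continuousOn continuousOn_const)
  exact fun x hx => this hx

theorem exists_branchSol_ge (H : GreenForm Ω I T) (hsup : ∀ x, M * T (ex U) x ≤ U x) {μ : ℝ}
    (hμ : 0 ≤ μ) (hμM : μ ≤ M) {w : BC} (hw0 : ∀ x, 0 ≤ w x) (hwU : ∀ x, w x ≤ U x)
    (hw : ∀ x, w x ≤ μ * T (ex w) x) : ∃ u, BranchSol T U μ u ∧ ∀ x, w x ≤ u x := by
  have hstep : ∀ {a b : BC}, (∀ x, a x ≤ b x) → ∀ x, (μ • T (ex a)) x ≤ (μ • T (ex b)) x :=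
    fun h x => mul_le_mul_of_nonneg_left (H.T_ex_mono h x) hμ
  set v : ℕ → BC := fun n => (fun a : BC => μ • T (ex a))^[n] w with hv
  have hs : ∀ n, v (n + 1) = μ • T (ex (v n)) := fun n => Function.iterate_succ_apply' _ _ _
  have hpos : ∀ g : BC, ∀ x, 0 ≤ T (ex g) x := fun g =>
    H.pos _ fun x => by rw [ex_apply]; positivity
  have hU : ∀ n x, v n x ≤ U x := by
    intro n
    induction n with
    | zero => exact hwU
    | succ n ih =>
      intro x
      rw [hs]
      refine (hstep ih x).trans (le_trans ?_ (hsup x))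
      exact mul_le_mul_of_nonneg_right hμM (hpos _ _)
  have hinc : ∀ n x, v n x ≤ v (n + 1) x := by
    intro n
    induction n with
    | zero => intro x; rw [hs]; exact hw x
    | succ n ih => intro x; rw [hs, hs (n + 1)]; exact hstep ih x
  have hmono : ∀ x, Monotone fun n => v n x := fun x => monotone_nat_of_le_succ fun n => hinc n x
  obtain ⟨z, hz⟩ := H.compact (hyperfilter ℕ) (fun n => ex (v n)) (I (ex U * ex U)) fun n => by
    refine H.mono fun x _ => ?_
    simp only [BoundedContinuousFunction.coe_mul, Pi.mul_apply, ex_apply]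
    have := hU n x
    gcongr
  have hlim : Tendsto (fun n => v (n + 1)) (hyperfilter ℕ) (𝓝 (μ • z)) := by
    simp_rw [hs]
    exact hz.const_smul μ
  have hle : ∀ n x, v n x ≤ (μ • z) x := fun n x => by
    have h1 : Tendsto (fun k => v (k + 1) x) (hyperfilter ℕ) (𝓝 ((μ • z) x)) :=
      ((BoundedContinuousFunction.evalCLM ℝ x : BC →L[ℝ] ℝ).continuous.tendsto _).comp hlim
    refine ge_of_tendsto h1 ?_
    filter_upwards [Nat.hyperfilter_le_atTop (eventually_ge_atTop n)] with k hk
    exact hmono x (by omega)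
  have hconv : Tendsto v atTop (𝓝 (μ • z)) := by
    rw [Metric.tendsto_atTop]
    intro ε hε
    obtain ⟨N, hN⟩ := ((Metric.tendsto_nhds.1 hlim) (ε / 2) (half_pos hε)).exists
    refine ⟨N + 1, fun n hn => lt_of_le_of_lt ?_ (half_lt_self hε)⟩
    rw [BoundedContinuousFunction.dist_le (half_pos hε).le]
    intro x
    have h1 := (BoundedContinuousFunction.dist_coe_le_dist x).trans hN.le
    rw [Real.dist_eq, _root_.abs_le] at h1 ⊢
    have h2 := hmono x hn
    have h3 := hle n x
    simp only at h2
    constructor <;> linarith [h1.1, h1.2]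
  have hfix : μ • z = μ • T (ex (μ • z)) := by
    have h1 : Tendsto (fun n => v (n + 1)) atTop (𝓝 (μ • T (ex (μ • z)))) := by
      simp_rw [hs]
      exact ((T.continuous.comp continuous_ex).continuousAt.tendsto.comp hconv).const_smul μ
    exact tendsto_nhds_unique ((tendsto_add_atTop_iff_nat 1).2 hconv) h1
  refine ⟨μ • z, ⟨fun x => (hw0 x).trans (hle 0 x), fun x => ?_, hfix⟩, hle 0⟩
  have h1 : Tendsto (fun k => v k x) atTop (𝓝 ((μ • z) x)) :=
    ((BoundedContinuousFunction.evalCLM ℝ x : BC →L[ℝ] ℝ).continuous.tendsto _).comp hconv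
  exact le_of_tendsto' h1 fun n => hU n x

theorem branchSol_le_mul (H : GreenForm Ω I T) (hM : 0 < M) (hsup : ∀ x, M * T (ex U) x ≤ U x)
    {μ : ℝ} (hμ : 0 ≤ μ) {u : BC} (hu : BranchSol T U μ u) (x : ℂ) : u x ≤ μ / M * U x := by
  have h1 : u x = μ * T (ex u) x := by
    conv_lhs => rw [hu.eq]
    rfl
  have h2 := H.T_ex_mono hu.le x
  have h3 := hsup x
  rw [h1, div_mul_eq_mul_div, le_div_iff₀ hM, mul_assoc]
  exact mul_le_mul_of_nonneg_left (by nlinarith) hμ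

/-- The positive supersolution of the linearised equation provided by convexity. -/
theorem linearised_super (H : GreenForm Ω I T) (hM : 0 < M) (hsup : ∀ x, M * T (ex U) x ≤ U x)
    {m : BC} (hm : ∀ x, m x ≤ M * T (ex m) x) (x : ℂ) :
    M * T (ex m * (U - m)) x ≤ U x - m x := by
  have h1 : T (ex m * (U - m)) x ≤ T (ex U - ex m) x := H.T_mono (fun y => by
    simp only [BoundedContinuousFunction.coe_mul, BoundedContinuousFunction.coe_sub, Pi.mul_apply,
      Pi.sub_apply, ex_apply]
    have h2 := Real.add_one_le_exp (U y - m y)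
    have h3 : Real.exp (U y) = Real.exp (m y) * Real.exp (U y - m y) := by
      rw [← Real.exp_add]; congr 1; ring
    have h4 := Real.exp_pos (m y)
    rw [h3]
    nlinarith) x
  rw [map_sub, BoundedContinuousFunction.coe_sub, Pi.sub_apply] at h1
  have := hsup x
  have := hm x
  nlinarith

theorem branchSol_unique (H : GreenForm Ω I T) (hM : 0 < M) (hU : ∀ x ∈ Ω, 0 < U x)
    (hsup : ∀ x, M * T (ex U) x ≤ U x) {μ : ℝ} (hμ : 0 ≤ μ) (hμM : μ < M) {u v : BC}
    (hu : BranchSol T U μ u) (hv : BranchSol T U μ v) : u = v := by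
  have hux : ∀ x, u x = μ * T (ex u) x := fun x => by conv_lhs => rw [hu.eq]
                                                      rfl
  have hvx : ∀ x, v x = μ * T (ex v) x := fun x => by conv_lhs => rw [hv.eq]
                                                      rfl
  have hpos : ∀ g : BC, ∀ x, 0 ≤ T (ex g) x := fun g =>
    H.pos _ fun x => by rw [ex_apply]; positivity
  set m : BC := u ⊔ v with hm
  have hmx : ∀ x, m x = max (u x) (v x) := fun x => rfl
  have hmsub : ∀ x, m x ≤ M * T (ex m) x := fun x => by
    have h1 : m x ≤ μ * T (ex m) x := by
      rw [hmx, max_le_iff]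
      constructor
      · rw [hux x]
        exact mul_le_mul_of_nonneg_left (H.T_ex_mono (fun y => le_max_left _ _) x) hμ
      · rw [hvx x]
        exact mul_le_mul_of_nonneg_left (H.T_ex_mono (fun y => le_max_right _ _) x) hμ
    exact h1.trans (mul_le_mul_of_nonneg_right hμM.le (hpos _ _))
  set ψ : BC := U - m with hψ
  set d : BC := ab (u - v) with hd
  have hψx : ∀ x, ψ x = U x - m x := fun x => rfl
  have hdx : ∀ x, d x = |u x - v x| := fun x => rfl
  have hψ0 : ∀ x, 0 ≤ ψ x := fun x => by
    rw [hψx, hmx, sub_nonneg]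
    exact max_le (hu.le x) (hv.le x)
  have hψpos : ∀ x ∈ Ω, 0 < ψ x := fun x hx => by
    have h1 := H.branchSol_le_mul hM hsup hμ hu x
    have h2 := H.branchSol_le_mul hM hsup hμ hv x
    have h3 : μ / M < 1 := (div_lt_one hM).2 hμM
    have h4 := hU x hx
    rw [hψx, hmx, sub_pos]
    exact max_lt (by nlinarith) (by nlinarith)
  have hsuper := H.linearised_super hM hsup hmsub
  have hdT : ∀ x, d x ≤ μ * T (ex m * d) x := by
    have hlip : ∀ {a b y : ℝ}, |Real.exp a - Real.exp b| ≤ Real.exp (max a b) * |a - b| := by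
      intro a b _
      have key : ∀ a b : ℝ, b ≤ a → |Real.exp a - Real.exp b| ≤ Real.exp a * |a - b| := by
        intro a b hab
        rw [abs_of_nonneg (sub_nonneg.2 (Real.exp_le_exp.2 hab)), abs_of_nonneg (sub_nonneg.2 hab)]
        have h2 := Real.add_one_le_exp (b - a)
        have h3 : Real.exp b = Real.exp a * Real.exp (b - a) := by
          rw [← Real.exp_add]; congr 1; ring
        have h4 := Real.exp_pos a
        rw [h3]
        nlinarith
      rcases le_total b a with h | h
      · rw [max_eq_left h]; exact key a b h
      · rw [max_eq_right h, abs_sub_comm, abs_sub_comm a b]; exact key b a h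
    intro x
    have hE : ∀ y, |(ex u - ex v) y| ≤ (ex m * d) y := fun y => by
      simp only [BoundedContinuousFunction.coe_mul, BoundedContinuousFunction.coe_sub,
        Pi.mul_apply, Pi.sub_apply, ex_apply, hdx, hmx]
      exact hlip (y := 0)
    have h1 := H.T_mono (fun y => (le_abs_self _).trans (hE y)) x
    have h2 := H.T_mono (g := -(ex u - ex v)) (fun y => (neg_le_abs _).trans (hE y)) x
    rw [hdx, hux, hvx, ← mul_sub, abs_mul, abs_of_nonneg hμ]
    refine mul_le_mul_of_nonneg_left ?_ hμ
    rw [_root_.abs_le]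
    simp only [map_sub, map_neg, BoundedContinuousFunction.coe_sub, Pi.sub_apply,
      BoundedContinuousFunction.coe_neg, Pi.neg_apply] at h1 h2
    constructor <;> linarith
  have hEx : ∀ x, 0 < ex m x := fun x => by rw [ex_apply]; positivity
  have hd0 : ∀ x, 0 ≤ d x := fun x => abs_nonneg _
  have h1 : I (ex m * ψ * d) ≤ μ * ip I T (ex m * ψ) (ex m * d) := by
    rw [ip, ← smul_eq_mul μ, ← map_smul]
    refine H.mono fun x _ => ?_
    have := hdT x
    have := mul_le_mul_of_nonneg_left this (mul_nonneg (hEx x).le (hψ0 x))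
    simp only [BoundedContinuousFunction.coe_mul, BoundedContinuousFunction.coe_smul,
      Pi.mul_apply, smul_eq_mul] at this ⊢
    linarith
  have h2 : M * ip I T (ex m * d) (ex m * ψ) ≤ I (ex m * ψ * d) := by
    rw [ip, ← smul_eq_mul M, ← map_smul]
    refine H.mono fun x _ => ?_
    have := mul_le_mul_of_nonneg_left (hsuper x) (mul_nonneg (hEx x).le (hd0 x))
    simp only [BoundedContinuousFunction.coe_mul, BoundedContinuousFunction.coe_smul,
      Pi.mul_apply, smul_eq_mul] at this ⊢
    have e := hψx x
    rw [← e] at this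
    linarith
  have h0 : ∀ x, 0 ≤ (ex m * ψ * d) x := fun x => by
    simp only [BoundedContinuousFunction.coe_mul, Pi.mul_apply]
    exact mul_nonneg (mul_nonneg (hEx x).le (hψ0 x)) (hd0 x)
  have h3 : I (ex m * ψ * d) ≤ 0 := by
    have h4 := H.nonneg fun x _ => h0 x
    rw [H.ip_comm] at h1
    have h5 : M * I (ex m * ψ * d) ≤ μ * I (ex m * ψ * d) := by nlinarith
    nlinarith
  have h4 := H.eq_zero_of_nonneg h0 h3
  ext x
  by_cases hx : x ∈ Ω
  · have := h4 x hx
    simp only [BoundedContinuousFunction.coe_mul, Pi.mul_apply, mul_eq_zero, (hEx x).ne',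
      (hψpos x hx).ne', false_or, hdx, abs_eq_zero] at this
    linarith
  · rw [hux, hvx, H.off _ x hx, H.off _ x hx]

theorem tendsto_branchSol (H : GreenForm Ω I T) (hM : 0 < M) (hU : ∀ x ∈ Ω, 0 < U x)
    (hsup : ∀ x, M * T (ex U) x ≤ U x) {μ : ℕ → ℝ} {ν : ℝ} (hν : 0 ≤ ν)
    (hνM : ν < M) {𝒰 : Ultrafilter ℕ} (hlim : Tendsto μ 𝒰 (𝓝 ν)) {u : ℕ → BC}
    (hu : ∀ n, BranchSol T U (μ n) (u n)) {v : BC} (hv : BranchSol T U ν v) :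
    Tendsto u 𝒰 (𝓝 v) := by
  obtain ⟨z, hz⟩ := H.compact 𝒰 (fun n => ex (u n)) (I (ex U * ex U)) fun n => by
    refine H.mono fun x _ => ?_
    simp only [BoundedContinuousFunction.coe_mul, Pi.mul_apply, ex_apply]
    have := (hu n).le x
    gcongr
  have h1 : Tendsto u 𝒰 (𝓝 (ν • z)) := by
    have := hlim.smul hz
    refine this.congr fun n => ?_
    exact (hu n).eq.symm
  have h2 : Tendsto u 𝒰 (𝓝 (ν • T (ex (ν • z)))) := by
    have h3 := (T.continuous.comp continuous_ex).continuousAt.tendsto.comp h1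
    exact (hlim.smul h3).congr fun n => (hu n).eq.symm
  have hx : ∀ x, Tendsto (fun n => u n x) 𝒰 (𝓝 ((ν • z) x)) := fun x =>
    ((BoundedContinuousFunction.evalCLM ℝ x : BC →L[ℝ] ℝ).continuous.tendsto _).comp h1
  have h3 : BranchSol T U ν (ν • z) := ⟨fun x => ge_of_tendsto' (hx x) fun n => (hu n).nonneg x,
    fun x => le_of_tendsto' (hx x) fun n => (hu n).le x, tendsto_nhds_unique h1 h2⟩
  rwa [H.branchSol_unique hM hU hsup hν hνM hv h3]

/-- The mass along the branch takes every value below that of a subsolution. -/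
theorem exists_branchSol_mass (H : GreenForm Ω I T) (hM : 0 < M) (hU0 : ∀ x, 0 ≤ U x)
    (hU : ∀ x ∈ Ω, 0 < U x) (hsup : ∀ x, M * T (ex U) x ≤ U x) {ν : ℝ} (hν : 0 ≤ ν)
    (hνM : ν < M) {w : BC} (hw0 : ∀ x, 0 ≤ w x) (hwU : ∀ x, w x ≤ U x)
    (hw : ∀ x, w x ≤ ν * T (ex w) x) {Λ : ℝ} (hΛ : 0 < Λ) (hΛw : Λ ≤ ν * I (ex w)) :
    ∃ μ u, 0 < μ ∧ μ < M ∧ BranchSol T U μ u ∧ μ * I (ex u) = Λ := by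
  have hex : ∀ μ : ℝ, ∃ u, μ ∈ Icc 0 ν → BranchSol T U μ u := fun μ => by
    by_cases hμ : μ ∈ Icc 0 ν
    · obtain ⟨u, hu, -⟩ := H.exists_branchSol_ge hsup hμ.1 (hμ.2.trans hνM.le) (w := 0)
        (fun _ => le_rfl) hU0 fun x => mul_nonneg hμ.1 (H.pos _ (fun y => by
          rw [ex_apply]; positivity) x)
      exact ⟨u, fun _ => hu⟩
    · exact ⟨0, fun h => absurd h hμ⟩
  choose s hs using hex
  have hcont : ContinuousOn (fun μ => μ * I (ex (s μ))) (Icc 0 ν) := by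
    intro ν' hν'
    refine tendsto_of_seq_tendsto fun μ hμ => ?_
    have hμ1 : Tendsto μ atTop (𝓝 ν') := tendsto_nhdsWithin_iff.1 hμ |>.1
    have hμ2 : ∀ᶠ n in atTop, μ n ∈ Icc 0 ν := tendsto_nhdsWithin_iff.1 hμ |>.2
    rw [tendsto_iff_ultrafilter]
    intro 𝒰 h𝒰
    have h1 : ∀ᶠ n in (𝒰 : Filter ℕ), μ n ∈ Icc 0 ν := h𝒰 hμ2
    obtain ⟨μ', hμ'⟩ : ∃ μ' : ℕ → ℝ, μ' = fun n => if μ n ∈ Icc 0 ν then μ n else ν' := ⟨_, rfl⟩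
    have hmem : ∀ n, μ' n ∈ Icc 0 ν := fun n => by
      rw [hμ']; dsimp only; split_ifs with h
      exacts [h, hν']
    have heq : μ' =ᶠ[𝒰] μ := h1.mono fun n hn => by rw [hμ']; exact if_pos hn
    have hl : Tendsto μ' 𝒰 (𝓝 ν') := (hμ1.mono_left h𝒰).congr' heq.symm
    have h2 := H.tendsto_branchSol hM hU hsup hν'.1 (hν'.2.trans_lt hνM) hl
      (fun n => hs _ (hmem n)) (hs ν' hν')
    have h3 := hl.mul ((I.continuous.comp continuous_ex).continuousAt.tendsto.comp h2)
    exact h3.congr' (heq.mono fun n hn => by simp [hn])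
  have hend : Λ ≤ ν * I (ex (s ν)) := by
    obtain ⟨u, hu, hwu⟩ := H.exists_branchSol_ge hsup hν hνM.le hw0 hwU hw
    rw [← H.branchSol_unique hM hU hsup hν hνM hu (hs ν ⟨hν, le_rfl⟩)]
    refine hΛw.trans (mul_le_mul_of_nonneg_left (H.mono fun x _ => ?_) hν)
    simpa [ex_apply] using hwu x
  obtain ⟨μ, hμ, hμΛ⟩ := intermediate_value_Icc hν hcont ⟨by simpa using hΛ.le, hend⟩
  refine ⟨μ, s μ, lt_of_le_of_ne hμ.1 ?_, hμ.2.trans_lt hνM, hs μ hμ, hμΛ⟩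
  rintro rfl
  simp at hμΛ
  linarith

end GreenForm
end

end

section

/-! ### Stability of the branch and the mountain pass geometry -/

theorem exp_le_quadratic_add (x : ℝ) :
    Real.exp x ≤ 1 + x + x ^ 2 / 2 + |x| ^ 3 * Real.exp |x| := by
  have h := Complex.norm_exp_sub_sum_le_norm_mul_exp (x : ℂ) 3
  have e : Complex.exp (x : ℂ) - ∑ m ∈ Finset.range 3, (x : ℂ) ^ m / (m.factorial : ℂ) =
      ((Real.exp x - (1 + x + x ^ 2 / 2) : ℝ) : ℂ) := by
    simp [Finset.sum_range_succ, Nat.factorial]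
  rw [e, Complex.norm_real, Complex.norm_real, Real.norm_eq_abs, Real.norm_eq_abs] at h
  linarith [(le_abs_self _).trans h]

theorem cube_mul_exp_le {x ε : ℝ} (hε : 0 < ε) (hε1 : ε ≤ 1) :
    |x| ^ 3 * Real.exp |x| ≤ 6 * ε ^ 3 * (Real.exp (2 / ε * x) + Real.exp (-2 / ε * x)) := by
  set y := |x| / ε with hy
  have hy0 : 0 ≤ y := by positivity
  have hx : |x| = ε * y := by rw [hy]; field_simp
  have h1 : y ^ 3 ≤ 6 * Real.exp y := by
    have := Real.pow_div_factorial_le_exp y hy0 3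
    norm_num [Nat.factorial] at this
    linarith
  have h2 : Real.exp |x| ≤ Real.exp y := Real.exp_le_exp.2 (by rw [hx]; nlinarith)
  have h3 : Real.exp (2 * y) ≤ Real.exp (2 / ε * x) + Real.exp (-2 / ε * x) := by
    rcases abs_cases x with ⟨h, _⟩ | ⟨h, _⟩
    · have : 2 * y = 2 / ε * x := by rw [hy, h]; ring
      rw [this]; linarith [Real.exp_pos (-2 / ε * x)]
    · have : 2 * y = -2 / ε * x := by rw [hy, h]; ring
      rw [this]; linarith [Real.exp_pos (2 / ε * x)]
  calc |x| ^ 3 * Real.exp |x| ≤ (ε ^ 3 * (6 * Real.exp y)) * Real.exp y := by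
        refine mul_le_mul ?_ h2 (by positivity) (by positivity)
        rw [hx, mul_pow]
        exact mul_le_mul_of_nonneg_left h1 (by positivity)
    _ = 6 * ε ^ 3 * Real.exp (2 * y) := by rw [two_mul, Real.exp_add]; ring
    _ ≤ _ := mul_le_mul_of_nonneg_left h3 (by positivity)

section
variable {Ω : Set ℂ} {I : BC →L[ℝ] ℝ} {T : BC →L[ℝ] BC} {U : BC} {M : ℝ}

/-- The Schur inequality for the form `ip I T`. -/
def SchurForm (I : BC →L[ℝ] ℝ) (T : BC →L[ℝ] BC) : Prop :=
  ∀ p h W : BC, (∀ x, 0 ≤ h x) → (∀ x, 0 ≤ W x) → (∀ x, p x ^ 2 = h x * W x) →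
    ip I T p p ≤ ip I T h W

namespace GreenForm

theorem schur_branchSol (H : GreenForm Ω I T) (hS : SchurForm I T) (hM : 0 < M)
    (hU : ∀ x ∈ Ω, 0 < U x) (hsup : ∀ x, M * T (ex U) x ≤ U x) {μ : ℝ} (hμ : 0 ≤ μ) (hμM : μ < M)
    {u : BC} (hu : BranchSol T U μ u) (f : BC) :
    M * ip I T (ex u * f) (ex u * f) ≤ I (ex u * (f * f)) := by
  have hpos : ∀ x, 0 ≤ T (ex u) x := H.pos _ fun x => by rw [ex_apply]; positivity
  have hsub : ∀ x, u x ≤ M * T (ex u) x := fun x => by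
    conv_lhs => rw [hu.eq]
    exact mul_le_mul_of_nonneg_right hμM.le (hpos x)
  have hsuper := H.linearised_super hM hsup hsub
  set ψ : BC := U - u with hψ
  have hψx : ∀ x, ψ x = U x - u x := fun x => rfl
  have hψ0 : ∀ x, 0 ≤ ψ x := fun x => sub_nonneg.2 (hu.le x)
  have hψpos : ∀ x ∈ Ω, 0 < ψ x := fun x hx => by
    have h1 := H.branchSol_le_mul hM hsup hμ hu x
    have h3 : μ / M < 1 := (div_lt_one hM).2 hμM
    have h4 := hU x hx
    rw [hψx, sub_pos]
    nlinarith
  have hEx : ∀ x, 0 < ex u x := fun x => by rw [ex_apply]; positivity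
  set C := ‖T (ex u)‖ with hC
  have key : ∀ n : ℕ, M * ip I T (ex u * f) (ex u * f) ≤ ∫ x in Ω, ex u x * (f x * f x) *
      ((ψ x + 1 / ((n : ℝ) + 1) * (M * C)) / (ψ x + 1 / ((n : ℝ) + 1))) := by
    intro n
    set ε : ℝ := 1 / ((n : ℝ) + 1) with hε
    have hε0 : 0 < ε := by positivity
    have hne : ∀ x, 0 < ψ x + ε := fun x => by linarith [hψ0 x]
    set k : BC := BoundedContinuousFunction.ofNormedAddCommGroup (fun x => (ψ x + ε)⁻¹)
      ((ψ.continuous.add continuous_const).inv₀ fun x => (hne x).ne') ε⁻¹ (fun x => by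
        rw [Real.norm_eq_abs, abs_of_nonneg (inv_nonneg.2 (hne x).le)]
        exact inv_anti₀ hε0 (by linarith [hψ0 x])) with hk
    have hkx : ∀ x, k x = (ψ x + ε)⁻¹ := fun x => rfl
    set W : BC := ex u * ψ + ε • ex u with hW
    set h : BC := ex u * (f * f) * k with hh
    have hWx : ∀ x, W x = ex u x * (ψ x + ε) := fun x => by
      simp only [hW, BoundedContinuousFunction.coe_add, BoundedContinuousFunction.coe_mul,
        BoundedContinuousFunction.coe_smul, Pi.add_apply, Pi.mul_apply, smul_eq_mul]
      ring
    have hhx : ∀ x, h x = ex u x * (f x * f x) * (ψ x + ε)⁻¹ := fun x => rfl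
    have h1 := hS (ex u * f) h W
      (fun x => by
        rw [hhx]
        exact mul_nonneg (mul_nonneg (hEx x).le (mul_self_nonneg _)) (inv_nonneg.2 (hne x).le))
      (fun x => by rw [hWx]; exact mul_nonneg (hEx x).le (hne x).le)
      (fun x => by
        rw [hWx, hhx]
        have := (hne x).ne'
        simp only [BoundedContinuousFunction.coe_mul, Pi.mul_apply]
        field_simp)
    refine (mul_le_mul_of_nonneg_left h1 hM.le).trans ?_
    rw [ip, ← smul_eq_mul M, ← map_smul, H.int_apply]
    have hcont : Continuous fun x => ex u x * (f x * f x) *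
        ((ψ x + ε * (M * C)) / (ψ x + ε)) :=
      ((ex u).continuous.mul (f.continuous.mul f.continuous)).mul
        ((ψ.continuous.add continuous_const).div (ψ.continuous.add continuous_const)
          fun x => (hne x).ne')
    refine setIntegral_mono_on (H.integrable _) (integrableOn_of_continuous H.bdd hcont)
      H.isOpen.measurableSet fun x _ => ?_
    have h2 : T W x = T (ex u * ψ) x + ε * T (ex u) x := by
      rw [hW, map_add, map_smul]; rfl
    have h3 : M * T W x ≤ ψ x + ε * (M * C) := by
      have h4 := hsuper x
      have h5 := (T (ex u)).abs_le x
      have h6 := (_root_.abs_le.1 h5).2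
      rw [h2, hψx]
      nlinarith [mul_pos hM hε0]
    simp only [BoundedContinuousFunction.coe_mul, BoundedContinuousFunction.coe_smul,
      Pi.mul_apply, smul_eq_mul, hhx]
    have h5 : 0 ≤ ex u x * (f x * f x) * (ψ x + ε)⁻¹ :=
      mul_nonneg (mul_nonneg (hEx x).le (mul_self_nonneg _)) (inv_nonneg.2 (hne x).le)
    have := mul_le_mul_of_nonneg_left h3 h5
    rw [div_eq_mul_inv]
    linarith
  have hMC : 0 ≤ M * C := mul_nonneg hM.le (norm_nonneg _)
  have hlim : Tendsto (fun n : ℕ => ∫ x in Ω, ex u x * (f x * f x) *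
      ((ψ x + 1 / ((n : ℝ) + 1) * (M * C)) / (ψ x + 1 / ((n : ℝ) + 1)))) atTop
      (𝓝 (∫ x in Ω, ex u x * (f x * f x))) := by
    refine tendsto_integral_of_dominated_convergence
      (fun x => ex u x * (f x * f x) * (1 + M * C)) (fun n => ?_) ?_ (fun n => ?_) ?_
    · have hε0 : (0 : ℝ) < 1 / ((n : ℝ) + 1) := by positivity
      exact (((ex u).continuous.mul (f.continuous.mul f.continuous)).mul
        ((ψ.continuous.add continuous_const).div (ψ.continuous.add continuous_const)
          fun x => (show (0 : ℝ) < ψ x + 1 / ((n : ℝ) + 1) by linarith [hψ0 x]).ne')).aestronglyMeasurable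
    · exact (H.integrable (ex u * (f * f))).mul_const _
    · have hε0 : (0 : ℝ) < 1 / ((n : ℝ) + 1) := by positivity
      refine ae_of_all _ fun x => ?_
      have h1 := hψ0 x
      have h0 := mul_nonneg (hEx x).le (mul_self_nonneg (f x))
      rw [Real.norm_eq_abs, abs_of_nonneg (mul_nonneg h0 (by positivity))]
      refine mul_le_mul_of_nonneg_left ?_ h0
      rw [div_le_iff₀ (by linarith)]
      nlinarith [mul_nonneg hMC h1]
    · filter_upwards [ae_restrict_mem H.isOpen.measurableSet] with x hx
      have h1 := (hψpos x hx).ne'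
      have h2 := tendsto_one_div_add_atTop_nhds_zero_nat (𝕜 := ℝ)
      have h3 := ((h2.mul_const (M * C)).const_add (ψ x)).div (h2.const_add (ψ x)) (by simpa)
      simp only [zero_mul, add_zero, div_self h1] at h3
      simpa using h3.const_mul (ex u x * (f x * f x))
  rw [H.int_apply]
  exact ge_of_tendsto' hlim key

theorem stable_branchSol (H : GreenForm Ω I T) (hS : SchurForm I T) (hM : 0 < M)
    (hU : ∀ x ∈ Ω, 0 < U x) (hsup : ∀ x, M * T (ex U) x ≤ U x) {μ : ℝ} (hμ : 0 ≤ μ) (hμM : μ < M)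
    {u : BC} (hu : BranchSol T U μ u) (v : BC) :
    M * I (ex u * (T v * T v)) ≤ ip I T v v := by
  have h1 := H.schur_branchSol hS hM hU hsup hμ hμM hu (T v)
  have h2 := H.ip_sq_le (ex u * T v) v
  have h3 : ip I T (ex u * T v) v = I (ex u * (T v * T v)) := by rw [ip, mul_assoc]
  rw [h3] at h2
  set J := I (ex u * (T v * T v)) with hJ
  have hJ0 : 0 ≤ J := H.nonneg fun x _ => by
    simp only [BoundedContinuousFunction.coe_mul, Pi.mul_apply, ex_apply]
    exact mul_nonneg (Real.exp_pos _).le (mul_self_nonneg _)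
  have h4 := H.ip_self_nonneg v
  rcases hJ0.eq_or_lt with h | h
  · rw [← h, mul_zero]; exact h4
  · have : M * J ^ 2 ≤ J * ip I T v v := by nlinarith
    nlinarith

/-- A strictly stable critical point is surrounded by a ridge. -/
theorem exists_ridge (H : GreenForm Ω I T) {t μ θ : ℝ} (ht : 0 < t) (hθ : θ < 1) {u : BC}
    (hu : u = μ • T (ex u)) (hmass : t * (μ * I (ex u)) = 1)
    (hst : ∀ v, μ * I (ex u * (T v * T v)) ≤ θ * ip I T v v) :
    ∃ r η : ℝ, 0 < r ∧ r ≤ 1 ∧ 0 < η ∧ ∀ v, ip I T v v = r ^ 2 →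
      Psi I T t (μ • ex u) + η ≤ Psi I T t (μ • ex u + v) := by
  obtain ⟨C, hC0, hC⟩ := H.exists_int_ex_scaled_le
  have hTg : T (μ • ex u) = u := by rw [map_smul, ← hu]
  set Z := I (ex u) with hZ
  have hZ0 : 0 < Z := H.ex_pos u
  set D := Real.exp ‖u‖ / Z * (12 * C) with hD
  have hD0 : 0 < D := by positivity
  set κ := t / 2 * (1 - θ) with hκ
  have hκ0 : 0 < κ := by
    have := sub_pos.2 hθ
    positivity
  set r := min 1 (κ / (2 * D)) with hr
  have hr0 : 0 < r := lt_min zero_lt_one (by positivity)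
  have hr1 : r ≤ 1 := min_le_left _ _
  have hr2 : D * r ≤ κ / 2 := by
    have : r ≤ κ / (2 * D) := min_le_right _ _
    rw [le_div_iff₀ (by positivity)] at this
    linarith
  refine ⟨r, κ / 2 * r ^ 2, hr0, hr1, by positivity, fun v hv => ?_⟩
  have hp := hC v r hr0 hv.le 2 (by norm_num)
  have hn := hC v r hr0 hv.le (-2) (by norm_num)
  have hR : I (ex (u + T v)) ≤ Z + I (ex u * T v) + I (ex u * (T v * T v)) / 2 +
      Real.exp ‖u‖ * (6 * r ^ 3) * (I (ex (T ((2 / r) • v))) + I (ex (T ((-2 / r) • v)))) := by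
    have h1 : I (ex (u + T v)) ≤ I (ex u + ex u * T v + (2 : ℝ)⁻¹ • (ex u * (T v * T v)) +
        (Real.exp ‖u‖ * (6 * r ^ 3)) • (ex (T ((2 / r) • v)) + ex (T ((-2 / r) • v)))) := by
      refine H.mono fun x _ => ?_
      simp only [map_smul, BoundedContinuousFunction.coe_add, BoundedContinuousFunction.coe_mul,
        BoundedContinuousFunction.coe_smul, Pi.add_apply, Pi.mul_apply, smul_eq_mul, ex_apply]
      rw [Real.exp_add]
      have h2 := exp_le_quadratic_add (T v x)
      have h3 := cube_mul_exp_le (x := T v x) hr0 hr1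
      have h4 : Real.exp (u x) ≤ Real.exp ‖u‖ :=
        Real.exp_le_exp.2 ((_root_.abs_le.1 (u.abs_le x)).2)
      have h5 := Real.exp_pos (u x)
      set S := 6 * r ^ 3 * (Real.exp (2 / r * T v x) + Real.exp (-2 / r * T v x)) with hSdef
      have hS0 : 0 ≤ S := by positivity
      have h6 : Real.exp (u x) * S ≤ Real.exp ‖u‖ * S := mul_le_mul_of_nonneg_right h4 hS0
      have h7 : Real.exp (u x) * Real.exp (T v x) ≤ Real.exp (u x) *
          (1 + T v x + T v x ^ 2 / 2 + S) :=
        mul_le_mul_of_nonneg_left (by linarith) h5.le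
      calc _ ≤ _ := h7
        _ = Real.exp (u x) + Real.exp (u x) * T v x + 2⁻¹ * (Real.exp (u x) *
            (T v x * T v x)) + Real.exp (u x) * S := by ring
        _ ≤ Real.exp (u x) + Real.exp (u x) * T v x + 2⁻¹ * (Real.exp (u x) *
            (T v x * T v x)) + Real.exp ‖u‖ * S := by linarith
        _ = _ := by rw [hSdef]; ring
    simp only [map_add, map_smul, smul_eq_mul] at h1
    rw [map_smul, map_smul]
    linarith
  have hlog : Real.log (I (ex (u + T v))) - Real.log Z ≤ I (ex (u + T v)) / Z - 1 := by
    rw [← Real.log_div (H.ex_pos _).ne' hZ0.ne']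
    exact Real.log_le_sub_one_of_pos (div_pos (H.ex_pos _) hZ0)
  have hip : ip I T (μ • ex u) v = μ * I (ex u * T v) := by rw [ip_smul_left, ip]
  have hμZ : μ = 1 / (t * Z) := by
    field_simp
    linarith
  have h8 := hst v
  rw [hv] at h8
  unfold Psi LZ
  rw [map_add, hTg, ip_add_left, ip_add_right, ip_add_right, H.ip_comm v, hip, hv]
  rw [← hZ]
  set A := I (ex u * T v) with hA
  set B := I (ex u * (T v * T v)) with hB
  have h9 : I (ex (u + T v)) / Z - 1 ≤ A / Z + B / (2 * Z) + D * r ^ 3 := by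
    rw [div_sub_one hZ0.ne', div_le_iff₀ hZ0]
    have : Real.exp ‖u‖ * (6 * r ^ 3) * (I (ex (T ((2 / r) • v))) + I (ex (T ((-2 / r) • v)))) ≤
        Real.exp ‖u‖ * (6 * r ^ 3) * (C + C) :=
      mul_le_mul_of_nonneg_left (add_le_add hp hn) (by positivity)
    have e : (A / Z + B / (2 * Z) + D * r ^ 3) * Z =
        A + B / 2 + Real.exp ‖u‖ * (6 * r ^ 3) * (C + C) := by
      rw [hD]; field_simp; ring
    rw [e]
    linarith
  have hAZ : A / Z = t * (μ * A) := by rw [hμZ]; field_simp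
  have hBZ : B / (2 * Z) = t / 2 * (μ * B) := by rw [hμZ]; field_simp
  have h10 : t / 2 * (μ * B) ≤ t / 2 * (θ * r ^ 2) :=
    mul_le_mul_of_nonneg_left h8 (by positivity)
  have h11 : D * r ^ 3 ≤ κ / 2 * r ^ 2 := by
    have := mul_le_mul_of_nonneg_right hr2 (sq_nonneg r)
    nlinarith
  have h12 : κ * r ^ 2 = t / 2 * r ^ 2 - t / 2 * (θ * r ^ 2) := by rw [hκ]; ring
  rw [hAZ, hBZ] at h9
  linarith

theorem exists_seq_of_stable (H : GreenForm Ω I T) {t μ θ : ℝ} (ht : 0 < t) (hμ : 0 ≤ μ)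
    (hθ : θ < 1) {u : BC} (hu : u = μ • T (ex u)) (hmass : t * (μ * I (ex u)) = 1)
    (hst : ∀ v, μ * I (ex u * (T v * T v)) ≤ θ * ip I T v v)
    (hunb : ∀ B : ℝ, ∃ g : BC, (∀ x, 0 ≤ g x) ∧ Psi I T t g < B) :
    ∃ (m : ℝ) (τ : ℕ → ℝ) (g : ℕ → BC) (M : ℝ), Psi I T t (μ • ex u) < m ∧ (∀ n, t < τ n) ∧
      Tendsto τ atTop (𝓝 t) ∧ (∀ n, NM I T (τ n) (g n) = g n) ∧
      ∀ n, m ≤ Psi I T (τ n) (g n) ∧ Psi I T (τ n) (g n) ≤ M := by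
  obtain ⟨r, η, hr0, hr1, hη, hridge⟩ := H.exists_ridge ht hθ hu hmass hst
  set g0 : BC := μ • ex u with hg0
  obtain ⟨C, hC⟩ := H.exists_LZ_le
  set R := ip I T g0 g0 with hRdef
  obtain ⟨g1, hg1, hlt⟩ := hunb (min (Psi I T t g0) (-((R + 1) / 2) - C))
  have hlt1 := hlt.trans_le (min_le_left _ _)
  have hlt2 := hlt.trans_le (min_le_right _ _)
  have hfar : r ^ 2 < ip I T (g1 - g0) (g1 - g0) := by
    by_contra! hcon
    have h1 : ip I T (g1 - g0) (g1 - g0) ≤ 1 := hcon.trans (by nlinarith)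
    have h2 : ip I T g1 g1 ≤ 2 * (R + 1) := by
      have h3 := H.ip_self_nonneg (g1 - g0 - g0)
      have h4 : ip I T (g1 - g0 - g0) (g1 - g0 - g0) + ip I T g1 g1 =
          2 * ip I T (g1 - g0) (g1 - g0) + 2 * R := by
        simp only [ip_sub_left, ip_sub_right, H.ip_comm g0 g1, hRdef]
        ring
      linarith
    have h5 := hC g1
    have h6 := H.ip_self_nonneg g1
    unfold Psi at hlt2
    nlinarith
  have h0 : ∀ x, 0 ≤ g0 x := fun x => by
    simp only [hg0, BoundedContinuousFunction.coe_smul, smul_eq_mul, ex_apply]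
    positivity
  obtain ⟨τ, g, M, h1, h2, h3, h4⟩ := H.exists_mountainPass_seq h0 hg1 ht
    (m := Psi I T t g0 + η) (fun K hK => by
      have hcont : Continuous fun g : BC => ip I T (g - g0) (g - g0) :=
        continuous_ip_self.comp (continuous_id.sub continuous_const)
      have hmem : r ^ 2 ∈ Icc (ip I T (g0 - g0) (g0 - g0)) (ip I T (g1 - g0) (g1 - g0)) :=
        ⟨by simp [ip]; positivity, hfar.le⟩
      obtain ⟨g, hg, hgr⟩ := hK.conn.intermediate_value hK.left hK.right hcont.continuousOn hmem
      exact ⟨g, hg, by simpa using hridge (g - g0) hgr⟩)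
    (by linarith) (by linarith)
  exact ⟨Psi I T t g0 + η, τ, g, M, by linarith, h1, h2, h3, h4⟩

end GreenForm
end

end

section

theorem hasDerivAt_comp_line {F : Type*} [NormedAddCommGroup F] [NormedSpace ℝ F] {v : ℂ → F}
    {L : ℂ →L[ℝ] F} {z e : ℂ} {s : ℝ} (hv : HasFDerivAt v L (z + s • e)) :
    HasDerivAt (fun s : ℝ => v (z + s • e)) (L e) s := by
  have h : HasDerivAt (fun s : ℝ => z + s • e) e s := by
    simpa using ((hasDerivAt_id s).smul_const e).const_add z
  exact hv.comp_hasDerivAt s h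

theorem deriv_deriv_line {v : ℂ → ℝ} {Q : ℂ → ℂ} {z : ℂ} (e : ℂ)
    (hv : ∀ᶠ x in 𝓝 z, HasFDerivAt v (reMul (Q x)) x) (hQ : DifferentiableAt ℝ Q z) :
    deriv (deriv fun s : ℝ => v (z + s • e)) 0 = (fderiv ℝ Q z e * e).re := by
  have hc : Tendsto (fun s : ℝ => z + s • e) (𝓝 0) (𝓝 z) := by
    have : Continuous fun s : ℝ => z + s • e := by fun_prop
    simpa using this.tendsto 0
  have h1 : deriv (fun s : ℝ => v (z + s • e)) =ᶠ[𝓝 0]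
      fun s : ℝ => (Q (z + s • e) * e).re := by
    filter_upwards [hc.eventually hv] with s hs
    simpa [reMul_apply] using (hasDerivAt_comp_line hs).deriv
  rw [h1.deriv_eq]
  have h2 : HasDerivAt (fun s : ℝ => Q (z + s • e)) (fderiv ℝ Q z e) 0 :=
    hasDerivAt_comp_line (by simpa using hQ.hasFDerivAt)
  exact (Complex.reCLM.hasFDerivAt.comp_hasDerivAt 0 (h2.mul_const e)).deriv

theorem dbar_re_eq (Q : ℂ → ℂ) (z : ℂ) : (dbar Q z).re =
    (fderiv ℝ Q z 1 * 1).re + (fderiv ℝ Q z Complex.I * Complex.I).re := by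
  simp [dbar]

theorem not_isLocalMax_of_dbar_pos {v : ℂ → ℝ} {Q : ℂ → ℂ} {z : ℂ}
    (hv : ∀ᶠ x in 𝓝 z, HasFDerivAt v (reMul (Q x)) x) (hQ : DifferentiableAt ℝ Q z)
    (hpos : 0 < (dbar Q z).re) : ¬ IsLocalMax v z := by
  intro hmax
  have key : ∀ e : ℂ, (fderiv ℝ Q z e * e).re ≤ 0 := by
    intro e
    by_contra hcon
    push Not at hcon
    rw [← deriv_deriv_line e hv hQ] at hcon
    have hv0 : HasFDerivAt v (reMul (Q z)) (z + (0 : ℝ) • e) := by simpa using hv.self_of_nhds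
    have hc : ContinuousAt (fun s : ℝ => z + s • e) 0 := by fun_prop
    have hm : IsLocalMax (fun s : ℝ => v (z + s • e)) 0 := by
      have : Tendsto (fun s : ℝ => z + s • e) (𝓝 0) (𝓝 z) := by simpa using hc.tendsto
      simpa [IsLocalMax, IsMaxFilter] using this.eventually hmax
    have hmin := isLocalMin_of_deriv_deriv_pos hcon hm.deriv_eq_zero
      (hasDerivAt_comp_line hv0).continuousAt
    have hconst : (fun s : ℝ => v (z + s • e)) =ᶠ[𝓝 0] fun _ => v (z + (0 : ℝ) • e) := by
      filter_upwards [hm, hmin] with s h1 h2 using le_antisymm h1 h2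
    have h0 : deriv (fun s : ℝ => v (z + s • e)) =ᶠ[𝓝 0] fun _ => 0 := by
      simpa using hconst.deriv
    rw [h0.deriv_eq] at hcon
    simp at hcon
  rw [dbar_re_eq] at hpos
  linarith [key 1, key Complex.I]

theorem hasFDerivAt_norm_sq (z : ℂ) :
    HasFDerivAt (fun x : ℂ => ‖x‖ ^ 2) (reMul (2 * conj z)) z := by
  refine (hasStrictFDerivAt_norm_sq z).hasFDerivAt.congr_fderiv ?_
  ext h
  simp [reMul_apply, Complex.inner]
  try ring

theorem le_zero_of_dbar_nonneg {K : Set ℂ} (hK : IsOpen K) (hb : Bornology.IsBounded K)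
    {v : ℂ → ℝ} {Q : ℂ → ℂ} (hv : ContinuousOn v (closure K))
    (hfr : ∀ x ∈ frontier K, v x ≤ 0) (hD : ∀ x ∈ K, HasFDerivAt v (reMul (Q x)) x)
    (hQ : ∀ x ∈ K, DifferentiableAt ℝ Q x) (hd : ∀ x ∈ K, 0 ≤ (dbar Q x).re) :
    ∀ x ∈ K, v x ≤ 0 := by
  intro x hx
  by_contra hcon
  push Not at hcon
  obtain ⟨R, hR0, hR⟩ : ∃ R, 0 < R ∧ ∀ z ∈ closure K, ‖z‖ ≤ R := by
    obtain ⟨R, hR⟩ := hb.closure.exists_norm_le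
    exact ⟨max R 1, by positivity, fun z hz => (hR z hz).trans (le_max_left _ _)⟩
  set δ := v x / (2 * R ^ 2) with hδ
  have hδ0 : 0 < δ := by positivity
  have hδR : δ * R ^ 2 = v x / 2 := by rw [hδ]; field_simp
  have hcV : ContinuousOn (fun z => v z + δ * ‖z‖ ^ 2) (closure K) := hv.add (by fun_prop)
  obtain ⟨z, hz, hmax⟩ := hb.isCompact_closure.exists_isMaxOn ⟨x, subset_closure hx⟩ hcV
  have hVx : v x ≤ v z + δ * ‖z‖ ^ 2 :=
    (le_add_of_nonneg_right (by positivity)).trans (hmax (subset_closure hx))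
  have hzK : z ∈ K := by
    by_contra hzn
    have h1 := hfr z ⟨hz, by rwa [hK.interior_eq]⟩
    have h2 : ‖z‖ ^ 2 ≤ R ^ 2 := by gcongr; exact hR z hz
    nlinarith
  have hloc : IsLocalMax (fun z => v z + δ * ‖z‖ ^ 2) z :=
    hmax.isLocalMax (mem_of_superset (hK.mem_nhds hzK) subset_closure)
  have hconj : ∀ z : ℂ, HasFDerivAt (fun z : ℂ => (δ : ℂ) * (2 * conj z))
      ((δ : ℂ) • ((2 : ℂ) • (Complex.conjCLE : ℂ →L[ℝ] ℂ))) z := fun z =>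
    ((Complex.conjCLE : ℂ →L[ℝ] ℂ).hasFDerivAt.const_mul (2 : ℂ)).const_mul (δ : ℂ)
  refine not_isLocalMax_of_dbar_pos (Q := fun z => Q z + (δ : ℂ) * (2 * conj z)) ?_
    ((hQ z hzK).add (hconj z).differentiableAt) ?_ hloc
  · filter_upwards [hK.mem_nhds hzK] with y hy
    refine ((hD y hy).add ((hasFDerivAt_norm_sq y).const_mul δ)).congr_fderiv ?_
    ext h
    simp [reMul_apply]
    try ring
  · rw [dbar_re_eq, fderiv_fun_add (hQ z hzK) (hconj z).differentiableAt, (hconj z).fderiv]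
    have := hd z hzK
    rw [dbar_re_eq] at this
    simp at this ⊢
    linarith

/-- The quadratic form whose sublevel sets are the ellipses of eccentricity parameter `α`. -/
def quad (α : ℝ) (z : ℂ) : ℝ := α ^ 2 * z.re ^ 2 + z.im ^ 2

theorem quad_nonneg (α : ℝ) (z : ℂ) : 0 ≤ quad α z := by unfold quad; positivity

theorem continuous_quad (α : ℝ) : Continuous (quad α) := by unfold quad; fun_prop

theorem hasFDerivAt_quad (α : ℝ) (z : ℂ) :
    HasFDerivAt (quad α) (reMul (2 * (α ^ 2 * z.re - Complex.I * z.im))) z := by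
  have h1 := ((Complex.reCLM.hasFDerivAt (x := z)).pow 2).const_mul (α ^ 2)
  have h2 := (Complex.imCLM.hasFDerivAt (x := z)).pow 2
  refine (h1.add h2).congr_fderiv ?_
  ext h
  simp [reMul_apply, ← Complex.ofReal_pow]
  try ring

/-- The Liouville bubble with elliptic level sets. -/
def bubbleFun (α κ t : ℝ) (z : ℂ) : ℝ := 2 * (log (1 + t) - log (1 + κ * quad α z))

/-- The complex gradient of `bubbleFun`. -/
def bubbleGrad (α κ : ℝ) (z : ℂ) : ℂ :=
  -(4 * κ) * (α ^ 2 * z.re - Complex.I * z.im) * ((1 + κ * quad α z : ℝ) : ℂ)⁻¹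

variable {α κ t : ℝ}

theorem bubble_den_pos (hκ : 0 ≤ κ) (z : ℂ) : 0 < 1 + κ * quad α z := by
  have := mul_nonneg hκ (quad_nonneg α z); linarith

theorem continuous_bubbleFun (hκ : 0 ≤ κ) : Continuous (bubbleFun α κ t) := by
  unfold bubbleFun
  exact continuous_const.mul (continuous_const.sub
    ((continuous_const.add (continuous_const.mul (continuous_quad α))).log
      fun z => (bubble_den_pos hκ z).ne'))

theorem exp_bubbleFun (hκ : 0 ≤ κ) (ht : 0 ≤ t) (z : ℂ) :
    Real.exp (bubbleFun α κ t z) = (1 + t) ^ 2 / (1 + κ * quad α z) ^ 2 := by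
  have h1 := bubble_den_pos (α := α) hκ z
  rw [bubbleFun, ← Real.log_div (by linarith) h1.ne', mul_comm, Real.exp_mul,
    Real.exp_log (by positivity)]
  norm_num [div_pow]

theorem hasFDerivAt_bubbleFun (hκ : 0 ≤ κ) (z : ℂ) :
    HasFDerivAt (bubbleFun α κ t) (reMul (bubbleGrad α κ z)) z := by
  have h1 := bubble_den_pos (α := α) hκ z
  have h2 := (((((hasFDerivAt_quad α z).const_mul κ).const_add 1).log h1.ne').const_sub
    (log (1 + t))).const_mul 2
  refine h2.congr_fderiv ?_
  ext h
  have e : bubbleGrad α κ z = ((-(4 * κ) * (1 + κ * quad α z)⁻¹ : ℝ) : ℂ) *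
      (α ^ 2 * z.re - Complex.I * z.im) := by
    rw [bubbleGrad]; push_cast; ring
  rw [e, reMul_apply, mul_assoc, Complex.re_ofReal_mul]
  simp [reMul_apply, ← Complex.ofReal_pow]
  ring

theorem hasFDerivAt_bubbleGrad (hκ : 0 ≤ κ) (z : ℂ) : DifferentiableAt ℝ (bubbleGrad α κ) z ∧
    (dbar (bubbleGrad α κ) z).re = -(4 * κ * ((1 + α ^ 2) + κ * (1 - α ^ 2) *
      (α ^ 2 * z.re ^ 2 - z.im ^ 2)) / (1 + κ * quad α z) ^ 2) := by
  have h1 := bubble_den_pos (α := α) hκ z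
  set L : ℂ →L[ℝ] ℂ := ((α ^ 2 : ℝ) : ℂ) • (Complex.ofRealCLM.comp Complex.reCLM) -
    Complex.I • (Complex.ofRealCLM.comp Complex.imCLM) with hL
  have hLz : ∀ z : ℂ, L z = α ^ 2 * z.re - Complex.I * z.im := by intro z; simp [hL]
  have h2 : HasFDerivAt (fun z : ℂ => ((1 + κ * quad α z : ℝ) : ℂ)⁻¹)
      (Complex.ofRealCLM.comp (-((1 + κ * quad α z) ^ 2)⁻¹ •
        (κ • reMul (2 * (α ^ 2 * z.re - Complex.I * z.im))))) z := by
    have := ((hasDerivAt_inv h1.ne').comp_hasFDerivAt z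
      (((hasFDerivAt_quad α z).const_mul κ).const_add 1))
    simpa [Function.comp_def] using Complex.ofRealCLM.hasFDerivAt.comp z this
  have h3 := (L.hasFDerivAt (x := z)).const_mul (-(4 * κ) : ℂ) |>.mul h2
  have h4 : bubbleGrad α κ = (fun z : ℂ => -(4 * κ : ℂ) * L z) * fun z : ℂ => ((1 + κ * quad α z : ℝ) : ℂ)⁻¹ := by
    ext z; simp only [Pi.mul_apply]; rw [hLz, bubbleGrad]
  rw [← h4] at h3
  refine ⟨h3.differentiableAt, ?_⟩
  rw [dbar_re_eq, h3.fderiv]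
  have e2 : ((1 + κ * quad α z : ℝ) : ℂ)⁻¹ = (((1 + κ * quad α z)⁻¹ : ℝ) : ℂ) := by push_cast; rfl
  rw [e2]
  have hq : (1 + κ * quad α z) = 1 + κ * (α ^ 2 * z.re ^ 2 + z.im ^ 2) := rfl
  simp only [hL]
  generalize hh : (1 + κ * quad α z) = h at *
  simp [reMul_apply, ← Complex.ofReal_pow]
  field_simp
  rw [hq]
  ring

end

section

variable {α κ t : ℝ}

/-- The positive part of the elliptic bubble, as a bounded continuous function. -/
def bubble (α : ℝ) (hκ : 0 ≤ κ) (ht : 0 ≤ t) : BC :=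
  BoundedContinuousFunction.ofNormedAddCommGroup (fun z => max (bubbleFun α κ t z) 0)
    ((continuous_bubbleFun hκ).max continuous_const) (2 * log (1 + t)) fun z => by
      have h1 : 0 ≤ log (1 + κ * quad α z) :=
        Real.log_nonneg (by have := mul_nonneg hκ (quad_nonneg α z); linarith)
      have h2 : 0 ≤ log (1 + t) := Real.log_nonneg (by linarith)
      rw [Real.norm_eq_abs, abs_of_nonneg (le_max_right _ _), bubbleFun]
      exact max_le (by linarith) (by linarith)

theorem bubble_apply (hκ : 0 ≤ κ) (ht : 0 ≤ t) (z : ℂ) :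
    bubble α hκ ht z = max (bubbleFun α κ t z) 0 := rfl

theorem bubble_nonneg (hκ : 0 ≤ κ) (ht : 0 ≤ t) (z : ℂ) : 0 ≤ bubble α hκ ht z :=
  le_max_right _ _

theorem bubbleFun_nonneg (hκ : 0 ≤ κ) {z : ℂ} (hz : κ * quad α z ≤ t) :
    0 ≤ bubbleFun α κ t z := by
  have := Real.log_le_log (bubble_den_pos (α := α) hκ z)
    (show 1 + κ * quad α z ≤ 1 + t by linarith)
  rw [bubbleFun]; linarith

theorem bubbleFun_pos (hκ : 0 ≤ κ) {z : ℂ} (hz : κ * quad α z < t) :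
    0 < bubbleFun α κ t z := by
  have := Real.log_lt_log (bubble_den_pos (α := α) hκ z)
    (show 1 + κ * quad α z < 1 + t by linarith)
  rw [bubbleFun]; linarith

theorem bubble_eq_zero (hκ : 0 ≤ κ) (ht : 0 ≤ t) {z : ℂ} (hz : t ≤ κ * quad α z) :
    bubble α hκ ht z = 0 := by
  have := Real.log_le_log (show 0 < 1 + t by linarith)
    (show 1 + t ≤ 1 + κ * quad α z by linarith)
  rw [bubble_apply, bubbleFun]; exact max_eq_right (by linarith)

theorem bubble_eventuallyEq (hκ : 0 ≤ κ) (ht : 0 ≤ t) {z : ℂ} (hz : κ * quad α z < t) :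
    bubble α hκ ht =ᶠ[𝓝 z] bubbleFun α κ t := by
  have hc : Continuous fun z => κ * quad α z := continuous_const.mul (continuous_quad α)
  filter_upwards [hc.continuousAt.eventually (gt_mem_nhds hz)] with y hy
  exact max_eq_left (bubbleFun_nonneg hκ hy.le)

theorem hasFDerivAt_bubble (hκ : 0 ≤ κ) (ht : 0 ≤ t) {z : ℂ} (hz : κ * quad α z < t) :
    HasFDerivAt (bubble α hκ ht) (reMul (bubbleGrad α κ z)) z :=
  (hasFDerivAt_bubbleFun hκ z).congr_of_eventuallyEq (bubble_eventuallyEq hκ ht hz)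

theorem contDiffAt_bubble {n : ℕ∞} (hκ : 0 ≤ κ) (ht : 0 ≤ t) {z : ℂ} (hz : κ * quad α z < t) :
    ContDiffAt ℝ n (bubble α hκ ht) z := by
  have hq : ContDiff ℝ n (quad α) := by
    have h1 : ContDiff ℝ n Complex.re := Complex.reCLM.contDiff
    have h2 : ContDiff ℝ n Complex.im := Complex.imCLM.contDiff
    unfold quad
    exact (contDiff_const.mul (h1.pow 2)).add (h2.pow 2)
  have : ContDiffAt ℝ n (bubbleFun α κ t) z := by
    unfold bubbleFun
    exact contDiffAt_const.mul (contDiffAt_const.sub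
      ((contDiffAt_const.add (contDiffAt_const.mul hq.contDiffAt)).log
        (bubble_den_pos hκ z).ne'))
  exact this.congr_of_eventuallyEq (bubble_eventuallyEq hκ ht hz)

theorem contDiffAt_ex {n : ℕ∞} {g : BC} {z : ℂ} (hg : ContDiffAt ℝ n g z) :
    ContDiffAt ℝ n (ex g) z := by
  have : (ex g : ℂ → ℝ) = fun z => Real.exp (g z) := by ext; rw [ex_apply]
  rw [this]
  exact hg.exp

section
variable {Ω : Set ℂ} {φ f : ℂ → ℂ}

theorem dbar_greenGrad_sub {hR : RiemannPair Ω φ f} (hb : Bornology.IsBounded Ω) {g : BC} {z : ℂ}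
    (hz : z ∈ Ω) (hg : ContDiffAt ℝ 1 g z) {Q : ℂ → ℂ} (hQ : DifferentiableAt ℝ Q z) (M s : ℝ) :
    DifferentiableAt ℝ (fun z => (M : ℂ) * greenGrad φ f g z + (s : ℂ) * Q z) z ∧
    (dbar (fun z => (M : ℂ) * greenGrad φ f g z + (s : ℂ) * Q z) z).re =
      -(M * g z) + s * (dbar Q z).re := by
  obtain ⟨h1, h2⟩ := greenGrad_regular hR hb g hz hg
  have h3 := h1.differentiableAt one_ne_zero
  refine ⟨(h3.const_mul _).add (hQ.const_mul _), ?_⟩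
  rw [dbar_add (h3.const_mul _) (hQ.const_mul _), dbar_const_mul _ h3, dbar_const_mul _ hQ]
  simp [h2]

theorem bubble_super (hR : RiemannPair Ω φ f) (hb : Bornology.IsBounded Ω) (hκ : 0 ≤ κ)
    (ht : 0 ≤ t) (hsub : ∀ z ∈ Ω, κ * quad α z < t) {M : ℝ}
    (hM : ∀ z ∈ Ω, M * (1 + t) ^ 2 ≤ 4 * κ * ((1 + α ^ 2) + κ * (1 - α ^ 2) *
      (α ^ 2 * z.re ^ 2 - z.im ^ 2))) (x : ℂ) :
    M * greenOp hR hb (ex (bubble α hκ ht)) x ≤ bubble α hκ ht x := by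
  by_cases hx : x ∈ Ω
  swap
  · rw [greenOp_of_notMem hR hb _ hx, mul_zero]; exact bubble_nonneg hκ ht x
  set U := bubble α hκ ht
  suffices h : M * greenOp hR hb (ex U) x - U x ≤ 0 by linarith
  have hreg : ∀ z ∈ Ω, _ := fun z hz => dbar_greenGrad_sub (hR := hR) hb hz
    (contDiffAt_ex (contDiffAt_bubble (n := 1) hκ ht (hsub z hz)))
    (hasFDerivAt_bubbleGrad (α := α) hκ z).1 M (-1)
  refine le_zero_of_dbar_nonneg hR.isOpen hb (v := fun x => M * greenOp hR hb (ex U) x - U x)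
    (((continuous_const.mul (greenOp hR hb (ex U)).continuous).sub U.continuous).continuousOn)
    (fun z hz => ?_) (fun z hz => ?_) (fun z hz => (hreg z hz).1) (fun z hz => ?_) x hx
  · have : z ∉ Ω := by rw [hR.isOpen.frontier_eq] at hz; exact hz.2
    change M * greenOp hR hb (ex U) z - U z ≤ 0
    rw [greenOp_of_notMem hR hb _ this, mul_zero]
    linarith [bubble_nonneg (α := α) hκ ht z]
  · refine (((hasFDerivAt_greenOp hR hb (ex U) hz).const_mul M).sub
      (hasFDerivAt_bubble hκ ht (hsub z hz))).congr_fderiv ?_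
    ext h
    simp [reMul_apply, add_mul, mul_assoc]
    try ring
  · rw [(hreg z hz).2, (hasFDerivAt_bubbleGrad (α := α) hκ z).2, ex_apply,
      (bubble_eventuallyEq hκ ht (hsub z hz)).self_of_nhds, exp_bubbleFun hκ ht]
    have h1 := hM z hz
    have h2 : 0 < (1 + κ * quad α z) ^ 2 := by have := bubble_den_pos (α := α) hκ z; positivity
    have h3 := div_le_div_of_nonneg_right h1 h2.le
    rw [mul_div_assoc] at h3
    linarith

theorem bubble_sub (hR : RiemannPair Ω φ f) (hb : Bornology.IsBounded Ω) (hκ : 0 ≤ κ)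
    (ht : 0 ≤ t) (hsub : ∀ z, κ * quad α z < t → z ∈ Ω) {ν : ℝ} (hν : 0 ≤ ν)
    (hM : ∀ z, κ * quad α z < t → 4 * κ * ((1 + α ^ 2) + κ * (1 - α ^ 2) *
      (α ^ 2 * z.re ^ 2 - z.im ^ 2)) ≤ ν * (1 + t) ^ 2) (x : ℂ) :
    bubble α hκ ht x ≤ ν * greenOp hR hb (ex (bubble α hκ ht)) x := by
  set U := bubble α hκ ht
  have hT : ∀ x, 0 ≤ ν * greenOp hR hb (ex U) x := fun x =>
    mul_nonneg hν (greenOp_nonneg hR hb (fun y _ => by rw [ex_apply]; positivity) x)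
  by_cases hx : κ * quad α x < t
  swap
  · rw [bubble_eq_zero hκ ht (not_lt.1 hx)]; exact hT x
  suffices h : U x - ν * greenOp hR hb (ex U) x ≤ 0 by linarith
  set K := {z : ℂ | κ * quad α z < t} with hKdef
  have hKo : IsOpen K :=
    isOpen_lt (continuous_const.mul (continuous_quad α)) continuous_const
  have hreg : ∀ z ∈ K, _ := fun z hz => dbar_greenGrad_sub (hR := hR) hb (hsub z hz)
    (contDiffAt_ex (contDiffAt_bubble (n := 1) hκ ht hz))
    (hasFDerivAt_bubbleGrad (α := α) hκ z).1 (-ν) 1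
  refine le_zero_of_dbar_nonneg hKo (hb.subset hsub)
    (v := fun x => U x - ν * greenOp hR hb (ex U) x)
    ((U.continuous.sub (continuous_const.mul (greenOp hR hb (ex U)).continuous)).continuousOn)
    (fun z hz => ?_) (fun z hz => ?_) (fun z hz => (hreg z hz).1) (fun z hz => ?_) x hx
  · have : z ∉ K := by rw [hKo.frontier_eq] at hz; exact hz.2
    change U z - ν * greenOp hR hb (ex U) z ≤ 0
    have h0 : U z = 0 := bubble_eq_zero hκ ht (not_lt.1 this)
    rw [h0]
    linarith [hT z]
  · refine ((hasFDerivAt_bubble hκ ht hz).sub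
      ((hasFDerivAt_greenOp hR hb (ex U) (hsub z hz)).const_mul ν)).congr_fderiv ?_
    ext h
    simp [reMul_apply, add_mul, mul_assoc]
    try ring
  · rw [(hreg z hz).2, (hasFDerivAt_bubbleGrad (α := α) hκ z).2, ex_apply,
      (bubble_eventuallyEq hκ ht hz).self_of_nhds, exp_bubbleFun hκ ht]
    have h1 := hM z hz
    have h2 : 0 < (1 + κ * quad α z) ^ 2 := by have := bubble_den_pos (α := α) hκ z; positivity
    have h3 := div_le_div_of_nonneg_right h1 h2.le
    rw [mul_div_assoc ν] at h3
    linarith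

end

theorem integral_comp_ellipse (hα : 0 < α) (F : ℝ → ℝ) :
    ∫ z : ℂ, F (quad α z) = α⁻¹ * ∫ z : ℂ, F (‖z‖ ^ 2) := by
  set L : ℂ →ₗ[ℝ] ℂ := Matrix.toLin Complex.basisOneI Complex.basisOneI !![α, 0; 0, 1] with hL
  have hdet : LinearMap.det L = α := by rw [hL, LinearMap.det_toLin]; simp
  have hLz : ∀ z, ‖L z‖ ^ 2 = quad α z := by
    intro z
    have : L z = ⟨α * z.re, z.im⟩ := by
      apply Complex.ext <;> simp [hL, Matrix.toLin_apply, Matrix.mulVec, dotProduct]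
    rw [this, Complex.sq_norm, Complex.normSq_apply, quad]
    ring
  have hm := Measure.map_linearMap_addHaar_eq_smul_addHaar (μ := (volume : Measure ℂ)) (f := L)
    (by rw [hdet]; exact hα.ne')
  have hinj : Function.Injective L :=
    (LinearMap.equivOfDetNeZero L (by rw [hdet]; exact hα.ne')).injective
  have hemb : MeasurableEmbedding L :=
    ((LinearMap.isClosedEmbedding_of_injective (LinearMap.ker_eq_bot.2 hinj))).measurableEmbedding
  have h1 := hemb.integral_map (μ := volume) (fun z => F (‖z‖ ^ 2))
  rw [hm, integral_smul_measure, hdet] at h1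
  simp only [hLz] at h1
  rw [← h1, ENNReal.toReal_ofReal (abs_nonneg _), abs_of_pos (inv_pos.2 hα), smul_eq_mul]

theorem integral_radial (F : ℝ → ℝ) :
    ∫ z : ℂ, F (‖z‖ ^ 2) = 2 * π * ∫ r in Ioi (0 : ℝ), r * F (r ^ 2) := by
  rw [← Complex.integral_comp_polarCoord_symm]
  have : polarCoord.target = Ioi (0 : ℝ) ×ˢ Ioo (-π) π := rfl
  rw [this]
  have h : EqOn (fun p : ℝ × ℝ => p.1 • F (‖Complex.polarCoord.symm p‖ ^ 2))
      (fun p => (p.1 * F (p.1 ^ 2)) * 1) (Ioi (0 : ℝ) ×ˢ Ioo (-π) π) := by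
    intro p hp
    simp
  rw [setIntegral_congr_fun (measurableSet_Ioi.prod measurableSet_Ioo) h,
    Measure.volume_eq_prod,
    setIntegral_prod_mul (fun r : ℝ => r * F (r ^ 2)) (fun _ : ℝ => (1 : ℝ))]
  simp
  rw [max_eq_left (by linarith [Real.pi_pos])]
  ring

theorem integral_Ioo_mul_inv_sq (ht : 0 ≤ t) :
    ∫ r in (0 : ℝ)..1, r * ((1 + t) ^ 2 / (1 + t * r ^ 2) ^ 2) = (1 + t) / 2 := by
  have hd : ∀ r : ℝ, 0 < 1 + t * r ^ 2 := fun r => by positivity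
  have h := intervalIntegral.integral_eq_sub_of_hasDerivAt (a := 0) (b := 1)
    (f := fun r : ℝ => (1 + t) ^ 2 / 2 * (r ^ 2 / (1 + t * r ^ 2)))
    (f' := fun r : ℝ => r * ((1 + t) ^ 2 / (1 + t * r ^ 2) ^ 2)) (fun r _ => by
      have h1 : HasDerivAt (fun r : ℝ => r ^ 2) (2 * r) r := by simpa using hasDerivAt_pow 2 r
      have h2 := (h1.div ((h1.const_mul t).const_add 1) (hd r).ne').const_mul ((1 + t) ^ 2 / 2)
      refine h2.congr_deriv ?_
      have := (hd r).ne'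
      field_simp
      ring) (Continuous.intervalIntegrable (by
      exact continuous_id.mul (continuous_const.div (by fun_prop)
        fun r => (pow_pos (hd r) 2).ne')) _ _)
  rw [h]
  have : 0 < 1 + t := by linarith
  field_simp
  try ring

theorem integral_bubble_ge {Ω : Set ℂ} (hΩ : MeasurableSet Ω) (hb : Bornology.IsBounded Ω)
    (hα : 0 < α) {β : ℝ} (hβ : 0 < β) (ht : 0 < t)
    (hsub : ∀ z, t / β ^ 2 * quad α z < t → z ∈ Ω) :
    π * β ^ 2 / α * (1 + t) ≤
      ∫ z in Ω, ex (bubble α (κ := t / β ^ 2) (by positivity) ht.le) z := by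
  have hκ : 0 ≤ t / β ^ 2 := by positivity
  have hlt : ∀ s : ℝ, t / β ^ 2 * s < t ↔ s < β ^ 2 := by
    intro s
    rw [div_mul_eq_mul_div, div_lt_iff₀ (by positivity)]
    exact mul_lt_mul_iff_right₀ ht
  set F : ℝ → ℝ := fun s => if s < β ^ 2 then (1 + t) ^ 2 / (1 + t / β ^ 2 * s) ^ 2 else 0 with hF
  have h1 : ∫ z : ℂ, F (quad α z) = π * β ^ 2 / α * (1 + t) := by
    rw [integral_comp_ellipse hα, integral_radial]
    have h2 : ∫ r in Ioi (0 : ℝ), r * F (r ^ 2) = β ^ 2 * ((1 + t) / 2) := by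
      rw [← integral_Ioo_mul_inv_sq ht.le]
      have h3 : ∫ r in Ioi (0 : ℝ), r * F (r ^ 2) =
          ∫ r in Ioi (0 : ℝ), (fun r => β * r * F ((β * r) ^ 2)) r * β := by
        have := integral_comp_mul_left_Ioi (fun r => r * F (r ^ 2)) 0 hβ
        rw [mul_zero] at this
        rw [integral_mul_const, this, smul_eq_mul]
        field_simp
      rw [h3, intervalIntegral.integral_of_le zero_le_one,
        integral_Ioc_eq_integral_Ioo, ← integral_const_mul,
        ← integral_indicator measurableSet_Ioi, ← integral_indicator measurableSet_Ioo]
      congr 1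
      ext r
      by_cases h0 : 0 < r
      · by_cases h4 : r < 1
        · have h5 : (β * r) ^ 2 < β ^ 2 := by
            gcongr; nlinarith
          rw [indicator_of_mem (mem_Ioi.2 h0), indicator_of_mem (mem_Ioo.2 ⟨h0, h4⟩)]
          simp only [hF, if_pos h5]
          have : t / β ^ 2 * (β * r) ^ 2 = t * r ^ 2 := by field_simp
          rw [this]; ring
        · have h5 : ¬ (β * r) ^ 2 < β ^ 2 := by
            rw [not_lt]; push Not at h4; gcongr; nlinarith
          rw [indicator_of_mem (mem_Ioi.2 h0), indicator_of_notMem (by simp [h4])]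
          simp [hF, if_neg h5]
      · rw [indicator_of_notMem (by simpa using h0), indicator_of_notMem (by simp [h0])]
    rw [h2]; field_simp
  rw [← h1, ← integral_indicator hΩ]
  have hcont := (ex (bubble α hκ ht.le)).continuous
  refine integral_mono_of_nonneg (ae_of_all _ fun z => ?_)
    ((integrable_indicator_iff hΩ).2 (integrableOn_of_continuous hb hcont))
    (ae_of_all _ fun z => ?_)
  · simp only [hF, Pi.zero_apply]; split_ifs <;> positivity
  · by_cases hz : quad α z < β ^ 2
    · have hz' := (hlt _).2 hz
      rw [indicator_of_mem (hsub z hz'), ex_apply,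
        (bubble_eventuallyEq hκ ht.le hz').self_of_nhds, exp_bubbleFun hκ ht.le]
      simp only [hF, if_pos hz]
      exact le_rfl
    · simp only [hF, if_neg hz]
      exact indicator_nonneg (fun z _ => by rw [ex_apply]; positivity) _

theorem quad_lt_of_isOpen {Ω : Set ℂ} (hΩ : IsOpen Ω) {B : ℝ} (hB : 0 < B)
    (h : ∀ z ∈ Ω, quad α z ≤ B) {z : ℂ} (hz : z ∈ Ω) : quad α z < B := by
  refine lt_of_le_of_ne (h z hz) fun heq => ?_
  have hc : Tendsto (fun s : ℝ => (s : ℂ) * z) (𝓝[>] 1) (𝓝 z) := by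
    have : Continuous fun s : ℝ => (s : ℂ) * z := by fun_prop
    simpa using (this.tendsto 1).mono_left nhdsWithin_le_nhds
  obtain ⟨s, hs, hs1⟩ := ((hc.eventually (hΩ.mem_nhds hz)).and self_mem_nhdsWithin).exists
  have h1 := h _ hs
  have h2 : quad α ((s : ℂ) * z) = s ^ 2 * quad α z := by simp [quad]; ring
  rw [h2, heq] at h1
  have h3 : (1 : ℝ) < s := hs1
  have h4 : 1 < s ^ 2 := by nlinarith
  nlinarith

theorem bubble_le_bubble {κ' t' : ℝ} (hκ : 0 ≤ κ) (ht : 0 ≤ t) (hκ' : 0 ≤ κ') (ht' : 0 ≤ t')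
    (htt : t ≤ t') {r r' : ℝ} (hr : 0 ≤ r) (hrr : r' ≤ r) (hk : κ = t * r)
    (hk' : κ' = t' * r') (x : ℂ) : bubble α hκ ht x ≤ bubble α hκ' ht' x := by
  have hq := quad_nonneg α x
  by_cases hx : κ * quad α x < t
  swap
  · rw [bubble_eq_zero hκ ht (not_lt.1 hx)]; exact bubble_nonneg _ _ _
  refine max_le_max ?_ le_rfl
  rw [bubbleFun, bubbleFun]
  refine mul_le_mul_of_nonneg_left ?_ zero_le_two
  have h1 := bubble_den_pos (α := α) hκ x
  have h2 := bubble_den_pos (α := α) hκ' x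
  rw [← Real.log_div (by linarith) h1.ne', ← Real.log_div (by linarith) h2.ne']
  refine Real.log_le_log (div_pos (by linarith) h1) ?_
  rw [div_le_div_iff₀ h1 h2]
  set s := r * quad α x with hs
  have hs0 : 0 ≤ s := mul_nonneg hr hq
  have hs' : r' * quad α x ≤ s := mul_le_mul_of_nonneg_right hrr hq
  have e1 : κ * quad α x = t * s := by rw [hk, hs]; ring
  have e2 : κ' * quad α x = t' * (r' * quad α x) := by rw [hk']; ring
  rw [e1, e2]
  rw [e1] at hx
  have hs1 : s ≤ 1 := by by_contra hcon; push Not at hcon; nlinarith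
  nlinarith [mul_le_mul_of_nonneg_left hs' ht', mul_nonneg (sub_nonneg.2 htt) (sub_nonneg.2 hs1),
    mul_le_mul_of_nonneg_left hs' (mul_nonneg ht ht')]

set_option maxHeartbeats 800000 in
theorem exists_bubble_branch {Ω : Set ℂ} {φ f : ℂ → ℂ} (hR : RiemannPair Ω φ f)
    (hb : Bornology.IsBounded Ω) (hα : 0 < α) (hα1 : α ≤ 1 / 2) {c βm βp γ lam : ℝ}
    (hc1 : c ≤ 1) (hm : 0 < βm) (hp : 0 < βp) (hc : c = βm ^ 2 / βp ^ 2)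
    (hin : ∀ z, quad α z ≤ βm ^ 2 → z ∈ Ω) (hout : ∀ z ∈ Ω, quad α z ≤ βp ^ 2) (hγ : 0 < γ)
    (hroot : γ ^ 2 * (8 * (1 - α ^ 2) - c * (1 + α ^ 2) ^ 2) +
      γ * (8 * (1 + α ^ 2) - 2 * c * (1 + α ^ 2) ^ 2) - c * (1 + α ^ 2) ^ 2 = 0)
    (hlam : 0 < lam) (hlam' : lam < π * c * (1 + α ^ 2) ^ 2 / (2 * α) * (1 + γ)) :
    ∃ M U μ u, 0 < M ∧ (∀ x ∈ Ω, 0 < U x) ∧ (∀ x, M * greenOp hR hb (ex U) x ≤ U x) ∧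
      0 < μ ∧ μ < M ∧ BranchSol (greenOp hR hb) U μ u ∧ μ * intCLM hb (ex u) = lam := by
  have hc0 : 0 < c := by rw [hc]; positivity
  set A := 1 + α ^ 2 with hA
  set B := 1 - α ^ 2 with hB
  have hα2 : α ^ 2 ≤ 1 / 4 := by nlinarith
  have hA1 : 1 < A := by rw [hA]; nlinarith [pow_pos hα 2]
  have hB1 : 3 / 4 ≤ B := by rw [hB]; linarith
  have hAB : A + B = 2 := by rw [hA, hB]; ring
  have hA2 : A ≤ 5 / 4 := by linarith
  have hD : 0 < 8 * B - c * A ^ 2 := by nlinarith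
  have hneg : ∀ s, 0 < s → s < γ → 8 * s * (A + s * B) < c * A ^ 2 * (1 + s) ^ 2 := by
    intro s hs hsγ
    have h1 : 0 < c * A ^ 2 := by positivity
    have h2 := mul_pos (mul_pos hD (mul_pos hs hγ)) (sub_pos.2 hsγ)
    have h3 := mul_pos h1 (sub_pos.2 hsγ)
    have h4 : γ * (8 * s * (A + s * B) - c * A ^ 2 * (1 + s) ^ 2) =
        -((8 * B - c * A ^ 2) * (s * γ) * (γ - s)) - c * A ^ 2 * (γ - s) := by
      linear_combination s * hroot
    by_contra hcon
    push Not at hcon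
    have h5 := mul_nonneg hγ.le (sub_nonneg.2 hcon)
    linarith
  set tp := A / (A + 2 * B) with htp
  have hden : 0 < A + 2 * B := by linarith
  have htp0 : 0 < tp := by positivity
  have htpe : tp * (A + 2 * B) = A := by rw [htp]; field_simp
  have htpid : 8 * tp * (A - tp * B) = A ^ 2 * (1 + tp) ^ 2 := by
    have hB' : B = 2 - A := by linarith
    have h1 : tp = A / (4 - A) := by rw [htp, hB']; ring_nf
    have h2 : (4 - A) ≠ 0 := by linarith
    rw [h1, hB']
    field_simp
    ring
  have htp_ge : ∀ s, 0 < s → s < γ → s ≤ tp := by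
    intro s hs hsγ
    by_contra hcon
    push Not at hcon
    have h1 := hneg tp htp0 (hcon.trans hsγ)
    have h2 : c * (A ^ 2 * (1 + tp) ^ 2) ≤ 1 * (A ^ 2 * (1 + tp) ^ 2) := by gcongr
    nlinarith [mul_pos (mul_pos htp0 htp0) (show 0 < B by linarith)]
  set M := A ^ 2 / (2 * βp ^ 2) with hM
  have hM0 : 0 < M := by positivity
  have hMm : M * βm ^ 2 = c * A ^ 2 / 2 := by rw [hM, hc]; field_simp
  obtain ⟨t, ht0, htγ, htl⟩ : ∃ t, 0 < t ∧ t < γ ∧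
      lam < π * c * A ^ 2 / (2 * α) * (1 + t) := by
    have h1 : Tendsto (fun t : ℝ => π * c * A ^ 2 / (2 * α) * (1 + t)) (𝓝[<] γ)
        (𝓝 (π * c * A ^ 2 / (2 * α) * (1 + γ))) :=
      ((continuous_const.mul (continuous_const.add continuous_id)).tendsto γ).mono_left
        nhdsWithin_le_nhds
    obtain ⟨t, ⟨h2, h3⟩, h4⟩ := ((h1.eventually (lt_mem_nhds hlam')).and
      (nhdsWithin_le_nhds (lt_mem_nhds hγ))).and self_mem_nhdsWithin |>.exists
    exact ⟨t, h3, h4, h2⟩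
  have hκp : 0 ≤ tp / βp ^ 2 := by positivity
  have hκm : 0 ≤ t / βm ^ 2 := by positivity
  have hlt : ∀ {s β τ : ℝ}, 0 < β → 0 < τ → (τ / β ^ 2 * s < τ ↔ s < β ^ 2) := by
    intro s β τ hβ hτ
    rw [div_mul_eq_mul_div, div_lt_iff₀ (by positivity)]
    exact mul_lt_mul_iff_right₀ hτ
  have hoff : ∀ z : ℂ, |α ^ 2 * z.re ^ 2 - z.im ^ 2| ≤ quad α z := by
    intro z
    rw [_root_.abs_le, quad]
    constructor <;> nlinarith [mul_nonneg (sq_nonneg α) (sq_nonneg z.re), sq_nonneg z.im]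
  set U := bubble α hκp htp0.le with hU
  set w := bubble α hκm ht0.le with hw
  have hΩp : ∀ z ∈ Ω, tp / βp ^ 2 * quad α z < tp := fun z hz =>
    (hlt hp htp0).2 (quad_lt_of_isOpen hR.isOpen (by positivity) hout hz)
  have hUpos : ∀ x ∈ Ω, 0 < U x := fun x hx => by
    rw [hU, (bubble_eventuallyEq hκp htp0.le (hΩp x hx)).self_of_nhds]
    exact bubbleFun_pos hκp (hΩp x hx)
  have hsup : ∀ x, M * greenOp hR hb (ex U) x ≤ U x := by
    refine bubble_super hR hb hκp htp0.le hΩp fun z hz => ?_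
    have h1 := (hΩp z hz).le
    have h2 := (_root_.abs_le.1 (hoff z)).1
    have h3 : -tp ≤ tp / βp ^ 2 * (α ^ 2 * z.re ^ 2 - z.im ^ 2) := by
      linarith [mul_le_mul_of_nonneg_left h2 hκp]
    have h4 : M * (1 + tp) ^ 2 = 4 * (tp / βp ^ 2) * (A - tp * B) := by
      rw [hM, div_mul_eq_mul_div, ← htpid]; field_simp; ring
    rw [h4]
    refine mul_le_mul_of_nonneg_left ?_ (by positivity)
    nlinarith [mul_le_mul_of_nonneg_left h3 (show 0 ≤ B by linarith)]
  have hΩm : ∀ z, t / βm ^ 2 * quad α z < t → z ∈ Ω := fun z hz => hin z ((hlt hm ht0).1 hz).le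
  have hmass := integral_bubble_ge hR.isOpen.measurableSet hb hα hm ht0 hΩm
  set J := π * βm ^ 2 / α * (1 + t) with hJ
  have hJ0 : 0 < J := by positivity
  set ν := max (4 * t * (A + t * B) / (βm ^ 2 * (1 + t) ^ 2)) (lam / J) with hν
  have hν0 : 0 ≤ ν := le_max_of_le_right (by positivity)
  have hνM : ν < M := by
    refine max_lt ?_ ?_
    · rw [div_lt_iff₀ (by positivity), ← mul_assoc, hMm]
      linarith [hneg t ht0 htγ]
    · rw [div_lt_iff₀ hJ0]
      calc lam < _ := htl
        _ = M * βm ^ 2 * (π / α * (1 + t)) := by rw [hMm]; field_simp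
        _ = _ := by rw [hJ]; field_simp
  have hsubw : ∀ x, w x ≤ ν * greenOp hR hb (ex w) x := by
    refine bubble_sub hR hb hκm ht0.le hΩm hν0 fun z hz => ?_
    have h1 := hz.le
    have h2 := (_root_.abs_le.1 (hoff z)).2
    have h3 : t / βm ^ 2 * (α ^ 2 * z.re ^ 2 - z.im ^ 2) ≤ t := by
      exact (mul_le_mul_of_nonneg_left h2 hκm).trans h1
    have h4 : 4 * (t / βm ^ 2) * (A + t * B) ≤ ν * (1 + t) ^ 2 := by
      have := mul_le_mul_of_nonneg_right (le_max_left (4 * t * (A + t * B) /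
        (βm ^ 2 * (1 + t) ^ 2)) (lam / J)) (sq_nonneg (1 + t))
      refine le_trans (le_of_eq ?_) this
      field_simp
    refine le_trans (mul_le_mul_of_nonneg_left ?_ (by positivity)) h4
    nlinarith [mul_le_mul_of_nonneg_left h3 (show 0 ≤ B by linarith)]
  have hwU : ∀ x, w x ≤ U x := by
    refine bubble_le_bubble hκm ht0.le hκp htp0.le (htp_ge t ht0 htγ) (r := (βm ^ 2)⁻¹)
      (r' := (βp ^ 2)⁻¹) (by positivity) ?_ (div_eq_mul_inv _ _) (div_eq_mul_inv _ _)
    refine inv_anti₀ (by positivity) ?_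
    have : c * βp ^ 2 = βm ^ 2 := by rw [hc]; field_simp
    nlinarith [pow_pos hp 2]
  have hΛ : lam ≤ ν * intCLM hb (ex w) := by
    have h1 : lam = lam / J * J := by field_simp
    calc lam = lam / J * J := h1
      _ ≤ ν * J := mul_le_mul_of_nonneg_right (le_max_right _ _) hJ0.le
      _ ≤ _ := mul_le_mul_of_nonneg_left hmass hν0
  obtain ⟨μ, u, h1, h2, h3, h4⟩ := (greenForm hR hb).exists_branchSol_mass hM0
    (fun x => bubble_nonneg _ _ x) hUpos hsup hν0 hνM (fun x => bubble_nonneg _ _ x) hwU hsubw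
    hlam hΛ
  exact ⟨M, U, μ, u, hM0, hUpos, hsup, h1, h2, h3, h4⟩

end

section

variable {Ω : Set ℂ} {φ f : ℂ → ℂ}

theorem exists_greenOp_le_of_le_exp (hR : RiemannPair Ω φ f) (hb : Bornology.IsBounded Ω) {β : ℝ}
    (hβ : 0 ≤ β) (hβ' : β < 4 * π) : ∃ C, ∀ (g : BC) (l : ℝ), (∀ x, 0 ≤ g x) →
      (∀ x, g x ≤ Real.exp l) → ∀ x, β * greenOp hR hb g x ≤ l * intCLM hb g + C := by
  obtain ⟨C, hC0, hC⟩ := exists_integral_exp_green_le hR hb hβ hβ'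
  refine ⟨C, fun g l hg0 hgl x => ?_⟩
  obtain ⟨hi, hle⟩ := hC x
  have hgi := integrableOn_of_continuous hb g.continuous
  have h1 : ∫ y in Ω, β * (green Ω φ x y * g y) ≤
      ∫ y in Ω, (l * g y + Real.exp (β * green Ω φ x y)) := by
    refine integral_mono ((BC.integrable_green_mul hR hb g x).const_mul β)
      ((hgi.const_mul l).add hi) fun y => ?_
    have h2 := mul_le_mul_log_add_exp (hg0 y) (β * green Ω φ x y)
    have h3 : g y * Real.log (g y) ≤ g y * l := by
      rcases (hg0 y).eq_or_lt with h | h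
      · rw [← h]; simp
      · exact mul_le_mul_of_nonneg_left ((Real.log_le_log h (hgl y)).trans_eq (Real.log_exp l))
          (hg0 y)
    change β * (green Ω φ x y * g y) ≤ l * g y + Real.exp (β * green Ω φ x y)
    linarith [hg0 y]
  rw [integral_const_mul, integral_add (hgi.const_mul l) hi, integral_const_mul] at h1
  rw [greenOp_apply, intCLM_apply]
  linarith

theorem exists_green_ge_log (hR : RiemannPair Ω φ f) : ∃ r C : ℝ, 0 < r ∧ 0 < C ∧
    ball (f 0) r ⊆ Ω ∧ ∀ x ∈ ball (f 0) r, ∀ y ∈ ball (f 0) r, x ≠ y →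
      -(2 * π)⁻¹ * Real.log (C * ‖x - y‖) ≤ green Ω φ x y := by
  have h0 : f 0 ∈ Ω := hR.mapsTo_inv (by simp)
  have hφ0 : φ (f 0) = 0 := hR.right_inv 0 (by simp)
  have han : AnalyticAt ℂ φ (f 0) := hR.diff.analyticAt (hR.isOpen.mem_nhds h0)
  obtain ⟨K, s, hs, hlip⟩ := han.hasStrictDerivAt.hasStrictFDerivAt.exists_lipschitzOnWith
  have hsmall : ∀ᶠ x in 𝓝 (f 0), ‖φ x‖ < 1 / 2 := by
    have := han.continuousAt.norm
    have h2 : Tendsto (fun x => ‖φ x‖) (𝓝 (f 0)) (𝓝 0) := by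
      simpa [ContinuousAt, hφ0] using this
    exact h2.eventually (gt_mem_nhds (by norm_num))
  obtain ⟨r, hr, hsub⟩ := Metric.mem_nhds_iff.1
    (inter_mem (inter_mem hs hsmall) (hR.isOpen.mem_nhds h0))
  refine ⟨r, 4 / 3 * (K + 1), hr, by positivity, fun x hx => (hsub hx).2, fun x hx y hy hxy => ?_⟩
  obtain ⟨⟨hxs, hxn⟩, hxΩ⟩ := hsub hx
  obtain ⟨⟨hys, hyn⟩, hyΩ⟩ := hsub hy
  have hxn' : ‖φ x‖ < 1 / 2 := hxn
  have hyn' : ‖φ y‖ < 1 / 2 := hyn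
  rw [green_of_mem hxΩ hyΩ]
  have hp := hR.pd_pos hxΩ hyΩ hxy
  have h1 : ‖φ x - φ y‖ ≤ K * ‖x - y‖ := by
    simpa [dist_eq_norm] using hlip.dist_le_mul x hxs y hys
  have h2 : 3 / 4 ≤ ‖1 - conj (φ y) * φ x‖ := by
    have h3 := norm_sub_norm_le (1 : ℂ) (conj (φ y) * φ x)
    have h4 : ‖conj (φ y) * φ x‖ ≤ 1 / 2 * (1 / 2) := by
      rw [norm_mul, Complex.norm_conj]; gcongr
    rw [norm_one] at h3
    linarith
  have h3 : pd (φ x) (φ y) ≤ 4 / 3 * (K + 1) * ‖x - y‖ := by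
    rw [pd_eq, div_le_iff₀ (by linarith)]
    have h4 : 0 ≤ (K + 1 : ℝ) * ‖x - y‖ := by positivity
    nlinarith [norm_nonneg (x - y)]
  have h4 := Real.log_le_log hp h3
  have h5 : 0 ≤ (2 * π)⁻¹ := by positivity
  nlinarith

/-- A continuous bump of total mass `8π` concentrated in a small ball. -/
theorem exists_bump (x0 : ℂ) {ε : ℝ} (hε : 0 < ε) (hsub : ball x0 ε ⊆ Ω)
    (hb : Bornology.IsBounded Ω) : ∃ g : BC, (∀ x, 0 ≤ g x) ∧ (∀ x, g x ≤ 64 / ε ^ 2) ∧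
      (∀ x ∉ ball x0 ε, g x = 0) ∧ intCLM hb g = 8 * π := by
  set χ : BC := BoundedContinuousFunction.ofNormedAddCommGroup
    (fun x => max 0 (1 - dist x x0 / ε)) (by fun_prop) 1 (fun x => by
      rw [Real.norm_eq_abs, abs_of_nonneg (le_max_left _ _)]
      have : 0 ≤ dist x x0 / ε := by positivity
      exact max_le zero_le_one (by linarith)) with hχ
  have hχa : ∀ x, χ x = max 0 (1 - dist x x0 / ε) := fun _ => rfl
  have hχ0 : ∀ x, 0 ≤ χ x := fun x => le_max_left _ _
  have hχ1 : ∀ x, χ x ≤ 1 := fun x => by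
    have : 0 ≤ dist x x0 / ε := by positivity
    exact max_le zero_le_one (by linarith)
  have hm : π * ε ^ 2 / 8 ≤ intCLM hb χ := by
    have h1 : ∫ x in ball x0 (ε / 2), (1 / 2 : ℝ) ≤ ∫ x in ball x0 (ε / 2), χ x := by
      refine setIntegral_mono_on (integrableOn_const measure_ball_lt_top.ne)
        (integrableOn_of_continuous isBounded_ball χ.continuous) measurableSet_ball fun x hx => ?_
      have : dist x x0 / ε ≤ 1 / 2 := by
        rw [div_le_iff₀ hε]; rw [mem_ball] at hx; linarith
      exact le_max_of_le_right (by linarith)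
    have h2 : ∫ x in ball x0 (ε / 2), χ x ≤ ∫ x in Ω, χ x :=
      setIntegral_mono_set (integrableOn_of_continuous hb χ.continuous)
        (ae_of_all _ hχ0)
        (((ball_subset_ball (by linarith)).trans hsub : ball x0 (ε / 2) ⊆ Ω).eventuallyLE)
    rw [setIntegral_const, measureReal_def, Complex.volume_ball] at h1
    rw [intCLM_apply]
    refine le_trans (le_of_eq ?_) (h1.trans h2)
    simp [ENNReal.toReal_ofReal (show 0 ≤ ε / 2 by linarith)]
    ring
  have hm0 : 0 < intCLM hb χ := lt_of_lt_of_le (by positivity) hm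
  refine ⟨(8 * π / intCLM hb χ) • χ, fun x => ?_, fun x => ?_, fun x hx => ?_, ?_⟩
  · exact mul_nonneg (by positivity) (hχ0 x)
  · change 8 * π / intCLM hb χ * χ x ≤ _
    calc 8 * π / intCLM hb χ * χ x ≤ 8 * π / (π * ε ^ 2 / 8) * 1 := by
          gcongr
          exacts [hχ0 x, hχ1 x]
      _ = 64 / ε ^ 2 := by field_simp; norm_num
  · change 8 * π / intCLM hb χ * χ x = 0
    have : 1 ≤ dist x x0 / ε := by
      rw [le_div_iff₀ hε]; rw [mem_ball, not_lt] at hx; linarith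
    rw [hχa, max_eq_left (by linarith), mul_zero]
  · rw [map_smul, smul_eq_mul]; field_simp

theorem exists_Psi_lt (hR : RiemannPair Ω φ f) (hb : Bornology.IsBounded Ω) {t : ℝ} (ht0 : 0 < t)
    (ht : t < 1 / (8 * π)) (B : ℝ) :
    ∃ g : BC, (∀ x, 0 ≤ g x) ∧ Psi (intCLM hb) (greenOp hR hb) t g < B := by
  have hπ := Real.pi_pos
  have ht' : 32 * π ^ 2 * t < 4 * π := by
    rw [lt_div_iff₀ (by positivity)] at ht
    nlinarith
  obtain ⟨β, hβ1, hβ2⟩ := exists_between ht'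
  have hβ0 : 0 < β := lt_trans (by positivity) hβ1
  obtain ⟨C1, hC1⟩ := exists_greenOp_le_of_le_exp hR hb hβ0.le hβ2
  obtain ⟨r, C2, hr, hC20, hrΩ, hC2⟩ := exists_green_ge_log hR
  set δ := 2 - 64 * π ^ 2 * t / β with hδ
  have hδ0 : 0 < δ := by
    rw [hδ, sub_pos, div_lt_iff₀ hβ0]; linarith
  set K := t / 2 * (8 * π / β * (8 * π * Real.log 64 + C1)) + 4 * Real.log (2 * C2) - Real.log π
    with hK
  obtain ⟨ε, hεr, hε0, hεL⟩ : ∃ ε, ε < r ∧ 0 < ε ∧ K - B < δ * -Real.log ε := by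
    have h1 : Tendsto (fun ε : ℝ => δ * -Real.log ε) (𝓝[>] 0) atTop :=
      (tendsto_neg_atBot_atTop.comp Real.tendsto_log_nhdsGT_zero).const_mul_atTop hδ0
    obtain ⟨ε, ⟨h2, h3⟩, h4⟩ := (((h1.eventually_gt_atTop (K - B)).and
      (nhdsWithin_le_nhds (gt_mem_nhds hr))).and self_mem_nhdsWithin).exists
    exact ⟨ε, h3, h4, h2⟩
  set L := -Real.log ε with hL
  have hball : ball (f 0) ε ⊆ ball (f 0) r := ball_subset_ball hεr.le
  obtain ⟨g, hg0, hgle, hgoff, hgm⟩ := exists_bump (f 0) hε0 (hball.trans hrΩ) hb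
  refine ⟨g, hg0, ?_⟩
  have H := greenForm hR hb
  have hup : ∀ x, greenOp hR hb g x ≤ ((Real.log 64 + 2 * L) * (8 * π) + C1) / β := by
    intro x
    rw [le_div_iff₀ hβ0]
    have := hC1 g (Real.log 64 + 2 * L) hg0 (fun x => (hgle x).trans_eq (by
      rw [Real.exp_add, Real.exp_log (by norm_num), hL, mul_comm 2, neg_mul, Real.exp_neg,
        Real.exp_mul, Real.exp_log hε0, div_eq_mul_inv]
      norm_num)) x
    rw [hgm] at this
    linarith
  have hip : ip (intCLM hb) (greenOp hR hb) g g ≤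
      8 * π * (((Real.log 64 + 2 * L) * (8 * π) + C1) / β) := by
    set S := ((Real.log 64 + 2 * L) * (8 * π) + C1) / β
    have h1 : intCLM hb (g * greenOp hR hb g) ≤ intCLM hb (S • g) := H.mono fun x _ => by
      change g x * greenOp hR hb g x ≤ S * g x
      rw [mul_comm S]
      exact mul_le_mul_of_nonneg_left (hup x) (hg0 x)
    rw [map_smul, hgm, smul_eq_mul] at h1
    rw [ip]; linarith
  have hlow : ∀ x ∈ ball (f 0) ε, 4 * L - 4 * Real.log (2 * C2) ≤ greenOp hR hb g x := by
    intro x hx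
    have h1 : ∫ y in Ω, (2 * π)⁻¹ * (L - Real.log (2 * C2)) * g y ≤
        ∫ y in Ω, green Ω φ x y * g y := by
      refine integral_mono_ae ((integrableOn_of_continuous hb g.continuous).const_mul _)
        (BC.integrable_green_mul hR hb g x) ?_
      filter_upwards [ae_ne x] with y hxy
      by_cases hy : y ∈ ball (f 0) ε
      · refine mul_le_mul_of_nonneg_right ?_ (hg0 y)
        refine le_trans ?_ (hC2 x (hball hx) y (hball hy) hxy)
        have h2 : C2 * ‖x - y‖ ≤ 2 * C2 * ε := by
          have : ‖x - y‖ ≤ 2 * ε := by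
            rw [← dist_eq_norm]
            rw [mem_ball] at hx hy
            linarith [dist_triangle_right x y (f 0)]
          nlinarith
        have h3 := Real.log_le_log (mul_pos hC20 (norm_pos_iff.2 (sub_ne_zero.2 hxy))) h2
        rw [Real.log_mul (by positivity) hε0.ne'] at h3
        have h5 : 0 ≤ (2 * π)⁻¹ := by positivity
        nlinarith
      · rw [hgoff y hy]; simp
    rw [integral_const_mul] at h1
    rw [intCLM_apply] at hgm
    rw [hgm] at h1
    rw [greenOp_apply]
    refine le_trans (le_of_eq ?_) h1
    field_simp
    ring
  have hLZ : 2 * L - 4 * Real.log (2 * C2) + Real.log π ≤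
      LZ (intCLM hb) (greenOp hR hb) g := by
    rw [LZ]
    have hInt := integrableOn_of_continuous hb (ex (greenOp hR hb g)).continuous
    have h1 : ∫ x in ball (f 0) ε, Real.exp (4 * L - 4 * Real.log (2 * C2)) ≤
        ∫ x in ball (f 0) ε, ex (greenOp hR hb g) x := by
      refine setIntegral_mono_on (integrableOn_const measure_ball_lt_top.ne)
        (hInt.mono_set (hball.trans hrΩ)) measurableSet_ball fun x hx => ?_
      rw [ex_apply]
      exact Real.exp_le_exp.2 (hlow x hx)
    have h2 : ∫ x in ball (f 0) ε, ex (greenOp hR hb g) x ≤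
        ∫ x in Ω, ex (greenOp hR hb g) x :=
      setIntegral_mono_set hInt (ae_of_all _ fun x => by
        rw [ex_apply]; exact (Real.exp_pos _).le) (hball.trans hrΩ).eventuallyLE
    rw [setIntegral_const, measureReal_def, Complex.volume_ball] at h1
    have h3 := Real.log_le_log (by
      simp only [ENNReal.toReal_mul, ENNReal.toReal_pow, ENNReal.toReal_ofReal hε0.le,
        smul_eq_mul, ENNReal.coe_toReal, NNReal.coe_real_pi]
      positivity) (h1.trans h2)
    rw [intCLM_apply]
    refine le_trans (le_of_eq ?_) h3
    simp only [ENNReal.toReal_mul, ENNReal.toReal_pow, ENNReal.toReal_ofReal hε0.le,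
        smul_eq_mul, ENNReal.coe_toReal, NNReal.coe_real_pi]
    rw [Real.log_mul (by positivity) (Real.exp_pos _).ne', Real.log_mul (by positivity) hπ.ne',
      Real.log_exp, Real.log_pow, hL]
    push_cast
    ring
  rw [Psi]
  have h1 := mul_le_mul_of_nonneg_left hip (show 0 ≤ t / 2 by linarith)
  have h2 : t / 2 * (8 * π * (((Real.log 64 + 2 * L) * (8 * π) + C1) / β)) -
      (2 * L - 4 * Real.log (2 * C2) + Real.log π) = K - δ * L := by
    rw [hK, hδ]; field_simp; ring
  linarith

end

section

/-! ### The pseudo-hyperbolic metric and recentred Riemann maps -/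

theorem pd_mob {w z ζ : ℂ} (hw : ‖w‖ < 1) (hz : ‖z‖ < 1) (hζ : ‖ζ‖ < 1) :
    pd (mob w z) (mob w ζ) = pd z ζ := by
  have hz' : 1 - conj w * z ≠ 0 := one_sub_conj_mul_ne_zero hw hz.le
  have hζ' : 1 - conj w * ζ ≠ 0 := one_sub_conj_mul_ne_zero hw hζ.le
  have hζc : 1 - w * conj ζ ≠ 0 := by
    have := (map_ne_zero (starRingEnd ℂ)).2 hζ'
    simpa using this
  have hww : 1 - conj w * w ≠ 0 := one_sub_conj_mul_ne_zero hw hw.le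
  have e1 : mob w z - mob w ζ = (ζ - z) * (1 - conj w * w) /
      ((1 - conj w * z) * (1 - conj w * ζ)) := by
    rw [mob, mob, div_sub_div _ _ hz' hζ']
    congr 1
    ring
  have e2 : 1 - conj (mob w ζ) * mob w z = (1 - conj w * w) * (1 - conj ζ * z) /
      ((1 - w * conj ζ) * (1 - conj w * z)) := by
    rw [mob, mob, map_div₀, div_mul_div_comm]
    simp only [map_sub, map_mul, map_one, Complex.conj_conj]
    rw [eq_div_iff (mul_ne_zero hζc hz'), sub_mul, div_mul_cancel₀ _ (mul_ne_zero hζc hz')]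
    ring
  have e3 : ‖1 - w * conj ζ‖ = ‖1 - conj w * ζ‖ := by
    rw [← RCLike.norm_conj (1 - conj w * ζ)]
    simp
  have hD : 1 - conj ζ * z ≠ 0 := one_sub_conj_mul_ne_zero hζ hz.le
  rw [pd_eq, pd_eq, e1, e2, norm_div, norm_div, norm_mul, norm_mul, norm_mul, norm_mul, e3,
    norm_sub_rev ζ z]
  have h1 := norm_ne_zero_iff.2 hz'
  have h2 := norm_ne_zero_iff.2 hζ'
  have h3 := norm_ne_zero_iff.2 hww
  have h4 := norm_ne_zero_iff.2 hD
  generalize ‖1 - conj w * z‖ = A at *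
  generalize ‖1 - conj w * ζ‖ = B at *
  generalize ‖1 - conj w * w‖ = D at *
  generalize ‖1 - conj ζ * z‖ = E at *
  field_simp

theorem pd_le_norm_add {a b : ℂ} (ha : ‖a‖ < 1) (hb : ‖b‖ < 1) : pd a b ≤ ‖a‖ + ‖b‖ := by
  have hD : 0 < ‖1 - conj b * a‖ := norm_pos_iff.2 (one_sub_conj_mul_ne_zero hb ha.le)
  rcases le_or_gt 1 (‖a‖ + ‖b‖) with h | h
  · exact (pd_lt_one ha hb).le.trans h
  rw [pd_eq, div_le_iff₀ hD]
  have e := normSq_one_sub_conj_mul b a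
  have hX : ‖a - b‖ ≤ ‖a‖ + ‖b‖ := norm_sub_le _ _
  rw [norm_sub_rev] at hX ⊢
  refine abs_le_of_sq_le_sq' ?_ (by positivity) |>.2
  have hX2 : ‖b - a‖ ^ 2 ≤ (‖a‖ + ‖b‖) ^ 2 := by gcongr
  have hs : 0 ≤ 1 - (‖a‖ + ‖b‖) ^ 2 := by nlinarith [norm_nonneg a, norm_nonneg b]
  have := mul_le_mul_of_nonneg_right hX2 hs
  have hP : 1 - (‖a‖ + ‖b‖) ^ 2 ≤ (1 - ‖a‖ ^ 2) * (1 - ‖b‖ ^ 2) := by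
    nlinarith [mul_nonneg (norm_nonneg a) (norm_nonneg b), sq_nonneg (‖a‖ * ‖b‖)]
  have h2 := mul_le_mul_of_nonneg_left hP (sq_nonneg (‖a‖ + ‖b‖))
  rw [mul_pow]
  nlinarith

theorem pd_triangle {x y z : ℂ} (hx : ‖x‖ < 1) (hy : ‖y‖ < 1) (hz : ‖z‖ < 1) :
    pd x z ≤ pd x y + pd y z := by
  rw [← pd_mob hy hx hz, pd_comm y z]
  exact pd_le_norm_add (norm_mob_lt_one hy hx) (norm_mob_lt_one hy hz)

variable {Ω : Set ℂ} {φ f : ℂ → ℂ}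

theorem RiemannPair.recenter (hR : RiemannPair Ω φ f) {z0 : ℂ} (hz0 : z0 ∈ Ω) :
    RiemannPair Ω (mob (φ z0) ∘ φ) (f ∘ mob (φ z0)) where
  mapsTo := fun x hx => mem_ball_zero_iff.2 (norm_mob_lt_one (hR.norm_lt hz0) (hR.norm_lt hx))
  mapsTo_inv := fun z hz => hR.mapsTo_inv (mem_ball_zero_iff.2
    (norm_mob_lt_one (hR.norm_lt hz0) (mem_ball_zero_iff.1 hz)))
  left_inv := fun x hx => by
    simp only [Function.comp_apply]
    rw [mob_mob (hR.norm_lt hz0) (hR.norm_lt hx), hR.left_inv x hx]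
  right_inv := fun z hz => by
    have hz := mem_ball_zero_iff.1 hz
    simp only [Function.comp_apply]
    rw [hR.right_inv _ (mem_ball_zero_iff.2 (norm_mob_lt_one (hR.norm_lt hz0) hz)),
      mob_mob (hR.norm_lt hz0) hz]
  diff := (differentiableOn_mob (hR.norm_lt hz0)).comp hR.diff hR.mapsTo
  diff_inv := hR.diff_inv.comp (differentiableOn_mob (hR.norm_lt hz0)) fun z hz =>
    mem_ball_zero_iff.2 (norm_mob_lt_one (hR.norm_lt hz0) (mem_ball_zero_iff.1 hz))
  isOpen := hR.isOpen

theorem green_recenter (hR : RiemannPair Ω φ f) {z0 : ℂ} (hz0 : z0 ∈ Ω) :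
    green Ω (mob (φ z0) ∘ φ) = green Ω φ := by
  ext x y
  by_cases h : x ∈ Ω ∧ y ∈ Ω
  · rw [green_of_mem h.1 h.2, green_of_mem h.1 h.2, Function.comp_apply, Function.comp_apply,
      pd_mob (hR.norm_lt hz0) (hR.norm_lt h.1) (hR.norm_lt h.2)]
  · rw [green, green, if_neg h, if_neg h]

theorem greenOp_recenter (hR : RiemannPair Ω φ f) (hb : Bornology.IsBounded Ω) {z0 : ℂ}
    (hz0 : z0 ∈ Ω) : greenOp (hR.recenter hz0) hb = greenOp hR hb := by
  ext g x
  rw [greenOp_apply, greenOp_apply, green_recenter hR hz0]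

/-- The open pseudo-hyperbolic ball in `Ω`. -/
def pball (Ω : Set ℂ) (φ : ℂ → ℂ) (x : ℂ) (s : ℝ) : Set ℂ := {y ∈ Ω | pd (φ x) (φ y) < s}

theorem pball_subset (x : ℂ) (s : ℝ) : pball Ω φ x s ⊆ Ω := fun _ h => h.1

theorem pball_mono (x : ℂ) {s t : ℝ} (h : s ≤ t) : pball Ω φ x s ⊆ pball Ω φ x t :=
  fun _ hy => ⟨hy.1, hy.2.trans_le h⟩

theorem mem_pball_iff {z0 y : ℂ} {s : ℝ} :
    y ∈ pball Ω φ z0 s ↔ y ∈ Ω ∧ ‖(mob (φ z0) ∘ φ) y‖ < s := by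
  rw [pball, mem_sep_iff, pd_comm]
  rfl

theorem isOpen_pball (hR : RiemannPair Ω φ f) {x : ℂ} (hx : x ∈ Ω) (s : ℝ) :
    IsOpen (pball Ω φ x s) := by
  have : pball Ω φ x s = Ω ∩ (mob (φ x) ∘ φ) ⁻¹' ball 0 s := by
    ext y
    rw [mem_pball_iff, mem_inter_iff, mem_preimage, mem_ball_zero_iff]
  rw [this]
  exact (hR.recenter hx).diff.continuousOn.isOpen_inter_preimage hR.isOpen isOpen_ball

theorem measurableSet_pball (hR : RiemannPair Ω φ f) {x : ℂ} (hx : x ∈ Ω) (s : ℝ) :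
    MeasurableSet (pball Ω φ x s) := (isOpen_pball hR hx s).measurableSet

/-- Integrals over pseudo-hyperbolic balls become integrals over discs. -/
theorem RiemannPair.integral_pball (hR : RiemannPair Ω φ f) {z0 : ℂ} (hz0 : z0 ∈ Ω) {s : ℝ}
    (hs : s ≤ 1) (F : ℂ → ℝ) :
    ∫ x in pball Ω φ z0 s, F x = ∫ z in ball 0 s, pullDensity (f ∘ mob (φ z0)) F z := by
  have h := (hR.recenter hz0).integral_eq ((pball Ω φ z0 s).indicator F)
  rw [setIntegral_indicator (measurableSet_pball hR hz0 s),
    inter_eq_right.2 (pball_subset _ _)] at h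
  rw [h, ← inter_eq_right.2 (ball_subset_ball (x := (0 : ℂ)) hs),
    ← setIntegral_indicator measurableSet_ball]
  refine setIntegral_congr_fun measurableSet_ball fun z hz => ?_
  have hm := (hR.recenter hz0).mapsTo_inv hz
  have hiff : (f ∘ mob (φ z0)) z ∈ pball Ω φ z0 s ↔ z ∈ ball (0 : ℂ) s := by
    rw [mem_pball_iff, (hR.recenter hz0).right_inv z hz, mem_ball_zero_iff]
    exact and_iff_right hm
  by_cases h : z ∈ ball (0 : ℂ) s
  · simp only [indicator_of_mem (hiff.2 h), indicator_of_mem h, pullDensity]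
  · simp only [indicator_of_notMem (fun h' => h (hiff.1 h')), indicator_of_notMem h, mul_zero]

end

section

/-! ### Bounds at points without concentration of mass -/

theorem exp_integral_mul_le {X : Type*} [MeasurableSpace X] {ν : Measure X} {a ρ : X → ℝ}
    (hρ0 : ∀ x, 0 ≤ ρ x) (hρ : Integrable ρ ν) (hρ1 : ∫ x, ρ x ∂ν ≤ 1)
    (ha : Integrable (fun x => a x * ρ x) ν) (hea : Integrable (fun x => Real.exp (a x) * ρ x) ν) :
    Real.exp (∫ x, a x * ρ x ∂ν) ≤ 1 + ∫ x, Real.exp (a x) * ρ x ∂ν := by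
  set m := ∫ x, a x * ρ x ∂ν with hm
  have h1 : ∫ x, (Real.exp m * (1 - m) * ρ x + Real.exp m * (a x * ρ x)) ∂ν ≤
      ∫ x, Real.exp (a x) * ρ x ∂ν := by
    refine integral_mono ((hρ.const_mul _).fun_add (ha.const_mul _)) hea fun x => ?_
    have h2 := Real.add_one_le_exp (a x - m)
    have h3 : Real.exp m * (a x - m + 1) ≤ Real.exp (a x) := by
      calc _ ≤ Real.exp m * Real.exp (a x - m) := by gcongr
        _ = _ := by rw [← Real.exp_add]; ring_nf
    have := mul_le_mul_of_nonneg_right h3 (hρ0 x)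
    linarith
  rw [integral_add (hρ.const_mul _) (ha.const_mul _), integral_const_mul, integral_const_mul,
    ← hm] at h1
  have h4 : Real.exp m * (1 - m) ≤ 1 := by
    have h5 := Real.add_one_le_exp (-m)
    calc _ ≤ Real.exp m * Real.exp (-m) := by gcongr; linarith
      _ = 1 := by rw [← Real.exp_add]; simp
  have h6 : 0 ≤ ∫ x, ρ x ∂ν := integral_nonneg hρ0
  nlinarith [mul_nonneg (sub_nonneg.2 h4) (sub_nonneg.2 hρ1)]

variable {Ω : Set ℂ} {φ f : ℂ → ℂ}

theorem green_le_of_le_pd {x y : ℂ} (hx : x ∈ Ω) (hy : y ∈ Ω) {s : ℝ} (hs : 0 < s)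
    (h : s ≤ pd (φ x) (φ y)) : green Ω φ x y ≤ -(2 * π)⁻¹ * Real.log s := by
  rw [green_of_mem hx hy]
  have h1 := Real.log_le_log hs h
  have h2 : 0 < (2 * π)⁻¹ := by positivity
  nlinarith

/-- A solution of the Liouville equation is bounded at every point around which it has mass at
most `3 * π`. -/
theorem exists_light_bound (hR : RiemannPair Ω φ f) (hb : Bornology.IsBounded Ω) {s : ℝ}
    (hs : 0 < s) (hs1 : s ≤ 1) {Λ μ₀ : ℝ} (hμ₀ : 0 ≤ μ₀) : ∃ C, ∀ (g : BC) (μ : ℝ), 0 ≤ μ → μ ≤ μ₀ →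
      g = μ • ex (greenOp hR hb g) → intCLM hb g ≤ Λ → ∀ x ∈ Ω,
        ∫ y in pball Ω φ x s, g y ≤ 3 * π → greenOp hR hb g x ≤ C := by
  obtain ⟨C₁, hC₁0, hC₁⟩ := exists_integral_exp_green_le hR hb zero_le_one
    (by linarith [Real.pi_gt_three] : (1 : ℝ) < 4 * π)
  obtain ⟨C₂, hC₂0, hC₂⟩ := exists_integral_exp_green_le hR hb
    (by positivity : (0 : ℝ) ≤ 5 / 4 * (3 * π)) (by linarith [Real.pi_pos])
  set L : ℝ := -(2 * π)⁻¹ * Real.log (s / 2) with hL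
  have hL0 : 0 ≤ L := by
    have h1 : Real.log (s / 2) ≤ 0 := Real.log_nonpos (by positivity) (by linarith)
    have h2 : 0 < (2 * π)⁻¹ := by positivity
    nlinarith
  have : IsFiniteMeasure (volume.restrict Ω) := ⟨by simpa using hb.measure_lt_top⟩
  refine ⟨L * Λ + μ₀ * Real.exp (L * Λ) * (4 * (volume.real Ω + C₂) + C₁),
    fun g μ hμ0 hμ hg hgΛ x hx hmass => ?_⟩
  set T := greenOp hR hb
  have hgpos : ∀ y, 0 ≤ g y := fun y => by
    rw [hg]; simp only [BoundedContinuousFunction.coe_smul, ex_apply, smul_eq_mul]; positivity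
  have hgi := integrableOn_of_continuous hb g.continuous
  set B := pball Ω φ x s with hB
  have hBm : MeasurableSet B := measurableSet_pball hR hx s
  set ρ : ℂ → ℝ := fun w => (3 * π)⁻¹ * B.indicator g w with hρ
  have hρm : Measurable ρ := (g.continuous.measurable.indicator hBm).const_mul _
  have hρ0 : ∀ w, 0 ≤ ρ w := fun w =>
    mul_nonneg (by positivity) (indicator_nonneg (fun y _ => hgpos y) w)
  have hρi : IntegrableOn ρ Ω := (hgi.indicator hBm).const_mul _
  have hρ1 : ∫ w in Ω, ρ w ≤ 1 := by
    rw [hρ, integral_const_mul, setIntegral_indicator hBm, inter_eq_right.2 (pball_subset _ _),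
      inv_mul_le_iff₀ (by positivity)]
    linarith
  have hρb : ∀ w, ‖ρ w‖ ≤ (3 * π)⁻¹ * ‖g‖ := fun w => by
    rw [hρ, norm_mul, norm_of_nonneg (by positivity : 0 ≤ (3 * π)⁻¹)]
    gcongr
    exact (norm_indicator_le_norm_self _ _).trans (g.norm_coe_le_norm w)
  set β : ℝ := 5 / 4 * (3 * π) with hβ
  have hKm : Measurable fun p : ℂ × ℂ => Real.exp (β * green Ω φ p.1 p.2) :=
    Real.measurable_exp.comp ((measurable_green hR).const_mul β)
  have hKi : Integrable (fun p : ℂ × ℂ => Real.exp (β * green Ω φ p.1 p.2))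
      ((volume.restrict Ω).prod (volume.restrict Ω)) := by
    rw [integrable_prod_iff hKm.aestronglyMeasurable]
    refine ⟨Eventually.of_forall fun x => (hC₂ x).1, ?_⟩
    refine (integrable_const C₂).mono' ?_ (Eventually.of_forall fun x => ?_)
    · exact hKm.norm.aestronglyMeasurable.integral_prod_right'
    · simp only [Real.norm_of_nonneg (Real.exp_pos _).le]
      rw [Real.norm_of_nonneg (integral_nonneg fun y => (Real.exp_pos _).le)]
      exact (hC₂ x).2
  have hKρ : Integrable (fun p : ℂ × ℂ => Real.exp (β * green Ω φ p.1 p.2) * ρ p.2)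
      ((volume.restrict Ω).prod (volume.restrict Ω)) :=
    hKi.mul_bdd (hρm.comp measurable_snd).aestronglyMeasurable
      (Eventually.of_forall fun p => hρb p.2)
  set q : ℂ → ℝ := fun y => ∫ w in Ω, Real.exp (β * green Ω φ y w) * ρ w with hq
  have hqi : IntegrableOn q Ω := hKρ.integral_prod_left
  have hq1 : ∫ y in Ω, q y ≤ C₂ := by
    rw [hq, integral_integral_swap hKρ]
    have h1 : ∀ w, ∫ y in Ω, Real.exp (β * green Ω φ y w) * ρ w ≤ C₂ * ρ w := fun w => by
      rw [integral_mul_const]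
      refine mul_le_mul_of_nonneg_right ?_ (hρ0 w)
      simp only [green_comm _ w]
      exact (hC₂ w).2
    refine (integral_mono hKρ.integral_prod_right (hρi.const_mul C₂) h1).trans ?_
    rw [integral_const_mul]
    nlinarith
  have hsplit : ∀ y ∈ pball Ω φ x (s / 2), T g y ≤
      L * Λ + ∫ w in Ω, green Ω φ y w * B.indicator g w := by
    intro y hy
    have hind : IntegrableOn (fun w => green Ω φ y w * B.indicator g w) Ω := by
      refine ((BC.integrable_green_mul hR hb g y).indicator hBm).congr
        (Eventually.of_forall fun w => ?_)
      by_cases hw : w ∈ B <;> simp [hw]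
    have h1 : T g y ≤ ∫ w in Ω, (L * g w + green Ω φ y w * B.indicator g w) := by
      rw [greenOp_apply]
      refine setIntegral_mono_on (BC.integrable_green_mul hR hb g y)
        ((hgi.const_mul L).fun_add hind) hR.isOpen.measurableSet fun w hw => ?_
      by_cases hwB : w ∈ B
      · rw [indicator_of_mem hwB]
        linarith [mul_nonneg hL0 (hgpos w)]
      · rw [indicator_of_notMem hwB, mul_zero, add_zero]
        refine mul_le_mul_of_nonneg_right (green_le_of_le_pd hy.1 hw (by positivity) ?_) (hgpos w)
        have h2 : s ≤ pd (φ x) (φ w) := not_lt.1 fun h => hwB ⟨hw, h⟩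
        have h3 := pd_triangle (hR.norm_lt hx) (hR.norm_lt hy.1) (hR.norm_lt hw)
        linarith [hy.2]
    rw [integral_add (hgi.const_mul L) hind, integral_const_mul] at h1
    rw [intCLM_apply] at hgΛ
    nlinarith
  have hexp : ∀ y, Real.exp (5 / 4 * ∫ w in Ω, green Ω φ y w * B.indicator g w) ≤ 1 + q y := by
    intro y
    have h1 : 5 / 4 * ∫ w in Ω, green Ω φ y w * B.indicator g w =
        ∫ w in Ω, (β * green Ω φ y w) * ρ w := by
      rw [← integral_const_mul]
      congr 1
      ext w
      simp only [hρ, hβ]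
      field_simp
    rw [h1]
    refine exp_integral_mul_le hρ0 hρi hρ1 ?_ ?_
    · refine (((BC.integrable_green_mul hR hb g y).indicator hBm).const_mul (5 / 4)).congr
        (Eventually.of_forall fun w => ?_)
      simp only [hρ, hβ]
      by_cases hw : w ∈ B
      · simp only [indicator_of_mem hw]; field_simp
      · simp [hw]
    · exact (hC₂ y).1.mul_bdd hρm.aestronglyMeasurable (Eventually.of_forall fun p => hρb p)
  set K := μ₀ * Real.exp (L * Λ) with hK
  have hK0 : 0 ≤ K := by positivity
  have hq0 : ∀ y, 0 ≤ q y := fun y =>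
    integral_nonneg fun w => mul_nonneg (Real.exp_pos _).le (hρ0 w)
  have hC₁x := hC₁ x
  simp only [one_mul] at hC₁x
  have hfin : T g x ≤ ∫ y in Ω, (L * g y + K * (4 * (1 + q y) + Real.exp (green Ω φ x y))) := by
    have hi2 : IntegrableOn (fun y => K * (4 * (1 + q y) + Real.exp (green Ω φ x y))) Ω :=
      ((((integrable_const (1 : ℝ)).add hqi).const_mul 4).add hC₁x.1).const_mul K
    rw [greenOp_apply]
    refine setIntegral_mono_on (BC.integrable_green_mul hR hb g x)
      ((hgi.const_mul L).fun_add hi2) hR.isOpen.measurableSet fun y hy => ?_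
    by_cases hyB : y ∈ pball Ω φ x (s / 2)
    · have h1 := hsplit y hyB
      have h2 := hexp y
      set h := ∫ w in Ω, green Ω φ y w * B.indicator g w
      have h3 : g y ≤ K * Real.exp h := by
        have : g y = μ * Real.exp (T g y) := by
          conv_lhs => rw [hg]
          simp [ex_apply]
        rw [this, hK, mul_assoc, ← Real.exp_add]
        gcongr
      have h4 : green Ω φ x y * Real.exp h ≤ 4 * (1 + q y) + Real.exp (green Ω φ x y) := by
        have h5 := mul_le_mul_log_add_exp (Real.exp_pos h).le (green Ω φ x y)
        rw [Real.log_exp] at h5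
        have h6 : h ≤ 4 * Real.exp (1 / 4 * h) := by
          linarith [Real.add_one_le_exp (1 / 4 * h)]
        have h7 : Real.exp h * (4 * Real.exp (1 / 4 * h)) = 4 * Real.exp (5 / 4 * h) := by
          rw [mul_left_comm, ← Real.exp_add]; ring_nf
        have h8 := mul_le_mul_of_nonneg_left h6 (Real.exp_pos h).le
        linarith [Real.exp_pos h]
      have h9 := mul_le_mul_of_nonneg_left h3 (green_nonneg hR x y)
      have h10 := mul_le_mul_of_nonneg_left h4 hK0
      linarith [mul_nonneg hL0 (hgpos y)]
    · have h2 : green Ω φ x y ≤ L := green_le_of_le_pd hx hy (by positivity)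
        (not_lt.1 fun h => hyB ⟨hy, h⟩)
      have h3 := mul_le_mul_of_nonneg_right h2 (hgpos y)
      have h4 : 0 ≤ K * (4 * (1 + q y) + Real.exp (green Ω φ x y)) :=
        mul_nonneg hK0 (by linarith [hq0 y, Real.exp_pos (green Ω φ x y)])
      linarith
  have hi1 : IntegrableOn (fun y => 4 * (1 + q y)) Ω :=
    ((integrable_const (1 : ℝ)).add hqi).const_mul 4
  rw [integral_add (hgi.const_mul L) ((hi1.fun_add hC₁x.1).const_mul K), integral_const_mul,
    integral_const_mul, integral_add hi1 hC₁x.1, integral_const_mul,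
    integral_add (integrable_const _) hqi] at hfin
  simp only [integral_const, smul_eq_mul, mul_one, measureReal_restrict_apply_univ] at hfin
  rw [intCLM_apply] at hgΛ
  have e1 : L * ∫ y in Ω, g y ≤ L * Λ := by gcongr
  have e2 : 4 * (volume.real Ω + ∫ y in Ω, q y) + ∫ y in Ω, Real.exp (green Ω φ x y) ≤
      4 * (volume.real Ω + C₂) + C₁ := by linarith [hC₁x.2]
  have e3 := mul_le_mul_of_nonneg_left e2 hK0
  linarith

end

section

/-! ### A distortion estimate for univalent functions -/

theorem hasDerivAt_of_sq {h F : ℂ → ℂ} {F' z : ℂ} (hca : ContinuousAt h z) (h0 : h z ≠ 0)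
    (hF : HasDerivAt F F' z) (hh : ∀ y, h y ^ 2 = F y) : HasDerivAt h ((2 * h z)⁻¹ * F') z := by
  have h2 : (2 * h z) ≠ 0 := mul_ne_zero two_ne_zero h0
  rw [hasDerivAt_iff_tendsto_slope] at hF ⊢
  have hsum : Tendsto (fun y => (h y + h z)⁻¹) (𝓝[≠] z) (𝓝 (2 * h z)⁻¹) := by
    apply Tendsto.inv₀ _ h2
    have : Tendsto (fun y => h y + h z) (𝓝 z) (𝓝 (h z + h z)) := hca.tendsto.add_const _
    rw [two_mul]
    exact this.mono_left nhdsWithin_le_nhds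
  refine (hsum.mul hF).congr' ?_
  have hne : ∀ᶠ y in 𝓝[≠] z, h y + h z ≠ 0 := by
    have : ContinuousAt (fun y => h y + h z) z := hca.add continuousAt_const
    exact (this.eventually_ne (by simpa [two_mul] using h2)).filter_mono nhdsWithin_le_nhds
  filter_upwards [hne] with y hy
  simp only [slope_def_field]
  rw [← hh y, ← hh z]
  have : h y ^ 2 - h z ^ 2 = (h y + h z) * (h y - h z) := by ring
  rw [this, mul_div_assoc, inv_mul_cancel_left₀ hy]

variable {Ω : Set ℂ} {φ f : ℂ → ℂ}

theorem RiemannPair.norm_deriv_deriv_zero_le (hR : RiemannPair Ω φ f)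
    (hb : Bornology.IsBounded Ω) : ‖deriv (deriv f) 0‖ ≤ 28800 * ‖deriv f 0‖ := by
  have h0D : (0 : ℂ) ∈ ball (0 : ℂ) 1 := by simp
  have h0 : f 0 ∈ Ω := hR.mapsTo_inv h0D
  have hφ0 : φ (f 0) = 0 := hR.right_inv 0 h0D
  have hne : (Ωᶜ).Nonempty := by
    by_contra h
    rw [not_nonempty_iff_eq_empty, compl_empty_iff] at h
    exact NormedSpace.unbounded_univ ℝ ℂ (h ▸ hb)
  obtain ⟨w, hw, hwd⟩ := hR.isOpen.isClosed_compl.exists_infDist_eq_dist hne (f 0)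
  set d := dist (f 0) w with hd
  have hd0 : 0 < d := dist_pos.2 fun h => hw (h ▸ h0)
  have hball : ball (f 0) d ⊆ Ω := by
    intro x hx
    by_contra hxΩ
    have h1 := infDist_le_dist_of_mem (x := f 0) (show x ∈ Ωᶜ from hxΩ)
    rw [hwd, dist_comm] at h1
    exact absurd (mem_ball.1 hx) (not_lt.2 h1)
  have hf' : d ≤ ‖deriv f 0‖ := by
    have h1 : ‖deriv φ (f 0)‖ ≤ 1 / d := by
      refine Complex.norm_deriv_le_div_of_mapsTo_ball (hR.diff.mono hball) (fun x hx => ?_) hd0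
      rw [hφ0]
      exact ball_subset_closedBall (hR.mapsTo (hball hx))
    have h2 := congrArg norm (hR.deriv_mul_deriv h0)
    rw [hφ0, norm_mul, norm_one] at h2
    rw [le_div_iff₀ hd0] at h1
    nlinarith [norm_nonneg (deriv f 0), norm_nonneg (deriv φ (f 0))]
  have hsc : IsSimplyConnected (ball (0 : ℂ) 1) := by
    have := (convex_ball (0 : ℂ) 1).contractibleSpace ⟨0, h0D⟩
    exact (inferInstance : SimplyConnectedSpace (ball (0 : ℂ) 1))
  obtain ⟨h, hhc, hh⟩ := Complex.exists_continuousOn_pow_eq hsc isOpen_ball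
    (hR.diff_inv.sub_const w).continuousOn
    (by
      rintro ⟨z, hz, hz'⟩
      exact hw (by rw [← sub_eq_zero.1 hz']; exact hR.mapsTo_inv hz)) two_ne_zero
  have hfw : ∀ z ∈ ball (0 : ℂ) 1, f z - w ≠ 0 := fun z hz hz' =>
    hw (by rw [← sub_eq_zero.1 hz']; exact hR.mapsTo_inv hz)
  have hh0 : ∀ z ∈ ball (0 : ℂ) 1, h z ≠ 0 := fun z hz hz' =>
    hfw z hz (by rw [← hh, hz']; simp)
  have hhd : DifferentiableOn ℂ h (ball 0 1) := fun z hz =>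
    (hasDerivAt_of_sq (hhc.continuousAt (isOpen_ball.mem_nhds hz)) (hh0 z hz)
      ((hR.hasDerivAt_inv hz).sub_const w) hh).differentiableAt.differentiableWithinAt
  set e := √d with he
  have he0 : 0 < e := Real.sqrt_pos.2 hd0
  have hee : e * e = d := Real.mul_self_sqrt hd0.le
  have hnh0 : ‖h 0‖ = e := by
    have h1 : ‖h 0‖ ^ 2 = d := by rw [← norm_pow, hh, hd, dist_eq_norm]
    rw [he, ← h1, Real.sqrt_sq (norm_nonneg _)]
  set s := 2 / 5 * e with hs
  have hin : ∀ u ∈ ball (h 0) s, u ^ 2 + w ∈ Ω := by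
    intro u hu
    apply hball
    rw [mem_ball, dist_eq_norm] at hu ⊢
    have e1 : u ^ 2 + w - f 0 = (u - h 0) * (u - h 0 + (h 0 + h 0)) := by
      have := hh 0
      linear_combination this
    rw [e1, norm_mul]
    have h2 : ‖u - h 0 + (h 0 + h 0)‖ ≤ s + 2 * e := by
      refine (norm_add_le _ _).trans ?_
      have := norm_add_le (h 0) (h 0)
      linarith
    calc _ ≤ s * (s + 2 * e) := by gcongr
      _ < d := by rw [hs, ← hee]; nlinarith
  have hsec : EqOn (fun u => h (φ (u ^ 2 + w))) (fun u => u) (ball (h 0) s) := by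
    refine IsPreconnected.eq_of_sq_eq (convex_ball _ _).isPreconnected ?_ continuousOn_id ?_ ?_
      (mem_ball_self (by positivity)) ?_
    · exact hhc.comp (hR.diff.continuousOn.comp (by fun_prop) hin)
        fun u hu => hR.mapsTo (hin u hu)
    · intro u hu
      simp only [Pi.pow_apply]
      rw [hh, hR.left_inv _ (hin u hu)]
      simp
    · intro u hu h1
      rw [h1, mem_ball, dist_eq_norm, zero_sub, norm_neg, hnh0, hs] at hu
      linarith
    · rw [hh]
      simp [hφ0]
  have hlow : ∀ z ∈ ball (0 : ℂ) 1, s ≤ ‖h z + h 0‖ := by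
    intro z hz
    by_contra hlt
    have hm : -h z ∈ ball (h 0) s := by
      rw [mem_ball, dist_eq_norm, ← norm_neg]
      simpa [add_comm] using not_le.1 hlt
    have h1 := hsec hm
    simp only [neg_sq] at h1
    rw [hh] at h1
    simp only [sub_add_cancel, hR.right_inv z hz] at h1
    exact hh0 z hz (self_eq_neg.1 h1)
  have hs0 : 0 < s := by positivity
  have hkd : DifferentiableOn ℂ (fun z => (h z + h 0)⁻¹) (ball 0 1) :=
    (hhd.add_const _).inv fun z hz h1 => by
      have := hlow z hz
      rw [h1, norm_zero] at this
      linarith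
  have hkb : ∀ z ∈ ball (0 : ℂ) 1, ‖(h z + h 0)⁻¹‖ ≤ s⁻¹ := fun z hz => by
    rw [norm_inv]
    exact inv_anti₀ hs0 (hlow z hz)
  have hk0 : ‖(h 0 + h 0)⁻¹‖ = (2 * e)⁻¹ := by
    rw [norm_inv, ← two_mul, norm_mul, hnh0]; simp
  have hup : ∀ z ∈ closedBall (0 : ℂ) (1 / 24), ‖f z - w‖ ≤ 25 * d := by
    intro z hz
    have hz1 : ‖z‖ ≤ 1 / 24 := by simpa using hz
    have hzD : z ∈ ball (0 : ℂ) 1 := by rw [mem_ball_zero_iff]; linarith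
    have h1 := Complex.dist_le_div_mul_dist_of_mapsTo_ball (R₂ := s⁻¹ + s⁻¹) hkd (fun y hy => by
      rw [mem_closedBall, dist_eq_norm]
      exact (norm_sub_le _ _).trans (add_le_add (hkb y hy) (hkb 0 h0D))) hzD
    rw [dist_eq_norm, dist_zero_right, div_one] at h1
    have h2 : (s⁻¹ + s⁻¹) * ‖z‖ ≤ (s⁻¹ + s⁻¹) * (1 / 24) := by gcongr
    have h3 : s⁻¹ = 5 / 2 * e⁻¹ := by rw [hs, mul_inv]; norm_num
    have h4 : ‖(h 0 + h 0)⁻¹‖ ≤ ‖(h z + h 0)⁻¹‖ + ‖(h z + h 0)⁻¹ - (h 0 + h 0)⁻¹‖ := by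
      have := norm_sub_le (h z + h 0)⁻¹ ((h z + h 0)⁻¹ - (h 0 + h 0)⁻¹)
      simpa using this
    have hei : 0 < e⁻¹ := by positivity
    have h5 : (4 * e)⁻¹ ≤ ‖(h z + h 0)⁻¹‖ := by
      rw [hk0, mul_inv] at h4
      rw [h3] at h1 h2
      rw [mul_inv]
      norm_num at h4 ⊢
      nlinarith
    have h6 : ‖h z + h 0‖ ≤ 4 * e := by
      rw [norm_inv] at h5
      exact (inv_le_inv₀ (by positivity) (hs0.trans_le (hlow z hzD))).1 h5
    have h7 : ‖h z‖ ≤ 5 * e := by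
      have := norm_sub_le (h z + h 0) (h 0)
      rw [add_sub_cancel_right, hnh0] at this
      linarith
    rw [← hh, norm_pow, ← hee]
    nlinarith [norm_nonneg (h z)]
  have hdc : DiffContOnCl ℂ (fun z => f z - w) (ball 0 (1 / 24)) := by
    refine DifferentiableOn.diffContOnCl ?_
    rw [closure_ball _ (by norm_num)]
    exact (hR.diff_inv.mono (closedBall_subset_ball (by norm_num))).sub_const w
  have hC := Complex.norm_iteratedDeriv_le_of_forall_mem_sphere_norm_le 2 (by norm_num) hdc
    fun z hz => hup z (sphere_subset_closedBall hz)
  rw [iteratedDeriv_succ, iteratedDeriv_one] at hC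
  have hdd : deriv (fun z => f z - w) = deriv f := by ext z; exact deriv_sub_const w
  rw [hdd] at hC
  norm_num [Nat.factorial] at hC
  linarith

theorem RiemannPair.norm_deriv_deriv_le (hR : RiemannPair Ω φ f)
    (hb : Bornology.IsBounded Ω) {a : ℂ} (ha : ‖a‖ ≤ 1 / 2) :
    ‖deriv (deriv f) a‖ ≤ 57600 * ‖deriv f a‖ := by
  have hin : ∀ z ∈ ball (0 : ℂ) 1, a + z / 2 ∈ ball (0 : ℂ) 1 := fun z hz => by
    rw [mem_ball_zero_iff] at hz ⊢
    have := norm_add_le a (z / 2)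
    rw [norm_div, Complex.norm_ofNat] at this
    linarith
  have hR' : RiemannPair (Ω ∩ φ ⁻¹' ball a (1 / 2)) (fun x => 2 * (φ x - a))
      (fun z => f (a + z / 2)) :=
    { mapsTo := fun x hx => by
        have h1 : ‖φ x - a‖ < 1 / 2 := by simpa [dist_eq_norm] using hx.2
        rw [mem_ball_zero_iff, norm_mul, Complex.norm_ofNat]
        linarith
      mapsTo_inv := fun z hz => by
        refine ⟨hR.mapsTo_inv (hin z hz), ?_⟩
        rw [mem_preimage, hR.right_inv _ (hin z hz), mem_ball, dist_eq_norm, add_sub_cancel_left,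
          norm_div, Complex.norm_ofNat]
        rw [mem_ball_zero_iff] at hz
        linarith
      left_inv := fun x hx => by
        rw [mul_div_cancel_left₀ _ two_ne_zero, add_sub_cancel, hR.left_inv x hx.1]
      right_inv := fun z hz => by
        rw [hR.right_inv _ (hin z hz)]
        ring
      diff := ((hR.diff.mono inter_subset_left).sub_const a).const_mul 2
      diff_inv := hR.diff_inv.comp (by fun_prop) hin
      isOpen := hR.diff.continuousOn.isOpen_inter_preimage hR.isOpen isOpen_ball }
  have h := hR'.norm_deriv_deriv_zero_le (hb.subset inter_subset_left)
  have hd1 : ∀ z ∈ ball (0 : ℂ) 1, deriv (fun z => f (a + z / 2)) z =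
      deriv f (a + z / 2) * (1 / 2) := fun z hz => by
    have h1 : HasDerivAt (fun z : ℂ => a + z / 2) (1 / 2) z :=
      ((hasDerivAt_id z).div_const 2).const_add a
    exact ((hR.hasDerivAt_inv (hin z hz)).comp z h1).deriv
  have hd2 : deriv (deriv fun z => f (a + z / 2)) 0 = deriv (deriv f) a * (1 / 2) * (1 / 2) := by
    have h1 : HasDerivAt (fun z : ℂ => a + z / 2) (1 / 2) 0 :=
      ((hasDerivAt_id 0).div_const 2).const_add a
    have haD : a + 0 / 2 ∈ ball (0 : ℂ) 1 := hin 0 (by simp)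
    have h2 : HasDerivAt (deriv f) (deriv (deriv f) (a + 0 / 2)) (a + 0 / 2) :=
      ((hR.diff_inv.deriv isOpen_ball).differentiableAt (isOpen_ball.mem_nhds haD)).hasDerivAt
    have h3 := ((h2.comp 0 h1).mul_const (1 / 2)).congr_of_eventuallyEq
      (f₁ := deriv fun z => f (a + z / 2)) (by
        filter_upwards [isOpen_ball.mem_nhds (show (0 : ℂ) ∈ ball (0 : ℂ) 1 by simp)] with z hz
        exact hd1 z hz)
    rw [h3.deriv]
    simp
  rw [hd2, hd1 0 (by simp)] at h
  simp only [norm_mul, zero_div, add_zero] at h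
  norm_num at h
  linarith

end

/-! ### A local Pohozaev identity -/

theorem exists_dilation_field : ∃ K : NNReal, ∀ r : ℝ, 0 < r → ∃ X : ℂ → ℂ, ContDiff ℝ 1 X ∧
    LipschitzWith K X ∧ (∀ z ∈ ball (0 : ℂ) (r / 2), X z = z) ∧ (∀ z, r ≤ ‖z‖ → X z = 0) ∧
    ∀ z, ‖X z‖ ≤ r := by
  let χ : ContDiffBump (0 : ℂ) := ⟨1 / 2, 1, by norm_num, by norm_num⟩
  have hcd : ContDiff ℝ 1 fun z : ℂ => ((χ z : ℝ) : ℂ) * z :=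
    (Complex.ofRealCLM.contDiff.comp χ.contDiff).mul contDiff_id
  have hcs : HasCompactSupport fun z : ℂ => ((χ z : ℝ) : ℂ) * z :=
    (χ.hasCompactSupport.comp_left (g := ((↑) : ℝ → ℂ)) Complex.ofReal_zero).mul_right
  obtain ⟨K, hK⟩ := hcd.lipschitzWith_of_hasCompactSupport hcs one_ne_zero
  refine ⟨K, fun r hr => ⟨fun z => r * (((χ (z / r) : ℝ) : ℂ) * (z / r)), ?_, ?_, ?_, ?_, ?_⟩⟩
  · exact contDiff_const.mul (hcd.comp (contDiff_id.div_const (r : ℂ)))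
  · refine LipschitzWith.of_dist_le_mul fun z w => ?_
    have h := hK.dist_le_mul (z / r) (w / r)
    rw [dist_eq_norm, dist_eq_norm] at h ⊢
    rw [← mul_sub, norm_mul, Complex.norm_real, Real.norm_of_nonneg hr.le]
    rw [← sub_div, norm_div, Complex.norm_real, Real.norm_of_nonneg hr.le] at h
    calc _ ≤ r * (K * (‖z - w‖ / r)) := by gcongr
      _ = _ := by field_simp
  · intro z hz
    rw [mem_ball_zero_iff] at hz
    have h1 : χ (z / r) = 1 := by
      apply χ.one_of_mem_closedBall
      rw [mem_closedBall_zero_iff, norm_div, Complex.norm_real, Real.norm_of_nonneg hr.le,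
        div_le_iff₀ hr]
      change ‖z‖ ≤ 1 / 2 * r
      linarith
    have : (r : ℂ) ≠ 0 := by exact_mod_cast hr.ne'
    simp only [h1, Complex.ofReal_one, one_mul]
    field_simp
  · intro z hz
    have h1 : χ (z / r) = 0 := by
      apply χ.zero_of_le_dist
      rw [dist_zero_right, norm_div, Complex.norm_real, Real.norm_of_nonneg hr.le]
      change 1 ≤ ‖z‖ / r
      rwa [le_div_iff₀ hr, one_mul]
    simp [h1]
  · intro z
    rw [norm_mul, norm_mul, Complex.norm_real, Complex.norm_real, Real.norm_of_nonneg hr.le,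
      Real.norm_of_nonneg χ.nonneg]
    have h2 : χ (z / r) * ‖z / (r : ℂ)‖ ≤ 1 := by
      rcases le_or_gt 1 ‖z / (r : ℂ)‖ with h | h
      · have h1 : χ (z / r) = 0 := χ.zero_of_le_dist (by rw [dist_zero_right]; exact h)
        rw [h1, zero_mul]; exact zero_le_one
      · exact mul_le_one₀ χ.le_one (norm_nonneg _) h.le
    nlinarith

theorem dbar_ofReal_mul {k : ℂ → ℝ} {W : ℂ → ℂ} {q z : ℂ} (hk : HasFDerivAt k (reMul q) z)
    (hW : DifferentiableAt ℝ W z) :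
    dbar (fun z => (k z : ℂ) * W z) z = conj q * W z + k z * dbar W z := by
  have h1 : HasFDerivAt (fun z => (k z : ℂ)) (Complex.ofRealCLM ∘L reMul q) z :=
    Complex.ofRealCLM.hasFDerivAt.comp z hk
  rw [dbar, (h1.fun_mul hW.hasFDerivAt).fderiv, dbar]
  simp only [add_apply, smul_apply, ContinuousLinearMap.comp_apply, Complex.ofRealCLM_apply,
    reMul_apply, smul_eq_mul]
  have h2 : (((q * 1).re : ℝ) : ℂ) + Complex.I * (((q * Complex.I).re : ℝ) : ℂ) = conj q := by
    apply Complex.ext <;> simp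
  rw [← h2]
  ring

theorem norm_dbar_le {W : ℂ → ℂ} {K : NNReal} (hW : LipschitzWith K W) (z : ℂ) :
    ‖dbar W z‖ ≤ 2 * K := by
  have h := norm_fderiv_le_of_lipschitz ℝ hW (x₀ := z)
  have h1 := (fderiv ℝ W z).le_opNorm 1
  have h2 := (fderiv ℝ W z).le_opNorm Complex.I
  rw [norm_one, mul_one] at h1
  rw [Complex.norm_I, mul_one] at h2
  calc _ ≤ ‖fderiv ℝ W z 1‖ + ‖Complex.I * fderiv ℝ W z Complex.I‖ := norm_add_le _ _
    _ ≤ _ := by rw [norm_mul, Complex.norm_I, one_mul]; linarith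

theorem dbar_conj_of_eventuallyEq {X : ℂ → ℂ} {z : ℂ} (h : X =ᶠ[𝓝 z] fun z => z) :
    dbar (fun z => conj (X z)) z = 2 := by
  have h1 : (fun z => conj (X z)) =ᶠ[𝓝 z] fun z => conj z := h.mono fun w hw => by simp only [hw]
  rw [dbar_congr h1, dbar]
  have : HasFDerivAt (fun z : ℂ => conj z) (Complex.conjCLE : ℂ →L[ℝ] ℂ) z :=
    Complex.conjCLE.hasFDerivAt
  rw [this.fderiv]
  simp
  norm_num

theorem integrable_prod_inv {R : ℝ} {a b : ℂ → ℂ} (ha : ContinuousOn a (closedBall 0 R))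
    (hb : ContinuousOn b (closedBall 0 R)) :
    Integrable (fun p : ℂ × ℂ => (p.1 - p.2)⁻¹ * (a p.1 * b p.2))
      ((volume.restrict (ball (0 : ℂ) R)).prod (volume.restrict (ball (0 : ℂ) R))) := by
  obtain ⟨C, hC0, hC⟩ := exists_integral_norm_rpow_le (Ω := ball (0 : ℂ) R)
    measure_ball_lt_top.ne zero_le_one one_lt_two
  have : IsFiniteMeasure (volume.restrict (ball (0 : ℂ) R)) := ⟨by
    rw [Measure.restrict_apply_univ]; exact measure_ball_lt_top⟩
  have hm : Measurable fun p : ℂ × ℂ => (p.1 - p.2)⁻¹ := by fun_prop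
  obtain ⟨A, hA⟩ := (isCompact_closedBall (0 : ℂ) R).exists_bound_of_continuousOn ha
  obtain ⟨B, hB⟩ := (isCompact_closedBall (0 : ℂ) R).exists_bound_of_continuousOn hb
  have ham := (ha.mono ball_subset_closedBall).aestronglyMeasurable (μ := volume)
    (measurableSet_ball (x := (0 : ℂ)) (ε := R))
  have hbm := (hb.mono ball_subset_closedBall).aestronglyMeasurable (μ := volume)
    (measurableSet_ball (x := (0 : ℂ)) (ε := R))
  refine Integrable.mul_bdd (c := A * B) ?_ (ham.comp_fst.mul hbm.comp_snd) ?_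
  · simp only [Real.rpow_neg_one] at hC
    rw [integrable_prod_iff hm.aestronglyMeasurable]
    refine ⟨Eventually.of_forall fun x => ?_, ?_⟩
    · refine (hC x).1.mono' (by fun_prop) (Eventually.of_forall fun y => ?_)
      rw [norm_inv]
    · refine (integrable_const C).mono' hm.norm.aestronglyMeasurable.integral_prod_right'
        (Eventually.of_forall fun x => ?_)
      simp only [norm_inv]
      rw [Real.norm_of_nonneg (integral_nonneg fun y => by positivity)]
      exact (hC x).2
  · rw [Measure.prod_restrict]
    filter_upwards [ae_restrict_mem (measurableSet_ball.prod measurableSet_ball)] with p hp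
    rw [norm_mul]
    have h1 := hA p.1 (ball_subset_closedBall hp.1)
    exact mul_le_mul h1 (hB p.2 (ball_subset_closedBall hp.2)) (norm_nonneg _)
      ((norm_nonneg _).trans h1)

theorem ae_prod_ne (μ ν : Measure ℂ) [SFinite μ] [SFinite ν] [NullSingletonClass ν] :
    ∀ᵐ p ∂μ.prod ν, p.1 ≠ p.2 := by
  have hs : MeasurableSet {p : ℂ × ℂ | p.1 = p.2} := measurableSet_eq_fun measurable_fst measurable_snd
  rw [ae_iff]
  simp only [not_not]
  rw [Measure.measure_prod_null hs]
  refine Eventually.of_forall fun x => ?_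
  have : Prod.mk x ⁻¹' {p : ℂ × ℂ | p.1 = p.2} = {x} := by ext y; simp [eq_comm]
  simp [this]

/-- The symmetrised interaction energy of a dilation field. -/
theorem norm_interaction_sub_le {R r : ℝ} {K : NNReal} {X : ℂ → ℂ} (hX : LipschitzWith K X)
    (hXr : ∀ z ∈ ball (0 : ℂ) (r / 2), X z = z)
    {k : ℂ → ℝ} (hk : ContinuousOn k (closedBall 0 R)) (hk0 : ∀ z ∈ ball (0 : ℂ) R, 0 ≤ k z) :
    ‖2 * (∫ z in ball (0 : ℂ) R, k z * X z * ∫ ζ in ball (0 : ℂ) R, (z - ζ)⁻¹ * k ζ) -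
      (∫ z in ball (0 : ℂ) R, k z : ℝ) ^ 2‖ ≤
    (K + 1) * (2 * (∫ z in ball (0 : ℂ) R \ ball 0 (r / 2), k z) * ∫ z in ball (0 : ℂ) R, k z) := by
  have hfin : IsFiniteMeasure (volume.restrict (ball (0 : ℂ) R)) := ⟨by
    rw [Measure.restrict_apply_univ]; exact measure_ball_lt_top⟩
  set ν := volume.restrict (ball (0 : ℂ) R) with hν
  have hkc : ContinuousOn (fun z => (k z : ℂ)) (closedBall 0 R) :=
    Complex.continuous_ofReal.comp_continuousOn hk
  set F : ℂ × ℂ → ℂ := fun p => (p.1 - p.2)⁻¹ * ((k p.1 * X p.1) * k p.2) with hF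
  have hFi : Integrable F (ν.prod ν) :=
    integrable_prod_inv (a := fun z => k z * X z) (b := fun z => k z)
      (hkc.fun_mul hX.continuous.continuousOn) hkc
  have hJ : ∫ z in ball (0 : ℂ) R, k z * X z * ∫ ζ in ball (0 : ℂ) R, (z - ζ)⁻¹ * k ζ =
      ∫ p, F p ∂ν.prod ν := by
    rw [integral_prod _ hFi]
    congr 1
    ext z
    rw [← integral_const_mul]
    congr 1
    ext ζ
    simp only [hF]
    ring
  have hki : Integrable k ν := (hk.integrableOn_compact (isCompact_closedBall _ _)).mono_set
    ball_subset_closedBall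
  have hkci : Integrable (fun z => (k z : ℂ)) ν := hki.ofReal
  have hMM : (((∫ z in ball (0 : ℂ) R, k z : ℝ) : ℂ)) ^ 2 =
      ∫ p, (k p.1 : ℂ) * (k p.2 : ℂ) ∂ν.prod ν := by
    rw [integral_prod_mul (fun z => (k z : ℂ)) fun z => (k z : ℂ), integral_complex_ofReal, sq]
  have hFs : Integrable (fun p : ℂ × ℂ => F p.swap) (ν.prod ν) := hFi.swap
  have h2J : 2 * ∫ p, F p ∂ν.prod ν = ∫ p, (F p + F p.swap) ∂ν.prod ν := by
    rw [integral_add hFi hFs, integral_prod_swap, two_mul]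
  rw [hJ, hMM, h2J, ← integral_sub (hFi.fun_add hFs) (hkci.mul_prod hkci)]
  set S := ball (0 : ℂ) R \ ball 0 (r / 2) with hS
  have hSm : MeasurableSet S := measurableSet_ball.diff measurableSet_ball
  have hSi : Integrable (S.indicator k) ν := hki.indicator hSm
  have hSint : ∫ z, S.indicator k z ∂ν = ∫ z in S, k z := by
    rw [hν, setIntegral_indicator hSm, inter_eq_right.2 sdiff_subset]
  set G : ℂ × ℂ → ℝ := fun p => (K + 1) * (S.indicator k p.1 * k p.2 + k p.1 * S.indicator k p.2)
    with hG
  have hGi : Integrable G (ν.prod ν) := ((hSi.mul_prod hki).add (hki.mul_prod hSi)).const_mul _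
  have hGint : ∫ p, G p ∂ν.prod ν = (K + 1) * (2 * (∫ z in S, k z) * ∫ z in ball (0 : ℂ) R, k z) := by
    rw [hG, integral_const_mul, integral_add (hSi.mul_prod hki) (hki.mul_prod hSi),
      integral_prod_mul (S.indicator k) k, integral_prod_mul k (S.indicator k), hSint]
    ring
  rw [← hGint]
  refine norm_integral_le_of_norm_le hGi ?_
  have hmem : ∀ᵐ p ∂ν.prod ν, p ∈ ball (0 : ℂ) R ×ˢ ball (0 : ℂ) R := by
    rw [hν, Measure.prod_restrict]
    exact ae_restrict_mem (measurableSet_ball.prod measurableSet_ball)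
  filter_upwards [hmem, ae_prod_ne ν ν] with p hp hne
  obtain ⟨z, ζ⟩ := p
  obtain ⟨hz, hζ⟩ : z ∈ ball (0 : ℂ) R ∧ ζ ∈ ball (0 : ℂ) R := hp
  have hne' : z - ζ ≠ 0 := sub_ne_zero.2 hne
  have hne2 : ζ - z ≠ 0 := sub_ne_zero.2 (Ne.symm hne)
  have e1 : F (z, ζ) + F (z, ζ).swap - k z * k ζ =
      k z * k ζ * ((X z - X ζ) / (z - ζ) - 1) := by
    simp only [hF, Prod.swap, ← neg_sub z ζ, inv_neg]
    rw [div_eq_mul_inv]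
    ring
  have hkz := hk0 z hz
  have hkζ := hk0 ζ hζ
  have hL : ‖(X z - X ζ) / (z - ζ) - 1‖ ≤ K + 1 := by
    refine (norm_sub_le _ _).trans ?_
    rw [norm_one, norm_div]
    gcongr
    rw [div_le_iff₀ (norm_pos_iff.2 hne')]
    simpa [dist_eq_norm] using hX.dist_le_mul z ζ
  have hK1 : (0 : ℝ) ≤ K + 1 := by positivity
  rw [e1, norm_mul, norm_mul, Complex.norm_real, Complex.norm_real, Real.norm_of_nonneg hkz,
    Real.norm_of_nonneg hkζ]
  simp only [hG]
  have i1 : 0 ≤ S.indicator k z := indicator_nonneg (fun w hw => hk0 w hw.1) z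
  have i2 : 0 ≤ S.indicator k ζ := indicator_nonneg (fun w hw => hk0 w hw.1) ζ
  by_cases h1 : z ∈ S
  · rw [indicator_of_mem h1] at i1 ⊢
    have h4 := mul_le_mul_of_nonneg_left hL (mul_nonneg hkz hkζ)
    have h5 := mul_nonneg hK1 (mul_nonneg hkz i2)
    linarith
  · by_cases h2 : ζ ∈ S
    · rw [indicator_of_mem h2] at i2 ⊢
      have h4 := mul_le_mul_of_nonneg_left hL (mul_nonneg hkz hkζ)
      have h5 := mul_nonneg hK1 (mul_nonneg i1 hkζ)
      linarith
    · have h3 : X z = z := hXr z (by_contra fun h => h1 ⟨hz, h⟩)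
      have h4 : X ζ = ζ := hXr ζ (by_contra fun h => h2 ⟨hζ, h⟩)
      rw [h3, h4, div_self hne', sub_self, norm_zero, mul_zero]
      exact mul_nonneg hK1 (add_nonneg (mul_nonneg i1 hkζ) (mul_nonneg hkz i2))

theorem norm_diskGrad_sub_le {k : ℂ → ℝ} {r R : ℝ} (hr : 0 < r) (hrR : 2 * r ≤ R) (hR : R ≤ 1 / 2)
    (hk0 : ∀ z ∈ ball (0 : ℂ) 1, 0 ≤ k z) (hki : IntegrableOn k (ball 0 1))
    (hkc : ContinuousOn k (ball 0 1)) {z : ℂ} (hz : ‖z‖ < r) :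
    ‖-(2 * π) * diskGrad k z - ∫ ζ in ball (0 : ℂ) R, (z - ζ)⁻¹ * k ζ‖ ≤
      4 / R * ∫ ζ in ball (0 : ℂ) 1, k ζ := by
  have hz1 : z ∈ ball (0 : ℂ) 1 := by rw [mem_ball_zero_iff]; linarith
  have hR0 : 0 < R := by linarith
  have hBD : ball (0 : ℂ) R ⊆ ball 0 1 := ball_subset_ball (by linarith)
  set h : ℂ → ℂ := fun ζ => conj ζ * (1 - z * conj ζ)⁻¹ * k ζ with hh
  have hlow : ∀ ζ ∈ ball (0 : ℂ) 1, 1 / 2 ≤ ‖1 - z * conj ζ‖ := fun ζ hζ => by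
    rw [mem_ball_zero_iff] at hζ
    have h1 := norm_sub_norm_le (1 : ℂ) (z * conj ζ)
    rw [norm_one, norm_mul, RCLike.norm_conj] at h1
    nlinarith [norm_nonneg z, norm_nonneg ζ]
  have hbd : ∀ ζ ∈ ball (0 : ℂ) 1, ‖h ζ‖ ≤ 2 / R * k ζ := fun ζ hζ => by
    have h1 := hlow ζ hζ
    have h2 := hk0 ζ hζ
    rw [mem_ball_zero_iff] at hζ
    rw [hh]
    simp only [norm_mul, norm_inv, RCLike.norm_conj, Complex.norm_real, Real.norm_of_nonneg h2]
    refine mul_le_mul_of_nonneg_right ?_ h2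
    rw [← div_eq_mul_inv, div_le_div_iff₀ (by linarith) hR0]
    nlinarith [norm_nonneg ζ]
  have hhc : ContinuousOn h (ball 0 1) := by
    refine (Complex.continuous_conj.continuousOn.mul (ContinuousOn.inv₀ (by fun_prop)
      fun ζ hζ => ?_)).mul (Complex.continuous_ofReal.comp_continuousOn hkc)
    exact norm_pos_iff.1 (by linarith [hlow ζ hζ])
  have hhi : IntegrableOn h (ball 0 1) := (hki.const_mul (2 / R)).mono'
    (hhc.aestronglyMeasurable measurableSet_ball)
    ((ae_restrict_mem measurableSet_ball).mono fun ζ hζ => hbd ζ hζ)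
  have hgi := integrableOn_gradK_mul hki hkc hz1
  have hπ : (2 * π : ℂ) ≠ 0 := by exact_mod_cast Real.two_pi_pos.ne'
  set n : ℂ → ℂ := fun ζ => (z - ζ)⁻¹ * k ζ with hn
  have en : ∀ ζ, n ζ = -(2 * π) * (gradK z ζ * k ζ) - h ζ := fun ζ => by
    simp only [hn, hh, gradK]
    push_cast
    field_simp
    ring
  have hni : IntegrableOn n (ball 0 1) := by
    have : n = fun ζ => -(2 * π) * (gradK z ζ * k ζ) - h ζ := funext en
    rw [this]
    exact (hgi.const_mul _).sub hhi
  have e1 : -(2 * π) * diskGrad k z = (∫ ζ in ball (0 : ℂ) 1, n ζ) + ∫ ζ in ball (0 : ℂ) 1, h ζ := by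
    rw [← integral_add hni hhi, diskGrad, ← integral_const_mul]
    congr 1
    ext ζ
    rw [en]
    ring
  have e2 := setIntegral_sdiff measurableSet_ball hni hBD
  have e3 : -(2 * π) * diskGrad k z - ∫ ζ in ball (0 : ℂ) R, n ζ =
      (∫ ζ in ball (0 : ℂ) 1 \ ball 0 R, n ζ) + ∫ ζ in ball (0 : ℂ) 1, h ζ := by
    rw [e1, e2]; ring
  rw [e3]
  have b1 : ‖∫ ζ in ball (0 : ℂ) 1, h ζ‖ ≤ 2 / R * ∫ ζ in ball (0 : ℂ) 1, k ζ := by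
    rw [← integral_const_mul]
    exact norm_integral_le_of_norm_le (hki.const_mul _)
      ((ae_restrict_mem measurableSet_ball).mono fun ζ hζ => hbd ζ hζ)
  have b2 : ‖∫ ζ in ball (0 : ℂ) 1 \ ball 0 R, n ζ‖ ≤ 2 / R * ∫ ζ in ball (0 : ℂ) 1, k ζ := by
    have b3 : ‖∫ ζ in ball (0 : ℂ) 1 \ ball 0 R, n ζ‖ ≤
        ∫ ζ in ball (0 : ℂ) 1 \ ball 0 R, 2 / R * k ζ := by
      refine norm_integral_le_of_norm_le ((hki.mono_set sdiff_subset).const_mul _)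
        ((ae_restrict_mem (measurableSet_ball.diff measurableSet_ball)).mono fun ζ hζ => ?_)
      have h2 := hk0 ζ hζ.1
      have h3 : R ≤ ‖ζ‖ := by simpa using hζ.2
      have h4 := norm_sub_norm_le ζ z
      rw [norm_sub_rev] at h4
      simp only [hn, norm_mul, norm_inv, Complex.norm_real, Real.norm_of_nonneg h2]
      refine mul_le_mul_of_nonneg_right ?_ h2
      rw [inv_eq_one_div, div_le_div_iff₀ (by linarith) hR0]
      linarith
    rw [integral_const_mul] at b3
    refine b3.trans (mul_le_mul_of_nonneg_left ?_ (by positivity))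
    exact setIntegral_mono_set hki ((ae_restrict_mem measurableSet_ball).mono fun ζ hζ => hk0 ζ hζ)
      sdiff_subset.eventuallyLE
  refine (norm_add_le _ _).trans ((add_le_add b2 b1).trans (le_of_eq ?_))
  ring

theorem exists_virial_bound : ∃ C : ℝ, 0 < C ∧ ∀ (k : ℂ → ℝ) (p : ℂ → ℂ) (P r R Λ : ℝ), 0 < r →
    2 * r ≤ R → R ≤ 1 / 2 → (∀ z ∈ ball (0 : ℂ) 1, 0 ≤ k z) → IntegrableOn k (ball 0 1) →
    (∀ z ∈ ball (0 : ℂ) 1, ContDiffAt ℝ 1 k z) →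
    (∀ z ∈ ball (0 : ℂ) 1, HasFDerivAt k (reMul (k z * (diskGrad k z + p z))) z) →
    ContinuousOn p (ball 0 1) → (∀ z ∈ ball (0 : ℂ) (1 / 2), ‖p z‖ ≤ P) →
    ∫ z in ball (0 : ℂ) 1, k z ≤ Λ →
    |2 * (∫ z in ball (0 : ℂ) R, k z) - (∫ z in ball (0 : ℂ) R, k z) ^ 2 / (4 * π)| ≤
      C * ((1 + Λ) * (∫ z in ball (0 : ℂ) R \ ball 0 (r / 2), k z) + r * (P * Λ + Λ ^ 2 / R)) := by
  obtain ⟨K, hK⟩ := exists_dilation_field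
  refine ⟨2 * K + 2, by positivity, fun k p P r R Λ hr hrR hR1 hk0 hki hkd hkf hpc hp hΛ => ?_⟩
  obtain ⟨X, hXd, hXl, hXi, hX0, hXb⟩ := hK r hr
  have hR0 : 0 < R := by linarith
  have hcB : closedBall (0 : ℂ) R ⊆ ball 0 1 := closedBall_subset_ball (by linarith)
  have hBD : ball (0 : ℂ) R ⊆ ball 0 1 := ball_subset_closedBall.trans hcB
  have hkc : ContinuousOn k (ball 0 1) := fun z hz => (hkd z hz).continuousAt.continuousWithinAt
  have hkc' : ContinuousOn (fun z => (k z : ℂ)) (ball 0 1) :=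
    Complex.continuous_ofReal.comp_continuousOn hkc
  have hGc : ContinuousOn (diskGrad k) (ball 0 1) := fun z hz =>
    (continuousAt_diskGrad hki hkc hz).continuousWithinAt
  have hXc := hXd.continuous
  have hcXd : ContDiff ℝ 1 fun z => conj (X z) := Complex.conjCLE.contDiff.comp hXd
  have hcXl : LipschitzWith K fun z => conj (X z) := by
    refine LipschitzWith.of_dist_le_mul fun z w => ?_
    rw [dist_eq_norm, ← map_sub, RCLike.norm_conj, ← dist_eq_norm]
    exact hXl.dist_le_mul z w
  set Y : ℂ → ℂ := dbar fun z => conj (X z) with hY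
  have hYc : Continuous Y := by
    have := hcXd.continuous_fderiv one_ne_zero
    unfold Y dbar
    fun_prop
  have hInt : ∀ {F : ℂ → ℂ}, ContinuousOn F (ball 0 1) → IntegrableOn F (ball 0 R) := fun hF =>
    ((hF.mono hcB).integrableOn_compact (isCompact_closedBall _ _)).mono_set ball_subset_closedBall
  have i1 := hInt (hkc'.fun_mul hYc.continuousOn)
  have i2 := hInt ((hkc'.fun_mul hXc.continuousOn).fun_mul hGc)
  have i3 := hInt ((hkc'.fun_mul hXc.continuousOn).fun_mul hpc)
  have hkR : IntegrableOn k (ball 0 R) := hki.mono_set hBD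
  have hkR' : IntegrableOn (fun z => (k z : ℂ)) (ball 0 R) := hkR.ofReal
  set M := ∫ z in ball (0 : ℂ) R, k z with hM
  set A := ∫ z in ball (0 : ℂ) R \ ball 0 (r / 2), k z with hA
  have hSm : MeasurableSet (ball (0 : ℂ) R \ ball 0 (r / 2)) :=
    measurableSet_ball.diff measurableSet_ball
  have hA0 : 0 ≤ A := setIntegral_nonneg hSm fun z hz => hk0 z (hBD hz.1)
  have hM0 : 0 ≤ M := setIntegral_nonneg measurableSet_ball fun z hz => hk0 z (hBD hz)
  have hMΛ : M ≤ Λ := le_trans (setIntegral_mono_set hki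
    ((ae_restrict_mem measurableSet_ball).mono fun ζ hζ => hk0 ζ hζ) hBD.eventuallyLE) hΛ
  have hΛ0 : 0 ≤ Λ := hM0.trans hMΛ
  have hP0 : 0 ≤ P := (norm_nonneg _).trans (hp 0 (mem_ball_self (by norm_num)))
  -- the divergence identity
  have hdiv : ((∫ z in ball (0 : ℂ) R, k z * Y z) + (∫ z in ball (0 : ℂ) R, k z * X z * diskGrad k z) +
      ∫ z in ball (0 : ℂ) R, k z * X z * p z).re = 0 := by
    set V : ℂ → ℂ := fun z => (k z : ℂ) * conj (X z) with hV
    have hV0 : ∀ z, r < ‖z‖ → V =ᶠ[𝓝 z] fun _ => 0 := fun z hz => by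
      filter_upwards [(isOpen_lt continuous_const continuous_norm).mem_nhds hz] with w hw
      rw [hV]
      simp only [hX0 w (le_of_lt hw), map_zero, mul_zero]
    have hVd : ContDiff ℝ 1 V := by
      rw [contDiff_iff_contDiffAt]
      intro z
      rcases lt_or_ge r ‖z‖ with h | h
      · exact contDiffAt_const.congr_of_eventuallyEq (hV0 z h)
      · have hz : z ∈ ball (0 : ℂ) 1 := by rw [mem_ball_zero_iff]; linarith
        exact (Complex.ofRealCLM.contDiff.contDiffAt.comp z (hkd z hz)).mul hcXd.contDiffAt
    have hVs : HasCompactSupport V := by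
      refine HasCompactSupport.intro (isCompact_closedBall (0 : ℂ) r) fun z hz => ?_
      exact (hV0 z (by simpa using hz)).self_of_nhds
    have h := integral_re_dbar_eq_zero hVd hVs
    rw [← setIntegral_eq_integral_of_forall_compl_eq_zero (s := ball (0 : ℂ) R) fun z hz => by
      rw [dbar_congr (hV0 z (by have : R ≤ ‖z‖ := by simpa using hz
                                linarith))]
      simp [dbar]] at h
    rw [← integral_add i1 i2, ← integral_add (i1.fun_add i2) i3]
    rw [← RCLike.re_eq_complex_re, ← integral_re ((i1.fun_add i2).fun_add i3), ← h]
    refine setIntegral_congr_fun measurableSet_ball fun z hz => ?_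
    simp only [hV]
    rw [dbar_ofReal_mul (hkf z (hBD hz)) (hcXd.differentiable one_ne_zero z), ← map_mul]
    simp only [RCLike.re_eq_complex_re, Complex.add_re, Complex.conj_re, hY]
    rw [show (k z : ℂ) * (diskGrad k z + p z) * X z =
      k z * X z * diskGrad k z + k z * X z * p z by ring, Complex.add_re]
    ring
  -- the three terms
  have h1 : ‖(∫ z in ball (0 : ℂ) R, k z * Y z) - 2 * M‖ ≤ (2 * K + 2) * A := by
    have e : (∫ z in ball (0 : ℂ) R, k z * Y z) - 2 * M = ∫ z in ball (0 : ℂ) R, k z * (Y z - 2) := by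
      rw [hM, ← integral_complex_ofReal, ← integral_const_mul,
        ← integral_sub i1 (hkR'.const_mul _)]
      congr 1; ext z; ring
    rw [e]
    have e2 : (2 * K + 2) * A =
        ∫ z in ball (0 : ℂ) R, (2 * K + 2) * (ball (0 : ℂ) R \ ball 0 (r / 2)).indicator k z := by
      rw [integral_const_mul, setIntegral_indicator hSm, inter_eq_right.2 sdiff_subset]
    rw [e2]
    refine norm_integral_le_of_norm_le ((hkR.indicator hSm).const_mul _)
      ((ae_restrict_mem measurableSet_ball).mono fun z hz => ?_)
    have hkz := hk0 z (hBD hz)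
    rw [norm_mul, Complex.norm_real, Real.norm_of_nonneg hkz]
    by_cases hzr : z ∈ ball (0 : ℂ) (r / 2)
    · have : Y z = 2 := dbar_conj_of_eventuallyEq
        ((isOpen_ball.eventually_mem hzr).mono fun w hw => hXi w hw)
      rw [this, sub_self, norm_zero, mul_zero]
      exact mul_nonneg (by positivity) (indicator_nonneg (fun w hw => hk0 w (hBD hw.1)) z)
    · rw [indicator_of_mem (show z ∈ ball (0 : ℂ) R \ ball 0 (r / 2) from ⟨hz, hzr⟩), mul_comm]
      refine mul_le_mul_of_nonneg_right ((norm_sub_le _ _).trans ?_) hkz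
      rw [Complex.norm_ofNat]
      linarith [norm_dbar_le hcXl z]
  set J := ∫ z in ball (0 : ℂ) R, k z * X z * ∫ ζ in ball (0 : ℂ) R, (z - ζ)⁻¹ * k ζ with hJ
  have h2 := norm_interaction_sub_le hXl hXi (hkc.mono hcB) fun z hz => hk0 z (hBD hz)
  rw [← hJ, ← hM, ← hA] at h2
  have h3 : ‖-(2 * π) * (∫ z in ball (0 : ℂ) R, k z * X z * diskGrad k z) - J‖ ≤
      r * (4 / R * Λ) * M := by
    have iJ : IntegrableOn (fun z => k z * X z * ∫ ζ in ball (0 : ℂ) R, (z - ζ)⁻¹ * k ζ)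
        (ball 0 R) := by
      have := (integrable_prod_inv (a := fun z => k z * X z) (b := fun z => (k z : ℂ))
        ((hkc'.mono hcB).fun_mul hXc.continuousOn) (hkc'.mono hcB)).integral_prod_left
      refine this.congr (Eventually.of_forall fun z => ?_)
      simp only
      rw [← integral_const_mul]
      congr 1; ext ζ; ring
    rw [hJ, ← integral_const_mul, ← integral_sub (i2.const_mul _) iJ, hM, ← integral_const_mul]
    refine norm_integral_le_of_norm_le (hkR.const_mul _)
      ((ae_restrict_mem measurableSet_ball).mono fun z hz => ?_)
    have hkz := hk0 z (hBD hz)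
    have e : -(2 * π) * (k z * X z * diskGrad k z) -
        k z * X z * ∫ ζ in ball (0 : ℂ) R, (z - ζ)⁻¹ * k ζ =
        k z * X z * (-(2 * π) * diskGrad k z - ∫ ζ in ball (0 : ℂ) R, (z - ζ)⁻¹ * k ζ) := by ring
    rw [e, norm_mul, norm_mul, Complex.norm_real, Real.norm_of_nonneg hkz, mul_assoc,
      mul_comm _ (k z)]
    refine mul_le_mul_of_nonneg_left ?_ hkz
    rcases lt_or_ge ‖z‖ r with h | h
    · refine mul_le_mul (hXb z) ((norm_diskGrad_sub_le hr hrR hR1 hk0 hki hkc h).trans ?_)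
        (norm_nonneg _) hr.le
      exact mul_le_mul_of_nonneg_left hΛ (by positivity)
    · rw [hX0 z h, norm_zero, zero_mul]
      positivity
  have h4 : ‖∫ z in ball (0 : ℂ) R, k z * X z * p z‖ ≤ r * P * M := by
    rw [hM, ← integral_const_mul]
    refine norm_integral_le_of_norm_le (hkR.const_mul _)
      ((ae_restrict_mem measurableSet_ball).mono fun z hz => ?_)
    have hkz := hk0 z (hBD hz)
    rw [norm_mul, norm_mul, Complex.norm_real, Real.norm_of_nonneg hkz, mul_assoc, mul_comm _ (k z)]
    refine mul_le_mul_of_nonneg_left ?_ hkz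
    exact mul_le_mul (hXb z) (hp z (ball_subset_ball hR1 hz)) (norm_nonneg _) hr.le
  clear_value M A J
  set Z1 := ∫ z in ball (0 : ℂ) R, k z * Y z
  set Z2 := ∫ z in ball (0 : ℂ) R, k z * X z * diskGrad k z
  set Z3 := ∫ z in ball (0 : ℂ) R, k z * X z * p z
  clear_value Z1 Z2 Z3
  have hπ : (2 * π : ℂ) ≠ 0 := by exact_mod_cast Real.two_pi_pos.ne'
  have e : ((2 * M - M ^ 2 / (4 * π) : ℝ) : ℂ) = (Z1 + Z2 + Z3) + (-(Z1 - 2 * M) +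
      (((4 * π)⁻¹ : ℝ) : ℂ) * (2 * J - (M : ℂ) ^ 2) +
      (((2 * π)⁻¹ : ℝ) : ℂ) * (-(2 * π) * Z2 - J) - Z3) := by
    push_cast
    field_simp
    ring
  have e' := congrArg Complex.re e
  rw [Complex.ofReal_re, Complex.add_re _ (_ - Z3), hdiv, zero_add] at e'
  rw [e']
  refine (Complex.abs_re_le_norm _).trans ?_
  have hπ3 := Real.pi_gt_three
  have n2 : ‖(((4 * π)⁻¹ : ℝ) : ℂ) * (2 * J - (M : ℂ) ^ 2)‖ ≤ (2 * K + 2) * (A * Λ) := by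
    rw [norm_mul, Complex.norm_real, Real.norm_of_nonneg (by positivity)]
    have : (4 * π)⁻¹ ≤ 1 := inv_le_one_of_one_le₀ (by linarith)
    calc _ ≤ 1 * ((K + 1) * (2 * A * M)) := mul_le_mul this h2 (norm_nonneg _) zero_le_one
      _ ≤ 1 * ((K + 1) * (2 * A * Λ)) := by gcongr
      _ = _ := by ring
  have n3 : ‖(((2 * π)⁻¹ : ℝ) : ℂ) * (-(2 * π) * Z2 - J)‖ ≤ r * (Λ ^ 2 / R) := by
    rw [norm_mul, Complex.norm_real, Real.norm_of_nonneg (by positivity)]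
    have : (2 * π)⁻¹ ≤ 1 / 4 := by
      rw [inv_eq_one_div]; exact one_div_le_one_div_of_le (by norm_num) (by linarith)
    calc _ ≤ 1 / 4 * (r * (4 / R * Λ) * M) := mul_le_mul this h3 (norm_nonneg _) (by norm_num)
      _ ≤ 1 / 4 * (r * (4 / R * Λ) * Λ) := by gcongr
      _ = _ := by ring
  have n4 : ‖Z3‖ ≤ r * (P * Λ) := h4.trans (by
    rw [mul_assoc]; gcongr)
  have n5 : r * (P * Λ + Λ ^ 2 / R) ≤ (2 * K + 2) * (r * (P * Λ + Λ ^ 2 / R)) :=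
    le_mul_of_one_le_left (by positivity) (by linarith [K.coe_nonneg])
  calc _ ≤ ‖Z1 - 2 * M‖ + ‖(((4 * π)⁻¹ : ℝ) : ℂ) * (2 * J - (M : ℂ) ^ 2)‖ +
      ‖(((2 * π)⁻¹ : ℝ) : ℂ) * (-(2 * π) * Z2 - J)‖ + ‖Z3‖ := by
        refine (norm_sub_le _ _).trans (add_le_add_left ?_ _)
        refine (norm_add_le _ _).trans (add_le_add_left ?_ _)
        refine (norm_add_le _ _).trans (add_le_add_left ?_ _)
        rw [norm_neg]
    _ ≤ _ := by linarith

section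

section
variable {Ω : Set ℂ} {φ f : ℂ → ℂ}

theorem contDiffAt_greenOp (hR : RiemannPair Ω φ f) (hb : Bornology.IsBounded Ω) (g : BC) {x : ℂ}
    (hx : x ∈ Ω) : ContDiffAt ℝ 1 (greenOp hR hb g) x :=
  contDiffAt_one_iff.2 ⟨fun y => reMul (greenGrad φ f g y), Ω, hR.isOpen.mem_nhds hx,
    reMulL.continuous.comp_continuousOn (continuousOn_greenGrad hR hb g),
    fun _ hy => hasFDerivAt_greenOp hR hb g hy⟩

theorem contDiffAt_of_eq_smul_ex (hR : RiemannPair Ω φ f) (hb : Bornology.IsBounded Ω) {g : BC}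
    {μ : ℝ} (hg : g = μ • ex (greenOp hR hb g)) {x : ℂ} (hx : x ∈ Ω) : ContDiffAt ℝ 1 g x := by
  have h : (g : ℂ → ℝ) = fun z => μ * ex (greenOp hR hb g) z := by
    conv_lhs => rw [hg]
    rfl
  rw [h]
  exact contDiffAt_const.mul (contDiffAt_ex (n := 1) (contDiffAt_greenOp hR hb g hx))

theorem contDiffAt_two_greenOp (hR : RiemannPair Ω φ f) (hb : Bornology.IsBounded Ω) {g : BC}
    {x : ℂ} (hx : x ∈ Ω) (hg : ContDiffAt ℝ 1 g x) : ContDiffAt ℝ 2 (greenOp hR hb g) x := by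
  rw [show (2 : WithTop ℕ∞) = (1 : ℕ) + 1 by norm_num, contDiffAt_succ_iff_hasFDerivAt]
  exact ⟨fun y => reMul (greenGrad φ f g y), ⟨Ω, hR.isOpen.mem_nhds hx,
    fun _ hy => hasFDerivAt_greenOp hR hb g hy⟩,
    reMulL.contDiff.contDiffAt.comp x (greenGrad_regular hR hb g hx hg).1⟩

theorem RiemannPair.deriv_inv_ne_zero (hR : RiemannPair Ω φ f) {z : ℂ} (hz : z ∈ ball (0 : ℂ) 1) :
    deriv f z ≠ 0 := by
  have h := hR.deriv_mul_deriv (hR.mapsTo_inv hz)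
  rw [hR.right_inv z hz] at h
  exact left_ne_zero_of_mul_eq_one h

theorem hasFDerivAt_pullDensity (hR : RiemannPair Ω φ f) (hb : Bornology.IsBounded Ω) {g : BC}
    {μ : ℝ} (hg : g = μ • ex (greenOp hR hb g)) {z : ℂ} (hz : z ∈ ball (0 : ℂ) 1) :
    HasFDerivAt (pullDensity f g) (reMul (pullDensity f g z *
      (diskGrad (pullDensity f g) z + 2 * deriv (deriv f) z / deriv f z))) z := by
  have hi := hR.integrableOn_pull (integrableOn_of_continuous hb g.continuous)
  have hD := hasFDerivAt_diskPot hi (hR.continuousOn_pull g.continuous) hz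
  have hval : ∀ w ∈ ball (0 : ℂ) 1, pullDensity f g w =
      ‖deriv f w‖ ^ 2 * (μ * Real.exp (diskPot (pullDensity f g) w)) := fun w hw => by
    have : g (f w) = μ * Real.exp (diskPot (pullDensity f g) w) := by
      conv_lhs => rw [hg]
      change μ * ex (greenOp hR hb g) (f w) = _
      rw [ex_apply, greenOp_eq_diskPot hR hb g (hR.mapsTo_inv hw), hR.right_inv w hw]
    rw [← this, pullDensity]
  have hf2 : HasDerivAt (deriv f) (deriv (deriv f) z) z :=
    ((hR.diff_inv.deriv isOpen_ball).differentiableAt (isOpen_ball.mem_nhds hz)).hasDerivAt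
  have h1 := (hasFDerivAt_norm_sq (deriv f z)).comp z (hasFDerivAt_real_of_hasDerivAt hf2)
  have h2 := h1.fun_mul (hD.exp.const_mul μ)
  refine (h2.congr_of_eventuallyEq ?_).congr_fderiv ?_
  · filter_upwards [isOpen_ball.mem_nhds hz] with w hw using hval w hw
  · have hne := hR.deriv_inv_ne_zero hz
    have e : (pullDensity f g z : ℂ) * (2 * deriv (deriv f) z / deriv f z) =
        2 * conj (deriv f z) * deriv (deriv f) z *
          (μ * Real.exp (diskPot (pullDensity f g) z) : ℝ) := by
      rw [hval z hz, Complex.ofReal_mul, Complex.ofReal_pow, ← Complex.conj_mul']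
      field_simp
    rw [mul_add, e, hval z hz]
    refine ContinuousLinearMap.ext fun h => ?_
    simp only [Function.comp_apply]
    generalize ‖deriv f z‖ ^ 2 = a
    generalize Real.exp (diskPot (pullDensity f g) z) = b
    simp [reMul_apply]
    ring

/-- The local Pohozaev estimate for solutions of the mean field equation. -/
theorem exists_pohozaev_bound (hR : RiemannPair Ω φ f) (hb : Bornology.IsBounded Ω) {Λ : ℝ}
    (hΛ0 : 0 ≤ Λ) : ∃ C : ℝ, 0 < C ∧ ∀ (g : BC) (μ : ℝ), 0 ≤ μ → g = μ • ex (greenOp hR hb g) →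
    intCLM hb g ≤ Λ → ∀ z0 ∈ Ω, ∀ r R : ℝ, 0 < r → 2 * r ≤ R → R ≤ 1 / 2 →
    |2 * (∫ x in pball Ω φ z0 R, g x) - (∫ x in pball Ω φ z0 R, g x) ^ 2 / (4 * π)| ≤
      C * (((∫ x in pball Ω φ z0 R, g x) - ∫ x in pball Ω φ z0 (r / 2), g x) + r / R) := by
  obtain ⟨C, hC, h⟩ := exists_virial_bound
  refine ⟨C * ((1 + Λ) + (2 * 57600 * Λ + Λ ^ 2)), by positivity,
    fun g μ hμ hg hgΛ z0 hz0 r R hr hrR hR1 => ?_⟩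
  have hR0 : 0 < R := by linarith
  have hR' := hR.recenter hz0
  have hg' : g = μ • ex (greenOp hR' hb g) := by rw [greenOp_recenter hR hb hz0]; exact hg
  have hg0 : ∀ x, 0 ≤ g x := fun x => by
    rw [hg]
    change 0 ≤ μ * ex (greenOp hR hb g) x
    rw [ex_apply]; positivity
  have hi := hR'.integrableOn_pull (integrableOn_of_continuous hb g.continuous)
  have hk0 : ∀ z, 0 ≤ pullDensity (f ∘ mob (φ z0)) g z := fun z => mul_nonneg (sq_nonneg _) (hg0 _)
  have hfc : ContinuousOn (fun z => 2 * deriv (deriv (f ∘ mob (φ z0))) z /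
      deriv (f ∘ mob (φ z0)) z) (ball 0 1) :=
    (continuousOn_const.mul ((hR'.diff_inv.deriv isOpen_ball).deriv isOpen_ball).continuousOn).div
      hR'.continuousOn_deriv_inv fun z hz => hR'.deriv_inv_ne_zero hz
  have key := h (pullDensity (f ∘ mob (φ z0)) g) _ (2 * 57600) r R Λ hr hrR hR1 (fun z _ => hk0 z) hi
    (fun z hz => hR'.contDiffAt_pull hz (contDiffAt_of_eq_smul_ex hR' hb hg' (hR'.mapsTo_inv hz)))
    (fun z hz => hasFDerivAt_pullDensity hR' hb hg' hz) hfc (fun z hz => ?_)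
    ((hR'.integral_eq g).symm.le.trans hgΛ)
  · rw [setIntegral_sdiff measurableSet_ball (hi.mono_set (ball_subset_ball (by linarith)))
      (ball_subset_ball (by linarith)), ← hR.integral_pball hz0 (by linarith),
      ← hR.integral_pball hz0 (by linarith)] at key
    refine key.trans ?_
    have hA : 0 ≤ (∫ x in pball Ω φ z0 R, g x) - ∫ x in pball Ω φ z0 (r / 2), g x := by
      rw [sub_nonneg]
      exact setIntegral_mono_set ((integrableOn_of_continuous hb g.continuous).mono_set
        (pball_subset _ _)) (Eventually.of_forall hg0) (pball_mono _ (by linarith)).eventuallyLE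
    set A := (∫ x in pball Ω φ z0 R, g x) - ∫ x in pball Ω φ z0 (r / 2), g x
    rw [mul_assoc C]
    refine mul_le_mul_of_nonneg_left ?_ hC.le
    have e : r * (2 * 57600 * Λ + Λ ^ 2 / R) ≤ r / R * (2 * 57600 * Λ + Λ ^ 2) := by
      rw [div_mul_eq_mul_div, le_div_iff₀ hR0, mul_assoc, add_mul, div_mul_cancel₀ _ hR0.ne']
      have : 2 * 57600 * Λ * R ≤ 2 * 57600 * Λ := mul_le_of_le_one_right (by positivity) (by linarith)
      gcongr
    have e2 : 0 ≤ r / R * (1 + Λ) := by positivity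
    have e3 : 0 ≤ A * (2 * 57600 * Λ + Λ ^ 2) := by positivity
    linarith
  · rw [mem_ball_zero_iff] at hz
    have hz1 : z ∈ ball (0 : ℂ) 1 := by rw [mem_ball_zero_iff]; linarith
    have := hR'.norm_deriv_deriv_le hb hz.le
    rw [norm_div, norm_mul, Complex.norm_ofNat,
      div_le_iff₀ (norm_pos_iff.2 (hR'.deriv_inv_ne_zero hz1))]
    linarith

end

end

section

/-! ### Quantisation of the total mass of blowing-up solutions -/

/-- A finite family of mutually separated sequences of concentration points. -/
structure IsConcentrationFamily (Ω : Set ℂ) (φ : ℂ → ℂ) (𝒰 : Ultrafilter ℕ) (g : ℕ → BC)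
    (S : Finset (ℕ → ℂ)) : Prop where
  mem : ∀ z ∈ S, ∀ n, z n ∈ Ω
  heavy : ∀ z ∈ S, ∀ r > 0, ∀ᶠ n in 𝒰, 3 * π < ∫ x in pball Ω φ (z n) r, g n x
  sep : ∀ z ∈ S, ∀ w ∈ S, z ≠ w → ∀ᶠ r in 𝓝[>] (0 : ℝ), ∀ᶠ n in 𝒰,
    2 * r ≤ pd (φ (z n)) (φ (w n))

section
variable {Ω : Set ℂ} {φ f : ℂ → ℂ} {𝒰 : Ultrafilter ℕ} {g : ℕ → BC} {S : Finset (ℕ → ℂ)}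

theorem IsConcentrationFamily.disjoint (h : IsConcentrationFamily Ω φ 𝒰 g S)
    (hR : RiemannPair Ω φ f) : ∀ᶠ r in 𝓝[>] (0 : ℝ), ∀ᶠ n in 𝒰,
      (S : Set (ℕ → ℂ)).PairwiseDisjoint fun z => pball Ω φ (z n) r := by
  have h1 : ∀ᶠ r in 𝓝[>] (0 : ℝ), ∀ z ∈ S, ∀ w ∈ S, z ≠ w → ∀ᶠ n in 𝒰,
      2 * r ≤ pd (φ (z n)) (φ (w n)) := by
    simp only [Finset.eventually_all, eventually_imp_distrib_left]
    exact h.sep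
  filter_upwards [h1] with r hr
  have h2 : ∀ᶠ n in (𝒰 : Filter ℕ), ∀ z ∈ S, ∀ w ∈ S, z ≠ w → 2 * r ≤ pd (φ (z n)) (φ (w n)) := by
    simp only [Finset.eventually_all, eventually_imp_distrib_left]
    exact hr
  filter_upwards [h2] with n hn z hz w hw hzw
  refine Set.disjoint_left.2 fun y hy hy' => ?_
  have h3 := pd_triangle (hR.norm_lt (h.mem z hz n)) (hR.norm_lt hy.1) (hR.norm_lt (h.mem w hw n))
  have h4 := hy'.2
  rw [pd_comm] at h4
  linarith [hn z hz w hw hzw, hy.2]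

theorem integrableOn_pball (hb : Bornology.IsBounded Ω) (g : BC) (x : ℂ) (r : ℝ) :
    IntegrableOn g (pball Ω φ x r) :=
  (integrableOn_of_continuous hb g.continuous).mono_set (pball_subset x r)

theorem integral_eq_sum_add (hR : RiemannPair Ω φ f) (hb : Bornology.IsBounded Ω) (g : BC) {n : ℕ}
    {r : ℝ} (hmem : ∀ z ∈ S, z n ∈ Ω)
    (hd : (S : Set (ℕ → ℂ)).PairwiseDisjoint fun z => pball Ω φ (z n) r) :
    intCLM hb g = (∑ z ∈ S, ∫ x in pball Ω φ (z n) r, g x) +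
      ∫ x in Ω \ ⋃ z ∈ S, pball Ω φ (z n) r, g x := by
  have hm : ∀ z ∈ S, MeasurableSet (pball Ω φ (z n) r) := fun z hz =>
    measurableSet_pball hR (hmem z hz) r
  rw [← integral_biUnion_finset S hm hd fun z _ => integrableOn_pball hb g _ _,
    setIntegral_sdiff (Finset.measurableSet_biUnion S hm)
      (integrableOn_of_continuous hb g.continuous)
      (iUnion₂_subset fun z _ => pball_subset _ _), intCLM_apply]
  ring

theorem IsConcentrationFamily.card_le (h : IsConcentrationFamily Ω φ 𝒰 g S)
    (hR : RiemannPair Ω φ f) (hb : Bornology.IsBounded Ω) {Λ : ℝ} (hg0 : ∀ n x, 0 ≤ g n x)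
    (hΛ : ∀ᶠ n in 𝒰, intCLM hb (g n) ≤ Λ) : (S.card : ℝ) * (3 * π) ≤ Λ := by
  obtain ⟨r, hr, hr0⟩ := ((h.disjoint hR).and self_mem_nhdsWithin).exists
  have h1 : ∀ᶠ n in (𝒰 : Filter ℕ), ∀ z ∈ S, 3 * π < ∫ x in pball Ω φ (z n) r, g n x := by
    rw [Finset.eventually_all]
    exact fun z hz => h.heavy z hz r hr0
  obtain ⟨n, hn, hn1, hn2⟩ := (hr.and (h1.and hΛ)).exists
  rw [integral_eq_sum_add hR hb (g n) (fun z hz => h.mem z hz n) hn] at hn2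
  have h3 := Finset.card_nsmul_le_sum S _ _ fun z hz => (hn1 z hz).le
  have h4 : 0 ≤ ∫ x in Ω \ ⋃ z ∈ S, pball Ω φ (z n) r, g n x := integral_nonneg fun x => hg0 n x
  rw [nsmul_eq_mul] at h3
  linarith

theorem exists_maximal_concentrationFamily (hR : RiemannPair Ω φ f) (hb : Bornology.IsBounded Ω)
    {Λ : ℝ} (hg0 : ∀ n x, 0 ≤ g n x) (hΛ : ∀ᶠ n in 𝒰, intCLM hb (g n) ≤ Λ) :
    ∃ S, IsConcentrationFamily Ω φ 𝒰 g S ∧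
      ∀ S', IsConcentrationFamily Ω φ 𝒰 g S' → S'.card ≤ S.card := by
  set A : Set ℕ := {m | ∃ S, IsConcentrationFamily Ω φ 𝒰 g S ∧ S.card = m} with hA
  have h0 : A.Nonempty := ⟨0, ∅, ⟨by simp, by simp, by simp⟩, rfl⟩
  have hbd : BddAbove A := by
    refine ⟨⌊Λ⌋₊, ?_⟩
    rintro _ ⟨S, hS, rfl⟩
    refine Nat.le_floor ((le_mul_of_one_le_right (Nat.cast_nonneg _) ?_).trans
      (hS.card_le hR hb hg0 hΛ))
    linarith [Real.pi_gt_three]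
  obtain ⟨S, hS, hc⟩ := Nat.sSup_mem h0 hbd
  exact ⟨S, hS, fun S' hS' => hc ▸ le_csSup hbd ⟨S', hS', rfl⟩⟩

open Classical in
/-- Away from a maximal concentration family the densities are uniformly light. -/
theorem IsConcentrationFamily.exists_light (h : IsConcentrationFamily Ω φ 𝒰 g S)
    (hmax : ∀ S', IsConcentrationFamily Ω φ 𝒰 g S' → S'.card ≤ S.card) (hR : RiemannPair Ω φ f)
    (hb : Bornology.IsBounded Ω) (hΩ : Ω.Nonempty) (h𝒰 : (𝒰 : Filter ℕ) ≤ atTop)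
    (hg0 : ∀ n x, 0 ≤ g n x) {r : ℝ} (hr : 0 < r) :
    ∃ s > 0, ∀ᶠ n in 𝒰, ∀ x ∈ Ω, (∀ z ∈ S, r ≤ pd (φ x) (φ (z n))) →
      ∫ y in pball Ω φ x s, g n y ≤ 3 * π := by
  by_contra! hcon
  set P : ℕ → ℕ → Prop := fun n j => ∃ x ∈ Ω, (∀ z ∈ S, r ≤ pd (φ x) (φ (z n))) ∧
    3 * π < ∫ y in pball Ω φ x (1 / (j + 1 : ℝ)), g n y with hP
  have hPj : ∀ j, ∀ᶠ n in (𝒰 : Filter ℕ), P n j := fun j =>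
    hcon (1 / (j + 1 : ℝ)) (by positivity)
  obtain ⟨o, ho⟩ := hΩ
  set w : ℕ → ℂ := fun n => if hn : P n (Nat.findGreatest (P n) n) then hn.choose else o with hw
  have hwm : ∀ n, w n ∈ Ω := fun n => by
    simp only [hw]
    split_ifs with hn
    · exact hn.choose_spec.1
    · exact ho
  have hwj : ∀ j : ℕ, ∀ᶠ n in (𝒰 : Filter ℕ), (∀ z ∈ S, r ≤ pd (φ (w n)) (φ (z n))) ∧
      3 * π < ∫ y in pball Ω φ (w n) (1 / (j + 1 : ℝ)), g n y := fun j => by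
    filter_upwards [hPj j, h𝒰 (eventually_ge_atTop j)] with n hn hnj
    have h1 : P n (Nat.findGreatest (P n) n) := Nat.findGreatest_spec hnj hn
    have h2 : j ≤ Nat.findGreatest (P n) n := Nat.le_findGreatest hnj hn
    have h3 : w n = h1.choose := by simp only [hw, dif_pos h1]
    rw [h3]
    obtain ⟨h4, h5, h6⟩ := h1.choose_spec
    refine ⟨h5, h6.trans_le (setIntegral_mono_set (integrableOn_pball hb _ _ _)
      (Eventually.of_forall (hg0 n)) (pball_mono _ ?_).eventuallyLE)⟩
    have : (j : ℝ) ≤ (Nat.findGreatest (P n) n : ℕ) := by exact_mod_cast h2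
    exact one_div_le_one_div_of_le (by positivity) (by linarith)
  have hsep : ∀ z ∈ S, ∀ᶠ s in 𝓝[>] (0 : ℝ), ∀ᶠ n in (𝒰 : Filter ℕ),
      2 * s ≤ pd (φ (w n)) (φ (z n)) := fun z hz => by
    filter_upwards [Ioo_mem_nhdsGT (show (0 : ℝ) < r / 2 by positivity)] with s hs
    filter_upwards [hwj 0] with n hn
    linarith [hn.1 z hz, hs.2]
  have hwS : w ∉ S := fun hmem => by
    obtain ⟨n, hn⟩ := (hwj 0).exists
    have := hn.1 w hmem
    rw [pd_eq_zero (hR.norm_lt (hwm n)) (hR.norm_lt (hwm n)) |>.2 rfl] at this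
    linarith
  have hfam : IsConcentrationFamily Ω φ 𝒰 g (insert w S) := by
    refine ⟨?_, ?_, ?_⟩
    · intro z hz
      rcases Finset.mem_insert.1 hz with rfl | hz
      · exact hwm
      · exact h.mem z hz
    · intro z hz s hs
      rcases Finset.mem_insert.1 hz with rfl | hz
      · obtain ⟨j, hj⟩ := exists_nat_one_div_lt hs
        filter_upwards [hwj j] with n hn
        exact hn.2.trans_le (setIntegral_mono_set (integrableOn_pball hb _ _ _)
          (Eventually.of_forall (hg0 n)) (pball_mono _ hj.le).eventuallyLE)
      · exact h.heavy z hz s hs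
    · intro z hz z' hz' hne
      rcases Finset.mem_insert.1 hz with rfl | hz <;> rcases Finset.mem_insert.1 hz' with rfl | hz'
      · exact absurd rfl hne
      · exact hsep z' hz'
      · simp only [pd_comm (φ (z _))]
        exact hsep z hz
      · exact h.sep z hz z' hz' hne
  have := hmax _ hfam
  rw [Finset.card_insert_of_notMem hwS] at this
  omega

/-- The mass away from a maximal concentration family vanishes in the limit. -/
theorem IsConcentrationFamily.tendsto_outside (h : IsConcentrationFamily Ω φ 𝒰 g S)
    (hmax : ∀ S', IsConcentrationFamily Ω φ 𝒰 g S' → S'.card ≤ S.card) (hR : RiemannPair Ω φ f)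
    (hb : Bornology.IsBounded Ω) (hΩ : Ω.Nonempty) (h𝒰 : (𝒰 : Filter ℕ) ≤ atTop) {μ : ℕ → ℝ}
    (hμ0 : ∀ n, 0 ≤ μ n) (hg : ∀ n, g n = μ n • ex (greenOp hR hb (g n)))
    (hg0 : ∀ n x, 0 ≤ g n x) {Λ : ℝ} (hΛ : ∀ᶠ n in 𝒰, intCLM hb (g n) ≤ Λ)
    (hμ : Tendsto μ 𝒰 (𝓝 0)) {r : ℝ} (hr : 0 < r) :
    Tendsto (fun n => ∫ x in Ω \ ⋃ z ∈ S, pball Ω φ (z n) r, g n x) 𝒰 (𝓝 0) := by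
  obtain ⟨s, hs, hlight⟩ := h.exists_light hmax hR hb hΩ h𝒰 hg0 hr
  obtain ⟨C, hC⟩ := exists_light_bound hR hb (s := min s 1) (by positivity) (min_le_right _ _)
    (Λ := Λ) (zero_le_one' ℝ)
  have hfin : IsFiniteMeasure (volume.restrict Ω) := ⟨by simpa using hb.measure_lt_top⟩
  have hlim : Tendsto (fun n => μ n * Real.exp C * volume.real Ω) 𝒰 (𝓝 0) := by
    simpa using (hμ.mul_const (Real.exp C)).mul_const (volume.real Ω)
  refine squeeze_zero' (Eventually.of_forall fun n => integral_nonneg (hg0 n)) ?_ hlim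
  filter_upwards [hlight, hΛ, hμ.eventually (gt_mem_nhds zero_lt_one)] with n hn hn2 hn3
  have hsub : Ω \ ⋃ z ∈ S, pball Ω φ (z n) r ⊆ Ω := sdiff_subset
  have hms : MeasurableSet (Ω \ ⋃ z ∈ S, pball Ω φ (z n) r) :=
    hR.isOpen.measurableSet.diff (Finset.measurableSet_biUnion S fun z hz =>
      measurableSet_pball hR (h.mem z hz n) r)
  have hbound : ∀ x ∈ Ω \ ⋃ z ∈ S, pball Ω φ (z n) r, g n x ≤ μ n * Real.exp C := fun x hx => by
    have h1 : ∀ z ∈ S, r ≤ pd (φ x) (φ (z n)) := fun z hz => by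
      by_contra! hlt
      rw [pd_comm] at hlt
      exact hx.2 (mem_iUnion₂.2 ⟨z, hz, hx.1, hlt⟩)
    have h2 : ∫ y in pball Ω φ x (min s 1), g n y ≤ 3 * π :=
      (setIntegral_mono_set (integrableOn_pball hb _ _ _) (Eventually.of_forall (hg0 n))
        (pball_mono _ (min_le_left _ _)).eventuallyLE).trans (hn x hx.1 h1)
    have h3 := hC (g n) (μ n) (hμ0 n) hn3.le (hg n) hn2 x hx.1 h2
    rw [hg n]
    change μ n * ex (greenOp hR hb (g n)) x ≤ _
    rw [ex_apply]
    exact mul_le_mul_of_nonneg_left (Real.exp_le_exp.2 h3) (hμ0 n)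
  have hfv : volume Ω ≠ ⊤ := hb.measure_lt_top.ne
  calc ∫ x in Ω \ ⋃ z ∈ S, pball Ω φ (z n) r, g n x
      ≤ ∫ _ in Ω \ ⋃ z ∈ S, pball Ω φ (z n) r, μ n * Real.exp C :=
        setIntegral_mono_on ((integrableOn_of_continuous hb (g n).continuous).mono_set hsub)
          (integrableOn_const (measure_mono hsub |>.trans_lt hb.measure_lt_top).ne) hms hbound
    _ = volume.real (Ω \ ⋃ z ∈ S, pball Ω φ (z n) r) * (μ n * Real.exp C) := by
        rw [setIntegral_const, smul_eq_mul]
    _ ≤ volume.real Ω * (μ n * Real.exp C) := by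
        refine mul_le_mul_of_nonneg_right (measureReal_mono hsub hfv)
          (mul_nonneg (hμ0 n) (Real.exp_pos _).le)
    _ = _ := by ring

theorem exists_mass_quantized (hR : RiemannPair Ω φ f) (hb : Bornology.IsBounded Ω)
    (hΩ : Ω.Nonempty) (h𝒰 : (𝒰 : Filter ℕ) ≤ atTop) {μ : ℕ → ℝ} (hμ0 : ∀ n, 0 ≤ μ n)
    (hg : ∀ n, g n = μ n • ex (greenOp hR hb (g n))) (hμ : Tendsto μ 𝒰 (𝓝 0)) {lam : ℝ}
    (hlam : Tendsto (fun n => intCLM hb (g n)) 𝒰 (𝓝 lam)) : ∃ m : ℕ, lam = 8 * π * m := by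
  have hg0 : ∀ n x, 0 ≤ g n x := fun n x => by
    rw [hg]
    change 0 ≤ μ n * ex (greenOp hR hb (g n)) x
    rw [ex_apply]
    exact mul_nonneg (hμ0 n) (Real.exp_pos _).le
  set Λ := |lam| + 1 with hΛdef
  have hΛ : ∀ᶠ n in (𝒰 : Filter ℕ), intCLM hb (g n) ≤ Λ :=
    (hlam.eventually (gt_mem_nhds (show lam < Λ by linarith [le_abs_self lam]))).mono
      fun n hn => hn.le
  obtain ⟨S, hS, hmax⟩ := exists_maximal_concentrationFamily hR hb hg0 hΛ
  have hout := fun {r : ℝ} (hr : 0 < r) =>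
    hS.tendsto_outside hmax hR hb hΩ h𝒰 hμ0 hg hg0 hΛ hμ hr
  obtain ⟨R, hdisj, hR0⟩ := ((hS.disjoint hR).and
    (Ioo_mem_nhdsGT (show (0 : ℝ) < 1 / 2 by norm_num))).exists
  obtain ⟨C, hC, hpoh⟩ := exists_pohozaev_bound hR hb (Λ := Λ) (by positivity)
  have hmass : ∀ z ∈ S, Tendsto (fun n => ∫ x in pball Ω φ (z n) R, g n x) 𝒰 (𝓝 (8 * π)) := by
    intro z hz
    have hcpt : ∃ m ∈ Icc 0 Λ, Tendsto (fun n => ∫ x in pball Ω φ (z n) R, g n x) 𝒰 (𝓝 m) := by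
      have := isCompact_Icc.ultrafilter_le_nhds' (s := Icc 0 Λ)
        (𝒰.map fun n => ∫ x in pball Ω φ (z n) R, g n x) ?_
      · exact this
      · refine Ultrafilter.mem_map.2 (hΛ.mono fun n hn => ?_)
        refine ⟨integral_nonneg (hg0 n), le_trans ?_ hn⟩
        exact setIntegral_mono_set (integrableOn_of_continuous hb (g n).continuous)
          (Eventually.of_forall (hg0 n)) (pball_subset _ _).eventuallyLE
    obtain ⟨m, -, hm⟩ := hcpt
    have hann : ∀ r, 0 < r → r ≤ R → Tendsto (fun n => (∫ x in pball Ω φ (z n) R, g n x) -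
        ∫ x in pball Ω φ (z n) r, g n x) 𝒰 (𝓝 0) := fun r hr hrR => by
      refine squeeze_zero' (Eventually.of_forall fun n => sub_nonneg.2
        (setIntegral_mono_set (integrableOn_pball hb _ _ _) (Eventually.of_forall (hg0 n))
          (pball_mono _ hrR).eventuallyLE)) ?_ (hout hr)
      filter_upwards [hdisj] with n hn
      rw [← setIntegral_sdiff (measurableSet_pball hR (hS.mem z hz n) r)
        (integrableOn_pball hb _ _ _) (pball_mono _ hrR)]
      refine setIntegral_mono_set ((integrableOn_of_continuous hb (g n).continuous).mono_set
        sdiff_subset) (Eventually.of_forall (hg0 n)) (LE.le.eventuallyLE fun y hy => ?_)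
      refine ⟨hy.1.1, fun hy' => ?_⟩
      obtain ⟨w, hw, hyw⟩ := mem_iUnion₂.1 hy'
      rcases eq_or_ne z w with rfl | hne
      · exact hy.2 hyw
      · exact Set.disjoint_left.1 (hn hz hw hne) hy.1 (pball_mono _ hrR hyw)
    have hvir : ∀ r, 0 < r → 2 * r ≤ R → |2 * m - m ^ 2 / (4 * π)| ≤ C * (0 + r / R) :=
      fun r hr hrR => by
      refine le_of_tendsto_of_tendsto ((hm.const_mul 2).sub ((hm.pow 2).div_const (4 * π))).abs
        (((hann (r / 2) (by linarith) (by linarith)).add_const (r / R)).const_mul C) ?_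
      filter_upwards [hΛ] with n hn
      exact hpoh (g n) (μ n) (hμ0 n) (hg n) hn (z n) (hS.mem z hz n) r R hr hrR hR0.2.le
    have hzero : |2 * m - m ^ 2 / (4 * π)| ≤ 0 := by
      have ht : Tendsto (fun r : ℝ => C * (0 + r / R)) (𝓝[>] 0) (𝓝 (C * (0 + 0 / R))) :=
        Continuous.continuousWithinAt (by fun_prop)
      rw [zero_div, add_zero, mul_zero] at ht
      refine ge_of_tendsto ht ?_
      filter_upwards [Ioo_mem_nhdsGT (half_pos hR0.1)] with r hr
      exact hvir r hr.1 (by linarith [hr.2])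
    have h0 := abs_eq_zero.1 (le_antisymm hzero (abs_nonneg _))
    have hm3 : 3 * π ≤ m := ge_of_tendsto hm ((hS.heavy z hz R hR0.1).mono fun n hn => hn.le)
    have hπ := Real.pi_pos
    have hm8 : m = 8 * π := by
      field_simp at h0
      have : m * (8 * π - m) = 0 := by linarith
      rcases mul_eq_zero.1 this with h | h <;> linarith
    rwa [hm8] at hm
  refine ⟨S.card, tendsto_nhds_unique hlam ?_⟩
  have hsum := (tendsto_finsetSum S hmass).add (hout hR0.1)
  rw [Finset.sum_const, nsmul_eq_mul, add_zero, mul_comm] at hsum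
  refine hsum.congr' ?_
  filter_upwards [hdisj] with n hn
  exact (integral_eq_sum_add hR hb (g n) (fun z hz => hS.mem z hz n) hn).symm

end

end

/-! ### Two critical points of the reduced free energy -/

theorem GreenForm.exists_gt_of_seq {Ω : Set ℂ} {φ f : ℂ → ℂ} (hR : RiemannPair Ω φ f)
    (hb : Bornology.IsBounded Ω) {lam m M : ℝ} (hlam : 0 < lam) (hk : ∀ k : ℕ, lam ≠ 8 * π * k)
    {τ : ℕ → ℝ} {g : ℕ → BC} (hτ : ∀ n, 1 / lam < τ n) (hτl : Tendsto τ atTop (𝓝 (1 / lam)))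
    (hg : ∀ n, NM (intCLM hb) (greenOp hR hb) (τ n) (g n) = g n)
    (hm : ∀ n, m ≤ Psi (intCLM hb) (greenOp hR hb) (τ n) (g n))
    (hM : ∀ n, Psi (intCLM hb) (greenOp hR hb) (τ n) (g n) ≤ M) :
    ∃ g' : BC, NM (intCLM hb) (greenOp hR hb) (1 / lam) g' = g' ∧
      m ≤ Psi (intCLM hb) (greenOp hR hb) (1 / lam) g' := by
  have H := greenForm hR hb
  have ht : 0 < 1 / lam := by positivity
  have hτ0 : ∀ n, 0 < τ n := fun n => ht.trans (hτ n)
  set 𝒰 : Ultrafilter ℕ := hyperfilter ℕ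
  have h𝒰 : (𝒰 : Filter ℕ) ≤ atTop := Nat.hyperfilter_le_atTop
  set J : ℕ → ℝ := fun n => intCLM hb (ex (greenOp hR hb (g n))) with hJ
  have hJ0 : ∀ n, 0 < J n := fun n => H.ex_pos _
  by_cases hB : ∃ B, ∀ᶠ n in 𝒰, J n ≤ B
  · obtain ⟨B, hB⟩ := hB
    have hg0 : ∀ n x, 0 ≤ g n x := fun n x => by
      rw [← hg n]; exact H.NM_nonneg (hτ0 n) _ _
    have hA : ∀ᶠ n in 𝒰, ip (intCLM hb) (greenOp hR hb) (g n) (g n) ≤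
        2 * lam * (M + Real.log B) := by
      filter_upwards [hB] with n hn
      have h1 := hM n
      have h2 : LZ (intCLM hb) (greenOp hR hb) (g n) ≤ Real.log B :=
        Real.log_le_log (hJ0 n) hn
      have h3 := H.ip_self_nonneg (g n)
      rw [Psi] at h1
      have h4 : 1 / lam / 2 * ip (intCLM hb) (greenOp hR hb) (g n) (g n) ≤ M + Real.log B := by
        nlinarith [mul_le_mul_of_nonneg_right (hτ n).le h3]
      calc _ = 2 * lam * (1 / lam / 2 * ip (intCLM hb) (greenOp hR hb) (g n) (g n)) := by
            field_simp
        _ ≤ _ := by gcongr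
    obtain ⟨g', h1, h2⟩ := H.palaisSmale 𝒰 ht (fun n => (hτ n).le) (hτl.mono_left h𝒰) hg0 hA
      (by simp [hg, ip])
    exact ⟨g', h1, ge_of_tendsto' h2 hm⟩
  · exfalso
    have hJt : Tendsto J 𝒰 atTop := tendsto_atTop.2 fun B => by
      have h1 : ¬ ∀ᶠ n in 𝒰, J n ≤ B := fun h => hB ⟨B, h⟩
      rw [← Ultrafilter.eventually_not] at h1
      exact h1.mono fun n hn => (not_le.1 hn).le
    have hτ𝒰 := hτl.mono_left h𝒰
    have h1 : Tendsto (fun n => (τ n * J n)⁻¹) 𝒰 (𝓝 0) :=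
      (hτ𝒰.pos_mul_atTop ht hJt).inv_tendsto_atTop
    have h2 : Tendsto (fun n => intCLM hb (g n)) 𝒰 (𝓝 lam) := by
      have h3 : ∀ n, intCLM hb (g n) = (τ n)⁻¹ := fun n => by
        conv_lhs => rw [← hg n, NM, map_smul, smul_eq_mul]
        have h4 := (hJ0 n).ne'
        have h5 := (hτ0 n).ne'
        rw [mul_inv, mul_assoc, inv_mul_cancel₀ h4, mul_one]
      simp only [h3]
      simpa using hτ𝒰.inv₀ ht.ne'
    obtain ⟨k, hk'⟩ := exists_mass_quantized hR hb H.nonempty h𝒰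
      (fun n => by have h4 := hJ0 n; have h5 := hτ0 n; positivity)
      (fun n => (hg n).symm) h1 h2
    exact hk k hk'

theorem exists_two_critical {Ω : Set ℂ} {φ f : ℂ → ℂ} (hR : RiemannPair Ω φ f)
    (hb : Bornology.IsBounded Ω) {α c βm βp γ lam : ℝ} (hα : 0 < α) (hα1 : α ≤ 1 / 2)
    (hc1 : c ≤ 1) (hm : 0 < βm) (hp : 0 < βp) (hc : c = βm ^ 2 / βp ^ 2)
    (hin : ∀ z, quad α z ≤ βm ^ 2 → z ∈ Ω) (hout : ∀ z ∈ Ω, quad α z ≤ βp ^ 2) (hγ : 0 < γ)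
    (hroot : γ ^ 2 * (8 * (1 - α ^ 2) - c * (1 + α ^ 2) ^ 2) +
      γ * (8 * (1 + α ^ 2) - 2 * c * (1 + α ^ 2) ^ 2) - c * (1 + α ^ 2) ^ 2 = 0)
    (hlam : 8 * π < lam) (hlam' : lam < π * c * (1 + α ^ 2) ^ 2 / (2 * α) * (1 + γ))
    (hk : ∀ k : ℕ, lam ≠ 8 * π * k) :
    ∃ g₀ g₁ : BC, NM (intCLM hb) (greenOp hR hb) (1 / lam) g₀ = g₀ ∧
      NM (intCLM hb) (greenOp hR hb) (1 / lam) g₁ = g₁ ∧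
      Psi (intCLM hb) (greenOp hR hb) (1 / lam) g₀ <
        Psi (intCLM hb) (greenOp hR hb) (1 / lam) g₁ := by
  have hlam0 : 0 < lam := lt_trans (by positivity) hlam
  obtain ⟨M, U, μ, u, hM, hU, hsup, hμ, hμM, hu, hmass⟩ :=
    exists_bubble_branch hR hb hα hα1 hc1 hm hp hc hin hout hγ hroot hlam0 hlam'
  have H := greenForm hR hb
  have hS : SchurForm (intCLM hb) (greenOp hR hb) := fun p h W h1 h2 h3 => green_schur hR hb h1 h2 h3
  have hmass' : 1 / lam * (μ * intCLM hb (ex u)) = 1 := by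
    rw [hmass, one_div, inv_mul_cancel₀ hlam0.ne']
  obtain ⟨m, τ, g, B, h1, h2, h3, h4, h5⟩ := H.exists_seq_of_stable (t := 1 / lam) (by positivity)
    hμ.le ((div_lt_one hM).2 hμM) hu.eq hmass' (fun v => by
      have := H.stable_branchSol hS hM hU hsup hμ.le hμM hu v
      rw [div_mul_eq_mul_div, le_div_iff₀ hM]
      nlinarith [mul_le_mul_of_nonneg_left this hμ.le])
    (exists_Psi_lt hR hb (by positivity) (one_div_lt_one_div_of_lt (by positivity) hlam))
  obtain ⟨g₁, h6, h7⟩ := GreenForm.exists_gt_of_seq hR hb hlam0 hk h2 h3 h4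
    (fun n => (h5 n).1) (fun n => (h5 n).2)
  refine ⟨μ • ex u, g₁, ?_, h6, h1.trans_le h7⟩
  rw [NM, map_smul, ← hu.eq]
  congr 1
  have h8 : intCLM hb (ex u) ≠ 0 := fun h => by simp [h] at hmass'
  field_simp
  linarith

theorem gamma_pos_and_root {α c : ℝ} (hα : 0 < α) (hα1 : α ≤ 1 / 2) (hc : 0 < c)
    (hc1 : c ≤ 1) :
    let γ := (1 + α ^ 2) * (c - 4 + c * α ^ 2 + 4 * Real.sqrt (1 - c * α ^ 2)) /
      (8 * (1 - α ^ 2) - c * (1 + α ^ 2) ^ 2)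
    0 < γ ∧ γ ^ 2 * (8 * (1 - α ^ 2) - c * (1 + α ^ 2) ^ 2) +
      γ * (8 * (1 + α ^ 2) - 2 * c * (1 + α ^ 2) ^ 2) - c * (1 + α ^ 2) ^ 2 = 0 := by
  have hs : α ^ 2 ≤ 1 / 4 := by nlinarith
  have hs0 : 0 < α ^ 2 := by positivity
  set s := α ^ 2
  have hcs : c * s ≤ 1 := by nlinarith
  have hr2 : √(1 - c * s) ^ 2 = 1 - c * s := Real.sq_sqrt (by linarith)
  have hr : 1 - c * s ≤ √(1 - c * s) := Real.le_sqrt_of_sq_le (by nlinarith [mul_pos hc hs0])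
  set r := √(1 - c * s)
  have hD : 0 < 8 * (1 - s) - c * (1 + s) ^ 2 := by nlinarith
  have hS : 0 < c - 4 + c * s + 4 * r := by nlinarith
  refine ⟨by positivity, mul_left_cancel₀ hD.ne' ?_⟩
  have hγ := div_mul_cancel₀ ((1 + s) * (c - 4 + c * s + 4 * r)) hD.ne'
  set γ := (1 + s) * (c - 4 + c * s + 4 * r) / (8 * (1 - s) - c * (1 + s) ^ 2)
  set D := 8 * (1 - s) - c * (1 + s) ^ 2 with hDd
  linear_combination (γ * D + (1 + s) * (c - 4 + c * s + 4 * r) +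
    (8 * (1 + s) - 2 * c * (1 + s) ^ 2)) * hγ + (16 * (1 + s) ^ 2) * hr2 - c * (1 + s) ^ 2 * hDd

/-! ### From fixed points to solutions of the mean field problem -/

section
variable {Ω : Set ℂ} {φ f : ℂ → ℂ}

theorem greenOp_pos (hR : RiemannPair Ω φ f) (hb : Bornology.IsBounded Ω) {g : BC}
    (hg : ∀ x, 0 < g x) {x : ℂ} (hx : x ∈ Ω) : 0 < greenOp hR hb g x := by
  refine (greenOp_nonneg hR hb (fun y _ => (hg y).le) x).lt_of_ne fun h => ?_
  rw [greenOp_apply] at h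
  have h1 := (integral_eq_zero_iff_of_nonneg (fun y => mul_nonneg (green_nonneg hR x y) (hg y).le)
    (BC.integrable_green_mul hR hb g x)).1 h.symm
  have h2 : ∀ᵐ y ∂volume.restrict Ω, False := by
    filter_upwards [h1, ae_restrict_of_ae (ae_ne x), ae_restrict_mem hR.isOpen.measurableSet]
      with y h3 h4 hy
    have h5 := Real.log_neg (hR.pd_pos hx hy h4) (pd_lt_one (hR.norm_lt hx) (hR.norm_lt hy))
    have h6 : 0 < green Ω φ x y := by
      rw [green_of_mem hx hy, neg_mul]
      exact neg_pos.2 (mul_neg_of_pos_of_neg (by positivity) h5)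
    exact (mul_pos h6 (hg y)).ne' h3
  have h3 : volume Ω = 0 := by simpa [ae_iff] using h2
  exact (hR.isOpen.measure_pos volume ⟨x, hx⟩).ne' h3

/-- The isometric identification of the Euclidean plane with `ℂ`. -/
def planeIso : R2 ≃ₗᵢ[ℝ] ℂ := Complex.orthonormalBasisOneI.repr.symm

theorem planeIso_apply (p : R2) : planeIso p = p 0 + p 1 * Complex.I :=
  Complex.orthonormalBasisOneI_repr_symm_apply p

theorem measurePreserving_planeIso : MeasurePreserving planeIso :=
  planeIso.measurePreserving

theorem measurableEmbedding_planeIso : MeasurableEmbedding planeIso :=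
  planeIso.toHomeomorph.measurableEmbedding

theorem gradient_comp_planeIso {u : ℂ → ℝ} {q : ℂ} {p : R2}
    (hu : HasFDerivAt u (reMul q) (planeIso p)) :
    gradient (fun x => u (planeIso x)) p = planeIso.symm (conj q) := by
  refine HasGradientAt.gradient (hasGradientAt_iff_hasFDerivAt.2 ?_)
  refine (hu.comp p planeIso.toContinuousLinearEquiv.hasFDerivAt).congr_fderiv ?_
  ext h
  rw [InnerProductSpace.toDual_apply_apply, ← planeIso.inner_map_map]
  simp [reMul_apply, Complex.inner, mul_comm]

theorem lap_comp_planeIso {u : ℂ → ℝ} {Q : ℂ → ℂ} {p : R2}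
    (hu : ∀ᶠ x in 𝓝 (planeIso p), HasFDerivAt u (reMul (Q x)) x)
    (hQ : DifferentiableAt ℝ Q (planeIso p)) :
    lap (fun x => u (planeIso x)) p = (dbar Q (planeIso p)).re := by
  have h0 : planeIso (EuclideanSpace.single (0 : Fin 2) (1 : ℝ)) = 1 := by simp [planeIso_apply]
  have h1 : planeIso (EuclideanSpace.single (1 : Fin 2) (1 : ℝ)) = Complex.I := by
    simp [planeIso_apply]
  simp only [lap, Fin.sum_univ_two, map_add, map_smul, h0, h1, iteratedDeriv_succ,
    iteratedDeriv_zero, deriv_deriv_line _ hu hQ, dbar_re_eq]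

variable {lam : ℝ} {g : BC}

theorem solution_of_fixedPoint (hR : RiemannPair Ω φ f) (hb : Bornology.IsBounded Ω)
    (hlam : 0 < lam) (hg : NM (intCLM hb) (greenOp hR hb) (1 / lam) g = g) :
    let u := fun p : R2 => greenOp hR hb g (planeIso p)
    IsSolP (planeIso ⁻¹' Ω) lam u ∧ FiniteDirichlet (planeIso ⁻¹' Ω) u ∧
      freeEnergy (planeIso ⁻¹' Ω) lam u =
        lam * Psi (intCLM hb) (greenOp hR hb) (1 / lam) g := by
  intro u
  have H := greenForm hR hb
  have hZ : 0 < intCLM hb (ex (greenOp hR hb g)) := H.ex_pos _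
  have hgx : ∀ x, g x = lam * Real.exp (greenOp hR hb g x) / intCLM hb (ex (greenOp hR hb g)) :=
    fun x => by
      conv_lhs => rw [← hg]
      change (1 / lam * intCLM hb (ex (greenOp hR hb g)))⁻¹ * ex (greenOp hR hb g) x = _
      rw [ex_apply]
      field_simp
  have hgpos : ∀ x, 0 < g x := fun x => by rw [hgx]; positivity
  have hC1 : ∀ x ∈ Ω, ContDiffAt ℝ 1 g x := fun x hx => contDiffAt_of_eq_smul_ex hR hb hg.symm hx
  have hD : ∀ x ∈ Ω, HasFDerivAt (greenOp hR hb g) (reMul (greenGrad φ f g x)) x :=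
    fun x hx => hasFDerivAt_greenOp hR hb g hx
  have hQ := fun x hx => greenGrad_regular hR hb g hx (hC1 x hx)
  have hexp : ∫ q in planeIso ⁻¹' Ω, Real.exp (u q) = intCLM hb (ex (greenOp hR hb g)) := by
    simp only [intCLM_apply, ex_apply]
    exact measurePreserving_planeIso.setIntegral_preimage_emb measurableEmbedding_planeIso
      (fun z => Real.exp (greenOp hR hb g z)) Ω
  have hgrad : ∀ p ∈ planeIso ⁻¹' Ω,
      ‖gradient u p‖ ^ 2 = ‖greenGrad φ f g (planeIso p)‖ ^ 2 := fun p hp => by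
    rw [gradient_comp_planeIso (hD _ hp), LinearIsometryEquiv.norm_map, RCLike.norm_conj]
  have hmeas : MeasurableSet (planeIso ⁻¹' Ω) :=
    measurableEmbedding_planeIso.measurable hR.isOpen.measurableSet
  have hopen : IsOpen (planeIso ⁻¹' Ω) := hR.isOpen.preimage planeIso.continuous
  have hcont : Continuous u := (greenOp hR hb g).continuous.comp planeIso.continuous
  obtain ⟨hE, hE'⟩ := energy_eq hb (greenOp hR hb g).continuous
    (fun x hx => greenOp_of_notMem hR hb g hx) (fun x hx => greenOp_pos hR hb hgpos hx) hD
    (fun x hx => (hQ x hx).1) (fun x hx => (hQ x hx).2) hR.isOpen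
  refine ⟨⟨fun p hp => ?_, hcont.continuousOn, fun p hp => ?_, fun p hp => ?_⟩, ?_, ?_⟩
  · exact ((contDiffAt_two_greenOp hR hb hp (hC1 _ hp)).comp p
      planeIso.contDiff.contDiffAt).contDiffWithinAt
  · rw [hopen.frontier_eq] at hp
    exact greenOp_of_notMem hR hb g hp.2
  · rw [lap_comp_planeIso (Filter.mem_of_superset (hR.isOpen.mem_nhds hp) hD)
      ((hQ _ hp).1.differentiableAt one_ne_zero), (hQ _ hp).2, hexp, neg_neg, hgx]
  · exact (integrableOn_congr_fun hgrad hmeas).2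
      ((measurePreserving_planeIso.integrableOn_comp_preimage measurableEmbedding_planeIso).2 hE)
  · rw [freeEnergy, setIntegral_congr_fun hmeas hgrad, hexp,
      measurePreserving_planeIso.setIntegral_preimage_emb measurableEmbedding_planeIso
        (fun z => ‖greenGrad φ f g z‖ ^ 2) Ω, hE', Psi, LZ]
    have h1 : ip (intCLM hb) (greenOp hR hb) g g = ∫ x in Ω, greenOp hR hb g x * g x := by
      simp only [ip, intCLM_apply, BoundedContinuousFunction.coe_mul, Pi.mul_apply, mul_comm]
    rw [h1]
    field_simp

end

end MeanField

open MeanField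

/-- Multiplicity on thin sandwiched regular domains: for `λ ∈ (8π, λ̲(α,c))` not an integer
multiple of `8π`, the problem `P(λ,Ω)` admits two distinct finite-Dirichlet-energy solutions
`u, v` with `F_λ(u) < F_λ(v)`. -/
theorem statement2 :
    ∀ c ∈ Set.Ioc (0 : ℝ) 1, ∃ αs ∈ Set.Ioo (0 : ℝ) 1,
      ∀ α ∈ Set.Ioc (0 : ℝ) αs, ∀ Ω : Set R2, IsRegularDomain Ω → Sandwiched α c Ω →
        ∀ lam ∈ Set.Ioo (8 * π) (lamLow α c), (∀ k : ℤ, lam ≠ 8 * π * k) →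
          ∃ u v : R2 → ℝ, IsSolP Ω lam u ∧ IsSolP Ω lam v ∧ u ≠ v ∧
            FiniteDirichlet Ω u ∧ FiniteDirichlet Ω v ∧
            freeEnergy Ω lam u < freeEnergy Ω lam v := by
  rintro c ⟨hc0, hc1⟩
  refine ⟨1 / 2, by norm_num, ?_⟩
  rintro α ⟨hα, hα1⟩ Ω ⟨⟨hΩ, hb, hsc, -⟩, -⟩ ⟨βm, βp, hm, hmp, hc, hin, hout⟩ lam ⟨hl, hl'⟩ hk
  have hΩe : planeIso ⁻¹' (planeIso.symm ⁻¹' Ω) = Ω := by ext p; simp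
  have hΩ' : IsOpen (planeIso.symm ⁻¹' Ω) := hΩ.preimage planeIso.symm.continuous
  have hb' : Bornology.IsBounded (planeIso.symm ⁻¹' Ω) := by
    rw [← planeIso.image_eq_preimage_symm]
    exact planeIso.lipschitz.isBounded_image hb
  have hsc' : IsSimplyConnected (planeIso.symm ⁻¹' Ω) :=
    (planeIso.symm.toHomeomorph.isSimplyConnected_preimage).2 hsc
  have h0 : (0 : ℂ) ∈ planeIso.symm ⁻¹' Ω := hin (by simp [EllipseSet, sq_nonneg])
  obtain ⟨φ, f, hR⟩ := exists_riemannPair hΩ' hsc' hb' h0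
  have hcoord : ∀ z : ℂ, planeIso.symm z 0 = z.re ∧ planeIso.symm z 1 = z.im := fun z => by
    have h1 := planeIso.apply_symm_apply z
    rw [planeIso_apply] at h1
    exact ⟨by simpa using congrArg Complex.re h1, by simpa using congrArg Complex.im h1⟩
  obtain ⟨hγ, hroot⟩ := gamma_pos_and_root hα hα1 hc0 hc1
  obtain ⟨g₀, g₁, h₀, h₁, hlt⟩ := exists_two_critical hR hb' hα hα1 hc1 hm (hm.trans_le hmp) hc
    (fun z hz => hin (by simpa [EllipseSet, hcoord, quad] using hz))
    (fun z hz => by simpa [EllipseSet, hcoord, quad] using hout hz) hγ hroot hl hl'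
    (fun k => by simpa using hk k)
  have hlam0 : 0 < lam := lt_trans (by positivity) hl
  obtain ⟨hu, hud, hue⟩ := solution_of_fixedPoint hR hb' hlam0 h₀
  obtain ⟨hv, hvd, hve⟩ := solution_of_fixedPoint hR hb' hlam0 h₁
  rw [hΩe] at hu hud hue hv hvd hve
  have hF := mul_lt_mul_of_pos_left hlt hlam0
  rw [← hue, ← hve] at hF
  exact ⟨_, _, hu, hv, fun h => hF.ne (by rw [h]), hud, hvd, hF⟩
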